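/- Let (1+√17)/2 < p < 5 and max{4/(p−1) − 1, 1} < γ₀ < min{p−1, 2}, and let B > 0. There exists a constant C > 0, depending only on p, γ₀ and B, such that for every smooth solution φ of the defocusing semilinear wave equation with E_{0,γ₀}[φ] ≤ B and E_{1,γ₀}[φ] < ∞, and for every first-order operator Z in the family Γ = {∂_t, ∂_{x_1}, ∂_{x_2}, ∂_{x_3}, x_i∂_{x_j} − x_j∂_{x_i} (1 ≤ i < j ≤ 3), t∂_{x_i} + x_i∂_t (1 ≤ i ≤ 3)}, one has ∫₀^∞ ∫_{S²} [ ρ(t)^{γ₀} |L Z(rφ)|² + |L̄ Zφ|² + ρ(t)² |L Zφ|² + |∇̄ Z(rφ)|² ](t, ρ(t)ω) dσ(ω) dt ≤ C (1 + E_{1,γ₀}[φ])^{p−1}, where rφ denotes the function (t,x) ↦ |x| φ(t,x). -/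

import Mathlib

open MeasureTheory Real
open scoped ENNReal InnerProductSpace

noncomputable section

/-- Three-dimensional Euclidean space. -/
abbrev E3 : Type := EuclideanSpace ℝ (Fin 3)

/-- Second derivative of `f` at `x` in the direction `v`. -/
def der2 (f : E3 → ℝ) (x v : E3) : ℝ := fderiv ℝ (fun y => fderiv ℝ f y v) x v

/-- The (spatial) Laplacian on `ℝ³`. -/
def lap3 (f : E3 → ℝ) (x : E3) : ℝ :=
  ∑ i : Fin 3, der2 f x (EuclideanSpace.single i 1)

/-- First time derivative `∂_t φ`. -/
def dt1 (φ : ℝ → E3 → ℝ) (t : ℝ) (x : E3) : ℝ := deriv (fun s => φ s x) t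

/-- Second time derivative `∂_t² φ`. -/
def dtt (φ : ℝ → E3 → ℝ) (t : ℝ) (x : E3) : ℝ := deriv (fun s => dt1 φ s x) t

/-- `φ` is a smooth solution of the defocusing semilinear wave equation
`∂_t²φ − Δφ + |φ|^{p−1}φ = 0` on `[0,∞) × ℝ³`. -/
def IsNLWSolution (p : ℝ) (φ : ℝ → E3 → ℝ) : Prop :=
  ContDiff ℝ (⊤ : ℕ∞) (fun q : ℝ × E3 => φ q.1 q.2) ∧
    ∀ t : ℝ, 0 ≤ t → ∀ x : E3,
      dtt φ t x - lap3 (φ t) x + |φ t x| ^ (p - 1) * φ t x = 0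

/-- The weighted initial energy `E_{k,γ₀}[φ]`. -/
def wEnergy (p : ℝ) (k : ℕ) (γ₀ : ℝ) (φ : ℝ → E3 → ℝ) : ℝ≥0∞ :=
  (∑ l ∈ Finset.range (k + 1),
    ∫⁻ x : E3, ENNReal.ofReal ((1 + ‖x‖) ^ (γ₀ + 2 * (l : ℝ)) *
      (‖iteratedFDeriv ℝ (l + 1) (φ 0) x‖ ^ 2 + ‖iteratedFDeriv ℝ l (dt1 φ 0) x‖ ^ 2))) +
  ∫⁻ x : E3, ENNReal.ofReal ((1 + ‖x‖) ^ γ₀ * |φ 0 x| ^ (p + 1))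

/-- `u₊ = √(1+((t−r)/2)²)`. -/
def uplus (t r : ℝ) : ℝ := Real.sqrt (1 + ((t - r) / 2) ^ 2)

/-- `v₊ = √(1+((t+r)/2)²)`. -/
def vplus (t r : ℝ) : ℝ := Real.sqrt (1 + ((t + r) / 2) ^ 2)

/-- Surface measure on the unit sphere `S² ⊂ ℝ³` (total mass `4π`). -/
def sphereMeasure : Measure (Metric.sphere (0 : E3) 1) := (volume : Measure E3).toSphere

/-- Radial derivative `∂_r ψ = (x/|x|)·∇ψ`. -/
def drad (φ : ℝ → E3 → ℝ) (t : ℝ) (x : E3) : ℝ := ⟪‖x‖⁻¹ • x, gradient (φ t) x⟫_ℝ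

/-- `Lψ = ∂_tψ + ∂_rψ`. -/
def Lop (φ : ℝ → E3 → ℝ) (t : ℝ) (x : E3) : ℝ := dt1 φ t x + drad φ t x

/-- `L̄ψ = ∂_tψ − ∂_rψ`. -/
def Lbop (φ : ℝ → E3 → ℝ) (t : ℝ) (x : E3) : ℝ := dt1 φ t x - drad φ t x

/-- Angular gradient `∇̄ψ = ∇ψ − (x/|x|)∂_rψ`. -/
def angGrad (φ : ℝ → E3 → ℝ) (t : ℝ) (x : E3) : E3 :=
  gradient (φ t) x - drad φ t x • (‖x‖⁻¹ • x)

/-- The function `(t,x) ↦ |x| φ(t,x)`. -/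
def rmul (φ : ℝ → E3 → ℝ) : ℝ → E3 → ℝ := fun t x => ‖x‖ * φ t x

/-- Radius `ρ(t) = √((t+3)² − (6/5)(t+3))` of the hyperboloid `ℍ⁺` at time `t`. -/
def hypRho (t : ℝ) : ℝ := Real.sqrt ((t + 3) ^ 2 - (6 / 5) * (t + 3))

/-- The `i`-th standard basis vector of `ℝ³`. -/
def e3 (i : Fin 3) : E3 := EuclideanSpace.single i 1

/-- A first order operator is encoded by its coefficients `(a, b)`, acting as
`Zψ = a ∂_tψ + b·∇ψ`. -/
def applyZ (Z : (ℝ → E3 → ℝ) × (ℝ → E3 → E3)) (ψ : ℝ → E3 → ℝ) : ℝ → E3 → ℝ :=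
  fun t x => Z.1 t x * dt1 ψ t x + ⟪Z.2 t x, gradient (ψ t) x⟫_ℝ

/-- The family `Γ = {∂_t, ∂_{x_i}, x_i∂_{x_j} − x_j∂_{x_i} (i < j), t∂_{x_i} + x_i∂_t}`,
encoded as coefficient pairs. -/
def GammaSet : Set ((ℝ → E3 → ℝ) × (ℝ → E3 → E3)) :=
  {(fun _ _ => 1, fun _ _ => 0)} ∪
  (⋃ i : Fin 3, {(fun _ _ => 0, fun _ _ => e3 i)}) ∪
  (⋃ i : Fin 3, ⋃ j : Fin 3, ⋃ (_ : i < j),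
    {(fun _ _ => 0, fun _ x => x i • e3 j - x j • e3 i)}) ∪
  (⋃ i : Fin 3, {(fun _ x => x i, fun t _ => t • e3 i)})

open ENNReal (ofReal ofReal_mul ofReal_le_ofReal ofReal_ne_top ofReal_add ofReal_pow toReal_nonneg
  measurable_ofReal ofReal_rpow_of_nonneg ofReal_one ofReal_toReal)
open Set (Icc Ioi Ioc Ioo univ indicator indicator_of_mem indicator_of_notMem mem_Ioi uIcc
  uIcc_of_le)
open Metric (ball isOpen_ball mem_ball)
open Finset (sum_congr mul_sum sum_le_sum sum_add_distrib sum_div sum_nonneg)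
open Filter (Eventually)

/-- Space-time `ℝ × ℝ³`. -/
abbrev M4 := ℝ × E3

/-- Functions of time and space. -/
abbrev Wave := ℝ → E3 → ℝ

/-- The region `|x| ≥ 2`. -/
abbrev farDom : Set E3 := {x | 2 ≤ ‖x‖}

/-- Pull a constant `ofReal c` out of a lower integral. -/
lemma lintegral_ofReal_mul {α : Type*} [MeasurableSpace α] {μ : Measure α} {c : ℝ}
    {f : α → ℝ≥0∞} : ∫⁻ x, ofReal c * f x ∂μ = ofReal c * ∫⁻ x, f x ∂μ :=
  lintegral_const_mul' _ _ ofReal_ne_top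

/-- Joint smoothness of a function of time and space. -/
def Smooth (φ : Wave) : Prop := ContDiff ℝ (⊤ : ℕ∞) (fun q : M4 => φ q.1 q.2)

/-- The spatial partial derivative in direction `i`. -/
def dx (i : Fin 3) (φ : Wave) (t : ℝ) (x : E3) : ℝ := fderiv ℝ (φ t) x (e3 i)

lemma e3_apply (i j : Fin 3) : e3 i j = if j = i then 1 else 0 := by
  simp [e3]

lemma norm_e3 (i : Fin 3) : ‖e3 i‖ = 1 := by simp [e3]

lemma e3_sum (x : E3) : x = ∑ i, x i • e3 i := by
  ext j
  simp [e3_apply]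

namespace Smooth

variable {φ : Wave}

lemma differentiable (h : Smooth φ) : Differentiable ℝ (fun q : M4 => φ q.1 q.2) :=
  ContDiff.differentiable h (by simp)

lemma slice (h : Smooth φ) (t : ℝ) : ContDiff ℝ (⊤ : ℕ∞) (φ t) :=
  ContDiff.comp (g := fun q : M4 => φ q.1 q.2) (f := fun x => (t, x)) h (by fun_prop)

lemma continuous (h : Smooth φ) : Continuous (fun q : M4 => φ q.1 q.2) :=
  ContDiff.continuous h

lemma dt1_eq (h : Smooth φ) (t : ℝ) (x : E3) :
    dt1 φ t x = fderiv ℝ (fun q : M4 => φ q.1 q.2) (t, x) (1, 0) := by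
  have h1 := (h.differentiable (t, x)).hasFDerivAt
  have h2 : HasDerivAt (fun s : ℝ => (s, x)) ((1 : ℝ), (0 : E3)) t :=
    (hasDerivAt_id t).prodMk (hasDerivAt_const t x)
  exact (h1.comp_hasDerivAt t h2).deriv

lemma dx_eq (h : Smooth φ) (i : Fin 3) (t : ℝ) (x : E3) :
    dx i φ t x = fderiv ℝ (fun q : M4 => φ q.1 q.2) (t, x) (0, e3 i) := by
  have h1 := (h.differentiable (t, x)).hasFDerivAt
  have h2 : HasFDerivAt (fun y : E3 => (t, y)) (ContinuousLinearMap.inr ℝ ℝ E3) x :=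
    hasFDerivAt_prodMk_right t x
  have h3 : HasFDerivAt (φ t) _ x := h1.comp x h2
  simp [dx, h3.fderiv]

lemma hasDerivAt_comp (h : Smooth φ) {τ : ℝ → ℝ} {X : ℝ → E3} {τ' : ℝ} {X' : E3} {s : ℝ}
    (hτ : HasDerivAt τ τ' s) (hX : HasDerivAt X X' s) : HasDerivAt (fun s => φ (τ s) (X s))
      (τ' * dt1 φ (τ s) (X s) + ∑ i, X' i * dx i φ (τ s) (X s)) s := by
  have h1 := (h.differentiable (τ s, X s)).hasFDerivAt
  have h2 := h1.comp_hasDerivAt s (hτ.prodMk hX)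
  refine h2.congr_deriv ?_
  rw [h.dt1_eq]
  simp_rw [h.dx_eq]
  have : ((τ', X') : M4) = τ' • ((1 : ℝ), (0 : E3)) + ∑ i, X' i • ((0 : ℝ), e3 i) := by
    ext1
    · simp [Prod.fst_sum]
    · simp only [Prod.snd_add, Prod.snd_sum, Prod.smul_snd, smul_zero, zero_add]
      exact e3_sum X'
  rw [this]
  simp only [map_add, map_sum, map_smul, smul_eq_mul]

lemma hasDerivAt_t (h : Smooth φ) (t : ℝ) (x : E3) : HasDerivAt (fun s => φ s x) (dt1 φ t x) t := by
  simpa using h.hasDerivAt_comp (hasDerivAt_id t) (hasDerivAt_const t x)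

lemma hasFDerivAt_x (h : Smooth φ) (t : ℝ) (x : E3) :
    HasFDerivAt (φ t) (∑ i, dx i φ t x • (EuclideanSpace.proj i : E3 →L[ℝ] ℝ)) x := by
  have h1 := ((h.slice t).differentiable (by simp) x).hasFDerivAt
  refine h1.congr_fderiv ?_
  ext v
  conv_lhs => rw [e3_sum v]
  simp [_root_.dx, mul_comm]

lemma dt1 (h : Smooth φ) : Smooth (dt1 φ) := by
  have : (fun q : M4 => _root_.dt1 φ q.1 q.2) =
      fun q => fderiv ℝ (fun q : M4 => φ q.1 q.2) q (1, 0) := by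
    ext q; exact h.dt1_eq q.1 q.2
  unfold Smooth
  rw [this]
  exact (ContDiff.fderiv_right (m := (⊤ : ℕ∞)) h (by simp)).clm_apply contDiff_const

lemma dx (h : Smooth φ) (i : Fin 3) : Smooth (dx i φ) := by
  have : (fun q : M4 => _root_.dx i φ q.1 q.2) =
      fun q => fderiv ℝ (fun q : M4 => φ q.1 q.2) q (0, e3 i) := by
    ext q; exact h.dx_eq i q.1 q.2
  unfold Smooth
  rw [this]
  exact (ContDiff.fderiv_right (m := (⊤ : ℕ∞)) h (by simp)).clm_apply contDiff_const

lemma second_comm (h : Smooth φ) (q v w : M4) :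
    fderiv ℝ (fun q' => fderiv ℝ (fun q : M4 => φ q.1 q.2) q' v) q w =
    fderiv ℝ (fun q' => fderiv ℝ (fun q : M4 => φ q.1 q.2) q' w) q v := by
  have hs : IsSymmSndFDerivAt ℝ (fun q : M4 => φ q.1 q.2) q :=
    ContDiffAt.isSymmSndFDerivAt (n := (⊤ : ℕ∞)) (ContDiff.contDiffAt h) (by simpa using ENat.LEInfty.out)
  have hd : DifferentiableAt ℝ (fderiv ℝ (fun q : M4 => φ q.1 q.2)) q :=
    (ContDiff.fderiv_right (m := (⊤ : ℕ∞)) h (by simp)).differentiable (by simp) q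
  have e : ∀ u z, fderiv ℝ (fun q' => fderiv ℝ (fun q : M4 => φ q.1 q.2) q' u) q z =
      fderiv ℝ (fderiv ℝ (fun q : M4 => φ q.1 q.2)) q z u := by
    intro u z
    rw [fderiv_clm_apply hd (by fun_prop)]
    simp
  rw [e, e]
  exact hs w v

lemma dt1_dx (h : Smooth φ) (i : Fin 3) : _root_.dt1 (_root_.dx i φ) = _root_.dx i (_root_.dt1 φ) := by
  have e1 : (fun q : M4 => _root_.dt1 φ q.1 q.2) =
      fun q => fderiv ℝ (fun q : M4 => φ q.1 q.2) q (1, 0) := by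
    ext q; exact h.dt1_eq q.1 q.2
  have e2 : (fun q : M4 => _root_.dx i φ q.1 q.2) =
      fun q => fderiv ℝ (fun q : M4 => φ q.1 q.2) q (0, e3 i) := by
    ext q; exact h.dx_eq i q.1 q.2
  ext t x
  rw [(h.dx i).dt1_eq, h.dt1.dx_eq, e1, e2, h.second_comm]

lemma dx_comm (h : Smooth φ) (i j : Fin 3) :
    _root_.dx i (_root_.dx j φ) = _root_.dx j (_root_.dx i φ) := by
  have e2 : ∀ i, (fun q : M4 => _root_.dx i φ q.1 q.2) =
      fun q => fderiv ℝ (fun q : M4 => φ q.1 q.2) q (0, e3 i) := by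
    intro i; ext q; exact h.dx_eq i q.1 q.2
  ext t x
  rw [(h.dx i).dx_eq, (h.dx j).dx_eq, e2, e2, h.second_comm]

end Smooth

lemma lap3_eq (φ : Wave) (t : ℝ) (x : E3) : lap3 (φ t) x = ∑ i, dx i (dx i φ) t x := rfl

lemma dtt_eq (φ : Wave) (t : ℝ) (x : E3) : dtt φ t x = dt1 (dt1 φ) t x := rfl

lemma gradient_apply {f : E3 → ℝ} {x : E3} (i : Fin 3) : gradient f x i = fderiv ℝ f x (e3 i) := by
  have h1 : ⟪gradient f x, e3 i⟫_ℝ = fderiv ℝ f x (e3 i) := by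
    unfold gradient
    exact InnerProductSpace.toDual_symm_apply
  rw [← h1, e3, EuclideanSpace.inner_single_right]
  simp

lemma inner_E3 (x y : E3) : ⟪x, y⟫_ℝ = ∑ i, x i * y i := by
  simp [PiLp.inner_apply, mul_comm]

lemma norm_sq_E3 (x : E3) : ‖x‖ ^ 2 = ∑ i, x i ^ 2 := by
  simp [EuclideanSpace.norm_sq_eq]

lemma abs_dx_le (φ : Wave) (i : Fin 3) (t : ℝ) (x : E3) :
    |dx i φ t x| ≤ ‖iteratedFDeriv ℝ 1 (φ t) x‖ := by
  have h := (fderiv ℝ (φ t) x).le_opNorm (e3 i)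
  rw [norm_e3, mul_one] at h
  rwa [norm_iteratedFDeriv_one]

lemma abs_dx_dx_le {φ : Wave} (h : Smooth φ) (i j : Fin 3) (t : ℝ) (x : E3) :
    |dx i (dx j φ) t x| ≤ ‖iteratedFDeriv ℝ 2 (φ t) x‖ := by
  have hd : DifferentiableAt ℝ (fderiv ℝ (φ t)) x :=
    (ContDiff.fderiv_right (m := (⊤ : ℕ∞)) (h.slice t) (by simp)).differentiable (by simp) x
  have e : dx i (dx j φ) t x = iteratedFDeriv ℝ 2 (φ t) x ![e3 i, e3 j] := by
    rw [iteratedFDeriv_two_apply]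
    unfold dx
    rw [fderiv_clm_apply hd (by fun_prop)]
    simp
  rw [e]
  have := (iteratedFDeriv ℝ 2 (φ t) x).le_opNorm ![e3 i, e3 j]
  simpa [Fin.prod_univ_two, norm_e3] using this

/-- The unit sphere. -/
abbrev S2 : Type := Metric.sphere (0 : E3) 1

section Parametric

variable {α : Type*} [TopologicalSpace α] [MeasurableSpace α] [OpensMeasurableSpace α]
  {μ : Measure α} [IsFiniteMeasure μ] {K : Set α}

omit [IsFiniteMeasure μ] in
lemma continuousOn_setIntegral_compact [IsFiniteMeasureOnCompacts μ] {X : Type*} [TopologicalSpace X]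
    [LocallyCompactSpace X] [FirstCountableTopology X]
    (hK : IsCompact K) (hKm : MeasurableSet K) {f : X → α → ℝ} {U : Set X} (hU : IsOpen U)
    (hf : ContinuousOn (fun q : X × α => f q.1 q.2) (U ×ˢ K)) :
    ContinuousOn (fun s => ∫ ω in K, f s ω ∂μ) U := by
  intro x hx
  apply ContinuousAt.continuousWithinAt
  obtain ⟨V, hVc, hxV, hVU⟩ := exists_compact_subset hU hx
  obtain ⟨M, hM⟩ := (hVc.prod hK).exists_bound_of_continuousOn
    (hf.mono (Set.prod_mono hVU subset_rfl))
  have hsl : ∀ s ∈ U, ContinuousOn (f s) K := fun s hs =>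
    hf.comp (f := fun ω => (s, ω)) (by fun_prop) (fun ω hω => ⟨hs, hω⟩)
  have hVn : V ∈ nhds x := mem_interior_iff_mem_nhds.1 hxV
  apply continuousAt_of_dominated (bound := fun _ => M)
  · filter_upwards [hU.mem_nhds hx] with s hs
    exact (hsl s hs).aestronglyMeasurable hKm
  · filter_upwards [hVn] with s hs
    exact (ae_restrict_iff' hKm).2 (Eventually.of_forall fun ω hω => hM (s, ω) ⟨hs, hω⟩)
  · have : IsFiniteMeasure (μ.restrict K) := ⟨by simpa using hK.measure_lt_top⟩
    exact integrable_const M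
  · refine (ae_restrict_iff' hKm).2 (Eventually.of_forall fun ω hω => ?_)
    have : ContinuousOn (fun s => f s ω) U :=
      hf.comp (f := fun s => (s, ω)) (by fun_prop) (fun s hs => ⟨hs, hω⟩)
    exact this.continuousAt (hU.mem_nhds hx)

lemma hasDerivAt_setIntegral_compact
    (hK : IsCompact K) (hKm : MeasurableSet K) {f f' : ℝ → α → ℝ} {U : Set ℝ} (hU : IsOpen U)
    (hf : ContinuousOn (fun q : ℝ × α => f q.1 q.2) (U ×ˢ K))
    (hf' : ContinuousOn (fun q : ℝ × α => f' q.1 q.2) (U ×ˢ K))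
    (hd : ∀ s ∈ U, ∀ ω ∈ K, HasDerivAt (fun s => f s ω) (f' s ω) s) {t : ℝ} (ht : t ∈ U) :
    HasDerivAt (fun s => ∫ ω in K, f s ω ∂μ) (∫ ω in K, f' t ω ∂μ) t := by
  obtain ⟨V, hVc, hxV, hVU⟩ := exists_compact_subset hU ht
  obtain ⟨M, hM⟩ := (hVc.prod hK).exists_bound_of_continuousOn
    (hf'.mono (Set.prod_mono hVU subset_rfl))
  have hsl : ∀ s ∈ U, ContinuousOn (f s) K := fun s hs =>
    hf.comp (f := fun ω => (s, ω)) (by fun_prop) (fun ω hω => ⟨hs, hω⟩)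
  have hsl' : ∀ s ∈ U, ContinuousOn (f' s) K := fun s hs =>
    hf'.comp (f := fun ω => (s, ω)) (by fun_prop) (fun ω hω => ⟨hs, hω⟩)
  have hVn : V ∈ nhds t := mem_interior_iff_mem_nhds.1 hxV
  refine (hasDerivAt_integral_of_dominated_loc_of_deriv_le (bound := fun _ => M)
    (F' := f') hVn ?_ ?_ ?_ ?_ ?_ ?_).2
  · filter_upwards [hU.mem_nhds ht] with s hs
    exact (hsl s hs).aestronglyMeasurable hKm
  · obtain ⟨M', hM'⟩ := hK.exists_bound_of_continuousOn (hsl t ht)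
    exact Integrable.of_bound ((hsl t ht).aestronglyMeasurable hKm) M'
      ((ae_restrict_iff' hKm).2 (Eventually.of_forall fun ω hω => hM' ω hω))
  · exact (hsl' t ht).aestronglyMeasurable hKm
  · exact (ae_restrict_iff' hKm).2
      (Eventually.of_forall fun ω hω s hs => hM (s, ω) ⟨hs, hω⟩)
  · exact integrable_const M
  · exact (ae_restrict_iff' hKm).2
      (Eventually.of_forall fun ω hω s hs => hd s (hVU hs) ω hω)

end Parametric

instance : IsFiniteMeasure sphereMeasure := by unfold sphereMeasure; infer_instance

lemma hasDerivAt_sphere {f f' : ℝ → S2 → ℝ} {U : Set ℝ} (hU : IsOpen U)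
    (hf : ContinuousOn (fun q : ℝ × S2 => f q.1 q.2) (U ×ˢ univ))
    (hf' : ContinuousOn (fun q : ℝ × S2 => f' q.1 q.2) (U ×ˢ univ))
    (hd : ∀ s ∈ U, ∀ ω, HasDerivAt (fun s => f s ω) (f' s ω) s) {t : ℝ} (ht : t ∈ U) :
    HasDerivAt (fun s => ∫ ω, f s ω ∂sphereMeasure) (∫ ω, f' t ω ∂sphereMeasure) t := by
  simpa using hasDerivAt_setIntegral_compact (μ := sphereMeasure) isCompact_univ
    MeasurableSet.univ hU hf hf' (fun s hs ω _ => hd s hs ω) ht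

lemma continuousOn_sphere {X : Type*} [TopologicalSpace X]
    [LocallyCompactSpace X] [FirstCountableTopology X] {f : X → S2 → ℝ} {U : Set X} (hU : IsOpen U)
    (hf : ContinuousOn (fun q : X × S2 => f q.1 q.2) (U ×ˢ univ)) :
    ContinuousOn (fun s => ∫ ω, f s ω ∂sphereMeasure) U := by
  simpa using continuousOn_setIntegral_compact (μ := sphereMeasure) isCompact_univ
    MeasurableSet.univ hU hf

lemma isOpen_forall_compact {X α : Type*} [TopologicalSpace X] [TopologicalSpace α]
    {K : Set α} (hK : IsCompact K) {W : Set (X × α)} (hW : IsOpen W) :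
    IsOpen {x | ∀ ω ∈ K, (x, ω) ∈ W} := by
  rw [isOpen_iff_mem_nhds]
  intro x hx
  exact hK.eventually_forall_of_forall_eventually fun ω hω => hW.mem_nhds (hx ω hω)

/-- The action of a linear isometry on the unit sphere. -/
def sphereMap (L : E3 ≃ₗᵢ[ℝ] E3) : S2 ≃ₜ S2 where
  toFun ω := ⟨L ω, by simp⟩
  invFun ω := ⟨L.symm ω, by simp⟩
  left_inv ω := by simp
  right_inv ω := by simp
  continuous_toFun := by fun_prop
  continuous_invFun := by fun_prop

open scoped Pointwise in
lemma measurePreserving_sphereMap (L : E3 ≃ₗᵢ[ℝ] E3) :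
    MeasurePreserving (sphereMap L) sphereMeasure sphereMeasure := by
  refine ⟨(sphereMap L).continuous.measurable, ?_⟩
  ext A hA
  rw [Measure.map_apply (sphereMap L).continuous.measurable hA]
  unfold sphereMeasure
  rw [Measure.toSphere_apply' _ hA, Measure.toSphere_apply' _
    ((sphereMap L).continuous.measurable hA)]
  congr 1
  rw [← L.measurePreserving.measure_preimage_equiv (f := L.toMeasurableEquiv)
    (Ioo (0 : ℝ) 1 • (Set.image Subtype.val A))]
  congr 1
  ext x
  simp only [Set.mem_smul, Set.mem_image, Set.mem_preimage]
  constructor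
  · rintro ⟨r, hr, _, ⟨ω, hω, rfl⟩, rfl⟩
    exact ⟨r, hr, _, ⟨sphereMap L ω, hω, rfl⟩, (map_smul L r ω.1).symm⟩
  · rintro ⟨r, hr, _, ⟨ω, hω, rfl⟩, h⟩
    refine ⟨r, hr, _, ⟨(sphereMap L).symm ω, by simpa using hω, rfl⟩, ?_⟩
    apply L.injective
    have h' : r • ω.1 = L x := h
    rw [← h', map_smul]
    congr 1
    exact L.apply_symm_apply _

lemma integral_sphereMap (L : E3 ≃ₗᵢ[ℝ] E3) (f : S2 → ℝ) :
    ∫ ω, f (sphereMap L ω) ∂sphereMeasure = ∫ ω, f ω ∂sphereMeasure :=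
  (measurePreserving_sphereMap L).integral_comp (sphereMap L).measurableEmbedding f

/-- The rotation by angle `θ` in the coordinate plane `(i, j)`, as a linear map. -/
def rotLin (i j : Fin 3) (θ : ℝ) : E3 →ₗ[ℝ] E3 where
  toFun x := x + (cos θ - 1) • (x i • e3 i + x j • e3 j) + sin θ • (x i • e3 j - x j • e3 i)
  map_add' x y := by simp only [PiLp.add_apply]; module
  map_smul' c x := by simp only [PiLp.smul_apply, smul_eq_mul, RingHom.id_apply]; module

lemma norm_rotLin {i j : Fin 3} (hij : i ≠ j) (θ : ℝ) (x : E3) : ‖rotLin i j θ x‖ = ‖x‖ := by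
  rw [← sq_eq_sq₀ (norm_nonneg _) (norm_nonneg _), norm_sq_E3, norm_sq_E3]
  have h := sin_sq_add_cos_sq θ
  fin_cases i <;> fin_cases j <;> first | exact absurd rfl hij | skip
  all_goals
    simp [rotLin, Fin.sum_univ_three, e3_apply]
  · linear_combination (x 0 ^ 2 + x 1 ^ 2) * h
  · linear_combination (x 0 ^ 2 + x 2 ^ 2) * h
  · linear_combination (x 0 ^ 2 + x 1 ^ 2) * h
  · linear_combination (x 1 ^ 2 + x 2 ^ 2) * h
  · linear_combination (x 0 ^ 2 + x 2 ^ 2) * h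
  · linear_combination (x 1 ^ 2 + x 2 ^ 2) * h

/-- The rotation by angle `θ` in the coordinate plane `(i, j)`. -/
def rot {i j : Fin 3} (hij : i ≠ j) (θ : ℝ) : E3 ≃ₗᵢ[ℝ] E3 :=
  LinearIsometry.toLinearIsometryEquiv ⟨rotLin i j θ, norm_rotLin hij θ⟩ rfl

lemma rot_apply {i j : Fin 3} (hij : i ≠ j) (θ : ℝ) (x : E3) : rot hij θ x =
    x + (cos θ - 1) • (x i • e3 i + x j • e3 j) + sin θ • (x i • e3 j - x j • e3 i) := rfl

/-- Rotation vector fields integrate to zero on the sphere. -/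
lemma integral_rotation_field {h : E3 → ℝ} {V : Set E3} (hV : IsOpen V)
    (hS : Metric.sphere (0 : E3) 1 ⊆ V) (hh : ContDiffOn ℝ 1 h V) (i j : Fin 3) :
    ∫ ω : S2, fderiv ℝ h ω (ω.1 i • e3 j - ω.1 j • e3 i) ∂sphereMeasure = 0 := by
  by_cases hij : i = j
  · simp [hij]
  have hVn : ∀ (θ : ℝ) (ω : S2), rot hij θ ω ∈ V := fun θ ω => hS (by simp)
  have hc : ∀ (v : ℝ → E3 → E3), Continuous (fun q : ℝ × S2 => v q.1 q.2) →
      Continuous (fun q : ℝ × S2 => fderiv ℝ h (rot hij q.1 q.2) (v q.1 q.2)) := by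
    intro v hv
    have h1 : ContinuousOn (fderiv ℝ h) V := hh.continuousOn_fderiv_of_isOpen hV le_rfl
    have h2 : Continuous (fun q : ℝ × S2 => rot hij q.1 (q.2 : E3)) := by
      simp only [rot_apply]; fun_prop
    exact (h1.comp_continuous h2 fun q => hVn _ _).clm_apply hv
  have hD := hasDerivAt_sphere (f := fun θ ω => h (rot hij θ ω))
    (f' := fun θ ω => fderiv ℝ h (rot hij θ ω)
      ((-sin θ) • (ω.1 i • e3 i + ω.1 j • e3 j) +
        cos θ • (ω.1 i • e3 j - ω.1 j • e3 i))) isOpen_univ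
    (by
      refine Continuous.continuousOn ?_
      have h2 : Continuous (fun q : ℝ × S2 => rot hij q.1 (q.2 : E3)) := by
        simp only [rot_apply]; fun_prop
      exact hh.continuousOn.comp_continuous h2 fun q => hVn _ _)
    (Continuous.continuousOn (hc (fun θ x => (-sin θ) • (x i • e3 i + x j • e3 j) +
        cos θ • (x i • e3 j - x j • e3 i)) (by fun_prop)))
    (fun θ _ ω => by
      have h1 : HasFDerivAt h (fderiv ℝ h (rot hij θ ω)) (rot hij θ ω) :=
        ((hh.differentiableOn one_ne_zero).differentiableAt (hV.mem_nhds (hVn θ ω))).hasFDerivAt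
      have h2 : HasDerivAt (fun θ => rot hij θ ω)
          ((-sin θ) • (ω.1 i • e3 i + ω.1 j • e3 j) + cos θ • (ω.1 i • e3 j - ω.1 j • e3 i)) θ := by
        simp only [rot_apply]
        refine HasDerivAt.add (HasDerivAt.const_add _ ?_) ?_
        · exact ((hasDerivAt_cos θ).sub_const 1).smul_const _
        · exact (hasDerivAt_sin θ).smul_const _
      exact h1.comp_hasDerivAt θ h2) (Set.mem_univ (0 : ℝ))
  have hconst : (fun θ => ∫ ω : S2, h (rot hij θ ω) ∂sphereMeasure) =
      fun _ => ∫ ω : S2, h ω ∂sphereMeasure := by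
    ext θ
    exact integral_sphereMap (rot hij θ) (fun ω => h ω)
  rw [hconst] at hD
  have := hD.unique (hasDerivAt_const 0 _)
  simpa [rot_apply] using this


lemma sphere_coord_sq (ω : S2) : ∑ i, ω.1 i ^ 2 = 1 := by
  rw [← norm_sq_E3]; simp

lemma integral_sphere_div {Y : Fin 3 → E3 → ℝ} {V : Set E3} (hV : IsOpen V)
    (hY : ∀ i, ContDiffOn ℝ 1 (Y i) V) (o : E3) {s : ℝ} (hs : ∀ ω : S2, o + s • ω.1 ∈ V) :
    s * ∫ ω : S2, ∑ i, fderiv ℝ (Y i) (o + s • ω.1) (e3 i) ∂sphereMeasure =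
    ∫ ω : S2, (2 * ∑ i, ω.1 i * Y i (o + s • ω.1) +
      s * ∑ i, ω.1 i * fderiv ℝ (Y i) (o + s • ω.1) ω) ∂sphereMeasure := by
  have hpt : Continuous (fun ω : S2 => o + s • ω.1) := by fun_prop
  have hcY : ∀ i, Continuous (fun ω : S2 => Y i (o + s • ω.1)) := fun i =>
    (hY i).continuousOn.comp_continuous hpt hs
  have hcD : ∀ i, Continuous (fun ω : S2 => fderiv ℝ (Y i) (o + s • ω.1)) := fun i =>
    ((hY i).continuousOn_fderiv_of_isOpen hV le_rfl).comp_continuous hpt hs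
  have hInt : ∀ {f : S2 → ℝ}, Continuous f → Integrable f sphereMeasure := fun hf =>
    hf.integrable_of_hasCompactSupport (HasCompactSupport.of_compactSpace _)
  have hcoord : ∀ i, Continuous (fun ω : S2 => ω.1 i) := fun i => by fun_prop
  have key : ∀ i j : Fin 3, ∫ ω : S2, ((ω.1 j * e3 i j - ω.1 i * e3 j j) *
      Y i (o + s • ω.1) + ω.1 j * (s * fderiv ℝ (Y i) (o + s • ω.1)
        (ω.1 j • e3 i - ω.1 i • e3 j))) ∂sphereMeasure = 0 := by
    intro i j
    have hV' : IsOpen ((fun x : E3 => o + s • x) ⁻¹' V) := hV.preimage (by fun_prop)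
    have hS' : Metric.sphere (0 : E3) 1 ⊆ (fun x : E3 => o + s • x) ⁻¹' V :=
      fun x hx => hs ⟨x, hx⟩
    have hh : ContDiffOn ℝ 1 (fun x : E3 => x j * Y i (o + s • x))
        ((fun x : E3 => o + s • x) ⁻¹' V) := by
      refine ContDiffOn.mul (by fun_prop) ?_
      exact (hY i).comp (g := Y i) (f := fun x : E3 => o + s • x) (by fun_prop) (fun x hx => hx)
    rw [← integral_rotation_field hV' hS' hh j i]
    refine integral_congr_ae (Eventually.of_forall fun ω => ?_)
    have h1 : HasFDerivAt (Y i) (fderiv ℝ (Y i) (o + s • ω.1)) (o + s • ω.1) :=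
      (((hY i).differentiableOn one_ne_zero).differentiableAt (hV.mem_nhds (hs ω))).hasFDerivAt
    have h2 : HasFDerivAt (fun x : E3 => o + s • x) (s • ContinuousLinearMap.id ℝ E3) ω.1 :=
      ((hasFDerivAt_id ω.1).const_smul s).const_add o
    have h3 : HasFDerivAt (fun x : E3 => x j) (EuclideanSpace.proj j : E3 →L[ℝ] ℝ) ω.1 :=
      (EuclideanSpace.proj j : E3 →L[ℝ] ℝ).hasFDerivAt
    have h4 := h3.mul (h1.comp ω.1 h2)
    have h5 : HasFDerivAt (fun x : E3 => x j * Y i (o + s • x)) _ ω.1 := h4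
    simp only [h5.fderiv]
    simp
    ring
  have hcv : ∀ i j : Fin 3, Continuous (fun ω : S2 => fderiv ℝ (Y i) (o + s • ω.1)
        (ω.1 j • e3 i - ω.1 i • e3 j)) := fun i j => (hcD i).clm_apply (by fun_prop)
  have hsum : ∫ ω : S2, ∑ i, ∑ j, ((ω.1 j * e3 i j - ω.1 i * e3 j j) *
      Y i (o + s • ω.1) + ω.1 j * (s * fderiv ℝ (Y i) (o + s • ω.1)
        (ω.1 j • e3 i - ω.1 i • e3 j))) ∂sphereMeasure = 0 := by
    have hi : ∀ i j : Fin 3, Integrable (fun ω : S2 => ((ω.1 j * e3 i j - ω.1 i * e3 j j) *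
      Y i (o + s • ω.1) + ω.1 j * (s * fderiv ℝ (Y i) (o + s • ω.1)
        (ω.1 j • e3 i - ω.1 i • e3 j)))) sphereMeasure := by
      intro i j
      exact hInt (Continuous.add (Continuous.mul (by fun_prop) (hcY i))
        (Continuous.mul (by fun_prop) (continuous_const.mul (hcv i j))))
    rw [integral_finsetSum _ fun i _ => integrable_finsetSum _ fun j _ => hi i j]
    simp_rw [integral_finsetSum _ fun j _ => hi _ j, key]
    simp
  rw [← sub_eq_zero, ← integral_const_mul, ← integral_sub, ← hsum]
  · refine integral_congr_ae (Eventually.of_forall fun ω => ?_)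
    have hω := sphere_coord_sq ω
    have hlin : ∀ i, fderiv ℝ (Y i) (o + s • ω.1) ω.1 =
        ∑ j, ω.1 j * fderiv ℝ (Y i) (o + s • ω.1) (e3 j) := by
      intro i
      conv_lhs => rw [e3_sum ω.1]
      simp only [map_sum, map_smul, smul_eq_mul]
      rw [← e3_sum ω.1]
    simp only [hlin, map_sub, map_smul, smul_eq_mul, Fin.sum_univ_three, e3_apply] at hω ⊢
    simp
    linear_combination -s * (fderiv ℝ (Y 0) (o + s • ω.1) (e3 0) +
      fderiv ℝ (Y 1) (o + s • ω.1) (e3 1) + fderiv ℝ (Y 2) (o + s • ω.1) (e3 2)) * hω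
  · apply hInt
    have := fun i => (hcD i).clm_apply (continuous_const (y := e3 i))
    fun_prop
  · exact hInt ((continuous_const.mul (continuous_finsetSum _ fun i _ =>
      (hcoord i).mul (hcY i))).add (continuous_const.mul (continuous_finsetSum _ fun i _ =>
      (hcoord i).mul ((hcD i).clm_apply (by fun_prop)))))

/-- Derivative in the radius of the flux of a vector field through a sphere. -/
lemma hasDerivAt_sphere_flux {Y : Fin 3 → E3 → ℝ} {V : Set E3} (hV : IsOpen V)
    (hY : ∀ i, ContDiffOn ℝ 1 (Y i) V) (o : E3) {s : ℝ} (hs : ∀ ω : S2, o + s • ω.1 ∈ V) :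
    HasDerivAt (fun s => s ^ 2 * ∫ ω : S2, ∑ i, ω.1 i * Y i (o + s • ω.1) ∂sphereMeasure)
      (s ^ 2 * ∫ ω : S2, ∑ i, fderiv ℝ (Y i) (o + s • ω.1) (e3 i) ∂sphereMeasure) s := by
  have hpt : Continuous (fun q : ℝ × S2 => o + q.1 • (q.2 : E3)) := by fun_prop
  have hU : IsOpen {s : ℝ | ∀ ω ∈ (univ : Set S2), (s, ω) ∈
      (fun q : ℝ × S2 => o + q.1 • (q.2 : E3)) ⁻¹' V} :=
    isOpen_forall_compact isCompact_univ (hV.preimage hpt)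
  set U := {s : ℝ | ∀ ω ∈ (univ : Set S2), (s, ω) ∈
      (fun q : ℝ × S2 => o + q.1 • (q.2 : E3)) ⁻¹' V}
  have hm : Set.MapsTo (fun q : ℝ × S2 => o + q.1 • (q.2 : E3)) (U ×ˢ univ) V :=
    fun q hq => hq.1 q.2 trivial
  have hcY : ∀ i, ContinuousOn (fun q : ℝ × S2 => Y i (o + q.1 • (q.2 : E3))) (U ×ˢ univ) :=
    fun i => (hY i).continuousOn.comp hpt.continuousOn hm
  have hcD : ∀ i, ContinuousOn (fun q : ℝ × S2 => fderiv ℝ (Y i) (o + q.1 • (q.2 : E3)) q.2)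
      (U ×ˢ univ) :=
    fun i => (((hY i).continuousOn_fderiv_of_isOpen hV le_rfl).comp hpt.continuousOn hm).clm_apply
      (by fun_prop)
  have hD := hasDerivAt_sphere (f := fun s ω => ∑ i, ω.1 i * Y i (o + s • ω.1))
    (f' := fun s ω => ∑ i, ω.1 i * fderiv ℝ (Y i) (o + s • ω.1) ω) hU
    (continuousOn_finsetSum _ fun i _ => ContinuousOn.mul (by fun_prop) (hcY i))
    (continuousOn_finsetSum _ fun i _ => ContinuousOn.mul (by fun_prop) (hcD i))
    (fun r hr ω => by
      refine HasDerivAt.fun_sum fun i _ => HasDerivAt.const_mul _ ?_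
      have h1 : HasFDerivAt (Y i) (fderiv ℝ (Y i) (o + r • ω.1)) (o + r • ω.1) :=
        (((hY i).differentiableOn one_ne_zero).differentiableAt
          (hV.mem_nhds (hr ω trivial))).hasFDerivAt
      have h2 : HasDerivAt (fun r : ℝ => o + r • ω.1) ω.1 r := by
        simpa using ((hasDerivAt_id r).smul_const ω.1).const_add o
      exact h1.comp_hasDerivAt r h2) (show s ∈ U from fun ω _ => hs ω)
  refine ((hasDerivAt_pow 2 s).mul hD).congr_deriv ?_
  have hInt : ∀ {f : S2 → ℝ}, Continuous f → Integrable f sphereMeasure := fun hf =>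
    hf.integrable_of_hasCompactSupport (HasCompactSupport.of_compactSpace _)
  have hsl : Continuous (fun ω : S2 => (s, ω)) := by fun_prop
  have hslm : ∀ ω : S2, (s, ω) ∈ U ×ˢ (univ : Set S2) := fun ω => ⟨fun ω _ => hs ω, trivial⟩
  have h1 : Integrable (fun ω : S2 => ∑ i, ω.1 i * Y i (o + s • ω.1)) sphereMeasure := by
    exact hInt (continuous_finsetSum _ fun i _ =>
      Continuous.mul (by fun_prop) ((hcY i).comp_continuous hsl hslm))
  have h2 : Integrable (fun ω : S2 => ∑ i, ω.1 i * fderiv ℝ (Y i) (o + s • ω.1) ω)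
      sphereMeasure := by
    exact hInt (continuous_finsetSum _ fun i _ =>
      Continuous.mul (by fun_prop) ((hcD i).comp_continuous hsl hslm))
  have key := integral_sphere_div hV hY o hs
  rw [integral_add (h1.const_mul 2) (h2.const_mul s), integral_const_mul, integral_const_mul] at key
  simp only [Nat.cast_ofNat, Nat.add_one_sub_one, pow_one]
  linear_combination -s * key

lemma exists_nhd_moving {O : Set (ℝ × ℝ)} (hO : IsOpen O) {a b : ℝ → ℝ} {W : Set ℝ}
    (hW : IsOpen W) (hca : ContinuousOn a W) (hcb : ContinuousOn b W)
    {t : ℝ} (ht : t ∈ W) (hmem : ∀ θ ∈ Icc (0 : ℝ) 1, (t, a t + (b t - a t) * θ) ∈ O) :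
    ∃ U : Set ℝ, IsOpen U ∧ t ∈ U ∧ U ⊆ W ∧
      ∀ s ∈ U, ∀ θ ∈ Icc (0 : ℝ) 1, (s, a s + (b s - a s) * θ) ∈ O := by
  have hc : ContinuousOn (fun q : ℝ × ℝ => (q.1, a q.1 + (b q.1 - a q.1) * q.2))
      (W ×ˢ univ) := by
    have h1 : ContinuousOn (fun q : ℝ × ℝ => a q.1) (W ×ˢ univ) :=
      hca.comp continuousOn_fst fun q hq => hq.1
    have h2 : ContinuousOn (fun q : ℝ × ℝ => b q.1) (W ×ˢ univ) :=
      hcb.comp continuousOn_fst fun q hq => hq.1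
    exact continuousOn_fst.prodMk (h1.add ((h2.sub h1).mul continuousOn_snd))
  obtain ⟨P, hPo, hP⟩ := (continuousOn_iff'.1 hc) O hO
  have hPW : IsOpen (P ∩ (W ×ˢ univ)) := hPo.inter (hW.prod isOpen_univ)
  refine ⟨{t | ∀ θ ∈ Icc (0 : ℝ) 1, (t, θ) ∈ P ∩ (W ×ˢ univ)},
    isOpen_forall_compact isCompact_Icc hPW, ?_, fun s hs => (hs 0 (by simp)).2.1, ?_⟩
  · intro θ hθ
    rw [← hP]
    exact ⟨hmem θ hθ, ht, trivial⟩
  · intro s hs θ hθ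
    have := hs θ hθ
    rw [← hP] at this
    exact this.1

lemma integral_moving_eq (a b : ℝ) (F : ℝ → ℝ) :
    ∫ s in a..b, F s = ∫ θ in Icc (0 : ℝ) 1, (b - a) * F (a + (b - a) * θ) := by
  rw [integral_Icc_eq_integral_Ioc, ← intervalIntegral.integral_of_le zero_le_one,
    intervalIntegral.integral_const_mul, intervalIntegral.mul_integral_comp_add_mul]
  simp

lemma continuousAt_integral_moving {G : ℝ → ℝ → ℝ} {O : Set (ℝ × ℝ)} (hO : IsOpen O)
    (hG : ContinuousOn (fun q : ℝ × ℝ => G q.1 q.2) O) {a b : ℝ → ℝ} {W : Set ℝ}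
    (hW : IsOpen W) (hca : ContinuousOn a W) (hcb : ContinuousOn b W)
    {t : ℝ} (ht : t ∈ W) (hmem : ∀ θ ∈ Icc (0 : ℝ) 1, (t, a t + (b t - a t) * θ) ∈ O) :
    ContinuousAt (fun t => ∫ s in a t..b t, G t s) t := by
  obtain ⟨U, hU, htU, hUW, hUO⟩ := exists_nhd_moving hO hW hca hcb ht hmem
  simp only [integral_moving_eq]
  refine (continuousOn_setIntegral_compact isCompact_Icc measurableSet_Icc hU ?_).continuousAt
    (hU.mem_nhds htU)
  have h1 : ContinuousOn (fun q : ℝ × ℝ => a q.1) (U ×ˢ Icc (0 : ℝ) 1) :=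
    hca.comp continuousOn_fst fun q hq => hUW hq.1
  have h2 : ContinuousOn (fun q : ℝ × ℝ => b q.1) (U ×ˢ Icc (0 : ℝ) 1) :=
    hcb.comp continuousOn_fst fun q hq => hUW hq.1
  exact (h2.sub h1).mul (hG.comp (f := fun q : ℝ × ℝ => (q.1, a q.1 + (b q.1 - a q.1) * q.2))
    (continuousOn_fst.prodMk (h1.add ((h2.sub h1).mul continuousOn_snd)))
    (fun q hq => hUO q.1 hq.1 q.2 hq.2))

/-- Leibniz rule for an integral with moving end points. -/
lemma hasDerivAt_integral_moving {G Gt Gs : ℝ → ℝ → ℝ} {O : Set (ℝ × ℝ)} (hO : IsOpen O)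
    (hG : ContinuousOn (fun q : ℝ × ℝ => G q.1 q.2) O)
    (hGt : ContinuousOn (fun q : ℝ × ℝ => Gt q.1 q.2) O)
    (hGs : ContinuousOn (fun q : ℝ × ℝ => Gs q.1 q.2) O)
    (hs : ∀ t s, (t, s) ∈ O → HasDerivAt (fun s => G t s) (Gs t s) s)
    (hcurve : ∀ (σ σ' : ℝ → ℝ) (W : Set ℝ), IsOpen W → (∀ t ∈ W, HasDerivAt σ (σ' t) t) →
      ContinuousOn σ' W → (∀ t ∈ W, (t, σ t) ∈ O) →
      ∀ t ∈ W, HasDerivAt (fun t => G t (σ t)) (Gt t (σ t) + σ' t * Gs t (σ t)) t)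
    {a b a' b' : ℝ → ℝ} {W : Set ℝ} (hW : IsOpen W) (ha : ∀ t ∈ W, HasDerivAt a (a' t) t)
    (hb : ∀ t ∈ W, HasDerivAt b (b' t) t) (ha' : ContinuousOn a' W) (hb' : ContinuousOn b' W)
    {t : ℝ} (ht : t ∈ W) (hmem : ∀ θ ∈ Icc (0 : ℝ) 1, (t, a t + (b t - a t) * θ) ∈ O) :
    HasDerivAt (fun t => ∫ s in a t..b t, G t s)
      (b' t * G t (b t) - a' t * G t (a t) + ∫ s in a t..b t, Gt t s) t := by
  have hca : ContinuousOn a W := fun t ht => (ha t ht).continuousAt.continuousWithinAt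
  have hcb : ContinuousOn b W := fun t ht => (hb t ht).continuousAt.continuousWithinAt
  obtain ⟨U, hU, htU, hUW, hUO⟩ := exists_nhd_moving hO hW hca hcb ht hmem
  have hcomp : ∀ {F : ℝ → ℝ → ℝ}, ContinuousOn (fun q : ℝ × ℝ => F q.1 q.2) O →
      ContinuousOn (fun q : ℝ × ℝ => F q.1 (a q.1 + (b q.1 - a q.1) * q.2))
        (U ×ˢ Icc (0 : ℝ) 1) := by
    intro F hF
    have h1 : ContinuousOn (fun q : ℝ × ℝ => a q.1) (U ×ˢ Icc (0 : ℝ) 1) :=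
      hca.comp continuousOn_fst fun q hq => hUW hq.1
    have h2 : ContinuousOn (fun q : ℝ × ℝ => b q.1) (U ×ˢ Icc (0 : ℝ) 1) :=
      hcb.comp continuousOn_fst fun q hq => hUW hq.1
    exact hF.comp (f := fun q : ℝ × ℝ => (q.1, a q.1 + (b q.1 - a q.1) * q.2))
      (continuousOn_fst.prodMk (h1.add ((h2.sub h1).mul continuousOn_snd)))
      (fun q hq => hUO q.1 hq.1 q.2 hq.2)
  have hfst : ∀ {f : ℝ → ℝ}, ContinuousOn f W →
      ContinuousOn (fun q : ℝ × ℝ => f q.1) (U ×ˢ Icc (0 : ℝ) 1) := fun hf =>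
    hf.comp continuousOn_fst fun q hq => hUW hq.1
  have hD := hasDerivAt_setIntegral_compact (μ := volume.restrict (Icc (0 : ℝ) 1))
    (K := Icc (0 : ℝ) 1) isCompact_Icc measurableSet_Icc
    (f := fun t θ => (b t - a t) * G t (a t + (b t - a t) * θ))
    (f' := fun t θ => (b' t - a' t) * G t (a t + (b t - a t) * θ) +
      (b t - a t) * (Gt t (a t + (b t - a t) * θ) +
        (a' t + (b' t - a' t) * θ) * Gs t (a t + (b t - a t) * θ))) hU
    (((hfst hcb).sub (hfst hca)).mul (hcomp hG))
    ((((hfst hb').sub (hfst ha')).mul (hcomp hG)).add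
      (((hfst hcb).sub (hfst hca)).mul ((hcomp hGt).add
        (((hfst ha').add (((hfst hb').sub (hfst ha')).mul continuousOn_snd)).mul (hcomp hGs)))))
    (fun r hr θ hθ => by
      refine ((hb r (hUW hr)).sub (ha r (hUW hr))).mul ?_
      exact hcurve (fun t => a t + (b t - a t) * θ) (fun t => a' t + (b' t - a' t) * θ) U hU
        (fun t ht => (ha t (hUW ht)).add (((hb t (hUW ht)).sub (ha t (hUW ht))).mul_const θ))
        (ContinuousOn.add (ha'.mono hUW)
          (((hb'.mono hUW).sub (ha'.mono hUW)).mul continuousOn_const))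
        (fun t ht => hUO t ht θ hθ) r hr) htU
  rw [Measure.restrict_restrict measurableSet_Icc, Set.inter_self] at hD
  have hconv : ∀ f : ℝ → ℝ, ∫ θ in Icc (0 : ℝ) 1, f θ = ∫ θ in (0 : ℝ)..1, f θ := fun f => by
    rw [intervalIntegral.integral_of_le zero_le_one, integral_Icc_eq_integral_Ioc]
  simp only [hconv] at hD
  have hsub : ∀ (r : ℝ) (F : ℝ → ℝ), ∫ θ in (0 : ℝ)..1, (b r - a r) * F (a r + (b r - a r) * θ) =
      ∫ s in a r..b r, F s := by
    intro r F
    rw [intervalIntegral.integral_const_mul, intervalIntegral.mul_integral_comp_add_mul]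
    simp
  have e1 : (fun t => ∫ s in a t..b t, G t s) =
      fun t => ∫ θ in (0 : ℝ)..1, (b t - a t) * G t (a t + (b t - a t) * θ) := by
    ext r; rw [hsub r (G r)]
  rw [e1]
  refine hD.congr_deriv ?_
  have hsl : ∀ {F : ℝ → ℝ → ℝ}, ContinuousOn (fun q : ℝ × ℝ => F q.1 q.2) O →
      ContinuousOn (fun θ => F t (a t + (b t - a t) * θ)) (uIcc (0 : ℝ) 1) := by
    intro F hF
    rw [uIcc_of_le zero_le_one]
    exact hF.comp (f := fun θ => (t, a t + (b t - a t) * θ)) (by fun_prop) hmem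
  have hparts : ∫ θ in (0 : ℝ)..1, ((b' t - a' t) * G t (a t + (b t - a t) * θ) +
      (a' t + (b' t - a' t) * θ) * ((b t - a t) * Gs t (a t + (b t - a t) * θ))) =
      b' t * G t (b t) - a' t * G t (a t) := by
    rw [intervalIntegral.integral_eq_sub_of_hasDerivAt
      (f := fun θ => (a' t + (b' t - a' t) * θ) * G t (a t + (b t - a t) * θ))]
    · simp
    · intro θ hθ
      rw [uIcc_of_le zero_le_one] at hθ
      have h1 : HasDerivAt (fun θ : ℝ => a t + (b t - a t) * θ) (b t - a t) θ := by
        simpa using ((hasDerivAt_id θ).const_mul (b t - a t)).const_add (a t)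
      have h2 : HasDerivAt (fun θ : ℝ => a' t + (b' t - a' t) * θ) (b' t - a' t) θ := by
        simpa using ((hasDerivAt_id θ).const_mul (b' t - a' t)).const_add (a' t)
      have h3 := (hs t _ (hmem θ hθ)).comp θ h1
      exact (h2.mul h3).congr_deriv (by simp only [Function.comp]; ring)
    · exact ((continuousOn_const.mul (hsl hG)).add (ContinuousOn.mul (by fun_prop)
        (continuousOn_const.mul (hsl hGs)))).intervalIntegrable
  rw [← hparts, ← hsub t (Gt t), ← intervalIntegral.integral_add]
  · congr 1; ext θ; ring
  · exact ((continuousOn_const.mul (hsl hG)).add (ContinuousOn.mul (by fun_prop)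
        (continuousOn_const.mul (hsl hGs)))).intervalIntegrable
  · exact (continuousOn_const.mul (hsl hGt)).intervalIntegrable


/-- Space-time divergence of a current on `ℝ × ℝ³`. -/
def divST (J0 : M4 → ℝ) (J : Fin 3 → M4 → ℝ) (q : M4) : ℝ :=
  fderiv ℝ J0 q (1, 0) + ∑ i, fderiv ℝ (J i) q (0, e3 i)

/-- Integral of `F` over the sphere of radius `s` about `o` at time `t`. -/
def sphInt (o : E3) (F : M4 → S2 → ℝ) (t s : ℝ) : ℝ :=
  s ^ 2 * ∫ ω : S2, F (t, o + s • ω.1) ω ∂sphereMeasure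

/-- Radii and times whose spheres about `o` lie in `Ω`. -/
def sphDom (o : E3) (Ω : Set M4) : Set (ℝ × ℝ) :=
  {q | ∀ ω ∈ (univ : Set S2), (q, ω) ∈
    (fun z : (ℝ × ℝ) × S2 => (z.1.1, o + z.1.2 • (z.2 : E3))) ⁻¹' Ω}

lemma isOpen_sphDom (o : E3) {Ω : Set M4} (hΩ : IsOpen Ω) : IsOpen (sphDom o Ω) :=
  isOpen_forall_compact isCompact_univ (hΩ.preimage (by fun_prop))

lemma continuousOn_comp_sph {o : E3} {Ω : Set M4} {β : Type*} [TopologicalSpace β]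
    {F : M4 → β} (hF : ContinuousOn F Ω) :
    ContinuousOn (fun z : (ℝ × ℝ) × S2 => F (z.1.1, o + z.1.2 • (z.2 : E3)))
      (sphDom o Ω ×ˢ univ) :=
  hF.comp (f := fun z : (ℝ × ℝ) × S2 => (z.1.1, o + z.1.2 • (z.2 : E3))) (by fun_prop)
    fun z hz => hz.1 z.2 trivial

lemma continuousOn_sphInt {o : E3} {Ω : Set M4} (hΩ : IsOpen Ω) {F : M4 → S2 → ℝ}
    (hF : ContinuousOn (fun z : M4 × S2 => F z.1 z.2) (Ω ×ˢ univ)) :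
    ContinuousOn (fun q : ℝ × ℝ => sphInt o F q.1 q.2) (sphDom o Ω) := by
  refine ContinuousOn.mul (by fun_prop) (continuousOn_sphere (isOpen_sphDom o hΩ) ?_)
  exact hF.comp (f := fun z : (ℝ × ℝ) × S2 => ((z.1.1, o + z.1.2 • (z.2 : E3)), z.2))
    (by fun_prop) fun z hz => ⟨hz.1 z.2 trivial, trivial⟩

lemma hasDerivAt_sphInt_curve {o : E3} {Ω : Set M4} (hΩ : IsOpen Ω) {J0 : M4 → ℝ}
    (h0 : ContDiffOn ℝ 1 J0 Ω) {τ σ τ' σ' : ℝ → ℝ} {W : Set ℝ} (hW : IsOpen W)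
    (hτ : ∀ t ∈ W, HasDerivAt τ (τ' t) t) (hτ' : ContinuousOn τ' W)
    (hσ : ∀ t ∈ W, HasDerivAt σ (σ' t) t) (hσ' : ContinuousOn σ' W)
    (hmem : ∀ t ∈ W, (τ t, σ t) ∈ sphDom o Ω) {t : ℝ} (ht : t ∈ W) :
    HasDerivAt (fun t => ∫ ω : S2, J0 (τ t, o + σ t • ω.1) ∂sphereMeasure)
      (∫ ω : S2, (τ' t * fderiv ℝ J0 (τ t, o + σ t • ω.1) (1, 0) +
        σ' t * fderiv ℝ J0 (τ t, o + σ t • ω.1) (0, ω.1)) ∂sphereMeasure) t := by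
  have hcτ : ContinuousOn τ W := fun t ht => (hτ t ht).continuousAt.continuousWithinAt
  have hcσ : ContinuousOn σ W := fun t ht => (hσ t ht).continuousAt.continuousWithinAt
  have hfst : ∀ {f : ℝ → ℝ}, ContinuousOn f W →
      ContinuousOn (fun q : ℝ × S2 => f q.1) (W ×ˢ univ) := fun hf =>
    hf.comp continuousOn_fst fun q hq => hq.1
  have hpt : ContinuousOn (fun q : ℝ × S2 => (τ q.1, o + σ q.1 • (q.2 : E3)))
      (W ×ˢ univ) := by
    have h1 := hfst hcτ
    have h2 := hfst hcσ
    exact h1.prodMk (continuousOn_const.add (h2.smul (by fun_prop)))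
  have hm : Set.MapsTo (fun q : ℝ × S2 => (τ q.1, o + σ q.1 • (q.2 : E3)))
      (W ×ˢ univ) Ω := fun q hq => hmem q.1 hq.1 q.2 trivial
  have hcD := (h0.continuousOn_fderiv_of_isOpen hΩ le_rfl).comp hpt hm
  refine hasDerivAt_sphere (f := fun t ω => J0 (τ t, o + σ t • ω.1))
    (f' := fun t ω => τ' t * fderiv ℝ J0 (τ t, o + σ t • ω.1) (1, 0) +
        σ' t * fderiv ℝ J0 (τ t, o + σ t • ω.1) (0, ω.1)) hW
    (h0.continuousOn.comp hpt hm) ?_ ?_ ht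
  · exact ((hfst hτ').mul (hcD.clm_apply continuousOn_const)).add
      ((hfst hσ').mul (hcD.clm_apply (by fun_prop)))
  · intro s hs ω
    have h1 : HasFDerivAt J0 (fderiv ℝ J0 (τ s, o + σ s • ω.1))
        (τ s, o + σ s • ω.1) :=
      ((h0.differentiableOn one_ne_zero).differentiableAt
        (hΩ.mem_nhds (hmem s hs ω trivial))).hasFDerivAt
    have h2 : HasDerivAt (fun r : ℝ => o + σ r • ω.1) (σ' s • ω.1) s :=
      ((hσ s hs).smul_const ω.1).const_add o
    refine (h1.comp_hasDerivAt s ((hτ s hs).prodMk h2)).congr_deriv ?_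
    rw [← smul_eq_mul, ← smul_eq_mul, ← map_smul, ← map_smul, ← map_add]
    simp

lemma integrable_sphere {f : S2 → ℝ} (hf : Continuous f) : Integrable f sphereMeasure :=
  hf.integrable_of_hasCompactSupport (HasCompactSupport.of_compactSpace _)

/-- The energy identity for a current on the region `l t ≤ |x - o| ≤ c - t`, `0 ≤ t ≤ T`. -/
theorem energy_identity {J0 : M4 → ℝ} {J : Fin 3 → M4 → ℝ} {Ω : Set M4}
    (hΩ : IsOpen Ω) (h0 : ContDiffOn ℝ 1 J0 Ω) (hJ : ∀ i, ContDiffOn ℝ 1 (J i) Ω) (o : E3)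
    {l l' : ℝ → ℝ} {W : Set ℝ} (hW : IsOpen W) {c T : ℝ} (hT : 0 ≤ T)
    (hTW : Icc 0 T ⊆ W) (hl : ∀ t ∈ W, HasDerivAt l (l' t) t) (hl' : ContinuousOn l' W)
    (hle : ∀ t ∈ Icc 0 T, l t ≤ c - t)
    (hreg : ∀ t ∈ Icc 0 T, ∀ s ∈ Icc (l t) (c - t), ∀ ω : S2, (t, o + s • ω.1) ∈ Ω) :
    (∫ s in l T..c - T, sphInt o (fun q _ => J0 q) T s) +
      (∫ t in (0 : ℝ)..T, sphInt o (fun q ω => J0 q + ∑ i, ω.1 i * J i q) t (c - t)) +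
      (∫ t in (0 : ℝ)..T, sphInt o (fun q ω => l' q.1 * J0 q - ∑ i, ω.1 i * J i q) t (l t)) =
    (∫ s in l 0..c, sphInt o (fun q _ => J0 q) 0 s) +
      ∫ t in (0 : ℝ)..T, ∫ s in l t..c - t, sphInt o (fun q _ => divST J0 J q) t s := by
  have hO := isOpen_sphDom o hΩ
  have hcJ0 := h0.continuousOn
  have hcD0 := h0.continuousOn_fderiv_of_isOpen hΩ le_rfl
  have hcJ := fun i => (hJ i).continuousOn
  have hcDJ := fun i => (hJ i).continuousOn_fderiv_of_isOpen hΩ le_rfl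
  have hfst : ∀ {β : Type} [TopologicalSpace β] {F : M4 → β}, ContinuousOn F Ω →
      ContinuousOn (fun z : M4 × S2 => F z.1) (Ω ×ˢ univ) := fun hF =>
    hF.comp continuousOn_fst fun z hz => hz.1
  have hct : ContinuousOn (fun q => fderiv ℝ J0 q (1, 0)) Ω := hcD0.clm_apply continuousOn_const
  have hcx : ContinuousOn (fun q => ∑ i, fderiv ℝ (J i) q (0, e3 i)) Ω :=
    continuousOn_finsetSum _ fun i _ => (hcDJ i).clm_apply continuousOn_const
  have hfl : ContinuousOn (fun z : M4 × S2 => ∑ i, z.2.1 i * J i z.1) (Ω ×ˢ univ) :=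
    continuousOn_finsetSum _ fun i _ => ContinuousOn.mul (by fun_prop) (hfst (hcJ i))
  have hG0 : ContinuousOn (fun q : ℝ × ℝ => sphInt o (fun q _ => J0 q) q.1 q.2) (sphDom o Ω) :=
    continuousOn_sphInt hΩ (hfst hcJ0)
  have hGt : ContinuousOn (fun q : ℝ × ℝ => sphInt o (fun q _ => fderiv ℝ J0 q (1, 0)) q.1 q.2)
      (sphDom o Ω) := continuousOn_sphInt hΩ (hfst hct)
  have hGx : ContinuousOn (fun q : ℝ × ℝ =>
      sphInt o (fun q _ => ∑ i, fderiv ℝ (J i) q (0, e3 i)) q.1 q.2) (sphDom o Ω) :=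
    continuousOn_sphInt hΩ (hfst hcx)
  have hD : ContinuousOn (fun q : ℝ × ℝ => sphInt o (fun q _ => divST J0 J q) q.1 q.2)
      (sphDom o Ω) :=
    continuousOn_sphInt hΩ (hfst (hct.add hcx))
  have hG1 : ContinuousOn (fun q : ℝ × ℝ =>
      sphInt o (fun q ω => ∑ i, ω.1 i * J i q) q.1 q.2) (sphDom o Ω) :=
    continuousOn_sphInt hΩ hfl
  have hGs : ContinuousOn (fun q : ℝ × ℝ =>
      2 * q.2 * (∫ ω : S2, J0 (q.1, o + q.2 • ω.1) ∂sphereMeasure) +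
        sphInt o (fun q ω => fderiv ℝ J0 q (0, ω.1)) q.1 q.2) (sphDom o Ω) := by
    refine ContinuousOn.add (ContinuousOn.mul (by fun_prop) ?_) ?_
    · exact continuousOn_sphere hO (continuousOn_comp_sph hcJ0)
    · exact continuousOn_sphInt hΩ ((hfst hcD0).clm_apply (by fun_prop))
  have hInt : ∀ {t s : ℝ}, (t, s) ∈ sphDom o Ω → ∀ {F : M4 → S2 → ℝ},
      ContinuousOn (fun z : M4 × S2 => F z.1 z.2) (Ω ×ˢ univ) →
      Integrable (fun ω : S2 => F (t, o + s • ω.1) ω) sphereMeasure := by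
    intro t s hts F hF
    exact integrable_sphere (hF.comp_continuous
      (f := fun ω : S2 => ((t, o + s • ω.1), ω)) (by fun_prop)
      (fun ω => ⟨hts ω trivial, trivial⟩))
  have hslice : ∀ t s, (t, s) ∈ sphDom o Ω → HasDerivAt (fun s => sphInt o (fun q _ => J0 q) t s)
      (2 * s * (∫ ω : S2, J0 (t, o + s • ω.1) ∂sphereMeasure) +
        sphInt o (fun q ω => fderiv ℝ J0 q (0, ω.1)) t s) s := by
    intro t s hts
    have h1 := hasDerivAt_sphInt_curve hΩ h0 (o := o) (τ := fun _ => t) (τ' := fun _ => 0)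
      (σ := fun s => s) (σ' := fun _ => 1) (W := {s | (t, s) ∈ sphDom o Ω})
      (hO.preimage (by fun_prop)) (fun s _ => hasDerivAt_const s t) continuousOn_const
      (fun s _ => hasDerivAt_id s) continuousOn_const (fun s hs => hs) hts
    refine ((hasDerivAt_pow 2 s).mul h1).congr_deriv ?_
    simp [sphInt]
  have hflux : ∀ t s, (t, s) ∈ sphDom o Ω →
      HasDerivAt (fun s => sphInt o (fun q ω => ∑ i, ω.1 i * J i q) t s)
        (sphInt o (fun q _ => ∑ i, fderiv ℝ (J i) q (0, e3 i)) t s) s := by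
    intro t s hts
    have hV : IsOpen {x : E3 | (t, x) ∈ Ω} := hΩ.preimage (by fun_prop)
    have h1 := hasDerivAt_sphere_flux (Y := fun i x => J i (t, x)) hV
      (fun i => (hJ i).comp (f := fun x => (t, x)) (by fun_prop) (fun x hx => hx)) o
      (s := s) (fun ω => hts ω trivial)
    refine h1.congr_deriv ?_
    unfold sphInt
    congr 1
    refine integral_congr_ae (Eventually.of_forall fun ω => ?_)
    refine sum_congr rfl fun i _ => ?_
    have h2 : HasFDerivAt (J i) (fderiv ℝ (J i) (t, o + s • ω.1)) (t, o + s • ω.1) :=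
      (((hJ i).differentiableOn one_ne_zero).differentiableAt
        (hΩ.mem_nhds (hts ω trivial))).hasFDerivAt
    have h3 : HasFDerivAt (fun x => J i (t, x)) _ (o + s • ω.1) :=
      h2.comp (o + s • ω.1) (hasFDerivAt_prodMk_right t (o + s • ω.1))
    rw [h3.fderiv]
    simp
  have hcurve : ∀ (σ σ' : ℝ → ℝ) (W : Set ℝ), IsOpen W → (∀ t ∈ W, HasDerivAt σ (σ' t) t) →
      ContinuousOn σ' W → (∀ t ∈ W, (t, σ t) ∈ sphDom o Ω) →
      ∀ t ∈ W, HasDerivAt (fun t => sphInt o (fun q _ => J0 q) t (σ t))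
        (sphInt o (fun q _ => fderiv ℝ J0 q (1, 0)) t (σ t) + σ' t *
          (2 * σ t * (∫ ω : S2, J0 (t, o + σ t • ω.1) ∂sphereMeasure) +
            sphInt o (fun q ω => fderiv ℝ J0 q (0, ω.1)) t (σ t))) t := by
    intro σ σ' W hW hσ hσ' hmem t ht
    have h1 := hasDerivAt_sphInt_curve hΩ h0 (o := o) (τ := fun t => t) (τ' := fun _ => 1) hW
      (fun s _ => hasDerivAt_id s) continuousOn_const hσ hσ' hmem ht
    refine (((hσ t ht).pow 2).mul h1).congr_deriv ?_
    rw [integral_add, integral_const_mul, integral_const_mul]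
    · simp only [sphInt, Pi.pow_apply, Nat.cast_ofNat, Nat.add_one_sub_one, pow_one]
      ring
    · exact (hInt (hmem t ht) (F := fun q _ => fderiv ℝ J0 q (1, 0))
        (hfst hct)).const_mul _
    · exact (hInt (hmem t ht) (F := fun q ω => fderiv ℝ J0 q (0, ω.1))
        ((hfst hcD0).clm_apply (by fun_prop))).const_mul _
  have hmemseg : ∀ t ∈ Icc 0 T, ∀ s ∈ Icc (l t) (c - t), (t, s) ∈ sphDom o Ω :=
    fun t ht s hs ω _ => hreg t ht s hs ω
  have hmem : ∀ t ∈ Icc 0 T, ∀ θ ∈ Icc (0 : ℝ) 1, (t, l t + ((c - t) - l t) * θ) ∈ sphDom o Ω := by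
    intro t ht θ hθ
    refine hmemseg t ht _ ⟨?_, ?_⟩
    · nlinarith [hle t ht, hθ.1]
    · nlinarith [hle t ht, hθ.2]
  have hbd : ∀ t ∈ W, HasDerivAt (fun t : ℝ => c - t) (-1) t := fun t _ => by
    simpa using (hasDerivAt_id t).const_sub c
  have hin : ∀ t ∈ Icc 0 T, sphInt o (fun q ω => l' q.1 * J0 q - ∑ i, ω.1 i * J i q) t (l t) =
      l' t * sphInt o (fun q _ => J0 q) t (l t) -
        sphInt o (fun q ω => ∑ i, ω.1 i * J i q) t (l t) := by
    intro t ht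
    have hml := hmemseg t ht _ ⟨le_rfl, hle t ht⟩
    simp only [sphInt]
    rw [integral_sub, integral_const_mul]
    · ring
    · exact (hInt hml (F := fun q _ => J0 q) (hfst hcJ0)).const_mul _
    · exact hInt hml (F := fun q ω => ∑ i, ω.1 i * J i q) hfl
  have hder : ∀ t ∈ uIcc 0 T, HasDerivAt
      (fun t => ∫ s in l t..c - t, sphInt o (fun q _ => J0 q) t s)
      (-sphInt o (fun q ω => J0 q + ∑ i, ω.1 i * J i q) t (c - t) -
        sphInt o (fun q ω => l' q.1 * J0 q - ∑ i, ω.1 i * J i q) t (l t) +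
        ∫ s in l t..c - t, sphInt o (fun q _ => divST J0 J q) t s) t := by
    intro t ht
    rw [uIcc_of_le hT] at ht
    refine (hasDerivAt_integral_moving hO hG0 hGt hGs hslice hcurve hW hl hbd hl'
      continuousOn_const (hTW ht) (hmem t ht)).congr_deriv ?_
    have hu : uIcc (l t) (c - t) = Icc (l t) (c - t) := uIcc_of_le (hle t ht)
    have hsub : ∀ {G : ℝ → ℝ → ℝ}, ContinuousOn (fun q : ℝ × ℝ => G q.1 q.2) (sphDom o Ω) →
        IntervalIntegrable (G t) volume (l t) (c - t) := by
      intro G hG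
      refine ContinuousOn.intervalIntegrable_of_Icc (hle t ht) ?_
      exact hG.comp (f := fun s => (t, s)) (by fun_prop) (fun s hs => hmemseg t ht s hs)
    have h1 := intervalIntegral.integral_eq_sub_of_hasDerivAt
      (f := fun s => sphInt o (fun q ω => ∑ i, ω.1 i * J i q) t s)
      (f' := fun s => sphInt o (fun q _ => ∑ i, fderiv ℝ (J i) q (0, e3 i)) t s)
      (a := l t) (b := c - t)
      (fun s hs => hflux t s (hmemseg t ht s (hu ▸ hs))) (hsub hGx)
    have h2 : ∫ s in l t..c - t, sphInt o (fun q _ => divST J0 J q) t s =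
        (∫ s in l t..c - t, sphInt o (fun q _ => fderiv ℝ J0 q (1, 0)) t s) +
        ∫ s in l t..c - t, sphInt o (fun q _ => ∑ i, fderiv ℝ (J i) q (0, e3 i)) t s := by
      rw [← intervalIntegral.integral_add (hsub hGt) (hsub hGx)]
      refine intervalIntegral.integral_congr fun s hs => ?_
      have hm := hmemseg t ht s (hu ▸ hs)
      simp only [sphInt, divST]
      rw [integral_add, mul_add]
      · exact hInt hm (F := fun q _ => fderiv ℝ J0 q (1, 0)) (hfst hct)
      · exact hInt hm (F := fun q _ => ∑ i, fderiv ℝ (J i) q (0, e3 i)) (hfst hcx)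
    have hmb := hmemseg t ht (c - t) ⟨hle t ht, le_rfl⟩
    have h3 : sphInt o (fun q ω => J0 q + ∑ i, ω.1 i * J i q) t (c - t) =
        sphInt o (fun q _ => J0 q) t (c - t) +
          sphInt o (fun q ω => ∑ i, ω.1 i * J i q) t (c - t) := by
      simp only [sphInt]
      rw [integral_add, mul_add]
      · exact hInt hmb (F := fun q _ => J0 q) (hfst hcJ0)
      · exact hInt hmb (F := fun q ω => ∑ i, ω.1 i * J i q) hfl
    rw [h2, h1, h3, hin t ht]
    ring
  have hcl : ContinuousOn l W := fun t ht => (hl t ht).continuousAt.continuousWithinAt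
  have hI1 : IntervalIntegrable (fun t => sphInt o (fun q ω => J0 q + ∑ i, ω.1 i * J i q) t
      (c - t)) volume 0 T := by
    refine ContinuousOn.intervalIntegrable_of_Icc hT ?_
    have := continuousOn_sphInt (o := o) hΩ (F := fun q ω => J0 q + ∑ i, ω.1 i * J i q)
      ((hfst hcJ0).add hfl)
    exact this.comp (f := fun t => (t, c - t)) (by fun_prop)
      (fun t ht => hmemseg t ht _ ⟨hle t ht, le_rfl⟩)
  have hI2 : IntervalIntegrable (fun t => sphInt o (fun q ω => l' q.1 * J0 q -
      ∑ i, ω.1 i * J i q) t (l t)) volume 0 T := by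
    refine ContinuousOn.intervalIntegrable_of_Icc hT ?_
    have hpt : ContinuousOn (fun t => (t, l t)) (Icc 0 T) :=
      continuousOn_id.prodMk (hcl.mono hTW)
    have hmt : Set.MapsTo (fun t => (t, l t)) (Icc 0 T) (sphDom o Ω) :=
      fun t ht => hmemseg t ht _ ⟨le_rfl, hle t ht⟩
    have h5 := (hl'.mono hTW).mul (hG0.comp hpt hmt)
    exact (h5.sub (hG1.comp hpt hmt)).congr hin
  have hI3 : IntervalIntegrable (fun t => ∫ s in l t..c - t,
      sphInt o (fun q _ => divST J0 J q) t s) volume 0 T := by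
    refine ContinuousOn.intervalIntegrable_of_Icc hT ?_
    intro t ht
    exact (continuousAt_integral_moving hO hD hW hcl (b := fun t => c - t) (by fun_prop) (hTW ht)
      (hmem t ht)).continuousWithinAt
  have hI12 := hI1.neg.sub hI2
  have e1 := intervalIntegral.integral_add hI12 hI3
  have e2 := intervalIntegral.integral_sub hI1.neg hI2
  have hfin := intervalIntegral.integral_eq_sub_of_hasDerivAt hder (hI12.add hI3)
  simp only [Pi.neg_apply, intervalIntegral.integral_neg] at e1 e2
  rw [e1, e2, sub_zero] at hfin
  linarith

section Current

/-- The radial contraction `x · ∇ψ`. -/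
def rdot (ψ : Wave) (q : M4) : ℝ := ∑ i, q.2 i * dx i ψ q.1 q.2

/-- The squared length of the spatial gradient. -/
def gradSq (ψ : Wave) (q : M4) : ℝ := ∑ i, dx i ψ q.1 q.2 ^ 2

/-- `r⁻¹ ∂_r (r ψ)`. -/
def wrad (ψ : Wave) (q : M4) : ℝ := (rdot ψ q + ψ q.1 q.2) / ‖q.2‖

/-- The multiplier applied to `ψ`. -/
def curA (F G : M4 → ℝ) (ψ : Wave) (q : M4) : ℝ :=
  F q * dt1 ψ q.1 q.2 + G q * wrad ψ q

/-- Coefficient of `x` in the spatial current. -/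
def curB (F G U : M4 → ℝ) (ψ : Wave) (q : M4) : ℝ :=
  -(F q * dt1 ψ q.1 q.2 * ψ q.1 q.2 / ‖q.2‖ ^ 2) + G q / ‖q.2‖ *
    (gradSq ψ q / 2 - dt1 ψ q.1 q.2 ^ 2 / 2 - ψ q.1 q.2 ^ 2 / (2 * ‖q.2‖ ^ 2) + U q)

/-- Time component of the energy current. -/
def cur0 (F G U : M4 → ℝ) (ψ : Wave) (q : M4) : ℝ :=
  F q / 2 * (dt1 ψ q.1 q.2 ^ 2 + wrad ψ q ^ 2 + (gradSq ψ q - rdot ψ q ^ 2 / ‖q.2‖ ^ 2)) +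
    G q * dt1 ψ q.1 q.2 * wrad ψ q + F q * U q

/-- Space components of the energy current. -/
def curS (F G U : M4 → ℝ) (ψ : Wave) (i : Fin 3) (q : M4) : ℝ :=
  -(curA F G ψ q * dx i ψ q.1 q.2) + curB F G U ψ q * q.2 i

lemma Smooth.contDiff_one {φ : Wave} (h : Smooth φ) :
    ContDiff ℝ 1 (fun q : M4 => φ q.1 q.2) := ContDiff.of_le h (by exact_mod_cast le_top)

lemma contDiffOn_norm_snd {Ω : Set M4} (hx : ∀ q ∈ Ω, q.2 ≠ 0) :
    ContDiffOn ℝ 1 (fun q : M4 => ‖q.2‖) Ω :=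
  ContDiffOn.norm ℝ contDiff_snd.contDiffOn hx

lemma contDiff_coord (i : Fin 3) : ContDiff ℝ 1 (fun q : M4 => q.2 i) := by fun_prop

lemma contDiff_rdot {ψ : Wave} (h : Smooth ψ) : ContDiff ℝ 1 (rdot ψ) :=
  ContDiff.sum fun i _ => (contDiff_coord i).mul (h.dx i).contDiff_one

lemma contDiff_gradSq {ψ : Wave} (h : Smooth ψ) : ContDiff ℝ 1 (gradSq ψ) :=
  ContDiff.sum fun i _ => (h.dx i).contDiff_one.pow 2

variable {F G U : M4 → ℝ} {ψ : Wave} {Ω : Set M4}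

lemma contDiffOn_wrad (h : Smooth ψ) (hx : ∀ q ∈ Ω, q.2 ≠ 0) : ContDiffOn ℝ 1 (wrad ψ) Ω :=
  ((contDiff_rdot h).add h.contDiff_one).contDiffOn.div (contDiffOn_norm_snd hx)
    fun q hq => norm_ne_zero_iff.2 (hx q hq)

lemma contDiffOn_curA (h : Smooth ψ) (hx : ∀ q ∈ Ω, q.2 ≠ 0) (hF : ContDiffOn ℝ 1 F Ω)
    (hG : ContDiffOn ℝ 1 G Ω) : ContDiffOn ℝ 1 (curA F G ψ) Ω :=
  (hF.mul h.dt1.contDiff_one.contDiffOn).add (hG.mul (contDiffOn_wrad h hx))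

lemma contDiffOn_curB (h : Smooth ψ) (hx : ∀ q ∈ Ω, q.2 ≠ 0) (hF : ContDiffOn ℝ 1 F Ω)
    (hG : ContDiffOn ℝ 1 G Ω) (hU : ContDiffOn ℝ 1 U Ω) : ContDiffOn ℝ 1 (curB F G U ψ) Ω := by
  have hr := contDiffOn_norm_snd hx
  have hr0 : ∀ q ∈ Ω, ‖q.2‖ ≠ 0 := fun q hq => norm_ne_zero_iff.2 (hx q hq)
  have hT := h.dt1.contDiff_one.contDiffOn (s := Ω)
  have hψ := h.contDiff_one.contDiffOn (s := Ω)
  refine ((((hF.mul hT).mul hψ).div (hr.pow 2) fun q hq => pow_ne_zero 2 (hr0 q hq)).neg).add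
    ((hG.div hr hr0).mul ((((contDiff_gradSq h).contDiffOn.div_const 2).sub
      ((hT.pow 2).div_const 2)).sub ((hψ.pow 2).div (contDiffOn_const.mul (hr.pow 2)) ?_) |>.add hU))
  exact fun q hq => mul_ne_zero two_ne_zero (pow_ne_zero 2 (hr0 q hq))

lemma contDiffOn_cur0 (h : Smooth ψ) (hx : ∀ q ∈ Ω, q.2 ≠ 0) (hF : ContDiffOn ℝ 1 F Ω)
    (hG : ContDiffOn ℝ 1 G Ω) (hU : ContDiffOn ℝ 1 U Ω) : ContDiffOn ℝ 1 (cur0 F G U ψ) Ω := by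
  have hr := contDiffOn_norm_snd hx
  have hr0 : ∀ q ∈ Ω, ‖q.2‖ ≠ 0 := fun q hq => norm_ne_zero_iff.2 (hx q hq)
  have hT := h.dt1.contDiff_one.contDiffOn (s := Ω)
  have hw := contDiffOn_wrad h hx
  exact (((hF.div_const 2).mul (((hT.pow 2).add (hw.pow 2)).add
    ((contDiff_gradSq h).contDiffOn.sub (((contDiff_rdot h).contDiffOn.pow 2).div (hr.pow 2)
      fun q hq => pow_ne_zero 2 (hr0 q hq))))).add ((hG.mul hT).mul hw)).add (hF.mul hU)

lemma contDiffOn_curS (h : Smooth ψ) (hx : ∀ q ∈ Ω, q.2 ≠ 0) (hF : ContDiffOn ℝ 1 F Ω)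
    (hG : ContDiffOn ℝ 1 G Ω) (hU : ContDiffOn ℝ 1 U Ω) (i : Fin 3) :
    ContDiffOn ℝ 1 (curS F G U ψ i) Ω :=
  ((contDiffOn_curA h hx hF hG).mul (h.dx i).contDiff_one.contDiffOn).neg.add
    ((contDiffOn_curB h hx hF hG hU).mul (contDiff_coord i).contDiffOn)

lemma fderiv_eq_of_hasDerivAt_line {E : Type*} [NormedAddCommGroup E] [NormedSpace ℝ E]
    {f : E → ℝ} {q v : E} {d : ℝ} (hf : DifferentiableAt ℝ f q)
    (hd : HasDerivAt (fun s : ℝ => f (q + s • v)) d 0) : fderiv ℝ f q v = d := by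
  have h1 : HasDerivAt (fun s : ℝ => q + s • v) v 0 := by
    simpa using ((hasDerivAt_id (0 : ℝ)).smul_const v).const_add q
  have h2 : HasFDerivAt f (fderiv ℝ f q) (q + (0 : ℝ) • v) := by simpa using hf.hasFDerivAt
  exact (h2.comp_hasDerivAt 0 h1).unique hd

lemma hasDerivAt_norm_line {x y : E3} (hx : x ≠ 0) :
    HasDerivAt (fun s : ℝ => ‖x + s • y‖) ((∑ i, x i * y i) / ‖x‖) 0 := by
  have h1 : HasDerivAt (fun s : ℝ => x + s • y) y 0 := by
    simpa using ((hasDerivAt_id (0 : ℝ)).smul_const y).const_add x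
  have h2 := h1.norm_sq
  have h3 := h2.sqrt (by simpa using hx)
  simp only [Real.sqrt_sq (norm_nonneg _)] at h3
  refine h3.congr_deriv ?_
  simp only [zero_smul, add_zero, inner_E3]
  field_simp

end Current

section Line

variable {ψ : Wave} (h : Smooth ψ) (q v : M4)

include h

lemma smooth_hasDerivAt_line : HasDerivAt (fun s : ℝ => ψ (q + s • v).1 (q + s • v).2)
    (v.1 * dt1 ψ q.1 q.2 + ∑ i, v.2 i * dx i ψ q.1 q.2) 0 := by
  have h1 : HasDerivAt (fun s : ℝ => (q + s • v).1) v.1 0 := by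
    simpa using ((hasDerivAt_id (0 : ℝ)).mul_const v.1).const_add q.1
  have h2 : HasDerivAt (fun s : ℝ => (q + s • v).2) v.2 0 := by
    simpa using ((hasDerivAt_id (0 : ℝ)).smul_const v.2).const_add q.2
  simpa using h.hasDerivAt_comp h1 h2

lemma hasDerivAt_rdot_line : HasDerivAt (fun s : ℝ => rdot ψ (q + s • v))
    (∑ i, (v.2 i * dx i ψ q.1 q.2 + q.2 i * (v.1 * dt1 (dx i ψ) q.1 q.2 +
      ∑ j, v.2 j * dx j (dx i ψ) q.1 q.2))) 0 := by
  unfold rdot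
  refine HasDerivAt.fun_sum fun i _ => ?_
  have h1 : HasDerivAt (fun s : ℝ => (q + s • v).2 i) (v.2 i) 0 := by
    simpa using ((hasDerivAt_id (0 : ℝ)).mul_const (v.2 i)).const_add (q.2 i)
  refine (h1.mul (smooth_hasDerivAt_line (h.dx i) q v)).congr_deriv ?_
  simp

lemma hasDerivAt_gradSq_line : HasDerivAt (fun s : ℝ => gradSq ψ (q + s • v))
    (∑ i, 2 * dx i ψ q.1 q.2 * (v.1 * dt1 (dx i ψ) q.1 q.2 +
      ∑ j, v.2 j * dx j (dx i ψ) q.1 q.2)) 0 := by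
  unfold gradSq
  refine HasDerivAt.fun_sum fun i _ => ?_
  refine ((smooth_hasDerivAt_line (h.dx i) q v).pow 2).congr_deriv ?_
  simp

end Line

section Divergence

lemma hasDerivAt_wExpr {P ψ r : ℝ → ℝ} {P' ψ' r' s : ℝ} (hP : HasDerivAt P P' s)
    (hψ : HasDerivAt ψ ψ' s) (hr : HasDerivAt r r' s) (h0 : r s ≠ 0) :
    HasDerivAt (fun s => (P s + ψ s) / r s)
      ((P' + ψ') / r s - (P s + ψ s) * r' / r s ^ 2) s := by
  refine ((hP.add hψ).div hr h0).congr_deriv ?_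
  simp only [Pi.add_apply]
  field_simp

lemma hasDerivAt_aExpr {F T G w : ℝ → ℝ} {F' T' G' w' s : ℝ} (hF : HasDerivAt F F' s)
    (hT : HasDerivAt T T' s) (hG : HasDerivAt G G' s) (hw : HasDerivAt w w' s) :
    HasDerivAt (fun s => F s * T s + G s * w s)
      (F' * T s + F s * T' + (G' * w s + G s * w')) s :=
  (hF.mul hT).add (hG.mul hw)

lemma hasDerivAt_bExpr {F T ψ r G D U : ℝ → ℝ} {F' T' ψ' r' G' D' U' s : ℝ}
    (hF : HasDerivAt F F' s) (hT : HasDerivAt T T' s) (hψ : HasDerivAt ψ ψ' s)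
    (hr : HasDerivAt r r' s) (hG : HasDerivAt G G' s) (hD : HasDerivAt D D' s)
    (hU : HasDerivAt U U' s) (h0 : r s ≠ 0) :
    HasDerivAt (fun s => -(F s * T s * ψ s / r s ^ 2) + G s / r s *
        (D s / 2 - T s ^ 2 / 2 - ψ s ^ 2 / (2 * r s ^ 2) + U s))
      (-((F' * T s * ψ s + F s * T' * ψ s + F s * T s * ψ') / r s ^ 2 -
          2 * F s * T s * ψ s * r' / r s ^ 3) + (G' / r s - G s * r' / r s ^ 2) *
          (D s / 2 - T s ^ 2 / 2 - ψ s ^ 2 / (2 * r s ^ 2) + U s) +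
        G s / r s * (D' / 2 - T s * T' - (ψ s * ψ' / r s ^ 2 - ψ s ^ 2 * r' / r s ^ 3) + U')) s := by
  have h2 : (r s) ^ 2 ≠ 0 := pow_ne_zero 2 h0
  refine ((((hF.mul hT).mul hψ).div (hr.pow 2) h2).neg.add ((hG.div hr h0).mul
    ((((hD.div_const 2).sub ((hT.pow 2).div_const 2)).sub ((hψ.pow 2).div
      ((hr.pow 2).const_mul 2) (mul_ne_zero two_ne_zero h2))).add hU))).congr_deriv ?_
  simp only [Pi.mul_apply, Pi.pow_apply, Pi.sub_apply, Pi.add_apply, Pi.div_apply]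
  field_simp
  ring

lemma hasDerivAt_eExpr {F T w D P r G U : ℝ → ℝ} {F' T' w' D' P' r' G' U' s : ℝ}
    (hF : HasDerivAt F F' s) (hT : HasDerivAt T T' s) (hw : HasDerivAt w w' s)
    (hD : HasDerivAt D D' s) (hP : HasDerivAt P P' s) (hr : HasDerivAt r r' s)
    (hG : HasDerivAt G G' s) (hU : HasDerivAt U U' s) (h0 : r s ≠ 0) :
    HasDerivAt (fun s => F s / 2 * (T s ^ 2 + w s ^ 2 + (D s - P s ^ 2 / r s ^ 2)) +
        G s * T s * w s + F s * U s)
      (F' / 2 * (T s ^ 2 + w s ^ 2 + (D s - P s ^ 2 / r s ^ 2)) +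
        F s / 2 * (2 * T s * T' + 2 * w s * w' + (D' - (2 * P s * P' / r s ^ 2 -
          2 * P s ^ 2 * r' / r s ^ 3))) +
        (G' * T s * w s + G s * T' * w s + G s * T s * w') + (F' * U s + F s * U')) s := by
  have h2 : (r s) ^ 2 ≠ 0 := pow_ne_zero 2 h0
  refine ((((hF.div_const 2).mul (((hT.pow 2).add (hw.pow 2)).add (hD.sub
    ((hP.pow 2).div (hr.pow 2) h2)))).add ((hG.mul hT).mul hw)).add
      (hF.mul hU)).congr_deriv ?_
  simp only [Pi.mul_apply, Pi.pow_apply, Pi.sub_apply, Pi.add_apply, Pi.div_apply]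
  field_simp
  ring

/-- Algebraic form of the divergence identity. -/
lemma divergence_algebra {r ψ T P D S R M tt L V V' p f₁ f₂ a₁ b₁ a₂ b₂ w : ℝ} (h0 : r ≠ 0)
    (hV : V' * ψ = (p + 1) * V) (hw : w = (P + ψ) / r) :
    (((a₁ + a₂) / 2 * (T ^ 2 + w ^ 2 + (D - P ^ 2 / r ^ 2)) +
        (f₁ + f₂) / 2 * (2 * T * tt + 2 * w * ((R + T) / r) + (2 * S - 2 * P * R / r ^ 2)) +
        ((a₁ - a₂) * T * w + (f₁ - f₂) * tt * w + (f₁ - f₂) * T * ((R + T) / r)) +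
        ((a₁ + a₂) * V + (f₁ + f₂) * (V' * T))) +
      (-(((P / r * (b₁ + b₂)) * T + (f₁ + f₂) * S + (P / r * (b₁ - b₂) * w +
        (f₁ - f₂) * ((D + M + D) / r - (P + ψ) * (P / r) / r ^ 2))) +
        ((f₁ + f₂) * T + (f₁ - f₂) * w) * L) +
      ((-((r * (b₁ + b₂) * T * ψ + (f₁ + f₂) * R * ψ + (f₁ + f₂) * T * P) / r ^ 2 -
          2 * (f₁ + f₂) * T * ψ * r / r ^ 3) + (r * (b₁ - b₂) / r - (f₁ - f₂) * r / r ^ 2) *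
          (D / 2 - T ^ 2 / 2 - ψ ^ 2 / (2 * r ^ 2) + V) +
        (f₁ - f₂) / r * (2 * M / 2 - T * R - (ψ * P / r ^ 2 - ψ ^ 2 * r / r ^ 3) + V' * P)) +
      3 * (-((f₁ + f₂) * T * ψ / r ^ 2) + (f₁ - f₂) / r *
        (D / 2 - T ^ 2 / 2 - ψ ^ 2 / (2 * r ^ 2) + V))))) =
    -(L - tt - V') * ((f₁ + f₂) * T + (f₁ - f₂) * w) + (a₁ - b₁) / 2 * (T + w) ^ 2 +
      (a₂ + b₂) / 2 * (T - w) ^ 2 +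
      (a₁ + b₁ + a₂ - b₂ - 2 * (f₁ - f₂) / r) / 2 * (D - P ^ 2 / r ^ 2) +
      (a₁ + b₁ + a₂ - b₂ - (p - 1) * (f₁ - f₂) / r) * V := by
  have hP : P = r * w - ψ := by rw [hw]; field_simp; ring
  subst hP
  have e1 : V' * ψ - (p + 1) * V = 0 := by linarith
  field_simp
  linear_combination (-(2 * (f₁ - f₂) * r ^ 2)) * e1


lemma fderiv_coord_apply (q : M4) (i : Fin 3) (v : M4) :
    fderiv ℝ (fun q : M4 => q.2 i) q v = v.2 i := by
  refine fderiv_eq_of_hasDerivAt_line ((contDiff_coord i).differentiable one_ne_zero q) ?_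
  simpa using ((hasDerivAt_id (0 : ℝ)).mul_const (v.2 i)).const_add (q.2 i)

lemma sum_fderiv_smul_e3 {f : M4 → ℝ} (q : M4) (y : E3) :
    ∑ i, y i * fderiv ℝ f q (0, e3 i) = fderiv ℝ f q (0, y) := by
  have : ((0, y) : M4) = ∑ i, y i • ((0 : ℝ), e3 i) := by
    ext1
    · simp [Prod.fst_sum]
    · simpa [Prod.snd_sum] using e3_sum y
  rw [this, map_sum]
  simp_rw [map_smul, smul_eq_mul]

variable {f₁ f₂ U : M4 → ℝ} {ψ : Wave} {Ω : Set M4}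

/-- Divergence of the energy current with multiplier weights `f₁` (outgoing) and
`f₂` (incoming). -/
theorem divST_current (h : Smooth ψ) (hΩ : IsOpen Ω) (hx : ∀ q ∈ Ω, q.2 ≠ 0)
    (hf₁ : ContDiffOn ℝ 1 f₁ Ω) (hf₂ : ContDiffOn ℝ 1 f₂ Ω) (hU : ContDiffOn ℝ 1 U Ω)
    {q : M4} (hq : q ∈ Ω) {a₁ b₁ a₂ b₂ V' p : ℝ}
    (h₁ : ∀ v : M4, HasDerivAt (fun s : ℝ => f₁ (q + s • v))
      (v.1 * a₁ + (∑ i, q.2 i * v.2 i) / ‖q.2‖ * b₁) 0)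
    (h₂ : ∀ v : M4, HasDerivAt (fun s : ℝ => f₂ (q + s • v))
      (v.1 * a₂ + (∑ i, q.2 i * v.2 i) / ‖q.2‖ * b₂) 0)
    (h₃ : ∀ v : M4, HasDerivAt (fun s : ℝ => U (q + s • v))
      (V' * (v.1 * dt1 ψ q.1 q.2 + ∑ i, v.2 i * dx i ψ q.1 q.2)) 0)
    (hV : V' * ψ q.1 q.2 = (p + 1) * U q) :
    divST (cur0 (f₁ + f₂) (f₁ - f₂) U ψ) (curS (f₁ + f₂) (f₁ - f₂) U ψ) q =
    -(lap3 (ψ q.1) q.2 - dtt ψ q.1 q.2 - V') * curA (f₁ + f₂) (f₁ - f₂) ψ q +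
      (a₁ - b₁) / 2 * (dt1 ψ q.1 q.2 + wrad ψ q) ^ 2 +
      (a₂ + b₂) / 2 * (dt1 ψ q.1 q.2 - wrad ψ q) ^ 2 +
      (a₁ + b₁ + a₂ - b₂ - 2 * (f₁ q - f₂ q) / ‖q.2‖) / 2 *
        (gradSq ψ q - rdot ψ q ^ 2 / ‖q.2‖ ^ 2) +
      (a₁ + b₁ + a₂ - b₂ - (p - 1) * (f₁ q - f₂ q) / ‖q.2‖) * U q := by
  have hF : ContDiffOn ℝ 1 (f₁ + f₂) Ω := hf₁.add hf₂
  have hG : ContDiffOn ℝ 1 (f₁ - f₂) Ω := hf₁.sub hf₂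
  have hx0 := hx q hq
  have hr0 : ‖q.2‖ ≠ 0 := norm_ne_zero_iff.2 hx0
  have dAt : ∀ {f : M4 → ℝ}, ContDiffOn ℝ 1 f Ω → DifferentiableAt ℝ f q := fun hf =>
    (hf.differentiableOn one_ne_zero).differentiableAt (hΩ.mem_nhds hq)
  have lF : ∀ v : M4, HasDerivAt (fun s : ℝ => (f₁ + f₂) (q + s • v))
      (v.1 * (a₁ + a₂) + (∑ i, q.2 i * v.2 i) / ‖q.2‖ * (b₁ + b₂)) 0 := fun v =>
    ((h₁ v).add (h₂ v)).congr_deriv (by ring)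
  have lG : ∀ v : M4, HasDerivAt (fun s : ℝ => (f₁ - f₂) (q + s • v))
      (v.1 * (a₁ - a₂) + (∑ i, q.2 i * v.2 i) / ‖q.2‖ * (b₁ - b₂)) 0 := fun v =>
    ((h₁ v).sub (h₂ v)).congr_deriv (by ring)
  have lr : ∀ v : M4, HasDerivAt (fun s : ℝ => ‖(q + s • v).2‖)
      ((∑ i, q.2 i * v.2 i) / ‖q.2‖) 0 := fun v => hasDerivAt_norm_line hx0
  have hr0' : ∀ v : M4, ‖(q + (0 : ℝ) • v).2‖ ≠ 0 := fun v => by simpa using hr0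
  have lψ := smooth_hasDerivAt_line h q
  have lT := smooth_hasDerivAt_line h.dt1 q
  have lP := hasDerivAt_rdot_line h q
  have lD := hasDerivAt_gradSq_line h q
  have lw := fun v : M4 => hasDerivAt_wExpr (lP v) (lψ v) (lr v) (hr0' v)
  have la := fun v : M4 => hasDerivAt_aExpr (lF v) (lT v) (lG v) (lw v)
  have lb := fun v : M4 =>
    hasDerivAt_bExpr (lF v) (lT v) (lψ v) (lr v) (lG v) (lD v) (h₃ v) (hr0' v)
  have le := fun v : M4 =>
    hasDerivAt_eExpr (lF v) (lT v) (lw v) (lD v) (lP v) (lr v) (lG v) (h₃ v) (hr0' v)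
  have fa := fun v => fderiv_eq_of_hasDerivAt_line (dAt (contDiffOn_curA h hx hF hG)) (la v)
  have fb := fun v => fderiv_eq_of_hasDerivAt_line (dAt (contDiffOn_curB h hx hF hG hU)) (lb v)
  have fe := fderiv_eq_of_hasDerivAt_line (dAt (contDiffOn_cur0 h hx hF hG hU)) (le (1, 0))
  have fS : ∀ i, fderiv ℝ (curS (f₁ + f₂) (f₁ - f₂) U ψ i) q (0, e3 i) =
      -(dx i ψ q.1 q.2 * fderiv ℝ (curA (f₁ + f₂) (f₁ - f₂) ψ) q (0, e3 i) +
        curA (f₁ + f₂) (f₁ - f₂) ψ q * dx i (dx i ψ) q.1 q.2) +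
      (q.2 i * fderiv ℝ (curB (f₁ + f₂) (f₁ - f₂) U ψ) q (0, e3 i) +
        curB (f₁ + f₂) (f₁ - f₂) U ψ q) := by
    intro i
    have e1 := dAt (contDiffOn_curA h hx hF hG)
    have e2 := dAt (contDiffOn_curB h hx hF hG hU)
    have e3' := (h.dx i).differentiable q
    have e4 := (contDiff_coord i).differentiable one_ne_zero q
    have e5 := ((e1.hasFDerivAt.mul e3'.hasFDerivAt).neg.add
      (e2.hasFDerivAt.mul e4.hasFDerivAt)).fderiv
    have e6 : curS (f₁ + f₂) (f₁ - f₂) U ψ i =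
      -(curA (f₁ + f₂) (f₁ - f₂) ψ * fun q : M4 => dx i ψ q.1 q.2) +
        curB (f₁ + f₂) (f₁ - f₂) U ψ * fun q => q.2 i := rfl
    rw [e6, e5]
    have e7 := (h.dx i).dx_eq i q.1 q.2
    simp only [add_apply, neg_apply, smul_apply, smul_eq_mul, fderiv_coord_apply, e3_apply, if_true, e7]
    ring
  have hsum : ∑ i, fderiv ℝ (curS (f₁ + f₂) (f₁ - f₂) U ψ i) q (0, e3 i) =
      -(fderiv ℝ (curA (f₁ + f₂) (f₁ - f₂) ψ) q (0, gradient (ψ q.1) q.2) +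
        curA (f₁ + f₂) (f₁ - f₂) ψ q * lap3 (ψ q.1) q.2) +
      (fderiv ℝ (curB (f₁ + f₂) (f₁ - f₂) U ψ) q (0, q.2) +
        3 * curB (f₁ + f₂) (f₁ - f₂) U ψ q) := by
    simp_rw [fS]
    rw [sum_add_distrib, Finset.sum_neg_distrib, sum_add_distrib,
      sum_add_distrib, ← mul_sum, sum_fderiv_smul_e3 q q.2, lap3_eq,
      ← sum_fderiv_smul_e3 q (gradient (ψ q.1) q.2)]
    simp [gradient_apply, dx]
  set r := ‖q.2‖ with hr
  set n : E3 := gradient (ψ q.1) q.2 with hn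
  have hni : ∀ i, n i = dx i ψ q.1 q.2 := fun i => gradient_apply _
  have hxx : ∑ i, q.2 i * q.2 i = r ^ 2 := by
    rw [hr, norm_sq_E3]
    exact sum_congr rfl fun i _ => (pow_two _).symm
  have hxn : ∑ i, q.2 i * n i = rdot ψ q := sum_congr rfl fun i _ => by rw [hni]
  have hnd : ∑ i, n i * dx i ψ q.1 q.2 = gradSq ψ q :=
    sum_congr rfl fun i _ => by rw [hni]; ring
  set S := ∑ i, dx i ψ q.1 q.2 * dt1 (dx i ψ) q.1 q.2 with hS
  set R := ∑ i, q.2 i * dt1 (dx i ψ) q.1 q.2 with hR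
  set M := ∑ i, dx i ψ q.1 q.2 * ∑ j, q.2 j * dx j (dx i ψ) q.1 q.2 with hM
  have hnS : ∑ i, n i * dx i (dt1 ψ) q.1 q.2 = S :=
    sum_congr rfl fun i _ => by rw [hni, h.dt1_dx]
  have hxR : ∑ i, q.2 i * dx i (dt1 ψ) q.1 q.2 = R :=
    sum_congr rfl fun i _ => by rw [h.dt1_dx]
  have hM' : ∑ i, q.2 i * ∑ j, n j * dx j (dx i ψ) q.1 q.2 = M := by
    simp_rw [hM, mul_sum]
    rw [Finset.sum_comm]
    refine sum_congr rfl fun i _ => sum_congr rfl fun j _ => ?_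
    rw [hni, h.dx_comm i j]
    ring
  have hD2 : ∑ i, 2 * dx i ψ q.1 q.2 * dt1 (dx i ψ) q.1 q.2 = 2 * S := by
    rw [hS, mul_sum]
    exact sum_congr rfl fun i _ => by ring
  have hM2 : ∑ i, 2 * dx i ψ q.1 q.2 * ∑ j, q.2 j * dx j (dx i ψ) q.1 q.2 = 2 * M := by
    rw [hM, mul_sum]
    exact sum_congr rfl fun i _ => by ring
  have fan := fa (0, n)
  have fbx := fb (0, q.2)
  simp only [zero_smul, add_zero, zero_mul, zero_add, one_mul, mul_zero, PiLp.zero_apply,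
    Finset.sum_const_zero, zero_div, sum_add_distrib, hxx, hxn, hnd, hnS, hxR, hM', hD2,
    hM2, Pi.add_apply, Pi.sub_apply, ← hr, ← hR, sub_zero] at fan fbx fe
  have hxP : ∑ i, q.2 i * dx i ψ q.1 q.2 = rdot ψ q := rfl
  rw [hxP] at fbx
  have hrr : r ^ 2 / r = r := by field_simp
  rw [hrr] at fbx
  have hw : wrad ψ q = (rdot ψ q + ψ q.1 q.2) / r := rfl
  rw [← hw] at fan fe
  unfold divST
  rw [hsum, fe, fan, fbx]
  have hA : curA (f₁ + f₂) (f₁ - f₂) ψ q =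
    (f₁ q + f₂ q) * dt1 ψ q.1 q.2 + (f₁ q - f₂ q) * wrad ψ q := rfl
  have hB : curB (f₁ + f₂) (f₁ - f₂) U ψ q =
    -((f₁ q + f₂ q) * dt1 ψ q.1 q.2 * ψ q.1 q.2 / r ^ 2) + (f₁ q - f₂ q) / r *
      (gradSq ψ q / 2 - dt1 ψ q.1 q.2 ^ 2 / 2 - ψ q.1 q.2 ^ 2 / (2 * r ^ 2) + U q) := rfl
  rw [dtt_eq, hA, hB]
  exact divergence_algebra hr0 hV hw

end Divergence

/-- Admissible exponents: `p` the power, `γ` the weight, `ε` a small loss. -/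
structure Adm (p γ ε : ℝ) : Prop where
  p_gt : 5 / 2 < p
  p_lt : p < 5
  γ_gt : 1 < γ
  γ_lt : γ < 2
  γ_lt_p : γ < p - 1
  ε_pos : 0 < ε
  ε_le : ε ≤ γ - 1
  ε_lt : ε < 2 * p - 5
  decay : (2 + ε) / (p - 1) ≤ (γ + 1) / 2

/-- The region `|t| < |x|`. -/
def extDom : Set M4 := {q | |q.1| < ‖q.2‖}

/-- The exterior region `0 ≤ t`, `t + 2 ≤ |x|`. -/
def extReg : Set M4 := {q | 0 ≤ q.1 ∧ q.1 + 2 ≤ ‖q.2‖}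

/-- Amplitude of the outgoing weight. -/
def wAmp (p γ : ℝ) : ℝ := 8 * (p - 1) / (p - 1 - γ)

/-- Outgoing weight. -/
def wt1 (p γ ε : ℝ) (q : M4) : ℝ :=
  wAmp p γ * ‖q.2‖ ^ γ * (1 - (‖q.2‖ - q.1) ^ (-ε) / 2)

/-- Incoming weight. -/
def wt2 (γ ε : ℝ) (q : M4) : ℝ := (‖q.2‖ - q.1) ^ γ * (1 + (‖q.2‖ + q.1) ^ (-ε))

/-- Potential energy density. -/
def pot (c p : ℝ) (ψ : Wave) (q : M4) : ℝ := c * |ψ q.1 q.2| ^ (p + 1) / (p + 1)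

lemma isOpen_extDom : IsOpen extDom :=
  isOpen_lt (by fun_prop) (by fun_prop)

lemma ne_zero_of_mem_extDom {q : M4} (hq : q ∈ extDom) : q.2 ≠ 0 := by
  rintro h
  have : |q.1| < ‖q.2‖ := hq
  rw [h, norm_zero] at this
  exact absurd this (abs_nonneg _).not_gt

lemma extReg_subset_extDom : extReg ⊆ extDom := by
  rintro q ⟨h1, h2⟩
  change |q.1| < ‖q.2‖
  rw [abs_of_nonneg h1]
  linarith

section Weights

variable {p γ ε : ℝ}

lemma contDiffOn_u : ContDiffOn ℝ 1 (fun q : M4 => ‖q.2‖ - q.1) extDom :=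
  (contDiffOn_norm_snd fun _ hq => ne_zero_of_mem_extDom hq).sub contDiff_fst.contDiffOn

lemma contDiffOn_v : ContDiffOn ℝ 1 (fun q : M4 => ‖q.2‖ + q.1) extDom :=
  (contDiffOn_norm_snd fun _ hq => ne_zero_of_mem_extDom hq).add contDiff_fst.contDiffOn

lemma u_pos_of_mem {q : M4} (hq : q ∈ extDom) : 0 < ‖q.2‖ - q.1 := by
  have : |q.1| < ‖q.2‖ := hq
  linarith [le_abs_self q.1]

lemma v_pos_of_mem {q : M4} (hq : q ∈ extDom) : 0 < ‖q.2‖ + q.1 := by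
  have : |q.1| < ‖q.2‖ := hq
  linarith [neg_abs_le q.1]

lemma contDiffOn_wt1 : ContDiffOn ℝ 1 (wt1 p γ ε) extDom := by
  have hr := contDiffOn_norm_snd (Ω := extDom) fun _ hq => ne_zero_of_mem_extDom hq
  exact (contDiffOn_const.mul (hr.rpow_const_of_ne fun q hq =>
    norm_ne_zero_iff.2 (ne_zero_of_mem_extDom hq))).mul (contDiffOn_const.sub
      ((contDiffOn_u.rpow_const_of_ne fun q hq => (u_pos_of_mem hq).ne').div_const 2))

lemma contDiffOn_wt2 : ContDiffOn ℝ 1 (wt2 γ ε) extDom :=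
  (contDiffOn_u.rpow_const_of_ne fun _ hq => (u_pos_of_mem hq).ne').mul
    (contDiffOn_const.add (contDiffOn_v.rpow_const_of_ne fun _ hq => (v_pos_of_mem hq).ne'))

lemma contDiff_pot (c : ℝ) (hp : 1 < p) {ψ : Wave} (h : Smooth ψ) : ContDiff ℝ 1 (pot c p ψ) := by
  have h1 : ContDiff ℝ 1 (fun x : ℝ => ‖x‖ ^ (p + 1)) := contDiff_norm_rpow (by linarith)
  exact (contDiff_const.mul (h1.comp h.contDiff_one)).div_const _

lemma hasDerivAt_pot_line (c : ℝ) (hp : 1 < p) {ψ : Wave} (h : Smooth ψ) (q v : M4) :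
    HasDerivAt (fun s : ℝ => pot c p ψ (q + s • v)) (c * |ψ q.1 q.2| ^ (p - 1) * ψ q.1 q.2 *
      (v.1 * dt1 ψ q.1 q.2 + ∑ i, v.2 i * dx i ψ q.1 q.2)) 0 := by
  have h1 := smooth_hasDerivAt_line h q v
  have h2 := hasDerivAt_abs_rpow (ψ (q + (0 : ℝ) • v).1 (q + (0 : ℝ) • v).2)
    (p := p + 1) (by linarith)
  have h3 := (((h2.comp 0 h1).const_mul c).div_const (p + 1))
  refine h3.congr_deriv ?_
  have : p + 1 ≠ 0 := by linarith
  simp only [zero_smul, add_zero]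
  rw [show p + 1 - 2 = p - 1 by ring]
  field_simp

lemma hasDerivAt_wt1_line {q : M4} (hq : q ∈ extDom) (v : M4) :
    HasDerivAt (fun s : ℝ => wt1 p γ ε (q + s • v))
      (v.1 * (-(wAmp p γ * ‖q.2‖ ^ γ * (ε / 2) * (‖q.2‖ - q.1) ^ (-ε - 1))) +
        (∑ i, q.2 i * v.2 i) / ‖q.2‖ *
          (wAmp p γ * (γ * ‖q.2‖ ^ (γ - 1) * (1 - (‖q.2‖ - q.1) ^ (-ε) / 2) +
            ‖q.2‖ ^ γ * (ε / 2) * (‖q.2‖ - q.1) ^ (-ε - 1)))) 0 := by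
  have hx := ne_zero_of_mem_extDom hq
  have lr : HasDerivAt (fun s : ℝ => ‖(q + s • v).2‖) ((∑ i, q.2 i * v.2 i) / ‖q.2‖) 0 :=
    hasDerivAt_norm_line hx
  have lt : HasDerivAt (fun s : ℝ => (q + s • v).1) v.1 0 := by
    simpa using ((hasDerivAt_id (0 : ℝ)).mul_const v.1).const_add q.1
  have h1 := lr.rpow_const (p := γ) (Or.inl (by simpa using hx))
  have h2 := (lr.fun_sub lt).rpow_const (p := -ε) (Or.inl (by simpa using (u_pos_of_mem hq).ne'))
  refine ((h1.const_mul (wAmp p γ)).mul ((h2.div_const 2).const_sub 1)).congr_deriv ?_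
  simp only [zero_smul, add_zero]
  ring

lemma hasDerivAt_wt2_line {q : M4} (hq : q ∈ extDom) (v : M4) :
    HasDerivAt (fun s : ℝ => wt2 γ ε (q + s • v))
      (v.1 * (-(γ * (‖q.2‖ - q.1) ^ (γ - 1) * (1 + (‖q.2‖ + q.1) ^ (-ε))) -
          (‖q.2‖ - q.1) ^ γ * ε * (‖q.2‖ + q.1) ^ (-ε - 1)) + (∑ i, q.2 i * v.2 i) / ‖q.2‖ *
          (γ * (‖q.2‖ - q.1) ^ (γ - 1) * (1 + (‖q.2‖ + q.1) ^ (-ε)) -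
          (‖q.2‖ - q.1) ^ γ * ε * (‖q.2‖ + q.1) ^ (-ε - 1))) 0 := by
  have hx := ne_zero_of_mem_extDom hq
  have lr : HasDerivAt (fun s : ℝ => ‖(q + s • v).2‖) ((∑ i, q.2 i * v.2 i) / ‖q.2‖) 0 :=
    hasDerivAt_norm_line hx
  have lt : HasDerivAt (fun s : ℝ => (q + s • v).1) v.1 0 := by
    simpa using ((hasDerivAt_id (0 : ℝ)).mul_const v.1).const_add q.1
  have h1 := (lr.fun_sub lt).rpow_const (p := γ) (Or.inl (by simpa using (u_pos_of_mem hq).ne'))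
  have h2 := (lr.fun_add lt).rpow_const (p := -ε) (Or.inl (by simpa using (v_pos_of_mem hq).ne'))
  refine (h1.mul (h2.const_add 1)).congr_deriv ?_
  simp only [zero_smul, add_zero]
  ring

end Weights

section Bulk

variable {p γ ε : ℝ} (ha : Adm p γ ε) {q : M4} (hq : q ∈ extReg)

include ha in
lemma Adm.amp_ge : 8 ≤ wAmp p γ := by
  have h1 := ha.γ_lt_p
  have h2 := ha.γ_gt
  unfold wAmp
  rw [le_div_iff₀ (by linarith)]
  linarith

include ha hq

lemma wt1_le : wt1 p γ ε q ≤ wAmp p γ * ‖q.2‖ ^ γ := by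
  have h1 : 0 ≤ (‖q.2‖ - q.1) ^ (-ε) := rpow_nonneg (by linarith [hq.2]) _
  have h2 : 0 ≤ wAmp p γ * ‖q.2‖ ^ γ :=
    mul_nonneg (by linarith [ha.amp_ge]) (rpow_nonneg (norm_nonneg _) _)
  exact mul_le_of_le_one_right h2 (by linarith)

lemma half_le_eta : 1 / 2 ≤ 1 - (‖q.2‖ - q.1) ^ (-ε) / 2 := by
  have : (‖q.2‖ - q.1) ^ (-ε) ≤ 1 :=
    rpow_le_one_of_one_le_of_nonpos (by linarith [hq.2]) (by linarith [ha.ε_pos])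
  linarith

lemma le_wt1 : 4 * ‖q.2‖ ^ γ ≤ wt1 p γ ε q := by
  have h0 : 0 ≤ ‖q.2‖ ^ γ := rpow_nonneg (norm_nonneg _) _
  have h1 := half_le_eta ha hq
  have h2 := ha.amp_ge
  unfold wt1
  have h3 : 4 ≤ wAmp p γ * (1 - (‖q.2‖ - q.1) ^ (-ε) / 2) := by nlinarith
  nlinarith

lemma le_wt2 : (‖q.2‖ - q.1) ^ γ ≤ wt2 γ ε q := by
  have h0 : 0 ≤ (‖q.2‖ - q.1) ^ γ := rpow_nonneg (by linarith [hq.2]) _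
  have h1 : 0 ≤ (‖q.2‖ + q.1) ^ (-ε) := rpow_nonneg (by linarith [hq.1, hq.2]) _
  unfold wt2
  nlinarith

lemma wt2_le : wt2 γ ε q ≤ 2 * (‖q.2‖ - q.1) ^ γ := by
  have h0 : 0 ≤ (‖q.2‖ - q.1) ^ γ := rpow_nonneg (by linarith [hq.2]) _
  have h1 : (‖q.2‖ + q.1) ^ (-ε) ≤ 1 :=
    rpow_le_one_of_one_le_of_nonpos (by linarith [hq.1, hq.2]) (by linarith [ha.ε_pos])
  unfold wt2
  nlinarith

lemma one_le_u_rpow : 1 ≤ (‖q.2‖ - q.1) ^ γ :=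
  one_le_rpow (by linarith [hq.2]) (by linarith [ha.γ_gt])

omit ha hq in
lemma rdot_sq_le (ψ : Wave) (q : M4) : 0 ≤ gradSq ψ q - rdot ψ q ^ 2 / ‖q.2‖ ^ 2 := by
  have h1 := Finset.sum_mul_sq_le_sq_mul_sq Finset.univ (fun i => q.2 i)
    (fun i => dx i ψ q.1 q.2)
  have h2 : rdot ψ q ^ 2 ≤ ‖q.2‖ ^ 2 * gradSq ψ q := by
    rw [norm_sq_E3]
    exact h1
  rcases eq_or_ne ‖q.2‖ 0 with h0 | h0
  · have h3 : 0 ≤ gradSq ψ q := sum_nonneg fun i _ => sq_nonneg _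
    simpa [h0] using h3
  · have h3 : 0 < ‖q.2‖ ^ 2 := by positivity
    rw [sub_nonneg, div_le_iff₀ h3]
    linarith

lemma v_rpow_ge (hε : ε ≤ 1) : ‖q.2‖ ^ (-ε - 1) / 4 ≤ (‖q.2‖ + q.1) ^ (-ε - 1) := by
  have hr : 0 < ‖q.2‖ := by linarith [hq.1, hq.2]
  have h1 : (2 * ‖q.2‖) ^ (-ε - 1) ≤ (‖q.2‖ + q.1) ^ (-ε - 1) :=
    rpow_le_rpow_of_nonpos (by linarith [hq.1]) (by linarith [hq.2])
      (by linarith [ha.ε_pos])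
  have h2 : (2 : ℝ) ^ (-2 : ℝ) ≤ 2 ^ (-ε - 1) :=
    rpow_le_rpow_of_exponent_le (by norm_num) (by linarith)
  have h3 : (2 : ℝ) ^ (-2 : ℝ) = 1 / 4 := by
    rw [show (-2 : ℝ) = ((-2 : ℤ) : ℝ) by norm_num, Real.rpow_intCast]
    norm_num
  rw [h3] at h2
  rw [mul_rpow (by norm_num) hr.le] at h1
  have h4 : 0 ≤ ‖q.2‖ ^ (-ε - 1) := rpow_nonneg hr.le _
  nlinarith

omit ha hq in
lemma bulk_algebra {A R Q Q' K K' K'' θ ζ η r X EA T w c Y : ℝ} (hε : 0 < ε) (g1 : 1 < γ)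
    (g2 : γ < 2) (hp : 5 / 2 < p) (hc : 0 ≤ c) (hr2 : 0 ≤ r) (hEA : 0 ≤ EA) (hη : 1 / 2 ≤ η)
    (hA : 8 ≤ A) (hAγ : A * (p - 1 - γ) = 8 * (p - 1)) (hv : K'' / 4 ≤ K') (hv1 : ζ ≤ 1)
    (hv0 : 0 ≤ ζ) (huR : Q ≤ R) (hU0 : 0 ≤ Q) (hUε : 0 ≤ K) (hW : 0 ≤ Y) (hθ1 : θ ≤ 1)
    (hRr : 0 ≤ R) (hUu : 0 ≤ Q') :
    -X + (-(A * (R * r) * (ε / 2) * K) - A * (γ * R * η + R * r * (ε / 2) * K)) / 2 * (T + w) ^ 2 +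
      (-(γ * Q * (1 + ζ)) - Q' * ε * K' + (γ * Q * (1 + ζ) - Q' * ε * K')) / 2 * (T - w) ^ 2 +
      (-(A * (R * r) * (ε / 2) * K) + A * (γ * R * η + R * r * (ε / 2) * K) +
        (-(γ * Q * (1 + ζ)) - Q' * ε * K') - (γ * Q * (1 + ζ) - Q' * ε * K') -
        2 * (A * R * η - Q * θ * (1 + ζ))) / 2 * EA +
      (-(A * (R * r) * (ε / 2) * K) + A * (γ * R * η + R * r * (ε / 2) * K) +
        (-(γ * Q * (1 + ζ)) - Q' * ε * K') - (γ * Q * (1 + ζ) - Q' * ε * K') -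
        (p - 1) * (A * R * η - Q * θ * (1 + ζ))) * (c * Y / (p + 1)) ≤
    -X - (R * (T + w) ^ 2 + ε * (R * r * K) * (T + w) ^ 2 + ε / 4 * (K'' * Q') * (T - w) ^ 2 +
      (2 - γ) * R * EA + c / 2 * R * Y) := by
  have cL : (-(A * (R * r) * (ε / 2) * K) - A * (γ * R * η + R * r * (ε / 2) * K)) / 2 ≤
      -(R + ε * (R * r * K)) := by
    have e1 : 0 ≤ ε * (R * r * K) := by positivity
    have e2 : 4 ≤ A * η := by nlinarith
    have e3 : 4 ≤ A * η * γ := by nlinarith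
    linarith [mul_nonneg e1 (by linarith : 0 ≤ A - 2), mul_le_mul_of_nonneg_right e3 hRr]
  have cB : (-(γ * Q * (1 + ζ)) - Q' * ε * K' + (γ * Q * (1 + ζ) - Q' * ε * K')) / 2 ≤
      -(ε / 4 * (K'' * Q')) := by
    have e1 : 0 ≤ ε * Q' := by positivity
    linarith [mul_le_mul_of_nonneg_left hv e1]
  have cA : (-(A * (R * r) * (ε / 2) * K) + A * (γ * R * η + R * r * (ε / 2) * K) +
      (-(γ * Q * (1 + ζ)) - Q' * ε * K') - (γ * Q * (1 + ζ) - Q' * ε * K') -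
      2 * (A * R * η - Q * θ * (1 + ζ))) / 2 ≤ -((2 - γ) * R) := by
    have e1 : 0 ≤ Q * (1 + ζ) := by positivity
    have e2 : Q * (1 + ζ) * θ ≤ Q * (1 + ζ) * γ := mul_le_mul_of_nonneg_left (by linarith) e1
    have e3 : 2 ≤ A * η := by nlinarith
    have e4 : 0 ≤ (2 - γ) * R := mul_nonneg (by linarith) hRr
    linarith [mul_le_mul_of_nonneg_left e3 e4]
  have cV : -(A * (R * r) * (ε / 2) * K) + A * (γ * R * η + R * r * (ε / 2) * K) +
      (-(γ * Q * (1 + ζ)) - Q' * ε * K') - (γ * Q * (1 + ζ) - Q' * ε * K') -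
      (p - 1) * (A * R * η - Q * θ * (1 + ζ)) ≤ -(2 * (p - 1) * R) := by
    have e1 : 0 ≤ Q * (1 + ζ) := by positivity
    have e2 : Q * (1 + ζ) ≤ 2 * R := by nlinarith
    have e3 : 4 * (p - 1) ≤ A * (p - 1 - γ) * η := by rw [hAγ]; nlinarith
    have e4 : (p - 1) * (Q * (1 + ζ) * θ) ≤ (p - 1) * (2 * R) :=
      mul_le_mul_of_nonneg_left (by nlinarith) (by linarith)
    have e5 : R * (4 * (p - 1)) ≤ R * (A * (p - 1 - γ) * η) := mul_le_mul_of_nonneg_left e3 hRr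
    have e6 : 0 ≤ γ * (Q * (1 + ζ)) := mul_nonneg (by linarith) e1
    linarith
  have cY : -(2 * (p - 1) * R) * (c * Y / (p + 1)) ≤ -(c / 2 * R * Y) := by
    have e1 : 0 ≤ R * c * Y := by positivity
    have e2 : 1 / 2 ≤ 2 * (p - 1) / (p + 1) := by
      rw [div_le_div_iff₀ (by norm_num) (by linarith)]
      linarith
    have e3 : -(2 * (p - 1) * R) * (c * Y / (p + 1)) = -(R * c * Y * (2 * (p - 1) / (p + 1))) := by
      ring
    rw [e3]
    linarith [mul_le_mul_of_nonneg_left e2 e1]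
  have m1 := mul_le_mul_of_nonneg_right cL (sq_nonneg (T + w))
  have m2 := mul_le_mul_of_nonneg_right cB (sq_nonneg (T - w))
  have m3 := mul_le_mul_of_nonneg_right cA hEA
  have m4 : 0 ≤ c * Y / (p + 1) := by
    have : 0 < p + 1 := by linarith
    positivity
  have m5 := mul_le_mul_of_nonneg_right cV m4
  linarith

/-- The weighted bulk density controlled by the divergence of the current. -/
lemma divST_weighted_le {c : ℝ} (hc : 0 ≤ c) {ψ : Wave} (h : Smooth ψ) :
    divST (cur0 (wt1 p γ ε + wt2 γ ε) (wt1 p γ ε - wt2 γ ε) (pot c p ψ) ψ)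
      (curS (wt1 p γ ε + wt2 γ ε) (wt1 p γ ε - wt2 γ ε) (pot c p ψ) ψ) q ≤
    -(lap3 (ψ q.1) q.2 - dtt ψ q.1 q.2 - c * |ψ q.1 q.2| ^ (p - 1) * ψ q.1 q.2) *
        (wt1 p γ ε q * (dt1 ψ q.1 q.2 + wrad ψ q) + wt2 γ ε q * (dt1 ψ q.1 q.2 - wrad ψ q)) -
      (‖q.2‖ ^ (γ - 1) * (dt1 ψ q.1 q.2 + wrad ψ q) ^ 2 +
        ε * (‖q.2‖ ^ γ * (‖q.2‖ - q.1) ^ (-ε - 1)) * (dt1 ψ q.1 q.2 + wrad ψ q) ^ 2 +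
        ε / 4 * (‖q.2‖ ^ (-ε - 1) * (‖q.2‖ - q.1) ^ γ) * (dt1 ψ q.1 q.2 - wrad ψ q) ^ 2 +
        (2 - γ) * ‖q.2‖ ^ (γ - 1) * (gradSq ψ q - rdot ψ q ^ 2 / ‖q.2‖ ^ 2) +
        c / 2 * ‖q.2‖ ^ (γ - 1) * |ψ q.1 q.2| ^ (p + 1)) := by
  have hr2 : 2 ≤ ‖q.2‖ := by linarith [hq.1, hq.2]
  have hext := extReg_subset_extDom hq
  have hp1 : 1 < p := by linarith [ha.p_gt]
  have hUψ : c * |ψ q.1 q.2| ^ (p - 1) * ψ q.1 q.2 * ψ q.1 q.2 = (p + 1) * pot c p ψ q := by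
    have e1 : |ψ q.1 q.2| ^ (p + 1) = |ψ q.1 q.2| ^ (p - 1) * (ψ q.1 q.2) ^ 2 := by
      rw [← sq_abs, ← rpow_natCast, ← rpow_add_of_nonneg (abs_nonneg _)
        (by linarith) (by norm_num)]
      congr 1
      push_cast
      ring
    have : p + 1 ≠ 0 := by linarith
    unfold pot
    rw [e1]
    field_simp
  rw [divST_current h isOpen_extDom (fun _ => ne_zero_of_mem_extDom) contDiffOn_wt1 contDiffOn_wt2
    (contDiff_pot c hp1 h).contDiffOn hext (hasDerivAt_wt1_line hext) (hasDerivAt_wt2_line hext)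
    (hasDerivAt_pot_line c hp1 h q) hUψ]
  have hEA := rdot_sq_le ψ q
  set EA := gradSq ψ q - rdot ψ q ^ 2 / ‖q.2‖ ^ 2
  set T := dt1 ψ q.1 q.2
  set w := wrad ψ q
  have hη := half_le_eta ha hq
  have hA := ha.amp_ge
  have hAγ : wAmp p γ * (p - 1 - γ) = 8 * (p - 1) := by
    unfold wAmp
    rw [div_mul_cancel₀]
    linarith [ha.γ_lt_p]
  have hv := v_rpow_ge ha hq (by linarith [ha.ε_le, ha.γ_lt])
  have hu0 : 0 < ‖q.2‖ - q.1 := by linarith [hq.2]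
  have hv1 : (‖q.2‖ + q.1) ^ (-ε) ≤ 1 :=
    rpow_le_one_of_one_le_of_nonpos (by linarith [hq.1, hq.2]) (by linarith [ha.ε_pos])
  have hv0 : 0 ≤ (‖q.2‖ + q.1) ^ (-ε) := rpow_nonneg (by linarith [hq.1, hq.2]) _
  have hrγ : ‖q.2‖ ^ γ = ‖q.2‖ ^ (γ - 1) * ‖q.2‖ := by
    rw [← Real.rpow_add_one (by linarith)]; congr 1; ring
  have huγ : (‖q.2‖ - q.1) ^ γ = (‖q.2‖ - q.1) ^ (γ - 1) * (‖q.2‖ - q.1) := by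
    rw [← Real.rpow_add_one hu0.ne']; congr 1; ring
  have huR : (‖q.2‖ - q.1) ^ (γ - 1) ≤ ‖q.2‖ ^ (γ - 1) :=
    rpow_le_rpow hu0.le (by linarith [hq.1]) (by linarith [ha.γ_gt])
  have hU0 : 0 ≤ (‖q.2‖ - q.1) ^ (γ - 1) := rpow_nonneg hu0.le _
  have hUε : 0 ≤ (‖q.2‖ - q.1) ^ (-ε - 1) := rpow_nonneg hu0.le _
  have hεr : 0 ≤ ‖q.2‖ ^ (-ε - 1) := rpow_nonneg (norm_nonneg _) _
  have hcr : curA (wt1 p γ ε + wt2 γ ε) (wt1 p γ ε - wt2 γ ε) ψ q =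
      wt1 p γ ε q * (T + w) + wt2 γ ε q * (T - w) := by
    simp only [curA, Pi.add_apply, Pi.sub_apply]
    ring
  rw [hcr]
  have hf1 : wt1 p γ ε q = wAmp p γ * ‖q.2‖ ^ γ * (1 - (‖q.2‖ - q.1) ^ (-ε) / 2) := rfl
  have hf2 : wt2 γ ε q = (‖q.2‖ - q.1) ^ γ * (1 + (‖q.2‖ + q.1) ^ (-ε)) := rfl
  have hW : 0 ≤ |ψ q.1 q.2| ^ (p + 1) := rpow_nonneg (abs_nonneg _) _
  have hpot : pot c p ψ q = c * |ψ q.1 q.2| ^ (p + 1) / (p + 1) := rfl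
  set X := wt1 p γ ε q * (T + w) + wt2 γ ε q * (T - w)
  have hd : (wt1 p γ ε q - wt2 γ ε q) / ‖q.2‖ = wAmp p γ * ‖q.2‖ ^ (γ - 1) *
      (1 - (‖q.2‖ - q.1) ^ (-ε) / 2) - (‖q.2‖ - q.1) ^ (γ - 1) * ((‖q.2‖ - q.1) / ‖q.2‖) *
      (1 + (‖q.2‖ + q.1) ^ (-ε)) := by
    rw [hf1, hf2, hrγ, huγ]
    field_simp
  have hθ0 : 0 ≤ (‖q.2‖ - q.1) / ‖q.2‖ := by positivity
  have hθ1 : (‖q.2‖ - q.1) / ‖q.2‖ ≤ 1 := by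
    rw [div_le_one (by linarith)]
    linarith [hq.1]
  rw [mul_div_assoc 2, mul_div_assoc (p - 1), hd, hpot]
  clear_value X EA T w
  clear hf1 hf2 hd hpot hcr hUψ huγ
  rw [hrγ]
  rw [neg_mul]
  exact bulk_algebra ha.ε_pos ha.γ_gt ha.γ_lt ha.p_gt hc (norm_nonneg _) hEA hη hA hAγ hv hv1 hv0 huR hU0
    hUε hW hθ1 (rpow_nonneg (norm_nonneg _) _) (rpow_nonneg hu0.le _)

end Bulk

section Flux

variable {F G U f₁ f₂ : M4 → ℝ} {ψ : Wave} {q : M4}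

/-- Squared length of the angular gradient. -/
def angSq (ψ : Wave) (q : M4) : ℝ := gradSq ψ q - rdot ψ q ^ 2 / ‖q.2‖ ^ 2

lemma sum_curS (hq : q.2 ≠ 0) (n : Fin 3 → ℝ) : ∑ i, n i * curS F G U ψ i q =
      -((∑ i, n i * dx i ψ q.1 q.2) - (∑ i, n i * q.2 i) / ‖q.2‖ * (rdot ψ q / ‖q.2‖)) *
          (F q * dt1 ψ q.1 q.2 + G q * wrad ψ q) +
        (∑ i, n i * q.2 i) / ‖q.2‖ * (-(F q * dt1 ψ q.1 q.2 * wrad ψ q) -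
          G q / 2 * (dt1 ψ q.1 q.2 ^ 2 + wrad ψ q ^ 2) + G q / 2 * angSq ψ q + G q * U q) := by
  have hr : ‖q.2‖ ≠ 0 := norm_ne_zero_iff.2 hq
  have h1 : ∑ i, n i * curS F G U ψ i q =
      -(curA F G ψ q * ∑ i, n i * dx i ψ q.1 q.2) + curB F G U ψ q * ∑ i, n i * q.2 i := by
    simp only [curS, Fin.sum_univ_three]
    ring
  rw [h1]
  unfold curA curB angSq wrad
  generalize (∑ i, n i * dx i ψ q.1 q.2) = a
  generalize (∑ i, n i * q.2 i) = b
  field_simp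
  ring

lemma angular_cauchy_schwarz (hq : q.2 ≠ 0) {n : Fin 3 → ℝ} (hn : ∑ i, n i ^ 2 = 1) :
    ((∑ i, n i * dx i ψ q.1 q.2) - (∑ i, n i * q.2 i) / ‖q.2‖ * (rdot ψ q / ‖q.2‖)) ^ 2 ≤
      (1 - ((∑ i, n i * q.2 i) / ‖q.2‖) ^ 2) * angSq ψ q := by
  have hr : ‖q.2‖ ≠ 0 := norm_ne_zero_iff.2 hq
  have hr2 : ∑ i, q.2 i ^ 2 = ‖q.2‖ ^ 2 := (norm_sq_E3 q.2).symm
  have h := Finset.sum_mul_sq_le_sq_mul_sq Finset.univ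
    (fun i => n i - (∑ i, n i * q.2 i) / ‖q.2‖ * (q.2 i / ‖q.2‖))
    (fun i => dx i ψ q.1 q.2 - rdot ψ q / ‖q.2‖ * (q.2 i / ‖q.2‖))
  have e1 : ∑ i, (n i - (∑ i, n i * q.2 i) / ‖q.2‖ * (q.2 i / ‖q.2‖)) ^ 2 =
      1 - ((∑ i, n i * q.2 i) / ‖q.2‖) ^ 2 := by
    set c := ∑ i, n i * q.2 i with hc
    have : ∑ i, (n i - c / ‖q.2‖ * (q.2 i / ‖q.2‖)) ^ 2 = (∑ i, n i ^ 2) -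
        2 * (c / ‖q.2‖ ^ 2) * (∑ i, n i * q.2 i) + c ^ 2 / ‖q.2‖ ^ 4 * ∑ i, q.2 i ^ 2 := by
      simp only [Fin.sum_univ_three]
      field_simp
      ring
    rw [this, hn, hr2, ← hc]
    field_simp
    ring
  have e2 : ∑ i, (dx i ψ q.1 q.2 - rdot ψ q / ‖q.2‖ * (q.2 i / ‖q.2‖)) ^ 2 = angSq ψ q := by
    have : ∑ i, (dx i ψ q.1 q.2 - rdot ψ q / ‖q.2‖ * (q.2 i / ‖q.2‖)) ^ 2 = gradSq ψ q -
        2 * (rdot ψ q / ‖q.2‖ ^ 2) * (∑ i, q.2 i * dx i ψ q.1 q.2) +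
          rdot ψ q ^ 2 / ‖q.2‖ ^ 4 * ∑ i, q.2 i ^ 2 := by
      unfold gradSq
      generalize rdot ψ q = P
      simp only [Fin.sum_univ_three]
      field_simp
      ring
    rw [this, hr2, ← rdot, angSq]
    field_simp
    ring
  have e3 : ∑ i, (n i - (∑ i, n i * q.2 i) / ‖q.2‖ * (q.2 i / ‖q.2‖)) *
      (dx i ψ q.1 q.2 - rdot ψ q / ‖q.2‖ * (q.2 i / ‖q.2‖)) =
      (∑ i, n i * dx i ψ q.1 q.2) - (∑ i, n i * q.2 i) / ‖q.2‖ * (rdot ψ q / ‖q.2‖) := by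
    set c := ∑ i, n i * q.2 i with hc
    have : ∑ i, (n i - c / ‖q.2‖ * (q.2 i / ‖q.2‖)) *
        (dx i ψ q.1 q.2 - rdot ψ q / ‖q.2‖ * (q.2 i / ‖q.2‖)) =
        (∑ i, n i * dx i ψ q.1 q.2) - rdot ψ q / ‖q.2‖ ^ 2 * (∑ i, n i * q.2 i) -
          c / ‖q.2‖ ^ 2 * (∑ i, q.2 i * dx i ψ q.1 q.2) +
          c * rdot ψ q / ‖q.2‖ ^ 4 * ∑ i, q.2 i ^ 2 := by
      generalize rdot ψ q = P
      simp only [Fin.sum_univ_three]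
      field_simp
      ring
    rw [this, hr2, ← rdot, ← hc]
    field_simp
    ring
  rwa [e1, e2, e3] at h

lemma quad_nonneg {a d m L : ℝ} (ha : 0 ≤ a) (hd : 0 ≤ d) (h : m ^ 2 ≤ a * d) :
    0 ≤ a * L ^ 2 - 2 * m * L + d := by
  rcases ha.eq_or_lt with rfl | ha
  · have : m = 0 := by nlinarith
    simp [this, hd]
  · refine nonneg_of_mul_nonneg_right (?_ : 0 ≤ a * _) ha
    nlinarith [sq_nonneg (a * L - m)]

lemma abs_dot_div_norm_le {n : Fin 3 → ℝ} (hn : ∑ i, n i ^ 2 = 1) (x : E3) :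
    |(∑ i, n i * x i) / ‖x‖| ≤ 1 := by
  rw [abs_div, abs_norm]
  refine div_le_one_of_le₀ (abs_le_of_sq_le_sq ?_ (norm_nonneg _)) (norm_nonneg _)
  have h := Finset.sum_mul_sq_le_sq_mul_sq Finset.univ n (fun i => x i)
  rwa [hn, one_mul, ← norm_sq_E3] at h

lemma cone_flux_ge (hq : q.2 ≠ 0) (h1 : 0 ≤ f₁ q) (h2 : 0 ≤ f₂ q) {n : Fin 3 → ℝ}
    (hn : ∑ i, n i ^ 2 = 1) :
    (f₁ q * (1 + (∑ i, n i * q.2 i) / ‖q.2‖) + f₂ q * (1 - (∑ i, n i * q.2 i) / ‖q.2‖)) * U q ≤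
      cur0 (f₁ + f₂) (f₁ - f₂) U ψ q + ∑ i, n i * curS (f₁ + f₂) (f₁ - f₂) U ψ i q := by
  have hE : 0 ≤ angSq ψ q := rdot_sq_le ψ q
  have hcs := angular_cauchy_schwarz (ψ := ψ) hq hn
  have hc := abs_le.1 (abs_dot_div_norm_le hn q.2)
  rw [sum_curS hq]
  have h0 : cur0 (f₁ + f₂) (f₁ - f₂) U ψ q = (f₁ q + f₂ q) / 2 *
      (dt1 ψ q.1 q.2 ^ 2 + wrad ψ q ^ 2 + angSq ψ q) +
      (f₁ q - f₂ q) * dt1 ψ q.1 q.2 * wrad ψ q + (f₁ q + f₂ q) * U q := rfl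
  rw [h0]
  simp only [Pi.add_apply, Pi.sub_apply]
  generalize (∑ i, n i * dx i ψ q.1 q.2) - (∑ i, n i * q.2 i) / ‖q.2‖ * (rdot ψ q / ‖q.2‖) = m at *
  generalize (∑ i, n i * q.2 i) / ‖q.2‖ = c at *
  generalize dt1 ψ q.1 q.2 = T at *
  generalize wrad ψ q = w at *
  generalize angSq ψ q = E at *
  have b1 := mul_nonneg h1 (quad_nonneg (a := 1 - c) (d := (1 + c) * E) (m := m) (L := T + w)
    (by linarith) (mul_nonneg (by linarith) hE) (by linarith))
  have b2 := mul_nonneg h2 (quad_nonneg (a := 1 + c) (d := (1 - c) * E) (m := m) (L := T - w)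
    (by linarith) (mul_nonneg (by linarith) hE) (by linarith))
  linarith

lemma cur0_eq : cur0 (f₁ + f₂) (f₁ - f₂) U ψ q =
    f₁ q / 2 * ((dt1 ψ q.1 q.2 + wrad ψ q) ^ 2 + angSq ψ q) +
      f₂ q / 2 * ((dt1 ψ q.1 q.2 - wrad ψ q) ^ 2 + angSq ψ q) + (f₁ q + f₂ q) * U q := by
  simp only [cur0, angSq, Pi.add_apply, Pi.sub_apply]
  ring

lemma cur0_nonneg (h1 : 0 ≤ f₁ q) (h2 : 0 ≤ f₂ q) (hU : 0 ≤ U q) :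
    0 ≤ cur0 (f₁ + f₂) (f₁ - f₂) U ψ q := by
  have hE : 0 ≤ angSq ψ q := rdot_sq_le ψ q
  rw [cur0_eq]
  positivity

lemma radial_flux_eq (hq : q.2 ≠ 0) (s : ℝ) : s * cur0 (f₁ + f₂) (f₁ - f₂) U ψ q -
        ∑ i, q.2 i / ‖q.2‖ * curS (f₁ + f₂) (f₁ - f₂) U ψ i q =
      (s + 1) / 2 * f₁ q * (dt1 ψ q.1 q.2 + wrad ψ q) ^ 2 +
        (s - 1) / 2 * f₂ q * (dt1 ψ q.1 q.2 - wrad ψ q) ^ 2 +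
        ((s - 1) * f₁ q + (s + 1) * f₂ q) * (angSq ψ q / 2 + U q) := by
  have hr : ‖q.2‖ ≠ 0 := norm_ne_zero_iff.2 hq
  have hr2 : ∑ i, q.2 i ^ 2 = ‖q.2‖ ^ 2 := (norm_sq_E3 q.2).symm
  have e1 : (∑ i, q.2 i / ‖q.2‖ * q.2 i) / ‖q.2‖ = 1 := by
    have : ∑ i, q.2 i / ‖q.2‖ * q.2 i = (∑ i, q.2 i ^ 2) / ‖q.2‖ := by
      rw [sum_div]
      exact sum_congr rfl fun i _ => by ring
    rw [this, hr2]
    field_simp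
  have e2 : ∑ i, q.2 i / ‖q.2‖ * dx i ψ q.1 q.2 = rdot ψ q / ‖q.2‖ := by
    rw [rdot, sum_div]
    exact sum_congr rfl fun i _ => by ring
  rw [sum_curS hq, e1, e2, cur0_eq]
  simp only [Pi.add_apply, Pi.sub_apply]
  ring

lemma wrad_sq_le : wrad ψ q ^ 2 ≤ 2 * gradSq ψ q + 2 * (ψ q.1 q.2 ^ 2 / ‖q.2‖ ^ 2) := by
  have h : 0 ≤ gradSq ψ q - rdot ψ q ^ 2 / ‖q.2‖ ^ 2 := rdot_sq_le ψ q
  have : wrad ψ q ^ 2 ≤ 2 * (rdot ψ q ^ 2 / ‖q.2‖ ^ 2) + 2 * (ψ q.1 q.2 ^ 2 / ‖q.2‖ ^ 2) := by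
    rw [wrad, div_pow, ← mul_div_assoc, ← mul_div_assoc, ← add_div]
    gcongr
    nlinarith [sq_nonneg (rdot ψ q - ψ q.1 q.2)]
  linarith

lemma angSq_le : angSq ψ q ≤ gradSq ψ q := by
  unfold angSq
  have : 0 ≤ rdot ψ q ^ 2 / ‖q.2‖ ^ 2 := by positivity
  linarith

lemma cur0_le (h1 : 0 ≤ f₁ q) (h2 : 0 ≤ f₂ q) : cur0 (f₁ + f₂) (f₁ - f₂) U ψ q ≤ (f₁ q + f₂ q) *
      (dt1 ψ q.1 q.2 ^ 2 + 3 * gradSq ψ q + 2 * (ψ q.1 q.2 ^ 2 / ‖q.2‖ ^ 2) + U q) := by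
  rw [cur0_eq]
  have hw := wrad_sq_le (ψ := ψ) (q := q)
  have hE := angSq_le (ψ := ψ) (q := q)
  have hg : 0 ≤ gradSq ψ q := sum_nonneg fun i _ => sq_nonneg _
  have a1 : ((dt1 ψ q.1 q.2 + wrad ψ q) ^ 2 + angSq ψ q) / 2 ≤
      dt1 ψ q.1 q.2 ^ 2 + 3 * gradSq ψ q + 2 * (ψ q.1 q.2 ^ 2 / ‖q.2‖ ^ 2) := by
    nlinarith [sq_nonneg (dt1 ψ q.1 q.2 - wrad ψ q)]
  have a2 : ((dt1 ψ q.1 q.2 - wrad ψ q) ^ 2 + angSq ψ q) / 2 ≤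
      dt1 ψ q.1 q.2 ^ 2 + 3 * gradSq ψ q + 2 * (ψ q.1 q.2 ^ 2 / ‖q.2‖ ^ 2) := by
    nlinarith [sq_nonneg (dt1 ψ q.1 q.2 + wrad ψ q)]
  linarith [mul_le_mul_of_nonneg_left a1 h1, mul_le_mul_of_nonneg_left a2 h2]

end Flux

section Polar

lemma lintegral_polar (o : E3) {f : E3 → ℝ≥0∞} (hf : Measurable f) :
    ∫⁻ x, f x = ∫⁻ s in Ioi (0 : ℝ),
      ofReal (s ^ 2) * ∫⁻ ω : S2, f (o + s • ω.1) ∂sphereMeasure := by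
  set g : E3 → ℝ≥0∞ := fun x => f (o + x) with hg
  have hgm : Measurable g := hf.comp (measurable_const_add o)
  have h0 : ∫⁻ x, f x = ∫⁻ x, g x := (lintegral_add_left_eq_self f o).symm
  have h1 : ∫⁻ x, g x = ∫⁻ x : ({0}ᶜ : Set E3), g (x : E3) ∂(volume.comap Subtype.val) := by
    rw [lintegral_subtype_comap (measurableSet_singleton (0 : E3)).compl, restrict_compl_singleton]
  have h2 := (volume : Measure E3).measurePreserving_homeomorphUnitSphereProd.lintegral_comp_emb
    (Homeomorph.measurableEmbedding _) (fun z : S2 × Ioi (0 : ℝ) => g (z.2.1 • (z.1 : E3)))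
  have h3 : ∀ x : ({0}ᶜ : Set E3), g (((homeomorphUnitSphereProd E3 x).2 : ℝ) •
      ((homeomorphUnitSphereProd E3 x).1 : E3)) = g x := fun x => by
    have := congrArg Subtype.val ((homeomorphUnitSphereProd E3).symm_apply_apply x)
    rw [homeomorphUnitSphereProd_symm_apply_coe] at this
    rw [this]
  simp only [h3] at h2
  have hdim : Module.finrank ℝ E3 - 1 = 2 := by simp
  rw [h0, h1, h2, hdim, lintegral_prod_symm _ (by fun_prop), Measure.volumeIoiPow,
    lintegral_withDensity_eq_lintegral_mul _ (by fun_prop) ?_]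
  · rw [← lintegral_subtype_comap measurableSet_Ioi]
    rfl
  · exact Measurable.lintegral_prod_left'
      (f := fun z : S2 × Ioi (0 : ℝ) => g ((z.2 : ℝ) • (z.1 : E3))) (by fun_prop)

variable {o : E3} {Ω : Set M4} {F : M4 → S2 → ℝ}

lemma ofReal_integral_sphInt (hΩ : IsOpen Ω)
    (hF : ContinuousOn (fun z : M4 × S2 => F z.1 z.2) (Ω ×ˢ univ)) {a b : ℝ}
    (hab : a ≤ b) {τ σ : ℝ → ℝ} (hτ : ContinuousOn τ (Icc a b))
    (hσ : ContinuousOn σ (Icc a b))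
    (hm : ∀ t ∈ Icc a b, ∀ ω : S2, (τ t, o + σ t • ω.1) ∈ Ω)
    (hp : ∀ t ∈ Icc a b, ∀ ω : S2, 0 ≤ σ t ^ 2 * F (τ t, o + σ t • ω.1) ω) :
    ofReal (∫ t in a..b, sphInt o F (τ t) (σ t)) = ∫⁻ t in Ioc a b, ∫⁻ ω : S2,
      ofReal (σ t ^ 2 * F (τ t, o + σ t • ω.1) ω) ∂sphereMeasure := by
  have hc : ContinuousOn (fun t => sphInt o F (τ t) (σ t)) (Icc a b) :=
    (continuousOn_sphInt hΩ hF).comp (hτ.prodMk hσ) fun t ht ω _ => hm t ht ω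
  have hn : ∀ t ∈ Icc a b, 0 ≤ sphInt o F (τ t) (σ t) := fun t ht =>
    (integral_nonneg fun ω => hp t ht ω).trans_eq (integral_const_mul _ _)
  rw [intervalIntegral.integral_of_le hab, ofReal_integral_eq_lintegral_ofReal]
  · refine setLIntegral_congr_fun measurableSet_Ioc fun t ht => ?_
    have ht' := Set.Ioc_subset_Icc_self ht
    have hcω : Continuous fun ω : S2 => F (τ t, o + σ t • ω.1) ω := by
      have := hF.comp (f := fun ω : S2 => ((τ t, o + σ t • ω.1), ω)) (s := univ)
        (by fun_prop) fun ω _ => ⟨hm t ht' ω, trivial⟩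
      exact continuousOn_univ.1 this
    change ofReal (sphInt o F (τ t) (σ t)) = _
    rw [sphInt, ← integral_const_mul, ofReal_integral_eq_lintegral_ofReal]
    · exact integrable_sphere (continuous_const.mul hcω)
    · exact Eventually.of_forall fun ω => hp t ht' ω
  · exact (hc.integrableOn_Icc).mono_set Set.Ioc_subset_Icc_self
  · exact (ae_restrict_iff' measurableSet_Ioc).2
      (Eventually.of_forall fun t ht => hn t (Set.Ioc_subset_Icc_self ht))

lemma energy_inequality {J0 : M4 → ℝ} {J : Fin 3 → M4 → ℝ} (hΩ : IsOpen Ω)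
    (h0 : ContDiffOn ℝ 1 J0 Ω) (hJ : ∀ i, ContDiffOn ℝ 1 (J i) Ω)
    {l l' : ℝ → ℝ} {W : Set ℝ} (hW : IsOpen W) {c T : ℝ} (hT : 0 ≤ T)
    (hTW : Icc 0 T ⊆ W) (hl : ∀ t ∈ W, HasDerivAt l (l' t) t) (hl' : ContinuousOn l' W)
    (hle : ∀ t ∈ Icc 0 T, l t ≤ c - t)
    (hreg : ∀ t ∈ Icc 0 T, ∀ s ∈ Icc (l t) (c - t), ∀ ω : S2, (t, o + s • ω.1) ∈ Ω)
    (hdiv : ∀ t ∈ Icc 0 T, ∀ s ∈ Icc (l t) (c - t), ∀ ω : S2, divST J0 J (t, o + s • ω.1) ≤ 0)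
    (hpos : ∀ t ∈ Icc 0 T, ∀ s ∈ Icc (l t) (c - t), ∀ ω : S2, 0 ≤ J0 (t, o + s • ω.1))
    (hout : ∀ t ∈ Icc 0 T, ∀ ω : S2, 0 ≤ J0 (t, o + (c - t) • ω.1) +
      ∑ i, ω.1 i * J i (t, o + (c - t) • ω.1))
    (hin : ∀ t ∈ Icc 0 T, ∀ ω : S2, 0 ≤ l t ^ 2 * (l' t * J0 (t, o + l t • ω.1) -
      ∑ i, ω.1 i * J i (t, o + l t • ω.1))) : (∫⁻ t in Ioc 0 T, ∫⁻ ω : S2, ofReal ((c - t) ^ 2 *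
        (J0 (t, o + (c - t) • ω.1) + ∑ i, ω.1 i * J i (t, o + (c - t) • ω.1))) ∂sphereMeasure) +
      (∫⁻ t in Ioc 0 T, ∫⁻ ω : S2, ofReal (l t ^ 2 * (l' t * J0 (t, o + l t • ω.1) -
          ∑ i, ω.1 i * J i (t, o + l t • ω.1))) ∂sphereMeasure) ≤ ∫⁻ s in Ioc (l 0) c, ∫⁻ ω : S2,
      ofReal (s ^ 2 * J0 (0, o + s • ω.1)) ∂sphereMeasure := by
  have hid := energy_identity hΩ h0 hJ o hW hT hTW hl hl' hle hreg
  have m0 : (0 : ℝ) ∈ Icc 0 T := Set.left_mem_Icc.2 hT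
  have mT : T ∈ Icc 0 T := Set.right_mem_Icc.2 hT
  have hΩ' : IsOpen (Ω ∩ Prod.fst ⁻¹' W) := hΩ.inter (hW.preimage continuous_fst)
  have hlc : ContinuousOn l (Icc 0 T) := fun t ht =>
    (hl t (hTW ht)).continuousAt.continuousWithinAt
  have hf1 : ∀ {G : M4 → ℝ}, ContinuousOn G Ω →
      ContinuousOn (fun z : M4 × S2 => G z.1) ((Ω ∩ Prod.fst ⁻¹' W) ×ˢ univ) :=
    fun hG => hG.comp continuousOn_fst fun z hz => hz.1.1
  have hω : ∀ i : Fin 3, ContinuousOn (fun z : M4 × S2 => (z.2 : E3) i)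
      ((Ω ∩ Prod.fst ⁻¹' W) ×ˢ univ) := fun i => by fun_prop
  have hsum : ContinuousOn (fun z : M4 × S2 => ∑ i, (z.2 : E3) i * J i z.1)
      ((Ω ∩ Prod.fst ⁻¹' W) ×ˢ univ) :=
    continuousOn_finsetSum _ fun i _ => (hω i).mul (hf1 (hJ i).continuousOn)
  have hl1 : ContinuousOn (fun z : M4 × S2 => l' z.1.1)
      ((Ω ∩ Prod.fst ⁻¹' W) ×ˢ univ) :=
    hl'.comp (by fun_prop) fun z hz => hz.1.2
  have q1 := ofReal_integral_sphInt (o := o) hΩ'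
    (F := fun q ω => J0 q + ∑ i, ω.1 i * J i q) ((hf1 h0.continuousOn).add hsum) hT
    (τ := fun t => t) (σ := fun t => c - t) (by fun_prop) (by fun_prop)
    (fun t ht ω => ⟨hreg t ht _ (Set.right_mem_Icc.2 (hle t ht)) ω, hTW ht⟩)
    fun t ht ω => mul_nonneg (sq_nonneg _) (hout t ht ω)
  have q2 := ofReal_integral_sphInt (o := o) hΩ'
    (F := fun q ω => l' q.1 * J0 q - ∑ i, ω.1 i * J i q)
    ((hl1.mul (hf1 h0.continuousOn)).sub hsum) hT
    (τ := fun t => t) (σ := l) (by fun_prop) hlc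
    (fun t ht ω => ⟨hreg t ht _ (Set.left_mem_Icc.2 (hle t ht)) ω, hTW ht⟩) hin
  have hc0 : l 0 ≤ c := by simpa using hle 0 m0
  have q3 := ofReal_integral_sphInt (o := o) hΩ' (F := fun q _ => J0 q)
    (hf1 h0.continuousOn) hc0 (τ := fun _ => 0) (σ := fun s => s) (by fun_prop) (by fun_prop)
    (fun s hs ω => ⟨hreg 0 m0 s (by simpa using hs) ω, hTW m0⟩)
    (fun s hs ω => mul_nonneg (sq_nonneg _) (hpos 0 m0 s (by simpa using hs) ω))
  rw [← q1, ← q2, ← q3, ← ofReal_add]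
  · refine ofReal_le_ofReal ?_
    have n1 : 0 ≤ ∫ s in l T..c - T, sphInt o (fun q _ => J0 q) T s :=
      intervalIntegral.integral_nonneg (hle T mT) fun s hs =>
        mul_nonneg (sq_nonneg _) (integral_nonneg fun ω => hpos T mT s hs ω)
    have n2 : ∫ t in (0 : ℝ)..T, ∫ s in l t..c - t, sphInt o (fun q _ => divST J0 J q) t s ≤ 0 := by
      rw [← neg_nonneg, ← intervalIntegral.integral_neg]
      refine intervalIntegral.integral_nonneg hT fun t ht => ?_
      rw [← intervalIntegral.integral_neg]
      refine intervalIntegral.integral_nonneg (hle t ht) fun s hs => ?_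
      rw [sphInt, ← mul_neg, ← integral_neg]
      exact mul_nonneg (sq_nonneg _) (integral_nonneg fun ω => neg_nonneg.2 (hdiv t ht s hs ω))
    linarith
  · exact intervalIntegral.integral_nonneg hT fun t ht =>
      mul_nonneg (sq_nonneg _) (integral_nonneg fun ω => hout t ht ω)
  · exact intervalIntegral.integral_nonneg hT fun t ht =>
      (integral_nonneg fun ω => hin t ht ω).trans_eq (integral_const_mul _ _)

end Polar

section Hyperboloid

/-- Derivative of the radius of the hyperboloid. -/
def hypRho' (t : ℝ) : ℝ := (t + 12 / 5) / hypRho t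

lemma hypRho_sq {t : ℝ} (ht : -1 < t) : hypRho t ^ 2 = (t + 12 / 5) ^ 2 - 9 / 25 := by
  rw [hypRho, sq_sqrt (by nlinarith)]
  ring

lemma hypRho_pos {t : ℝ} (ht : -1 < t) : 0 < hypRho t := Real.sqrt_pos.2 (by nlinarith)

lemma add_two_le_hypRho {t : ℝ} (ht : 0 ≤ t) : t + 2 ≤ hypRho t := by
  have h1 := hypRho_sq (t := t) (by linarith)
  have h2 := hypRho_pos (t := t) (by linarith)
  nlinarith

lemma hypRho_le {t : ℝ} (ht : 0 ≤ t) : hypRho t ≤ t + 12 / 5 := by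
  have h1 := hypRho_sq (t := t) (by linarith)
  have h2 := hypRho_pos (t := t) (by linarith)
  nlinarith

lemma hypRho_mono {s t : ℝ} (hs : 0 ≤ s) (hst : s ≤ t) : hypRho s ≤ hypRho t :=
  Real.sqrt_le_sqrt (by nlinarith)

lemma hasDerivAt_hypRho {t : ℝ} (ht : -1 < t) : HasDerivAt hypRho (hypRho' t) t := by
  have h1 : HasDerivAt (fun t : ℝ => (t + 3) ^ 2 - (6 / 5) * (t + 3)) (2 * (t + 3) - 6 / 5) t := by
    have h := (hasDerivAt_id t).add_const (3 : ℝ)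
    exact ((h.pow 2).sub (h.const_mul (6 / 5))).congr_deriv (by simp)
  refine (h1.sqrt (by nlinarith)).congr_deriv ?_
  have h2 := hypRho_pos ht
  rw [hypRho', hypRho] at *
  field_simp
  ring

lemma continuousOn_hypRho' : ContinuousOn hypRho' (Ioi (-1)) :=
  ContinuousOn.div (by fun_prop)
    (fun _ ht => (hasDerivAt_hypRho ht).continuousAt.continuousWithinAt)
    fun _ ht => (hypRho_pos ht).ne'

lemma norm_smul_sphere {s : ℝ} (hs : 0 ≤ s) (ω : S2) : ‖s • ω.1‖ = s := by
  rw [norm_smul, norm_eq_of_mem_sphere ω, mul_one, Real.norm_of_nonneg hs]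

lemma measurable_indicator_slice {G : M4 → ℝ} (hG : ContinuousOn G extDom) :
    Measurable (indicator farDom fun x => ofReal (G (0, x))) := by
  classical
  rw [← Set.piecewise_eq_indicator]
  refine ContinuousOn.measurable_piecewise ?_ continuousOn_const
    (measurableSet_le measurable_const measurable_norm)
  refine ENNReal.continuous_ofReal.comp_continuousOn (hG.comp (by fun_prop) fun x hx => ?_)
  change 2 ≤ ‖x‖ at hx
  change |(0 : ℝ)| < ‖x‖
  rw [abs_zero]
  linarith

lemma lintegral_shell_le {G : M4 → ℝ} (hG : ContinuousOn G extDom) (o : E3) {a b : ℝ}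
    (ha : 0 ≤ a) (h : ∀ s ∈ Ioc a b, ∀ ω : S2, 2 ≤ ‖o + s • ω.1‖) :
    ∫⁻ s in Ioc a b, ∫⁻ ω : S2, ofReal (s ^ 2 * G (0, o + s • ω.1))
      ∂sphereMeasure ≤ ∫⁻ x in farDom, ofReal (G (0, x)) := by
  have hm := measurable_indicator_slice hG
  rw [← lintegral_indicator (measurableSet_le measurable_const measurable_norm),
    lintegral_polar o hm]
  refine le_trans (le_of_eq ?_) (lintegral_mono_set (μ := volume) (s := Ioc a b)
    (fun s hs => mem_Ioi.2 (lt_of_le_of_lt ha hs.1)))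
  refine setLIntegral_congr_fun measurableSet_Ioc fun s hs => ?_
  rw [← lintegral_ofReal_mul]
  refine lintegral_congr fun ω => ?_
  rw [indicator_of_mem (show o + s • ω.1 ∈ farDom from h s hs ω), ofReal_mul (sq_nonneg s)]

lemma hyperboloid_energy {J0 : M4 → ℝ} {J : Fin 3 → M4 → ℝ}
    (h0 : ContDiffOn ℝ 1 J0 extDom) (hJ : ∀ i, ContDiffOn ℝ 1 (J i) extDom)
    (hdiv : ∀ q ∈ extReg, divST J0 J q ≤ 0) (hpos : ∀ q ∈ extReg, 0 ≤ J0 q)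
    (hout : ∀ q ∈ extReg, 0 ≤ J0 q + ∑ i, q.2 i / ‖q.2‖ * J i q)
    (hin : ∀ q ∈ extReg, 0 ≤ hypRho' q.1 * J0 q - ∑ i, q.2 i / ‖q.2‖ * J i q) :
    ∫⁻ t in Ioi (0 : ℝ), ∫⁻ ω : S2, ofReal (hypRho t ^ 2 * (hypRho' t * J0 (t, hypRho t • ω.1) -
          ∑ i, ω.1 i * J i (t, hypRho t • ω.1))) ∂sphereMeasure ≤
      ∫⁻ x in farDom, ofReal (J0 (0, x)) := by
  have hU : Ioi (0 : ℝ) = ⋃ n : ℕ, Ioc 0 (n : ℝ) := by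
    ext t
    simp only [mem_Ioi, Set.mem_iUnion, Set.mem_Ioc]
    exact ⟨fun h => (exists_nat_ge t).imp fun n hn => ⟨h, hn⟩, fun ⟨n, hn⟩ => hn.1⟩
  rw [hU, setLIntegral_iUnion_of_directed]
  swap
  · exact (monotone_nat_of_le_succ fun n => Set.Ioc_subset_Ioc_right (by simp)).directed_le
  refine iSup_le fun n => ?_
  set T : ℝ := (n : ℝ)
  have hT : 0 ≤ T := Nat.cast_nonneg n
  have hmem : ∀ t ∈ Icc 0 T, ∀ s, hypRho t ≤ s → ∀ ω : S2,
      (t, (0 : E3) + s • ω.1) ∈ extReg := fun t ht s hs ω => by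
    have := add_two_le_hypRho ht.1
    refine ⟨ht.1, ?_⟩
    rw [zero_add, norm_smul_sphere (by linarith [ht.1])]
    linarith
  have hcoord : ∀ t ∈ Icc 0 T, ∀ s, hypRho t ≤ s → ∀ ω : S2, ∀ i,
      ((0 : E3) + s • ω.1) i / ‖(0 : E3) + s • ω.1‖ = ω.1 i :=
    fun t ht s hs ω i => by
      have := add_two_le_hypRho ht.1
      have hs : 0 < s := by linarith [ht.1]
      rw [zero_add, norm_smul_sphere hs.le]
      simp [hs.ne']
  have hle : ∀ t ∈ Icc 0 T, hypRho t ≤ hypRho T + T - t := fun t ht => by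
    linarith [hypRho_mono ht.1 ht.2, ht.2]
  have key := energy_inequality (o := 0) isOpen_extDom h0 hJ (l := hypRho) (l' := hypRho')
    isOpen_Ioi (c := hypRho T + T) hT (fun t ht => by simp only [mem_Ioi]; linarith [ht.1])
    (fun t ht => hasDerivAt_hypRho ht) continuousOn_hypRho' hle
    (fun t ht s hs ω => extReg_subset_extDom (hmem t ht s hs.1 ω))
    (fun t ht s hs ω => hdiv _ (hmem t ht s hs.1 ω))
    (fun t ht s hs ω => hpos _ (hmem t ht s hs.1 ω))
    (fun t ht ω => by
      have := hout _ (hmem t ht _ (hle t ht) ω)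
      simp only [hcoord t ht _ (hle t ht) ω] at this
      exact this)
    (fun t ht ω => by
      have := hin _ (hmem t ht _ le_rfl ω)
      simp only [hcoord t ht _ le_rfl ω] at this
      exact mul_nonneg (sq_nonneg _) this)
  simp only [zero_add] at key
  refine (le_add_self.trans key).trans ?_
  have h2 := add_two_le_hypRho le_rfl
  have := lintegral_shell_le h0.continuousOn 0 (a := hypRho 0) (b := hypRho T + T) (by linarith)
    fun s hs ω => by
      rw [zero_add, norm_smul_sphere (by linarith [hs.1])]
      linarith [hs.1]
  simpa only [zero_add] using this

lemma lintegral_ball_polar (o : E3) {R : ℝ} {f : E3 → ℝ≥0∞} (hf : Measurable f) :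
    ∫⁻ x in ball o R, f x = ∫⁻ s in Ioo 0 R,
      ofReal (s ^ 2) * ∫⁻ ω : S2, f (o + s • ω.1) ∂sphereMeasure := by
  rw [← lintegral_indicator isOpen_ball.measurableSet,
    lintegral_polar o (hf.indicator isOpen_ball.measurableSet),
    ← lintegral_indicator measurableSet_Ioi, ← lintegral_indicator measurableSet_Ioo]
  refine lintegral_congr fun s => ?_
  by_cases hs : 0 < s
  · have hmem : ∀ ω : S2, o + s • ω.1 ∈ ball o R ↔ s < R := fun ω => by
      rw [mem_ball_iff_norm, add_sub_cancel_left, norm_smul_sphere hs.le]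
    by_cases hR : s < R
    · rw [indicator_of_mem (mem_Ioi.2 hs), indicator_of_mem (Set.mem_Ioo.2 ⟨hs, hR⟩)]
      congr 1
      exact lintegral_congr fun ω => indicator_of_mem ((hmem ω).2 hR) _
    · rw [indicator_of_mem (mem_Ioi.2 hs), indicator_of_notMem fun h => hR h.2]
      simp [indicator, hmem, hR]
  · rw [indicator_of_notMem (by simpa using hs), indicator_of_notMem fun h => hs h.1]

lemma cone_energy {J0 : M4 → ℝ} {J : Fin 3 → M4 → ℝ}
    (h0 : ContDiffOn ℝ 1 J0 extDom) (hJ : ∀ i, ContDiffOn ℝ 1 (J i) extDom)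
    (hdiv : ∀ q ∈ extReg, divST J0 J q ≤ 0) (hpos : ∀ q ∈ extReg, 0 ≤ J0 q)
    (hout : ∀ q ∈ extReg, ∀ n : Fin 3 → ℝ, ∑ i, n i ^ 2 = 1 → 0 ≤ J0 q + ∑ i, n i * J i q)
    {o : E3} {T : ℝ} (hT : 0 ≤ T) (ho : T + 2 ≤ ‖o‖) {H : E3 → ℝ≥0∞} (hH : Measurable H)
    (hHle : ∀ s ∈ Ioo 0 T, ∀ ω : S2, H (o + s • ω.1) ≤ ofReal (J0 (T - s, o + s • ω.1) +
        ∑ i, ω.1 i * J i (T - s, o + s • ω.1))) : ∫⁻ x in ball o T, H x ≤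
      ∫⁻ x in farDom, ofReal (J0 (0, x)) := by
  have hnorm : ∀ s, 0 ≤ s → ∀ ω : S2, ‖o‖ - s ≤ ‖o + s • ω.1‖ := fun s hs ω => by
    have := norm_sub_norm_le o (-(s • ω.1))
    rwa [norm_neg, norm_smul_sphere hs, sub_neg_eq_add] at this
  have hmem : ∀ t ∈ Icc 0 T, ∀ s ∈ Icc 0 (T - t), ∀ ω : S2,
      (t, o + s • ω.1) ∈ extReg := fun t ht s hs ω =>
    ⟨ht.1, by linarith [hnorm s hs.1 ω, hs.2]⟩
  have key := energy_inequality (o := o) isOpen_extDom h0 hJ (l := fun _ => 0) (l' := fun _ => 0)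
    isOpen_univ (c := T) hT (fun t _ => trivial) (fun t _ => hasDerivAt_const _ _)
    continuousOn_const (fun t ht => by linarith [ht.2])
    (fun t ht s hs ω => extReg_subset_extDom (hmem t ht s hs ω))
    (fun t ht s hs ω => hdiv _ (hmem t ht s hs ω))
    (fun t ht s hs ω => hpos _ (hmem t ht s hs ω))
    (fun t ht ω => hout _ (hmem t ht _ ⟨by linarith [ht.2], le_rfl⟩ ω) _ (sphere_coord_sq ω))
    (fun t ht ω => by simp)
  refine le_trans ?_ ((le_self_add.trans key).trans (lintegral_shell_le h0.continuousOn o le_rfl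
    fun s hs ω => by linarith [hnorm s hs.1.le ω, hs.2]))
  rw [lintegral_ball_polar o hH, setLIntegral_congr Ioo_ae_eq_Ioc.symm,
    ← lintegral_indicator measurableSet_Ioo, ← lintegral_indicator measurableSet_Ioo,
    ← lintegral_sub_left_eq_self _ T]
  refine lintegral_mono fun t => ?_
  by_cases ht : t ∈ Ioo 0 T
  · have ht' : T - t ∈ Ioo 0 T := ⟨by linarith [ht.2], by linarith [ht.1]⟩
    rw [indicator_of_mem ht, indicator_of_mem ht', ← lintegral_ofReal_mul]
    refine lintegral_mono fun ω => ?_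
    rw [ofReal_mul (sq_nonneg _)]
    have := hHle _ ht' ω
    rw [sub_sub_cancel] at this
    exact mul_le_mul' le_rfl this
  · have ht' : T - t ∉ Ioo 0 T := fun h => ht ⟨by linarith [h.2], by linarith [h.1]⟩
    rw [indicator_of_notMem ht, indicator_of_notMem ht']

end Hyperboloid

section Tools

/-- Cauchy–Schwarz for lower Lebesgue integrals. -/
lemma lintegral_mul_sq_le {α : Type*} [MeasurableSpace α] {μ : Measure α}
    {f g : α → ℝ≥0∞} (hf : AEMeasurable f μ) (hg : AEMeasurable g μ) :
    (∫⁻ x, f x * g x ∂μ) ^ 2 ≤ (∫⁻ x, f x ^ 2 ∂μ) * ∫⁻ x, g x ^ 2 ∂μ := by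
  have h := ENNReal.lintegral_mul_le_Lp_mul_Lq μ (p := 2) (q := 2)
    ⟨by norm_num, by norm_num, by norm_num⟩ hf hg
  refine (pow_le_pow_left' h 2).trans (le_of_eq ?_)
  have key : ∀ A : ℝ≥0∞, (A ^ (1 / (2 : ℝ))) ^ 2 = A := fun A => by
    rw [← ENNReal.rpow_two, ← ENNReal.rpow_mul]
    norm_num
  simp only [mul_pow, key, ENNReal.rpow_two]

lemma lintegral_mul_le_of_sq_le {α : Type*} [MeasurableSpace α] {μ : Measure α}
    {f g : α → ℝ≥0∞} (hf : AEMeasurable f μ) (hg : AEMeasurable g μ) {a b : ℝ} (ha : 0 ≤ a)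
    (hb : 0 ≤ b) (h1 : ∫⁻ x, f x ^ 2 ∂μ ≤ ofReal (a ^ 2))
    (h2 : ∫⁻ x, g x ^ 2 ∂μ ≤ ofReal (b ^ 2)) : ∫⁻ x, f x * g x ∂μ ≤ ofReal (a * b) := by
  rw [← ENNReal.pow_le_pow_left_iff two_ne_zero, ← ofReal_pow (mul_nonneg ha hb), mul_pow,
    ofReal_mul (sq_nonneg a)]
  exact (lintegral_mul_sq_le hf hg).trans (mul_le_mul' h1 h2)

lemma lintegral_rpow_Ioo {b R : ℝ} (hb : -1 < b) (hR : 0 ≤ R) :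
    ∫⁻ s in Ioo 0 R, ofReal (s ^ b) = ofReal (R ^ (b + 1) / (b + 1)) := by
  rw [setLIntegral_congr Ioo_ae_eq_Ioc, ← ofReal_integral_eq_lintegral_ofReal]
  · rw [← intervalIntegral.integral_of_le hR, integral_rpow (Or.inl hb),
      Real.zero_rpow (by linarith), sub_zero]
  · exact (intervalIntegrable_iff_integrableOn_Ioc_of_le hR).1
      (intervalIntegral.intervalIntegrable_rpow' hb)
  · filter_upwards [ae_restrict_mem measurableSet_Ioc] with s hs
    exact rpow_nonneg hs.1.le _

lemma lintegral_rpow_Ioi {b c : ℝ} (hb : b < -1) (hc : 0 < c) :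
    ∫⁻ s in Ioi c, ofReal (s ^ b) = ofReal (c ^ (b + 1) / (-b - 1)) := by
  rw [← ofReal_integral_eq_lintegral_ofReal]
  · rw [integral_Ioi_rpow_of_lt hb hc]
    congr 1
    rw [neg_div, ← div_neg]
    ring_nf
  · exact integrableOn_Ioi_rpow_of_lt hb hc
  · filter_upwards [ae_restrict_mem measurableSet_Ioi] with s hs
    exact rpow_nonneg (hc.trans hs).le _

/-- Total mass of the unit sphere. -/
def sphMass : ℝ := (sphereMeasure univ).toReal

lemma sphMass_nonneg : 0 ≤ sphMass := toReal_nonneg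

lemma ofReal_sphMass : ofReal sphMass = sphereMeasure univ :=
  ofReal_toReal (measure_ne_top _ _)

lemma lintegral_sphere_const (c : ℝ≥0∞) : ∫⁻ _ : S2, c ∂sphereMeasure = c * ofReal sphMass := by
  rw [lintegral_const, ofReal_sphMass]

lemma lintegral_norm_sub_rpow_ball (o : E3) {a R : ℝ} (ha : -3 < a) (hR : 0 ≤ R) :
    ∫⁻ x in ball o R, ofReal (‖x - o‖ ^ a) = ofReal (sphMass * (R ^ (a + 3) / (a + 3))) := by
  rw [lintegral_ball_polar o (by fun_prop), ofReal_mul sphMass_nonneg,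
    show a + 3 = (2 + a) + 1 by ring, ← lintegral_rpow_Ioo (by linarith) hR, ← lintegral_ofReal_mul]
  refine setLIntegral_congr_fun measurableSet_Ioo fun s hs => ?_
  have hs0 : 0 < s := hs.1
  simp only [add_sub_cancel_left, norm_smul_sphere hs0.le, lintegral_sphere_const]
  rw [rpow_add hs0, rpow_two, ofReal_mul (sq_nonneg s)]
  ring

lemma lintegral_norm_rpow_ball {a R : ℝ} (ha : -3 < a) (hR : 0 ≤ R) :
    ∫⁻ x in ball (0 : E3) R, ofReal (‖x‖ ^ a) = ofReal (sphMass * (R ^ (a + 3) / (a + 3))) := by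
  simpa only [sub_zero] using lintegral_norm_sub_rpow_ball 0 ha hR

lemma lintegral_outside_polar (c : ℝ) (hc : 0 ≤ c) {f : E3 → ℝ≥0∞} (hf : Measurable f) :
    ∫⁻ x in {x : E3 | c < ‖x‖}, f x = ∫⁻ s in Ioi c,
      ofReal (s ^ 2) * ∫⁻ ω : S2, f (s • ω.1) ∂sphereMeasure := by
  have hm : MeasurableSet {x : E3 | c < ‖x‖} := measurableSet_lt measurable_const measurable_norm
  rw [← lintegral_indicator hm, lintegral_polar 0 (hf.indicator hm),
    ← lintegral_indicator measurableSet_Ioi, ← lintegral_indicator measurableSet_Ioi]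
  refine lintegral_congr fun s => ?_
  by_cases hs : 0 < s
  · have hmem : ∀ ω : S2, (s • ω.1) ∈ {x : E3 | c < ‖x‖} ↔ c < s := fun ω => by
      change c < ‖s • ω.1‖ ↔ _
      rw [norm_smul_sphere hs.le]
    rw [indicator_of_mem (mem_Ioi.2 hs)]
    simp only [zero_add]
    by_cases hR : c < s
    · rw [indicator_of_mem (mem_Ioi.2 hR)]
      congr 1
      exact lintegral_congr fun ω => indicator_of_mem ((hmem ω).2 hR) _
    · rw [indicator_of_notMem (show s ∉ Ioi c from fun h => hR h)]
      have : ∀ ω : S2, indicator {x : E3 | c < ‖x‖} f (s • ω.1) = 0 := fun ω =>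
        indicator_of_notMem (fun h => hR ((hmem ω).1 h)) _
      simp [this]
  · rw [indicator_of_notMem (show s ∉ Ioi (0 : ℝ) from fun h => hs h),
      indicator_of_notMem (show s ∉ Ioi c from fun h => hs (hc.trans_lt h))]

lemma lintegral_norm_rpow_outside {a c : ℝ} (ha : a < -3) (hc : 0 < c) :
    ∫⁻ x in {x : E3 | c < ‖x‖}, ofReal (‖x‖ ^ a) = ofReal (sphMass * (c ^ (a + 3) / (-a - 3))) := by
  rw [lintegral_outside_polar c hc.le (by fun_prop), ofReal_mul sphMass_nonneg,
    show a + 3 = (2 + a) + 1 by ring, show -a - 3 = -(2 + a) - 1 by ring,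
    ← lintegral_rpow_Ioi (by linarith) hc, ← lintegral_ofReal_mul]
  refine setLIntegral_congr_fun measurableSet_Ioi fun s hs => ?_
  have hs0 : 0 < s := hc.trans hs
  simp only [norm_smul_sphere hs0.le, lintegral_sphere_const]
  rw [rpow_add hs0, rpow_two, ofReal_mul (sq_nonneg s)]
  ring

end Tools

section RadialHardy

lemma two_mul_ofReal (a : ℝ) : 2 * ofReal a = ofReal (2 * a) := by
  rw [ofReal_mul (by norm_num), ENNReal.ofReal_ofNat]

variable {f : E3 → ℝ}

lemma continuous_norm_fderiv (hf : ContDiff ℝ 1 f) : Continuous fun x => ‖fderiv ℝ f x‖ :=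
  (hf.continuous_fderiv one_ne_zero).norm

lemma hasDerivAt_ray (hf : ContDiff ℝ 1 f) (o ω : E3) (s : ℝ) :
    HasDerivAt (fun s : ℝ => f (o + s • ω)) (fderiv ℝ f (o + s • ω) ω) s := by
  have h1 : HasDerivAt (fun s : ℝ => o + s • ω) ω s := by
    simpa using ((hasDerivAt_id s).smul_const ω).const_add o
  exact ((hf.differentiable one_ne_zero _).hasFDerivAt).comp_hasDerivAt s h1

lemma abs_fderiv_sphere_le (x : E3) (ω : S2) :
    |fderiv ℝ f x ω.1| ≤ ‖fderiv ℝ f x‖ := by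
  have h := (fderiv ℝ f x).le_opNorm ω.1
  rwa [norm_eq_of_mem_sphere ω, mul_one] at h

lemma ofReal_abs_ray_sub_le (hf : ContDiff ℝ 1 f) (o : E3) (ω : S2) {r R : ℝ} (hr : r ≤ R) :
    ofReal |f (o + R • ω.1) - f (o + r • ω.1)| ≤
      ∫⁻ s in Ioc r R, ofReal ‖fderiv ℝ f (o + s • ω.1)‖ := by
  have hc : Continuous fun s : ℝ => fderiv ℝ f (o + s • ω.1) ω.1 :=
    ((hf.continuous_fderiv one_ne_zero).comp (by fun_prop)).clm_apply continuous_const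
  rw [← intervalIntegral.integral_eq_sub_of_hasDerivAt
    (fun s _ => hasDerivAt_ray hf o ω.1 s) (hc.intervalIntegrable _ _),
    intervalIntegral.integral_of_le hr, ← norm_eq_abs, ofReal_norm]
  refine (enorm_integral_le_lintegral_enorm _).trans (lintegral_mono fun s => ?_)
  rw [← ofReal_norm]
  exact ofReal_le_ofReal (abs_fderiv_sphere_le _ ω)

lemma exists_sq_le_add {δ q : ℝ} (hδ : 0 < δ) (hq : 2 ≤ q) :
    ∃ C : ℝ, 0 < C ∧ ∀ x : ℝ, x ^ 2 ≤ δ + C * |x| ^ q := by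
  refine ⟨(√δ ^ (q - 2))⁻¹, by positivity, fun x => ?_⟩
  have hs : 0 < √δ := Real.sqrt_pos.2 hδ
  by_cases h : x ^ 2 ≤ δ
  · have : 0 ≤ (√δ ^ (q - 2))⁻¹ * |x| ^ q := by positivity
    linarith
  · have hx : √δ ≤ |x| := Real.sqrt_le_iff.2 ⟨abs_nonneg _, by rw [sq_abs]; linarith⟩
    have e : |x| ^ q = |x| ^ (q - 2) * x ^ 2 := by
      rw [← sq_abs, ← rpow_natCast, ← rpow_add (hs.trans_le hx)]
      norm_num
    have h1 : √δ ^ (q - 2) ≤ |x| ^ (q - 2) := rpow_le_rpow hs.le hx (by linarith)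
    have h2 : 1 ≤ (√δ ^ (q - 2))⁻¹ * |x| ^ (q - 2) := by
      rw [inv_mul_eq_div, one_le_div (by positivity)]
      exact h1
    rw [e, ← mul_assoc]
    nlinarith [sq_nonneg x]

lemma sphere_sq_le_two (hf : ContDiff ℝ 1 f) {r R : ℝ} (hr : 0 < r) (hR : r ≤ R) :
    ∫⁻ ω : S2, ofReal (f (r • ω.1) ^ 2) ∂sphereMeasure ≤
      2 * ∫⁻ ω : S2, ofReal (f (R • ω.1) ^ 2) ∂sphereMeasure + ofReal (2 / r) *
        ∫⁻ x in {x : E3 | r < ‖x‖}, ofReal (‖fderiv ℝ f x‖ ^ 2) := by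
  have hD := continuous_norm_fderiv hf
  have hpt : ∀ ω : S2, ofReal (f (r • ω.1) ^ 2) ≤ 2 * ofReal (f (R • ω.1) ^ 2) + ofReal (2 / r) *
        ∫⁻ s in Ioi r, ofReal (s ^ 2) * ofReal (‖fderiv ℝ f (s • ω.1)‖ ^ 2) := fun ω => by
    have h0 := ofReal_abs_ray_sub_le hf 0 ω hR
    simp only [zero_add] at h0
    have h1 : ∫⁻ s in Ioc r R, ofReal ‖fderiv ℝ f (s • ω.1)‖ ≤ ∫⁻ s in Ioi r, ofReal (s⁻¹) *
          ofReal (s * ‖fderiv ℝ f (s • ω.1)‖) := by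
      refine le_trans (le_of_eq ?_) (lintegral_mono_set
        (s := Ioc r R) fun s hs => hs.1)
      refine setLIntegral_congr_fun measurableSet_Ioc fun s hs => ?_
      have hs0 : 0 < s := hr.trans hs.1
      change _ = ofReal (s⁻¹) * _
      rw [← ofReal_mul (by positivity), inv_mul_cancel_left₀ hs0.ne']
    have hcs := lintegral_mul_sq_le (μ := volume.restrict (Ioi r))
      (f := fun s : ℝ => ofReal (s⁻¹))
      (g := fun s : ℝ => ofReal (s * ‖fderiv ℝ f (s • ω.1)‖))
      (by fun_prop) (by
        refine Measurable.aemeasurable (measurable_ofReal.comp ?_)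
        exact (continuous_id.mul (hD.comp (by fun_prop))).measurable)
    have e1 : ∫⁻ s in Ioi r, ofReal (s⁻¹) ^ 2 = ofReal (1 / r) := by
      have := lintegral_rpow_Ioi (b := -2) (by norm_num) hr
      rw [show (-2 : ℝ) + 1 = -1 by norm_num, show -(-2 : ℝ) - 1 = 1 by norm_num, div_one] at this
      rw [one_div, ← Real.rpow_neg_one, ← this]
      refine setLIntegral_congr_fun measurableSet_Ioi fun s hs => ?_
      have hs0 : 0 < s := hr.trans hs
      change ofReal (s⁻¹) ^ 2 = ofReal (s ^ (-2 : ℝ))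
      rw [← ofReal_pow (by positivity), Real.rpow_neg hs0.le, rpow_two, inv_pow]
    have e2 : ∫⁻ s in Ioi r, ofReal (s * ‖fderiv ℝ f (s • ω.1)‖) ^ 2 =
        ∫⁻ s in Ioi r, ofReal (s ^ 2) * ofReal (‖fderiv ℝ f (s • ω.1)‖ ^ 2) := by
      refine setLIntegral_congr_fun measurableSet_Ioi fun s hs => ?_
      have hs0 : 0 < s := hr.trans hs
      change ofReal (s * ‖fderiv ℝ f (s • ω.1)‖) ^ 2 = ofReal (s ^ 2) *
          ofReal (‖fderiv ℝ f (s • ω.1)‖ ^ 2)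
      rw [← ofReal_pow (by positivity), mul_pow, ofReal_mul (by positivity)]
    rw [e1, e2] at hcs
    have h2 := (pow_le_pow_left' (h0.trans h1) 2).trans hcs
    rw [← ofReal_pow (abs_nonneg _), sq_abs] at h2
    calc ofReal (f (r • ω.1) ^ 2)
        ≤ ofReal (2 * f (R • ω.1) ^ 2 + 2 * (f (R • ω.1) - f (r • ω.1)) ^ 2) := ofReal_le_ofReal (by
            nlinarith [sq_nonneg (2 * f (R • ω.1) - f (r • ω.1))])
      _ = 2 * ofReal (f (R • ω.1) ^ 2) + 2 * ofReal ((f (R • ω.1) - f (r • ω.1)) ^ 2) := by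
        rw [ofReal_add (by positivity) (by positivity), ofReal_mul (by norm_num),
          ofReal_mul (by norm_num), ENNReal.ofReal_ofNat]
      _ ≤ _ := by
        refine add_le_add le_rfl ((mul_le_mul' le_rfl h2).trans (le_of_eq ?_))
        rw [← mul_assoc, two_mul_ofReal, mul_one_div]
  refine (lintegral_mono hpt).trans ?_
  have hmeas : Measurable fun z : S2 × ℝ => ofReal (z.2 ^ 2) *
      ofReal (‖fderiv ℝ f (z.2 • (z.1 : E3))‖ ^ 2) := by
    refine Measurable.mul (by fun_prop) (measurable_ofReal.comp ?_)
    exact ((hD.comp (by fun_prop)).pow 2).measurable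
  rw [lintegral_add_left, lintegral_const_mul' _ _ (by simp),
    lintegral_ofReal_mul, lintegral_outside_polar r hr.le,
    lintegral_lintegral_swap (f := fun (ω : S2) (s : ℝ) => ofReal (s ^ 2) *
      ofReal (‖fderiv ℝ f (s • ω.1)‖ ^ 2))]
  · refine le_of_eq ?_
    congr 3
    funext s
    exact lintegral_ofReal_mul
  · exact hmeas.aemeasurable
  · exact (hD.pow 2).measurable.ennreal_ofReal
  · refine Measurable.const_mul (measurable_ofReal.comp ?_) _
    have : Continuous fun ω : S2 => f (R • ω.1) := hf.continuous.comp (by fun_prop)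
    exact (this.pow 2).measurable

lemma exists_sphere_sq_small (hf : ContDiff ℝ 1 f) {r q : ℝ} (hr : 0 < r) (hq : 2 ≤ q)
    (hInt : ∫⁻ x in {x : E3 | r < ‖x‖}, ofReal (|f x| ^ q) ≠ ⊤) {δ : ℝ} (hδ : 0 < δ) :
    ∃ R, r ≤ R ∧ 2 * ∫⁻ ω : S2, ofReal (f (R • ω.1) ^ 2) ∂sphereMeasure ≤ ofReal δ := by
  by_contra! hcon
  have hσ := sphMass_nonneg
  set δ' : ℝ := δ / (4 * (sphMass + 1)) with hδ'
  obtain ⟨C, hC, hCx⟩ := exists_sq_le_add (δ := δ') (q := q) (by positivity) hq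
  refine hInt ?_
  have hcq : Continuous fun x => |f x| ^ q := hf.continuous.abs.rpow_const (by
    intro x; right; linarith)
  have hlow : ∀ s ∈ Ioi r, ofReal (r ^ 2) * ofReal (δ / (4 * C)) ≤ ofReal (s ^ 2) *
        ∫⁻ ω : S2, ofReal (|f (s • ω.1)| ^ q) ∂sphereMeasure := fun s hs => by
    have hs' : r < s := hs
    refine mul_le_mul' (ofReal_le_ofReal (by nlinarith)) ?_
    have h1 := hcon s hs'.le
    have h2 : ∫⁻ ω : S2, ofReal (f (s • ω.1) ^ 2) ∂sphereMeasure ≤ ofReal (δ / 4) + ofReal C *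
          ∫⁻ ω : S2, ofReal (|f (s • ω.1)| ^ q) ∂sphereMeasure := by
      calc _ ≤ ∫⁻ ω : S2, (ofReal δ' + ofReal C * ofReal (|f (s • ω.1)| ^ q)) ∂sphereMeasure := by
            refine lintegral_mono fun ω => ?_
            rw [← ofReal_mul hC.le, ← ofReal_add (by positivity) (by positivity)]
            exact ofReal_le_ofReal (hCx _)
        _ ≤ _ := by
            rw [lintegral_add_left measurable_const, lintegral_ofReal_mul,
              lintegral_sphere_const, ← ofReal_mul (by positivity)]
            gcongr
            rw [hδ', div_mul_eq_mul_div, div_le_div_iff₀ (by positivity) (by norm_num)]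
            nlinarith
    by_contra! h3
    have hne : ofReal C * ∫⁻ ω : S2, ofReal (|f (s • ω.1)| ^ q) ∂sphereMeasure ≤
          ofReal (δ / 4) := by
      refine (mul_le_mul' le_rfl h3.le).trans ?_
      rw [← ofReal_mul hC.le]
      refine ofReal_le_ofReal (le_of_eq ?_)
      field_simp
    refine absurd h1 (not_lt.2 ?_)
    refine (mul_le_mul' le_rfl (h2.trans (add_le_add_right hne _))).trans (le_of_eq ?_)
    rw [← ofReal_add (by positivity) (by positivity), two_mul_ofReal]
    congr 1
    ring
  rw [lintegral_outside_polar r hr.le hcq.measurable.ennreal_ofReal]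
  refine eq_top_mono (setLIntegral_mono' measurableSet_Ioi hlow) ?_
  rw [setLIntegral_const, Real.volume_Ioi, ENNReal.mul_top]
  rw [← ofReal_mul (sq_nonneg r)]
  exact ne_of_gt (ENNReal.ofReal_pos.2 (by positivity))

/-- Radial trace bound for functions that do not approach a nonzero constant at infinity. -/
lemma sphere_sq_le (hf : ContDiff ℝ 1 f) {r q : ℝ} (hr : 0 < r) (hq : 2 ≤ q)
    (hInt : ∫⁻ x in {x : E3 | r < ‖x‖}, ofReal (|f x| ^ q) ≠ ⊤) :
    ∫⁻ ω : S2, ofReal (f (r • ω.1) ^ 2) ∂sphereMeasure ≤ ofReal (2 / r) *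
        ∫⁻ x in {x : E3 | r < ‖x‖}, ofReal (‖fderiv ℝ f x‖ ^ 2) := by
  refine ENNReal.le_of_forall_pos_le_add fun δ hδ _ => ?_
  obtain ⟨R, hR, h⟩ := exists_sphere_sq_small hf hr hq hInt (δ := δ) (by exact_mod_cast hδ)
  rw [add_comm]
  refine (sphere_sq_le_two hf hr hR).trans (add_le_add_left (h.trans ?_) _)
  simp

lemma hardy_outside (hf : ContDiff ℝ 1 f) {b q γ : ℝ} (hb : 0 < b) (hq : 2 ≤ q) (hγ : 0 < γ)
    (hInt : ∫⁻ x in {x : E3 | b < ‖x‖}, ofReal (|f x| ^ q) ≠ ⊤) :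
    ∫⁻ x in {x : E3 | b < ‖x‖}, ofReal (‖x‖ ^ (γ - 2) * f x ^ 2) ≤ ofReal (2 / γ) *
        ∫⁻ x in {x : E3 | b < ‖x‖}, ofReal (‖x‖ ^ γ * ‖fderiv ℝ f x‖ ^ 2) := by
  have hD := continuous_norm_fderiv hf
  have hm : ∀ c : ℝ, MeasurableSet {x : E3 | c < ‖x‖} :=
    fun c => measurableSet_lt measurable_const measurable_norm
  have hG : Measurable fun x => ofReal (‖fderiv ℝ f x‖ ^ 2) :=
    measurable_ofReal.comp (hD.pow 2).measurable
  have hstep : ∀ s ∈ Ioi b, ofReal (s ^ 2) *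
      ∫⁻ ω : S2, ofReal (‖s • ω.1‖ ^ (γ - 2) * f (s • ω.1) ^ 2) ∂sphereMeasure ≤
      ∫⁻ x in {x : E3 | b < ‖x‖}, indicator {z : M4 | z.1 < ‖z.2‖}
        (fun z => ofReal (2 * z.1 ^ (γ - 1)) * ofReal (‖fderiv ℝ f z.2‖ ^ 2))
        (s, x) := fun s hs => by
    have hs0 : 0 < s := hb.trans hs
    have hsub : {x : E3 | s < ‖x‖} ⊆ {x : E3 | b < ‖x‖} := fun x hx =>
      lt_trans (show b < s from hs) (show s < ‖x‖ from hx)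
    have h1 := sphere_sq_le hf hs0 hq (ne_top_of_le_ne_top hInt (lintegral_mono_set hsub))
    have e1 : ∀ ω : S2, ofReal (‖s • ω.1‖ ^ (γ - 2) * f (s • ω.1) ^ 2) =
        ofReal (s ^ (γ - 2)) * ofReal (f (s • ω.1) ^ 2) := fun ω => by
      rw [norm_smul_sphere hs0.le, ofReal_mul (by positivity)]
    simp only [e1]
    rw [lintegral_ofReal_mul]
    refine (mul_le_mul' le_rfl (mul_le_mul' le_rfl h1)).trans (le_of_eq ?_)
    rw [← lintegral_indicator (hm b), ← lintegral_indicator (hm s), ← lintegral_ofReal_mul,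
      ← lintegral_ofReal_mul, ← lintegral_ofReal_mul]
    refine lintegral_congr fun x => ?_
    by_cases hx : s < ‖x‖
    · rw [indicator_of_mem (show x ∈ {x : E3 | s < ‖x‖} from hx),
        indicator_of_mem (show x ∈ {x : E3 | b < ‖x‖} from hsub hx),
        indicator_of_mem (show (s, x) ∈ {z : M4 | z.1 < ‖z.2‖} from hx),
        ← mul_assoc, ← mul_assoc, ← ofReal_mul (by positivity), ← ofReal_mul (by positivity)]
      congr 2
      rw [show γ - 1 = (γ - 2) + 1 by ring, rpow_add hs0, Real.rpow_one]
      field_simp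
    · rw [indicator_of_notMem (show x ∉ {x : E3 | s < ‖x‖} from hx)]
      simp [indicator, hx]
  rw [lintegral_outside_polar b hb.le]
  swap
  · refine measurable_ofReal.comp (Measurable.mul (by fun_prop) ?_)
    exact (hf.continuous.pow 2).measurable
  refine (setLIntegral_mono' measurableSet_Ioi hstep).trans ?_
  rw [lintegral_lintegral_swap]
  swap
  · refine Measurable.aemeasurable (Measurable.indicator ?_
      (measurableSet_lt measurable_fst (measurable_norm.comp measurable_snd)))
    exact Measurable.mul (by fun_prop) (hG.comp measurable_snd)
  rw [← lintegral_ofReal_mul]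
  refine setLIntegral_mono' (hm b) fun x hx => ?_
  have hx' : b < ‖x‖ := hx
  calc _ ≤ ∫⁻ s in Ioo 0 ‖x‖, ofReal (2 * ‖fderiv ℝ f x‖ ^ 2) * ofReal (s ^ (γ - 1)) := by
        rw [← lintegral_indicator measurableSet_Ioi, ← lintegral_indicator measurableSet_Ioo]
        refine lintegral_mono fun s => ?_
        by_cases hs : b < s
        · rw [indicator_of_mem (show s ∈ Ioi b from hs)]
          by_cases hsx : s < ‖x‖
          · rw [indicator_of_mem (show s ∈ Ioo 0 ‖x‖ from ⟨hb.trans hs, hsx⟩),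
              indicator_of_mem (show (s, x) ∈ {z : M4 | z.1 < ‖z.2‖} from hsx)]
            have hs0 : 0 < s := hb.trans hs
            rw [← ofReal_mul (by positivity), ← ofReal_mul (by positivity)]
            exact ofReal_le_ofReal (le_of_eq (by ring))
          · rw [indicator_of_notMem (show (s, x) ∉ {z : M4 | z.1 < ‖z.2‖} from hsx)]
            exact zero_le
        · rw [indicator_of_notMem (show s ∉ Ioi b from hs)]
          exact zero_le
    _ = _ := by
        rw [lintegral_ofReal_mul,
          lintegral_rpow_Ioo (by linarith) (norm_nonneg x), ← ofReal_mul (by positivity),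
          ← ofReal_mul (by positivity)]
        congr 1
        rw [sub_add_cancel]
        ring

end RadialHardy

section DataBounds

/-- Integral of `|f|` over the sphere of radius `s` about `o`, in angular measure. -/
def sphAbs (o : E3) (f : E3 → ℝ) (s : ℝ) : ℝ≥0∞ :=
  ∫⁻ ω : S2, ofReal |f (o + s • ω.1)| ∂sphereMeasure

lemma lintegral_sphere_swap {g : ℝ × S2 → ℝ≥0∞} (hg : Measurable g) (I : Set ℝ) :
    ∫⁻ ω : S2, (∫⁻ s in I, g (s, ω)) ∂sphereMeasure =
      ∫⁻ s in I, (∫⁻ ω : S2, g (s, ω) ∂sphereMeasure) :=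
  lintegral_lintegral_swap (f := fun (ω : S2) (s : ℝ) => g (s, ω))
    (hg.comp measurable_swap).aemeasurable

variable {f : E3 → ℝ}

lemma sphAbs_le_ball (hf : ContDiff ℝ 1 f) (o : E3) {R : ℝ} (hR : 0 ≤ R) :
    ofReal (R ^ 3) * sphAbs o f R ≤ ∫⁻ x in ball o R, ofReal (3 * |f x| + R * ‖fderiv ℝ f x‖) := by
  have hD := continuous_norm_fderiv hf
  have hg : Continuous fun x => 3 * |f x| + R * ‖fderiv ℝ f x‖ :=
    (hf.continuous.abs.const_mul 3).add (hD.const_mul R)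
  rw [lintegral_ball_polar o hg.measurable.ennreal_ofReal, sphAbs, ← lintegral_ofReal_mul]
  have hpt : ∀ ω : S2, ofReal (R ^ 3) * ofReal |f (o + R • ω.1)| ≤
      ∫⁻ s in Ioo 0 R, ofReal (s ^ 2) * ofReal
        (3 * |f (o + s • ω.1)| + R * ‖fderiv ℝ f (o + s • ω.1)‖) := fun ω => by
    have hc1 : Continuous fun s : ℝ => f (o + s • ω.1) := hf.continuous.comp (by fun_prop)
    have hc2 : Continuous fun s : ℝ => fderiv ℝ f (o + s • ω.1) ω.1 :=
      ((hf.continuous_fderiv one_ne_zero).comp (by fun_prop)).clm_apply continuous_const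
    have hd : ∀ s ∈ uIcc 0 R, HasDerivAt (fun s : ℝ => s ^ 3 * f (o + s • ω.1))
        (3 * s ^ 2 * f (o + s • ω.1) + s ^ 3 * fderiv ℝ f (o + s • ω.1) ω.1) s := fun s _ => by
      refine ((hasDerivAt_pow 3 s).mul (hasDerivAt_ray hf o ω.1 s)).congr_deriv ?_
      norm_num
    have hc : Continuous fun s : ℝ => 3 * s ^ 2 * f (o + s • ω.1) +
          s ^ 3 * fderiv ℝ f (o + s • ω.1) ω.1 := by fun_prop
    have e := intervalIntegral.integral_eq_sub_of_hasDerivAt hd (hc.intervalIntegrable _ _)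
    simp only [ne_eq, OfNat.ofNat_ne_zero, not_false_eq_true, zero_pow, zero_mul, sub_zero] at e
    rw [← ofReal_mul (by positivity), ← abs_of_nonneg (pow_nonneg hR 3), ← abs_mul, ← e,
      intervalIntegral.integral_of_le hR, ← norm_eq_abs, ofReal_norm]
    refine (enorm_integral_le_lintegral_enorm _).trans ?_
    rw [setLIntegral_congr (μ := volume) (Ioo_ae_eq_Ioc (a := (0 : ℝ)) (b := R))]
    refine setLIntegral_mono' measurableSet_Ioc fun s hs => ?_
    rw [← ofReal_norm, ← ofReal_mul (sq_nonneg s)]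
    refine ofReal_le_ofReal ?_
    rw [norm_eq_abs]
    refine (abs_add_le _ _).trans ?_
    have hs0 := hs.1.le
    have h1 := abs_fderiv_sphere_le (f := f) (o + s • ω.1) ω
    rw [abs_mul (3 * s ^ 2), abs_mul (s ^ 3), abs_of_nonneg (show 0 ≤ 3 * s ^ 2 by positivity),
      abs_of_nonneg (show 0 ≤ s ^ 3 by positivity)]
    have h2 : s ^ 3 * |fderiv ℝ f (o + s • ω.1) ω.1| ≤
        s ^ 2 * (R * ‖fderiv ℝ f (o + s • ω.1)‖) := by
      rw [pow_succ, mul_assoc (s ^ 2)]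
      exact mul_le_mul_of_nonneg_left (mul_le_mul hs.2 h1 (abs_nonneg _) hR) (sq_nonneg s)
    linarith
  refine (lintegral_mono hpt).trans (le_of_eq ?_)
  rw [lintegral_sphere_swap (g := fun z : ℝ × S2 => ofReal (z.1 ^ 2) * ofReal
    (3 * |f (o + z.1 • (z.2 : E3))| + R * ‖fderiv ℝ f (o + z.1 • (z.2 : E3))‖))]
  · exact lintegral_congr fun s =>
      lintegral_const_mul' (ofReal (s ^ 2)) _ ofReal_ne_top
  · exact Measurable.mul (by fun_prop)
      (hg.comp (by fun_prop : Continuous fun z : ℝ × S2 => o + z.1 • (z.2 : E3))).measurable.ennreal_ofReal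

lemma sphAbs_le_add (hf : ContDiff ℝ 1 f) (o : E3) {s R : ℝ} (hR : s ≤ R) :
    sphAbs o f s ≤ sphAbs o f R + ∫⁻ σ in Ioc s R, ∫⁻ ω : S2,
      ofReal ‖fderiv ℝ f (o + σ • ω.1)‖ ∂sphereMeasure := by
  have hD := continuous_norm_fderiv hf
  have hm : Measurable fun z : ℝ × S2 =>
      ofReal ‖fderiv ℝ f (o + z.1 • (z.2 : E3))‖ :=
    (hD.comp (by fun_prop : Continuous fun z : ℝ × S2 =>
      o + z.1 • (z.2 : E3))).measurable.ennreal_ofReal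
  rw [← lintegral_sphere_swap hm, sphAbs, sphAbs, ← lintegral_add_left]
  · refine lintegral_mono fun ω => ?_
    have h := ofReal_abs_ray_sub_le hf o ω hR
    refine le_trans ?_ (add_le_add le_rfl h)
    rw [← ofReal_add (abs_nonneg _) (abs_nonneg _)]
    refine ofReal_le_ofReal ?_
    rw [abs_sub_comm]
    have := abs_add_le (f (o + R • ω.1))
      (f (o + s • ω.1) - f (o + R • ω.1))
    rwa [add_sub_cancel] at this
  · exact (hf.continuous.comp (by fun_prop)).abs.measurable.ennreal_ofReal

lemma lintegral_ball_inv_norm (hf : ContDiff ℝ 1 f) (o : E3) (R : ℝ) :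
    ∫⁻ x in ball o R, ofReal (‖x - o‖⁻¹ * ‖fderiv ℝ f x‖) = ∫⁻ s in Ioo 0 R, ofReal s * ∫⁻ ω : S2,
        ofReal ‖fderiv ℝ f (o + s • ω.1)‖ ∂sphereMeasure := by
  have hD := continuous_norm_fderiv hf
  have hm : Measurable fun x => ofReal (‖x - o‖⁻¹ * ‖fderiv ℝ f x‖) := by
    have := hD.measurable
    fun_prop
  rw [lintegral_ball_polar o hm]
  refine setLIntegral_congr_fun measurableSet_Ioo fun s hs => ?_
  have hs0 : 0 < s := hs.1
  change ofReal (s ^ 2) * _ = ofReal s * _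
  rw [← lintegral_ofReal_mul, ← lintegral_ofReal_mul]
  refine lintegral_congr fun ω => ?_
  rw [add_sub_cancel_left, norm_smul_sphere hs0.le, ← ofReal_mul (by positivity),
    ← ofReal_mul (by positivity)]
  congr 1
  field_simp

lemma mul_sphAbs_le (hf : ContDiff ℝ 1 f) (o : E3) {t R : ℝ} (ht : 0 ≤ t) (hR : t ≤ R) :
    ofReal t * sphAbs o f t ≤ ofReal R * sphAbs o f R +
      ∫⁻ x in ball o R, ofReal (‖x - o‖⁻¹ * ‖fderiv ℝ f x‖) := by
  rw [lintegral_ball_inv_norm hf]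
  refine (mul_le_mul' le_rfl (sphAbs_le_add hf o hR)).trans ?_
  rw [mul_add]
  refine add_le_add (mul_le_mul' (ofReal_le_ofReal hR) le_rfl) ?_
  rw [← lintegral_ofReal_mul,
    setLIntegral_congr (μ := volume) (Ioo_ae_eq_Ioc (a := (0 : ℝ)) (b := R))]
  refine le_trans ?_ (lintegral_mono_set (Set.Ioc_subset_Ioc_left ht))
  exact setLIntegral_mono' measurableSet_Ioc fun s hs =>
    mul_le_mul' (ofReal_le_ofReal hs.1.le) le_rfl

lemma lintegral_sphAbs_le (hf : ContDiff ℝ 1 f) (o : E3) (R : ℝ) :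
    ∫⁻ s in Ioc 0 R, sphAbs o f s ≤ ofReal R * sphAbs o f R +
      ∫⁻ x in ball o R, ofReal (‖x - o‖⁻¹ * ‖fderiv ℝ f x‖) := by
  have hD := continuous_norm_fderiv hf
  have hm : Measurable fun z : ℝ × S2 =>
      ofReal ‖fderiv ℝ f (o + z.1 • (z.2 : E3))‖ :=
    (hD.comp (by fun_prop : Continuous fun z : ℝ × S2 =>
      o + z.1 • (z.2 : E3))).measurable.ennreal_ofReal
  set g : ℝ → ℝ≥0∞ := fun σ => ∫⁻ ω : S2, ofReal ‖fderiv ℝ f (o + σ • ω.1)‖ ∂sphereMeasure with hg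
  have hgm : Measurable g := hm.lintegral_prod_right'
  rw [lintegral_ball_inv_norm hf]
  calc _ ≤ ∫⁻ s in Ioc 0 R, (sphAbs o f R +
        ∫⁻ σ in Ioc 0 R, indicator {z : ℝ × ℝ | z.1 < z.2} (fun z => g z.2) (s, σ)) := by
        refine setLIntegral_mono' measurableSet_Ioc fun s hs => ?_
        refine (sphAbs_le_add hf o hs.2).trans (add_le_add le_rfl ?_)
        rw [← lintegral_indicator measurableSet_Ioc, ← lintegral_indicator measurableSet_Ioc]
        refine lintegral_mono fun σ => ?_
        by_cases hσ : σ ∈ Ioc s R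
        · rw [indicator_of_mem hσ, indicator_of_mem
            (show σ ∈ Ioc 0 R from ⟨hs.1.trans hσ.1, hσ.2⟩),
            indicator_of_mem (show (s, σ) ∈ {z : ℝ × ℝ | z.1 < z.2} from hσ.1)]
        · rw [indicator_of_notMem hσ]
          exact zero_le
    _ = ofReal R * sphAbs o f R + ∫⁻ σ in Ioc 0 R, ∫⁻ s in Ioc 0 R,
          indicator {z : ℝ × ℝ | z.1 < z.2} (fun z => g z.2) (s, σ) := by
        rw [lintegral_add_left measurable_const, setLIntegral_const, Real.volume_Ioc, sub_zero,
          mul_comm, lintegral_lintegral_swap]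
        exact (Measurable.indicator (hgm.comp measurable_snd)
          (measurableSet_lt measurable_fst measurable_snd)).aemeasurable
    _ ≤ _ := by
        rw [setLIntegral_congr (μ := volume) (Ioo_ae_eq_Ioc (a := (0 : ℝ)) (b := R))]
        refine add_le_add le_rfl (setLIntegral_mono' measurableSet_Ioc fun σ hσ => ?_)
        change _ ≤ ofReal σ * g σ
        have : ∫⁻ s in Ioc 0 σ, g σ = ofReal σ * g σ := by
          rw [setLIntegral_const, Real.volume_Ioc, sub_zero, mul_comm]
        rw [← this, ← lintegral_indicator measurableSet_Ioc, ← lintegral_indicator measurableSet_Ioc]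
        refine lintegral_mono fun s => ?_
        by_cases hs : s ∈ Ioc 0 R
        · rw [indicator_of_mem hs]
          by_cases hsσ : s < σ
          · rw [indicator_of_mem (show (s, σ) ∈ {z : ℝ × ℝ | z.1 < z.2} from hsσ),
              indicator_of_mem (show s ∈ Ioc 0 σ from ⟨hs.1, hsσ.le⟩)]
          · rw [indicator_of_notMem (show (s, σ) ∉ {z : ℝ × ℝ | z.1 < z.2} from hsσ)]
            exact zero_le
        · rw [indicator_of_notMem hs]
          exact zero_le

lemma norm_fderiv_le_sum (f : E3 → ℝ) (x : E3) : ‖fderiv ℝ f x‖ ≤ ∑ i, |fderiv ℝ f x (e3 i)| := by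
  refine ContinuousLinearMap.opNorm_le_bound _ (sum_nonneg fun i _ => abs_nonneg _)
    fun v => ?_
  conv_lhs => rw [e3_sum v, map_sum]
  rw [Finset.sum_mul]
  refine (norm_sum_le _ _).trans (sum_le_sum fun i _ => ?_)
  rw [map_smul, smul_eq_mul, norm_mul, norm_eq_abs, norm_eq_abs, mul_comm]
  refine mul_le_mul_of_nonneg_left ?_ (abs_nonneg _)
  rw [← norm_eq_abs]
  exact PiLp.norm_apply_le v i

lemma sphAbs_le_second_order (hf : ContDiff ℝ 2 f) (o : E3) {t R : ℝ} (ht : 0 ≤ t)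
    (hR : t ≤ R) : sphAbs o f t ≤ sphAbs o f R +
      ∑ i, (ofReal R * sphAbs o (fun x => fderiv ℝ f x (e3 i)) R +
        ∫⁻ x in ball o R, ofReal (‖x - o‖⁻¹ * ‖fderiv ℝ (fun x => fderiv ℝ f x (e3 i)) x‖)) := by
  have hf1 : ContDiff ℝ 1 f := hf.of_le (by norm_num)
  have hfi : ∀ i, ContDiff ℝ 1 (fun x => fderiv ℝ f x (e3 i)) := fun i =>
    (hf.fderiv_right (by norm_num)).clm_apply contDiff_const
  refine (sphAbs_le_add hf1 o hR).trans (add_le_add le_rfl ?_)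
  refine le_trans ?_ (sum_le_sum fun i _ => lintegral_sphAbs_le (hfi i) o R)
  refine (lintegral_mono_set (Set.Ioc_subset_Ioc_left ht)).trans ?_
  have hmz (i : Fin 3) : Measurable fun z : ℝ × S2 =>
      ofReal |fderiv ℝ f (o + z.1 • (z.2 : E3)) (e3 i)| :=
    ((hfi i).continuous.abs.comp (by fun_prop : Continuous fun z : ℝ × S2 =>
      o + z.1 • (z.2 : E3))).measurable.ennreal_ofReal
  rw [← lintegral_finsetSum]
  · refine lintegral_mono fun s => ?_
    simp only [sphAbs]
    rw [← lintegral_finsetSum]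
    · refine lintegral_mono fun ω => ?_
      rw [← ENNReal.ofReal_sum_of_nonneg fun i _ => abs_nonneg _]
      exact ofReal_le_ofReal (norm_fderiv_le_sum _ _)
    · intro i _
      exact ((hfi i).continuous.abs.comp (by fun_prop : Continuous fun ω : S2 =>
        o + s • ω.1)).measurable.ennreal_ofReal
  · intro i _
    have := (hmz i).lintegral_prod_right' (ν := sphereMeasure)
    exact this

end DataBounds

section DataDecay

lemma lintegral_weight_mul_le {S : Set E3} (hS : MeasurableSet S) (hS1 : ∀ x ∈ S, 1 < ‖x‖)
    {g w : E3 → ℝ} (hg : Measurable g) (hw : Measurable w) {a A b : ℝ} (hA : 0 ≤ A) (hb : 0 ≤ b)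
    (hgA : ∫⁻ x in {x : E3 | 1 < ‖x‖}, ofReal (‖x‖ ^ a * g x ^ 2) ≤ ofReal (A ^ 2))
    (hwb : ∫⁻ x in S, ofReal (w x ^ 2 * ‖x‖ ^ (-a)) ≤ ofReal (b ^ 2)) :
    ∫⁻ x in S, ofReal (|w x| * |g x|) ≤ ofReal (b * A) := by
  have hm1 : Measurable fun x : E3 => ofReal (|w x| * ‖x‖ ^ (-a / 2)) := by fun_prop
  have hm2 : Measurable fun x : E3 => ofReal (‖x‖ ^ (a / 2) * |g x|) := by fun_prop
  refine le_trans (le_of_eq ?_) (lintegral_mul_le_of_sq_le (μ := volume.restrict S)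
    hm1.aemeasurable hm2.aemeasurable hb hA ?_ ?_)
  · refine setLIntegral_congr_fun hS fun x hx => ?_
    have hx0 : 0 < ‖x‖ := one_pos.trans (hS1 x hx)
    change _ = ofReal (|w x| * ‖x‖ ^ (-a / 2)) * ofReal (‖x‖ ^ (a / 2) * |g x|)
    rw [← ofReal_mul (by positivity)]
    congr 1
    have : ‖x‖ ^ (-a / 2) * ‖x‖ ^ (a / 2) = 1 := by
      rw [← rpow_add hx0, show -a / 2 + a / 2 = 0 by ring, rpow_zero]
    linear_combination (-|w x| * |g x|) * this
  · refine le_trans (le_of_eq ?_) hwb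
    refine setLIntegral_congr_fun hS fun x hx => ?_
    have hx0 : 0 < ‖x‖ := one_pos.trans (hS1 x hx)
    change ofReal (|w x| * ‖x‖ ^ (-a / 2)) ^ 2 = _
    rw [← ofReal_pow (by positivity), mul_pow, sq_abs, ← rpow_mul_natCast hx0.le]
    congr 3
    push_cast
    ring
  · refine le_trans ?_ hgA
    refine le_trans (le_of_eq ?_) (lintegral_mono_set (show S ⊆ {x : E3 | 1 < ‖x‖} from hS1))
    refine setLIntegral_congr_fun hS fun x hx => ?_
    have hx0 : 0 < ‖x‖ := one_pos.trans (hS1 x hx)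
    change ofReal (‖x‖ ^ (a / 2) * |g x|) ^ 2 = _
    rw [← ofReal_pow (by positivity), mul_pow, sq_abs, ← rpow_mul_natCast hx0.le]
    congr 3
    push_cast
    ring

variable {o : E3} {t R γ : ℝ}

/-- The decay rate of linear waves with data of finite weighted energy. -/
def linDecay (γ t : ℝ) (o : E3) : ℝ := ‖o‖⁻¹ * (‖o‖ - t) ^ ((1 - γ) / 2)

lemma linDecay_nonneg (hx : t + 2 ≤ ‖o‖) : 0 ≤ linDecay γ t o :=
  mul_nonneg (inv_nonneg.2 (norm_nonneg _)) (rpow_nonneg (by linarith) _)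

lemma linDecay_sq (hx : t + 2 ≤ ‖o‖) : linDecay γ t o ^ 2 = (‖o‖⁻¹) ^ 2 * (‖o‖ - t) ^ (1 - γ) := by
  rw [linDecay, mul_pow, ← rpow_mul_natCast (by linarith)]
  congr 2
  push_cast
  ring

lemma norm_rpow_le_linDecay_sq (hγ : 1 < γ) (ht : 0 ≤ t) (hx : t + 2 ≤ ‖o‖) :
    ‖o‖ ^ (-1 - γ) ≤ linDecay γ t o ^ 2 := by
  have hr : 0 < ‖o‖ := by linarith
  rw [linDecay_sq hx, show -1 - γ = -2 + (1 - γ) by ring, rpow_add hr, rpow_neg hr.le, inv_pow]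
  norm_cast
  exact mul_le_mul_of_nonneg_left (rpow_le_rpow_of_nonpos (by linarith) (by linarith)
    (by linarith)) (by positivity)

lemma norm_of_mem_data_ball (hR : R ≤ (‖o‖ + t) / 2) {x : E3} (hx : x ∈ ball o R) :
    (‖o‖ - t) / 2 < ‖x‖ := by
  rw [mem_ball, dist_eq_norm] at hx
  have := norm_sub_norm_le o x
  rw [norm_sub_rev] at this
  linarith

lemma ball_weight_pow_le (hγ : 1 < γ) (ht : 0 ≤ t) (hx : t + 2 ≤ ‖o‖) (hR : R ≤ (‖o‖ + t) / 2)
    {a k : ℝ} (ha : -3 < a) (hk : k = -(4 + γ + a) / 2) :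
    ∫⁻ x in ball o R, ofReal ((‖o‖ ^ k) ^ 2 * ‖x‖ ^ a) ≤
      ofReal ((√(sphMass * (2 ^ (a + 3) / (a + 3))) * linDecay γ t o) ^ 2) := by
  have hr : 0 < ‖o‖ := by linarith
  have hsub : ball o R ⊆ ball (0 : E3) (2 * ‖o‖) := fun x hxR => by
    rw [mem_ball, dist_eq_norm] at hxR
    rw [mem_ball_zero_iff]
    have := norm_sub_norm_le x o
    linarith
  have hs := sphMass_nonneg
  refine (lintegral_mono_set hsub).trans ?_
  simp_rw [ofReal_mul (sq_nonneg (‖o‖ ^ k))]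
  rw [lintegral_ofReal_mul, lintegral_norm_rpow_ball ha (by positivity), ← ofReal_mul (sq_nonneg _)]
  refine ofReal_le_ofReal ?_
  rw [mul_pow, sq_sqrt (mul_nonneg hs (div_nonneg (by positivity) (by linarith))),
    mul_rpow zero_le_two hr.le]
  have e : (‖o‖ ^ k) ^ 2 * ‖o‖ ^ (a + 3) = ‖o‖ ^ (-1 - γ) := by
    rw [← rpow_mul_natCast hr.le, ← rpow_add hr]
    congr 1
    rw [hk]
    push_cast
    ring
  have h := mul_le_mul_of_nonneg_left (norm_rpow_le_linDecay_sq hγ ht hx)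
    (mul_nonneg hs (div_nonneg (rpow_nonneg zero_le_two (a + 3)) (by linarith : 0 ≤ a + 3)))
  refine le_trans (le_of_eq ?_) h
  rw [← e]
  ring

lemma ball_weight_out_le (hγ : 1 < γ) (hx : t + 2 ≤ ‖o‖) (hR : R ≤ (‖o‖ + t) / 2) :
    ∫⁻ x in ball o R, ofReal ((‖o‖⁻¹) ^ 2 * ‖x‖ ^ (-(γ + 2))) ≤
      ofReal ((√(sphMass * (2 ^ (γ - 1) / (γ - 1))) * linDecay γ t o) ^ 2) := by
  have hs := sphMass_nonneg
  have hu : 0 < ‖o‖ - t := by linarith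
  refine (lintegral_mono_set (show _ ⊆ {x : E3 | (‖o‖ - t) / 2 < ‖x‖} from
    fun x hxR => norm_of_mem_data_ball hR hxR)).trans ?_
  simp_rw [ofReal_mul (sq_nonneg (‖o‖⁻¹))]
  rw [lintegral_ofReal_mul,
    lintegral_norm_rpow_outside (by linarith) (by positivity), ← ofReal_mul (sq_nonneg _)]
  refine ofReal_le_ofReal (le_of_eq ?_)
  rw [mul_pow, sq_sqrt (mul_nonneg hs (div_nonneg (by positivity) (by linarith))), linDecay_sq hx,
    show -(γ + 2) + 3 = 1 - γ by ring, show - -(γ + 2) - 3 = γ - 1 by ring,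
    div_rpow hu.le zero_le_two, show γ - 1 = -(1 - γ) by ring, rpow_neg zero_le_two]
  have : (2 : ℝ) ^ (1 - γ) ≠ 0 := by positivity
  field_simp

lemma ball_weight_sing_le (hγ : 1 < γ) (ht : 0 ≤ t) (hx : t + 2 ≤ ‖o‖) (hR : R = ‖o‖ / 2) :
    ∫⁻ x in ball o R, ofReal ((‖x - o‖⁻¹) ^ 2 * ‖x‖ ^ (-(γ + 2))) ≤
      ofReal ((√(sphMass * 2 ^ (γ + 2)) * linDecay γ t o) ^ 2) := by
  have hs := sphMass_nonneg
  have hr : 0 < ‖o‖ := by linarith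
  have hR0 : 0 < R := by rw [hR]; positivity
  calc _ ≤ ∫⁻ x in ball o R, ofReal (R ^ (-(γ + 2))) * ofReal (‖x - o‖ ^ (-2 : ℝ)) := by
        refine setLIntegral_mono' measurableSet_ball fun x hxR => ?_
        have h1 : R ≤ ‖x‖ := by
          rw [mem_ball, dist_eq_norm] at hxR
          have := norm_sub_norm_le o x
          rw [norm_sub_rev] at this
          linarith
        rw [← ofReal_mul (by positivity), mul_comm]
        refine ofReal_le_ofReal (mul_le_mul
          (rpow_le_rpow_of_nonpos hR0 h1 (by linarith)) (le_of_eq ?_) (by positivity)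
          (by positivity))
        rw [rpow_neg (norm_nonneg _), inv_pow]
        norm_cast
    _ ≤ _ := by
        rw [lintegral_ofReal_mul,
          lintegral_norm_sub_rpow_ball o (by norm_num) hR0.le, ← ofReal_mul (by positivity)]
        refine ofReal_le_ofReal ?_
        rw [mul_pow, sq_sqrt (by positivity)]
        have h := norm_rpow_le_linDecay_sq hγ ht hx
        refine le_trans ?_ (mul_le_mul_of_nonneg_left h (by positivity))
        have e1 : R ^ (-(γ + 2)) * R = ‖o‖ ^ (-1 - γ) * 2 ^ (1 + γ) := by
          nth_rewrite 2 [← rpow_one R]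
          rw [← rpow_add hR0, hR, div_rpow hr.le zero_le_two,
            show -(γ + 2) + 1 = -1 - γ by ring, div_eq_mul_inv, ← rpow_neg zero_le_two]
          congr 2
          ring
        have e2 : (2 : ℝ) ^ (1 + γ) ≤ 2 ^ (γ + 2) :=
          rpow_le_rpow_of_exponent_le one_le_two (by linarith)
        norm_num
        calc _ = sphMass * (R ^ (-(γ + 2)) * R) := by ring_nf
          _ = sphMass * 2 ^ (1 + γ) * ‖o‖ ^ (-1 - γ) := by rw [e1]; ring
          _ ≤ _ := by gcongr

variable {f : E3 → ℝ}

lemma sphAbs_le_weighted (hf : ContDiff ℝ 1 f) (hr : 0 < ‖o‖) (hR : ‖o‖ / 2 ≤ R) : sphAbs o f R ≤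
      (ofReal 24 * ∫⁻ x in ball o R, ofReal (|‖o‖ ^ (-3 : ℝ)| * |f x|)) +
      ofReal 4 * ∫⁻ x in ball o R, ofReal (|‖o‖ ^ (-2 : ℝ)| * |‖fderiv ℝ f x‖|) := by
  have hR0 : 0 < R := by linarith
  have h := sphAbs_le_ball hf o hR0.le
  have h1 : sphAbs o f R = ofReal (R⁻¹ ^ 3) * (ofReal (R ^ 3) * sphAbs o f R) := by
    rw [← mul_assoc, ← ofReal_mul (by positivity), ← mul_pow, inv_mul_cancel₀ hR0.ne']
    simp
  have hD := continuous_norm_fderiv hf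
  have hc := hf.continuous
  rw [h1]
  refine (mul_le_mul' le_rfl h).trans ?_
  rw [← lintegral_ofReal_mul, ← lintegral_ofReal_mul,
    ← lintegral_ofReal_mul, ← lintegral_add_left (by fun_prop)]
  refine lintegral_mono fun x => ?_
  rw [← ofReal_mul (by positivity), ← ofReal_mul (by positivity),
    ← ofReal_mul (by positivity), ← ofReal_add (by positivity) (by positivity)]
  refine ofReal_le_ofReal ?_
  have hinv : R⁻¹ ≤ 2 * ‖o‖⁻¹ := by
    rw [show 2 * ‖o‖⁻¹ = (‖o‖ / 2)⁻¹ by field_simp]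
    exact inv_anti₀ (by positivity) hR
  have e3 : |‖o‖ ^ (-3 : ℝ)| = ‖o‖⁻¹ ^ 3 := by
    rw [abs_of_nonneg (by positivity), rpow_neg hr.le, inv_pow]
    norm_cast
  have e2 : |‖o‖ ^ (-2 : ℝ)| = ‖o‖⁻¹ ^ 2 := by
    rw [abs_of_nonneg (by positivity), rpow_neg hr.le, inv_pow]
    norm_cast
  rw [e3, e2, abs_norm]
  have p3 := pow_le_pow_left₀ (by positivity) hinv 3
  have p2 := pow_le_pow_left₀ (by positivity) hinv 2
  have q3 := mul_le_mul_of_nonneg_right p3 (show 0 ≤ 3 * |f x| by positivity)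
  have q2 := mul_le_mul_of_nonneg_right p2 (norm_nonneg (fderiv ℝ f x))
  have e : R⁻¹ ^ 3 * (3 * |f x| + R * ‖fderiv ℝ f x‖) =
      R⁻¹ ^ 3 * (3 * |f x|) + R⁻¹ ^ 2 * ‖fderiv ℝ f x‖ := by
    field_simp
  rw [e]
  linarith

lemma mul_sphAbs_le_weighted (hf : ContDiff ℝ 1 f) (hr : 0 < ‖o‖) (hR : ‖o‖ / 2 ≤ R)
    (hR2 : R ≤ ‖o‖) : ofReal R * sphAbs o f R ≤
      (ofReal 24 * ∫⁻ x in ball o R, ofReal (|‖o‖ ^ (-2 : ℝ)| * |f x|)) +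
      ofReal 4 * ∫⁻ x in ball o R, ofReal (|‖o‖⁻¹| * |‖fderiv ℝ f x‖|) := by
  refine (mul_le_mul' (ofReal_le_ofReal hR2) (sphAbs_le_weighted hf hr hR)).trans
    (le_of_eq ?_)
  have e3 : ‖o‖ * ‖o‖ ^ (-3 : ℝ) = ‖o‖ ^ (-2 : ℝ) := by
    nth_rewrite 1 [← rpow_one ‖o‖]
    rw [← rpow_add hr]
    norm_num
  have e2 : ‖o‖ * ‖o‖ ^ (-2 : ℝ) = ‖o‖⁻¹ := by
    nth_rewrite 1 [← rpow_one ‖o‖]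
    rw [← rpow_add hr, ← rpow_neg_one]
    norm_num
  rw [mul_add, mul_left_comm, mul_left_comm (ofReal ‖o‖),
    ← lintegral_const_mul' (ofReal ‖o‖) _ ofReal_ne_top,
    ← lintegral_const_mul' (ofReal ‖o‖) _ ofReal_ne_top]
  congr 2 <;> refine lintegral_congr fun x => ?_ <;> rw [← ofReal_mul (norm_nonneg _)] <;>
    congr 1
  · rw [← e3, abs_mul, abs_norm]
    ring
  · rw [← e2]
    simp only [abs_mul, abs_norm]
    ring

/-- Decay of the spherical means of a function with finite weighted `H¹` norm. -/
lemma exists_mul_sphAbs_le (hγ : 1 < γ) (hγ2 : γ < 2) :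
    ∃ C : ℝ, 0 ≤ C ∧ ∀ (h : E3 → ℝ), ContDiff ℝ 1 h → ∀ A : ℝ, 0 ≤ A →
      ∫⁻ x in {x : E3 | 1 < ‖x‖}, ofReal (‖x‖ ^ γ * h x ^ 2) ≤ ofReal (A ^ 2) →
      ∫⁻ x in {x : E3 | 1 < ‖x‖}, ofReal (‖x‖ ^ (γ + 2) * ‖fderiv ℝ h x‖ ^ 2) ≤ ofReal (A ^ 2) →
      ∀ (o : E3) (t R : ℝ), 0 ≤ t → t + 2 ≤ ‖o‖ → (‖o‖ / 2 ≤ R → R ≤ (‖o‖ + t) / 2 →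
          ofReal R * sphAbs o h R ≤ ofReal (C * (A * linDecay γ t o))) ∧
        (R = ‖o‖ / 2 → ∫⁻ x in ball o R, ofReal (‖x - o‖⁻¹ * ‖fderiv ℝ h x‖) ≤
          ofReal (C * (A * linDecay γ t o))) := by
  have hs := sphMass_nonneg
  refine ⟨24 * √(sphMass * (2 ^ (-γ + 3) / (-γ + 3))) + 4 * √(sphMass * (2 ^ (γ - 1) / (γ - 1))) +
    √(sphMass * 2 ^ (γ + 2)), by positivity, ?_⟩
  intro h hh A hA h0 h1 o t R ht hx
  have hr : 0 < ‖o‖ := by linarith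
  have hY := linDecay_nonneg (γ := γ) hx
  have hD : Measurable (fun x => ‖fderiv ℝ h x‖) := (hh.continuous_fderiv one_ne_zero).norm.measurable
  have hS1 : R ≤ (‖o‖ + t) / 2 → ∀ x ∈ ball o R, 1 < ‖x‖ := fun hR x hxR => by
    have := norm_of_mem_data_ball hR hxR
    linarith
  have key : ∀ a b c : ℝ, 0 ≤ a → 0 ≤ b → 0 ≤ c → a * linDecay γ t o * A ≤
      (b + a + c) * (A * linDecay γ t o) := fun a b c ha hb hc => by
    have := mul_nonneg (add_nonneg hb hc) (mul_nonneg hA hY)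
    linarith
  constructor
  · intro hR1 hR2
    refine (mul_sphAbs_le_weighted hh hr hR1 (by linarith)).trans ?_
    have b1 := lintegral_weight_mul_le measurableSet_ball (hS1 hR2) hh.continuous.measurable
      (measurable_const (a := ‖o‖ ^ (-2 : ℝ))) hA (by positivity) h0
      (ball_weight_pow_le hγ ht hx hR2 (a := -γ) (by linarith) (by ring))
    have b2 := lintegral_weight_mul_le measurableSet_ball (hS1 hR2) hD
      (measurable_const (a := ‖o‖⁻¹)) hA (by positivity) h1 (ball_weight_out_le hγ hx hR2)
    refine (add_le_add (mul_le_mul' le_rfl b1) (mul_le_mul' le_rfl b2)).trans ?_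
    rw [← ofReal_mul (by positivity), ← ofReal_mul (by positivity),
      ← ofReal_add (by positivity) (by positivity)]
    refine ofReal_le_ofReal ?_
    have := mul_nonneg (sqrt_nonneg (sphMass * 2 ^ (γ + 2))) (mul_nonneg hA hY)
    linarith
  · intro hR
    have b3 := lintegral_weight_mul_le measurableSet_ball (hS1 (by linarith)) hD
      (w := fun x => ‖x - o‖⁻¹) (by fun_prop) hA (by positivity) h1
      (ball_weight_sing_le hγ ht hx hR)
    simp only [abs_inv, abs_norm] at b3
    refine b3.trans (ofReal_le_ofReal ?_)
    have := key (√(sphMass * 2 ^ (γ + 2))) (24 * √(sphMass * (2 ^ (-γ + 3) / (-γ + 3))) +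
      4 * √(sphMass * (2 ^ (γ - 1) / (γ - 1)))) 0 (by positivity) (by positivity) le_rfl
    linarith


lemma exists_time_mul_sphAbs_le (hγ : 1 < γ) (hγ2 : γ < 2) :
    ∃ C : ℝ, 0 ≤ C ∧ ∀ (h : E3 → ℝ), ContDiff ℝ 1 h → ∀ A : ℝ, 0 ≤ A →
      ∫⁻ x in {x : E3 | 1 < ‖x‖}, ofReal (‖x‖ ^ γ * h x ^ 2) ≤ ofReal (A ^ 2) →
      ∫⁻ x in {x : E3 | 1 < ‖x‖}, ofReal (‖x‖ ^ (γ + 2) * ‖fderiv ℝ h x‖ ^ 2) ≤ ofReal (A ^ 2) →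
      ∀ (o : E3) (t : ℝ), 0 ≤ t → t + 2 ≤ ‖o‖ →
        ofReal t * sphAbs o h t ≤ ofReal (C * (A * linDecay γ t o)) := by
  obtain ⟨C, hC, H⟩ := exists_mul_sphAbs_le hγ hγ2
  refine ⟨2 * C, by positivity, fun h hh A hA h0 h1 o t ht hx => ?_⟩
  have hY := linDecay_nonneg (γ := γ) hx
  have H := H h hh A hA h0 h1 o
  rcases le_total (‖o‖ / 2) t with hc | hc
  · refine ((H t t ht hx).1 hc (by linarith)).trans (ofReal_le_ofReal ?_)
    have := mul_nonneg hC (mul_nonneg hA hY)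
    linarith
  · have H1 := H t (‖o‖ / 2) ht hx
    refine (mul_sphAbs_le hh o ht hc).trans
      ((add_le_add (H1.1 le_rfl (by linarith)) (H1.2 rfl)).trans ?_)
    rw [← ofReal_add (by positivity) (by positivity)]
    exact ofReal_le_ofReal (by linarith)

/-- Decay of the spherical means of a function with finite weighted `H²` norm. -/
lemma exists_sphAbs_le (hγ : 1 < γ) (hγ2 : γ < 2) :
    ∃ C : ℝ, 0 ≤ C ∧ ∀ (f : E3 → ℝ), ContDiff ℝ 2 f → ∀ A : ℝ, 0 ≤ A →
      ∫⁻ x in {x : E3 | 1 < ‖x‖}, ofReal (‖x‖ ^ (γ - 2) * f x ^ 2) ≤ ofReal (A ^ 2) →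
      ∫⁻ x in {x : E3 | 1 < ‖x‖}, ofReal (‖x‖ ^ γ * ‖fderiv ℝ f x‖ ^ 2) ≤ ofReal (A ^ 2) →
      (∀ i, ∫⁻ x in {x : E3 | 1 < ‖x‖}, ofReal (‖x‖ ^ (γ + 2) *
        ‖fderiv ℝ (fun y => fderiv ℝ f y (e3 i)) x‖ ^ 2) ≤ ofReal (A ^ 2)) →
      ∀ (o : E3) (t : ℝ), 0 ≤ t → t + 2 ≤ ‖o‖ →
        sphAbs o f t ≤ ofReal (C * (A * linDecay γ t o)) := by
  obtain ⟨C, hC, H⟩ := exists_mul_sphAbs_le hγ hγ2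
  have hs := sphMass_nonneg
  refine ⟨24 * √(sphMass * (2 ^ (2 - γ + 3) / (2 - γ + 3))) +
    4 * √(sphMass * (2 ^ (-γ + 3) / (-γ + 3))) + 6 * C, ?_, fun f hf A hA h0 h1 h2 o t ht hx => ?_⟩
  · positivity
  have hr : 0 < ‖o‖ := by linarith
  have hY := linDecay_nonneg (γ := γ) hx
  have hf1 : ContDiff ℝ 1 f := hf.of_le (by norm_num)
  have hD : Measurable (fun x => ‖fderiv ℝ f x‖) := (hf1.continuous_fderiv one_ne_zero).norm.measurable
  have main : ∀ R, ‖o‖ / 2 ≤ R → R ≤ (‖o‖ + t) / 2 → sphAbs o f R ≤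
      ofReal ((24 * √(sphMass * (2 ^ (2 - γ + 3) / (2 - γ + 3))) +
    4 * √(sphMass * (2 ^ (-γ + 3) / (-γ + 3)))) * (A * linDecay γ t o)) := fun R hR1 hR2 => by
    have hS1 : ∀ x ∈ ball o R, 1 < ‖x‖ := fun x hxR => by
      have := norm_of_mem_data_ball hR2 hxR
      linarith
    refine (sphAbs_le_weighted hf1 hr hR1).trans ?_
    have bw := ball_weight_pow_le hγ ht hx hR2 (a := -(γ - 2)) (k := -3) (by linarith) (by ring)
    rw [show -(γ - 2) + 3 = 2 - γ + 3 by ring] at bw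
    have b1 := lintegral_weight_mul_le measurableSet_ball hS1 hf1.continuous.measurable
      (measurable_const (a := ‖o‖ ^ (-3 : ℝ))) hA (by positivity) h0 bw
    have b2 := lintegral_weight_mul_le measurableSet_ball hS1 hD
      (measurable_const (a := ‖o‖ ^ (-2 : ℝ))) hA (by positivity) h1
      (ball_weight_pow_le hγ ht hx hR2 (a := -γ) (by linarith) (by ring))
    refine (add_le_add (mul_le_mul' le_rfl b1) (mul_le_mul' le_rfl b2)).trans ?_
    rw [← ofReal_mul (by positivity), ← ofReal_mul (by positivity),
      ← ofReal_add (by positivity) (by positivity)]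
    exact ofReal_le_ofReal (by linarith)
  rcases le_total (‖o‖ / 2) t with hc | hc
  · refine (main t hc (by linarith)).trans (ofReal_le_ofReal ?_)
    have := mul_nonneg hC (mul_nonneg hA hY)
    linarith
  · have hfi : ∀ i, ContDiff ℝ 1 (fun x => fderiv ℝ f x (e3 i)) := fun i =>
      (hf.fderiv_right (by norm_num)).clm_apply contDiff_const
    have h1i : ∀ i, ∫⁻ x in {x : E3 | 1 < ‖x‖}, ofReal (‖x‖ ^ γ *
        fderiv ℝ f x (e3 i) ^ 2) ≤ ofReal (A ^ 2) := fun i => by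
      refine le_trans (lintegral_mono fun x => ofReal_le_ofReal ?_) h1
      refine mul_le_mul_of_nonneg_left ?_ (by positivity)
      have := (fderiv ℝ f x).le_opNorm (e3 i)
      rw [norm_e3, mul_one, norm_eq_abs] at this
      rw [← sq_abs]
      exact pow_le_pow_left₀ (abs_nonneg _) this 2
    refine (sphAbs_le_second_order hf o ht hc).trans ((add_le_add (main (‖o‖ / 2) le_rfl
      (by linarith)) (sum_le_sum fun i _ => add_le_add
        ((H _ (hfi i) A hA (h1i i) (h2 i) o t _ ht hx).1 le_rfl (by linarith))
        ((H _ (hfi i) A hA (h1i i) (h2 i) o t _ ht hx).2 rfl))).trans ?_)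
    have hn : 0 ≤ C * (A * linDecay γ t o) := by positivity
    rw [← ofReal_add hn hn, Finset.sum_const, Finset.card_univ, Fintype.card_fin,
      ← ENNReal.ofReal_nsmul, ← ofReal_add (by positivity) (by positivity)]
    refine ofReal_le_ofReal (le_of_eq ?_)
    rw [nsmul_eq_mul]
    push_cast
    ring

end DataDecay

section Kirchhoff

variable {φ : Wave}

/-- The integrand of Kirchhoff's formula on the backward light cone of `(T, o)`. -/
def coneMean (φ : Wave) (T : ℝ) (o : E3) (s : ℝ) (ω : S2) : ℝ :=
  s * dt1 φ (T - s) (o + s • ω.1) + φ (T - s) (o + s • ω.1) +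
    s * ∑ i, ω.1 i * dx i φ (T - s) (o + s • ω.1)

lemma Smooth.continuous_cone {ψ : Wave} (h : Smooth ψ) (T : ℝ) (o : E3) :
    Continuous fun q : ℝ × S2 => ψ (T - q.1) (o + q.1 • (q.2 : E3)) :=
  h.continuous.comp (by fun_prop : Continuous fun q : ℝ × S2 =>
    (T - q.1, o + q.1 • (q.2 : E3)))

lemma Smooth.hasDerivAt_cone {ψ : Wave} (h : Smooth ψ) (T : ℝ) (o : E3) (ω : S2) (s : ℝ) :
    HasDerivAt (fun s => ψ (T - s) (o + s • ω.1))
      (-_root_.dt1 ψ (T - s) (o + s • ω.1) +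
        ∑ i, ω.1 i * _root_.dx i ψ (T - s) (o + s • ω.1)) s := by
  have h1 : HasDerivAt (fun s : ℝ => T - s) (-1) s := by simpa using (hasDerivAt_id s).const_sub T
  have h2 : HasDerivAt (fun s : ℝ => o + s • ω.1) ω.1 s := by
    simpa using ((hasDerivAt_id s).smul_const ω.1).const_add o
  refine (h.hasDerivAt_comp h1 h2).congr_deriv ?_
  ring

lemma hasDerivAt_coneMean (h : Smooth φ) (T : ℝ) (o : E3) (ω : S2) (s : ℝ) :
    HasDerivAt (fun s => coneMean φ T o s ω)
      (-(s * dtt φ (T - s) (o + s • ω.1)) + (2 * ∑ i, ω.1 i * dx i φ (T - s) (o + s • ω.1) +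
          s * ∑ i, ω.1 i * ∑ j, ω.1 j * dx j (dx i φ) (T - s) (o + s • ω.1))) s := by
  have h1 := (hasDerivAt_id s).fun_mul (h.dt1.hasDerivAt_cone T o ω s)
  have h2 := h.hasDerivAt_cone T o ω s
  have h3 := (hasDerivAt_id s).fun_mul (HasDerivAt.fun_sum (u := Finset.univ) fun i _ =>
    ((h.dx i).hasDerivAt_cone T o ω s).const_mul (ω.1 i))
  refine ((h1.fun_add h2).fun_add h3).congr_deriv ?_
  simp only [h.dt1_dx, id_eq, one_mul, dtt_eq, mul_add, sum_add_distrib, mul_neg,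
    Finset.sum_neg_distrib]
  ring

lemma hasDerivAt_integral_coneMean (h : Smooth φ) (T : ℝ) (o : E3) (s : ℝ) :
    HasDerivAt (fun s => ∫ ω, coneMean φ T o s ω ∂sphereMeasure)
      (s * ∫ ω : S2, (lap3 (φ (T - s)) (o + s • ω.1) -
        dtt φ (T - s) (o + s • ω.1)) ∂sphereMeasure) s := by
  have hω : ∀ i : Fin 3, Continuous fun q : ℝ × S2 => (q.2 : E3) i := fun i => by fun_prop
  have c0 := h.continuous_cone T o
  have c1 := h.dt1.continuous_cone T o
  have c2 := fun i => (h.dx i).continuous_cone T o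
  have c3 := h.dt1.dt1.continuous_cone T o
  have c4 := fun i j => ((h.dx i).dx j).continuous_cone T o
  have hc : Continuous fun q : ℝ × S2 => coneMean φ T o q.1 q.2 :=
    ((continuous_fst.mul c1).add c0).add (continuous_fst.mul
      (continuous_finsetSum _ fun i _ => (hω i).mul (c2 i)))
  have hg : Continuous fun q : ℝ × S2 => (2 * ∑ i, (q.2 : E3) i *
      dx i φ (T - q.1) (o + q.1 • (q.2 : E3)) + q.1 * ∑ i, (q.2 : E3) i * ∑ j, (q.2 : E3) j *
            dx j (dx i φ) (T - q.1) (o + q.1 • (q.2 : E3))) :=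
    (continuous_const.mul (continuous_finsetSum _ fun i _ => (hω i).mul (c2 i))).add
      (continuous_fst.mul (continuous_finsetSum _ fun i _ => (hω i).mul
        (continuous_finsetSum _ fun j _ => (hω j).mul (c4 i j))))
  have hn : Continuous fun q : ℝ × S2 => -(q.1 * dtt φ (T - q.1) (o + q.1 • (q.2 : E3))) :=
    (continuous_fst.mul c3).neg
  have key := hasDerivAt_sphere isOpen_univ hc.continuousOn (hn.add hg).continuousOn
    (fun s _ ω => hasDerivAt_coneMean h T o ω s) (Set.mem_univ s)
  refine key.congr_deriv ?_
  have hsl : Continuous fun ω : S2 => (s, ω) := by fun_prop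
  have hd := integral_sphere_div (Y := fun i => dx i φ (T - s)) isOpen_univ
    (fun i => (((h.dx i).slice (T - s)).of_le (by simp)).contDiffOn) o (s := s)
    (fun ω => Set.mem_univ _)
  have hI1 := integrable_sphere (hn.comp hsl)
  have hI2 := integrable_sphere (hg.comp hsl)
  have hL : Continuous fun ω : S2 => lap3 (φ (T - s)) (o + s • ω.1) := by
    simp only [lap3_eq]
    exact continuous_finsetSum _ fun i _ => (c4 i i).comp hsl
  have hT : Continuous fun ω : S2 => dtt φ (T - s) (o + s • ω.1) := c3.comp hsl
  have hlin : ∀ (i : Fin 3) (x v : E3), fderiv ℝ (dx i φ (T - s)) x v =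
      ∑ j, v j * dx j (dx i φ) (T - s) x := fun i x v => by
    rw [((h.dx i).hasFDerivAt_x (T - s) x).fderiv]
    simp [mul_comm]
  refine (integral_add hI1 hI2).trans ?_
  rw [integral_sub (integrable_sphere hL) (integrable_sphere hT), mul_sub]
  have e1 : ∫ ω, ((fun q : ℝ × S2 => -(q.1 * dtt φ (T - q.1) (o + q.1 • (q.2 : E3)))) ∘
      fun ω : S2 => (s, ω)) ω ∂sphereMeasure =
      -(s * ∫ ω : S2, dtt φ (T - s) (o + s • ω.1) ∂sphereMeasure) := by
    rw [← integral_const_mul, ← integral_neg]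
    rfl
  rw [e1]
  simp only [hlin] at hd
  have e2 := hd.symm
  simp only [lap3_eq]
  have e3' : ∀ ω : S2, ∑ i, ∑ j, e3 i j * dx j (dx i φ) (T - s) (o + s • ω.1) =
      ∑ i, dx i (dx i φ) (T - s) (o + s • ω.1) := fun ω => by
    simp [e3_apply]
  simp only [e3'] at e2
  rw [← e2]
  exact neg_add_eq_sub _ _

/-- Kirchhoff's formula. -/
lemma kirchhoff (h : Smooth φ) (T : ℝ) (o : E3) :
    sphMass * φ T o = ∫ ω, coneMean φ T o T ω ∂sphereMeasure -
      ∫ s in (0)..T, s * ∫ ω : S2, (lap3 (φ (T - s)) (o + s • ω.1) -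
        dtt φ (T - s) (o + s • ω.1)) ∂sphereMeasure := by
  have hc : Continuous fun s : ℝ => s * ∫ ω : S2, (lap3 (φ (T - s)) (o + s • ω.1) -
        dtt φ (T - s) (o + s • ω.1)) ∂sphereMeasure := by
    refine continuous_id.mul (continuousOn_univ.1 (continuousOn_sphere isOpen_univ ?_))
    simp only [lap3_eq]
    exact ((continuous_finsetSum _ fun i _ => ((h.dx i).dx i).continuous_cone T o).sub
      (h.dt1.dt1.continuous_cone T o)).continuousOn
  rw [intervalIntegral.integral_eq_sub_of_hasDerivAt
    (fun s _ => hasDerivAt_integral_coneMean h T o s) (hc.intervalIntegrable _ _), sub_sub_cancel]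
  simp [coneMean, sphMass, Measure.real]

lemma ofReal_abs_integral_coneMean_le (h : Smooth φ) {T : ℝ} (ht : 0 ≤ T) (o : E3) :
    ofReal |∫ ω, coneMean φ T o T ω ∂sphereMeasure| ≤
      ofReal T * sphAbs o (dt1 φ 0) T + sphAbs o (φ 0) T +
        ∑ i, ofReal T * sphAbs o (dx i φ 0) T := by
  have hsl : Continuous fun ω : S2 => (T, ω) := by fun_prop
  have c0 : Continuous fun ω : S2 => φ (T - T) (o + T • ω.1) :=
    (h.continuous_cone T o).comp hsl
  have c1 : Continuous fun ω : S2 => dt1 φ (T - T) (o + T • ω.1) :=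
    (h.dt1.continuous_cone T o).comp hsl
  have c2 : ∀ i, Continuous fun ω : S2 => dx i φ (T - T) (o + T • ω.1) := fun i =>
    ((h.dx i).continuous_cone T o).comp hsl
  rw [← norm_eq_abs, ofReal_norm]
  refine (enorm_integral_le_lintegral_enorm _).trans ?_
  simp only [sphAbs]
  simp only [sub_self] at c0 c1 c2
  simp only [← lintegral_ofReal_mul]
  have hm : Measurable fun ω : S2 => ofReal T * ofReal |dt1 φ 0 (o + T • ω.1)| +
      ofReal |φ 0 (o + T • ω.1)| :=
    (c1.abs.measurable.ennreal_ofReal.const_mul _).add c0.abs.measurable.ennreal_ofReal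
  rw [← lintegral_finsetSum _ (fun i _ => by have := (c2 i).measurable; fun_prop),
    ← lintegral_add_left (by have := c1.measurable; fun_prop), ← lintegral_add_left hm]
  refine lintegral_mono fun ω => ?_
  simp only [← ofReal_mul ht]
  rw [← ofReal_norm, ← ENNReal.ofReal_sum_of_nonneg fun i _ => by positivity,
    ← ofReal_add (by positivity) (by positivity), ← ofReal_add (by positivity) (by positivity)]
  refine ofReal_le_ofReal ?_
  rw [norm_eq_abs, coneMean, sub_self]
  refine (abs_add_le _ _).trans (add_le_add ((abs_add_le _ _).trans (add_le_add ?_ le_rfl)) ?_)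
  · rw [abs_mul, abs_of_nonneg ht]
  · rw [abs_mul, abs_of_nonneg ht, ← mul_sum]
    refine mul_le_mul_of_nonneg_left ((Finset.abs_sum_le_sum_abs _ _).trans
      (sum_le_sum fun i _ => ?_)) ht
    rw [abs_mul]
    refine mul_le_of_le_one_left (abs_nonneg _) ?_
    have := PiLp.norm_apply_le ω.1 i
    rwa [norm_eq_of_mem_sphere ω, norm_eq_abs] at this

/-- Kirchhoff's formula estimates a solution of the nonlinear wave equation by its data and the
integral of the nonlinearity over the backward light cone. -/
lemma ofReal_abs_le_kirchhoff {p : ℝ} (hp : 1 < p) (h : IsNLWSolution p φ) {T : ℝ} (ht : 0 ≤ T)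
    (o : E3) : ofReal (sphMass * |φ T o|) ≤ ofReal T * sphAbs o (dt1 φ 0) T + sphAbs o (φ 0) T +
        (∑ i, ofReal T * sphAbs o (dx i φ 0) T) + ∫⁻ x in ball o T,
        ofReal (‖x - o‖⁻¹ * |φ (T - ‖x - o‖) x| ^ p) := by
  have hφ : Smooth φ := h.1
  have hc : Continuous fun x : E3 => φ (T - ‖x - o‖) x :=
    hφ.continuous.comp (by fun_prop : Continuous fun x : E3 => (T - ‖x - o‖, x))
  have e : sphMass * |φ T o| = |sphMass * φ T o| := by
    rw [abs_mul, abs_of_nonneg sphMass_nonneg]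
  rw [e, kirchhoff hφ]
  refine (ofReal_le_ofReal (abs_sub _ _)).trans ?_
  rw [ofReal_add (abs_nonneg _) (abs_nonneg _)]
  refine add_le_add (ofReal_abs_integral_coneMean_le hφ ht o) ?_
  have hm : Measurable fun x : E3 =>
      ofReal (‖x - o‖⁻¹ * |φ (T - ‖x - o‖) x| ^ p) := by
    have h1 : Measurable fun x : E3 => ‖x - o‖⁻¹ := by fun_prop
    exact (h1.mul (hc.abs.measurable.pow_const p)).ennreal_ofReal
  rw [lintegral_ball_polar o hm, intervalIntegral.integral_of_le ht, ← norm_eq_abs,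
    ofReal_norm, setLIntegral_congr (μ := volume) (Ioo_ae_eq_Ioc (a := (0 : ℝ)) (b := T))]
  refine (enorm_integral_le_lintegral_enorm _).trans
    (setLIntegral_mono' measurableSet_Ioc fun s hs => ?_)
  have hs0 : 0 < s := hs.1
  rw [enorm_mul, ← ofReal_norm s, Real.norm_of_nonneg hs0.le]
  refine (mul_le_mul' le_rfl (enorm_integral_le_lintegral_enorm _)).trans ?_
  rw [← lintegral_ofReal_mul, ← lintegral_ofReal_mul]
  refine lintegral_mono fun ω => ?_
  rw [← ofReal_norm, ← ofReal_mul hs0.le, ← ofReal_mul (by positivity),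
    add_sub_cancel_left, norm_smul_sphere hs0.le]
  refine ofReal_le_ofReal (le_of_eq ?_)
  have heq := h.2 (T - s) (by linarith [hs.2]) (o + s • ω.1)
  have e1 : lap3 (φ (T - s)) (o + s • ω.1) - dtt φ (T - s) (o + s • ω.1) =
      |φ (T - s) (o + s • ω.1)| ^ (p - 1) * φ (T - s) (o + s • ω.1) := by
    linarith
  rw [e1, norm_mul, Real.norm_of_nonneg (by positivity), norm_eq_abs]
  have e2 : ∀ y : ℝ, |y| ^ (p - 1) * |y| = |y| ^ p := fun y => by
    rcases eq_or_ne y 0 with rfl | hy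
    · rw [abs_zero, mul_zero, zero_rpow (by linarith)]
    · rw [← rpow_add_one (abs_ne_zero.2 hy), sub_add_cancel]
  rw [e2]
  field_simp

end Kirchhoff

/-- The inner product of `x` and `e` in coordinates. -/
def dot3 (x e : E3) : ℝ := ∑ i, x i * e i

lemma continuous_dot3 (e : E3) : Continuous fun x : E3 => dot3 x e := by
  unfold dot3; fun_prop

lemma dot3_abs_le (x e : E3) : |dot3 x e| ≤ ‖x‖ * ‖e‖ := by
  have h := abs_real_inner_le_norm x e
  rwa [inner_E3] at h

lemma hasFDerivAt_dot3_comp {F : ℝ → ℝ} {F' c : ℝ} {e x : E3} (hF : HasDerivAt F F' (dot3 x e)) :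
    HasFDerivAt (fun y => c * F (dot3 y e))
      ((c * F') • (innerSL ℝ e : E3 →L[ℝ] ℝ)) x := by
  have h1 : HasFDerivAt (fun y : E3 => dot3 y e) (innerSL ℝ e : E3 →L[ℝ] ℝ) x := by
    refine (innerSL ℝ e : E3 →L[ℝ] ℝ).hasFDerivAt.congr_of_eventuallyEq
      (Eventually.of_forall fun y => ?_)
    simp [dot3, inner_E3, mul_comm]
  have h2 := (hF.comp_hasFDerivAt x h1).const_mul c
  refine h2.congr_fderiv ?_
  rw [smul_smul]

lemma integral_zonal_identity {F F' : ℝ → ℝ} {I : Set ℝ} (hI : IsOpen I)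
    (hF : ∀ w ∈ I, HasDerivAt F (F' w) w) (hF' : ContinuousOn F' I) {e : E3} (he : ‖e‖ = 1)
    (hs : ∀ w ∈ Icc (-1 : ℝ) 1, w ∈ I) :
    ∫ ω : S2, ((1 - dot3 ω e ^ 2) * F' (dot3 ω e) - 2 * dot3 ω e * F (dot3 ω e))
      ∂sphereMeasure = 0 := by
  have hmem : ∀ ω : S2, dot3 ω e ∈ I := fun ω => hs _ (abs_le.1 (by
    have := dot3_abs_le ω e
    simpa [he] using this))
  have hd : ∀ (i : Fin 3) (x : E3), dot3 x e ∈ I → HasFDerivAt (fun y => e i * F (dot3 y e))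
      ((e i * F' (dot3 x e)) • (innerSL ℝ e : E3 →L[ℝ] ℝ)) x := fun i x hx =>
    hasFDerivAt_dot3_comp (hF _ hx)
  have hV : IsOpen {x : E3 | dot3 x e ∈ I} := hI.preimage (continuous_dot3 e)
  have hY : ∀ i : Fin 3, ContDiffOn ℝ 1 (fun y => e i * F (dot3 y e)) {x : E3 | dot3 x e ∈ I} := by
    intro i
    rw [show (1 : WithTop ℕ∞) = 0 + 1 from (zero_add 1).symm,
      contDiffOn_succ_iff_hasFDerivWithinAt (by simp)]
    intro x hx
    refine ⟨{x : E3 | dot3 x e ∈ I}, ?_, by simp, fun x =>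
      (e i * F' (dot3 x e)) • (innerSL ℝ e : E3 →L[ℝ] ℝ), fun y hy => (hd i y hy).hasFDerivWithinAt, ?_⟩
    · rw [Set.insert_eq_of_mem hx]; exact self_mem_nhdsWithin
    · rw [contDiffOn_zero]
      have : ContinuousOn (fun x : E3 => F' (dot3 x e)) {x : E3 | dot3 x e ∈ I} :=
        hF'.comp (continuous_dot3 e).continuousOn fun x hx => hx
      exact (continuousOn_const.mul this).smul continuousOn_const
  have hcF : Continuous fun ω : S2 => F (dot3 ω e) := by
    have h1 : ContinuousOn F I := fun w hw => (hF w hw).continuousAt.continuousWithinAt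
    exact h1.comp_continuous ((continuous_dot3 e).comp continuous_subtype_val) hmem
  have hcF' : Continuous fun ω : S2 => F' (dot3 ω e) :=
    hF'.comp_continuous ((continuous_dot3 e).comp continuous_subtype_val) hmem
  have hcd : Continuous fun ω : S2 => dot3 ω e := (continuous_dot3 e).comp continuous_subtype_val
  have key := integral_sphere_div hV hY 0 (s := 1) (fun ω => by
    simpa using hmem ω)
  have hee : ∑ i, e i ^ 2 = 1 := by rw [← norm_sq_E3, he]; norm_num
  have hfd : ∀ (i : Fin 3) (ω : S2) (v : E3), fderiv ℝ (fun y => e i * F (dot3 y e)) ω v =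
      e i * F' (dot3 ω e) * dot3 v e := by
    intro i ω v
    rw [(hd i ω (hmem ω)).fderiv]
    simp [dot3, inner_E3, mul_comm]
  simp only [one_smul, zero_add, one_mul, hfd] at key
  have e1 : ∀ ω : S2, ∑ i, e i * F' (dot3 ω e) * dot3 (e3 i) e = F' (dot3 ω e) := by
    intro ω
    simp only [dot3, Fin.sum_univ_three, e3_apply] at hee ⊢
    simp
    linear_combination F' (ω.1 0 * e 0 + ω.1 1 * e 1 + ω.1 2 * e 2) * hee
  have e2 : ∀ ω : S2, 2 * ∑ i, ω.1 i * (e i * F (dot3 ω e)) +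
      ∑ i, ω.1 i * (e i * F' (dot3 ω e) * dot3 ω e) =
      2 * dot3 ω e * F (dot3 ω e) + dot3 ω e ^ 2 * F' (dot3 ω e) := by
    intro ω
    simp only [dot3, Fin.sum_univ_three]
    ring
  simp only [e1, e2] at key
  have e3' : ∀ ω : S2, (1 - dot3 ω e ^ 2) * F' (dot3 ω e) - 2 * dot3 ω e * F (dot3 ω e) =
      F' (dot3 ω e) - (2 * dot3 ω e * F (dot3 ω e) + dot3 ω e ^ 2 * F' (dot3 ω e)) := by
    intro ω; ring
  simp only [e3']
  have hcR : Continuous fun ω : S2 => 2 * dot3 ω e * F (dot3 ω e) + dot3 ω e ^ 2 * F' (dot3 ω e) :=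
    ((continuous_const.mul hcd).mul hcF).add ((hcd.pow 2).mul hcF')
  rw [integral_sub (integrable_sphere hcF') (integrable_sphere hcR), key, sub_self]

lemma integral_zonal_le {τ δ : ℝ} (hτ : 0 < τ) (hτ1 : τ < 1) (hδ : 0 < δ) (hδ1 : δ ≤ 1) {e : E3}
    (he : ‖e‖ = 1) : ∫ ω : S2, (1 + δ + dot3 ω e) ^ (-τ) ∂sphereMeasure ≤
      (2 - τ) * 3 / (2 - 2 * τ) * sphMass := by
  have hb : ∀ ω : S2, |dot3 ω e| ≤ 1 := fun ω => by simpa [he] using dot3_abs_le ω e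
  have hcd : Continuous fun ω : S2 => dot3 ω e := (continuous_dot3 e).comp continuous_subtype_val
  have key := integral_zonal_identity (F := fun w => (1 + δ + w) ^ (-τ))
    (F' := fun w => -τ * (1 + δ + w) ^ (-τ - 1)) (I := Ioi (-(1 + δ))) isOpen_Ioi
    (fun w hw => by
      have hw' : 0 < 1 + δ + w := by have : -(1 + δ) < w := hw; linarith
      have := (((hasDerivAt_id w).const_add (1 + δ)).rpow_const (p := -τ) (Or.inl hw'.ne'))
      refine this.congr_deriv ?_
      simp)
    (fun w hw => by
      have hw' : 0 < 1 + δ + w := by have : -(1 + δ) < w := hw; linarith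
      refine ContinuousAt.continuousWithinAt ?_
      refine continuousAt_const.mul (ContinuousAt.rpow_const (by fun_prop) (Or.inl hw'.ne')))
    he (fun w hw => by
      have := hw.1
      change -(1 + δ) < w
      linarith)
  have hc : ∀ b : ℝ, Continuous fun ω : S2 => (1 + δ + dot3 ω e) ^ b := fun b =>
    Continuous.rpow_const (by fun_prop) fun ω => Or.inl (by
      have := (abs_le.1 (hb ω)).1
      linarith : 0 < 1 + δ + dot3 ω e).ne'
  have hmono : ∫ ω : S2, ((2 - 2 * τ) * (1 + δ + dot3 ω e) ^ (-τ) - (2 - τ) * 3) ∂sphereMeasure ≤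
      ∫ ω : S2, ((1 - dot3 ω e ^ 2) * (-τ * (1 + δ + dot3 ω e) ^ (-τ - 1)) -
        2 * dot3 ω e * (1 + δ + dot3 ω e) ^ (-τ)) ∂sphereMeasure := by
    have c1 := hc (-τ)
    have c2 := hc (-τ - 1)
    refine integral_mono (integrable_sphere (by fun_prop)) (integrable_sphere (by fun_prop))
      fun ω => ?_
    have h1 := (abs_le.1 (hb ω)).1
    have h2 := (abs_le.1 (hb ω)).2
    set c := dot3 ω e
    have hz : 0 < 1 + δ + c := by linarith
    have hP := rpow_nonneg hz.le (-τ)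
    have hQ := rpow_nonneg hz.le (-τ - 1)
    have hPQ : (1 + δ + c) ^ (-τ) = (1 + δ + c) * (1 + δ + c) ^ (-τ - 1) := by
      rw [← rpow_one_add' hz.le (by linarith)]; congr 1; ring
    have hR : (1 + δ + c) * (1 + δ + c) ^ (-τ) ≤ 3 := by
      rw [← rpow_one_add' hz.le (by linarith)]
      calc (1 + δ + c) ^ (1 + -τ) ≤ 3 ^ (1 + -τ) :=
            rpow_le_rpow hz.le (by linarith) (by linarith)
        _ ≤ 3 ^ (1 : ℝ) := rpow_le_rpow_of_exponent_le (by norm_num) (by linarith)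
        _ = 3 := rpow_one 3
    dsimp only
    set P := (1 + δ + c) ^ (-τ)
    set Q := (1 + δ + c) ^ (-τ - 1)
    have a1 : (1 + c) * P ≤ 3 := by nlinarith [mul_nonneg hδ.le hP]
    have a2 : (1 - c) * τ * ((1 + c) * Q) ≤ (1 - c) * τ * P := by
      refine mul_le_mul_of_nonneg_left ?_ (mul_nonneg (by linarith) hτ.le)
      rw [hPQ]; nlinarith [mul_nonneg hδ.le hQ]
    have a3 : (2 - τ) * ((1 + c) * P) ≤ (2 - τ) * 3 :=
      mul_le_mul_of_nonneg_left a1 (by linarith)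
    linarith
  have hci : Continuous fun ω : S2 => (2 - 2 * τ) * (1 + δ + dot3 ω e) ^ (-τ) :=
    continuous_const.mul (hc _)
  rw [key, integral_sub (integrable_sphere hci) (integrable_const _), integral_const_mul, integral_const, smul_eq_mul] at hmono
  change _ - sphMass * _ ≤ 0 at hmono
  rw [div_mul_eq_mul_div, le_div_iff₀ (by linarith)]
  linarith

lemma lintegral_ball_zonal_le {τ δ b R : ℝ} (hτ : 0 < τ) (hτ1 : τ < 1) (hδ : 0 < δ) (hδ1 : δ ≤ 1)
    (hb : -3 < b) (hR : 0 ≤ R) (x₁ : E3) {e : E3} (he : ‖e‖ = 1) :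
    ∫⁻ x in ball x₁ R, ofReal (‖x - x₁‖ ^ b * (1 + δ + dot3 (‖x - x₁‖⁻¹ • (x - x₁)) e) ^ (-τ)) ≤
    ofReal (R ^ (b + 3) / (b + 3) * ((2 - τ) * 3 / (2 - 2 * τ) * sphMass)) := by
  have hcd := continuous_dot3 e
  have hm : Measurable fun x : E3 => ofReal (‖x - x₁‖ ^ b *
      (1 + δ + dot3 (‖x - x₁‖⁻¹ • (x - x₁)) e) ^ (-τ)) := by
    have h1 : Measurable fun x : E3 => dot3 (‖x - x₁‖⁻¹ • (x - x₁)) e :=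
      hcd.measurable.comp (by fun_prop)
    exact (((by fun_prop : Measurable fun x : E3 => ‖x - x₁‖).pow_const b).mul
      ((h1.const_add (1 + δ)).pow_const (-τ))).ennreal_ofReal
  have hcs : ∀ ω : S2, 0 < 1 + δ + dot3 ω e := fun ω => by
    have : |dot3 ω e| ≤ 1 := by simpa [he] using dot3_abs_le ω e
    have := (abs_le.1 this).1
    linarith
  have hc : Continuous fun ω : S2 => (1 + δ + dot3 ω e) ^ (-τ) :=
    Continuous.rpow_const (by have := hcd.comp (continuous_subtype_val (p := fun x =>
      x ∈ Metric.sphere (0 : E3) 1)); exact continuous_const.add this) fun ω => Or.inl (hcs ω).ne'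
  have hz : ∫⁻ ω : S2, ofReal ((1 + δ + dot3 ω e) ^ (-τ)) ∂sphereMeasure ≤
      ofReal ((2 - τ) * 3 / (2 - 2 * τ) * sphMass) := by
    rw [← ofReal_integral_eq_lintegral_ofReal (integrable_sphere hc)
      (Eventually.of_forall fun ω => rpow_nonneg (hcs ω).le _)]
    exact ofReal_le_ofReal (integral_zonal_le hτ hτ1 hδ hδ1 he)
  rw [lintegral_ball_polar x₁ hm, ofReal_mul (by
    have := rpow_nonneg hR (b + 3); exact div_nonneg this (by linarith)),
    show b + 3 = (2 + b) + 1 by ring, ← lintegral_rpow_Ioo (by linarith) hR,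
    ← lintegral_mul_const' _ _ ofReal_ne_top]
  refine setLIntegral_mono' measurableSet_Ioo fun s hs => ?_
  have hs0 : 0 < s := hs.1
  have : ∀ ω : S2, ofReal (‖x₁ + s • ω.1 - x₁‖ ^ b *
      (1 + δ + dot3 (‖x₁ + s • ω.1 - x₁‖⁻¹ • (x₁ + s • ω.1 - x₁)) e) ^ (-τ)) =
      ofReal (s ^ b) * ofReal ((1 + δ + dot3 ω e) ^ (-τ)) := by
    intro ω
    rw [add_sub_cancel_left, norm_smul_sphere hs0.le, smul_smul, inv_mul_cancel₀ hs0.ne', one_smul,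
      ofReal_mul (rpow_nonneg hs0.le _)]
  simp only [this]
  rw [lintegral_ofReal_mul, ← mul_assoc, ← ofReal_mul (sq_nonneg s), rpow_add hs0, rpow_two]
  exact mul_le_mul' le_rfl hz

/-- The weight `1 + |x|^γ (1 + cos)`, with the angle between `x - o` and `x`. -/
def coneW (γ : ℝ) (o x : E3) : ℝ := 1 + ‖x‖ ^ γ * (1 + dot3 (x - o) x / (‖x - o‖ * ‖x‖))

lemma one_le_coneW (γ : ℝ) (o x : E3) : 1 ≤ coneW γ o x := by
  have h := abs_le.1 (dot3_abs_le (x - o) x)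
  have h2 : -1 ≤ dot3 (x - o) x / (‖x - o‖ * ‖x‖) := by
    rcases (mul_nonneg (norm_nonneg (x - o)) (norm_nonneg x)).eq_or_lt with h0 | h0
    · rw [← h0]; simp
    · rw [le_div_iff₀ h0]; linarith [h.1]
  have := mul_nonneg (rpow_nonneg (norm_nonneg x) γ) (by linarith :
    0 ≤ 1 + dot3 (x - o) x / (‖x - o‖ * ‖x‖))
  unfold coneW; linarith

lemma measurable_coneW (γ : ℝ) (o : E3) : Measurable (coneW γ o) := by
  unfold coneW dot3; fun_prop

lemma dot3_smul_smul (a b : ℝ) (x y : E3) : dot3 (a • x) (b • y) = a * b * dot3 x y := by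
  simp only [dot3, PiLp.smul_apply, smul_eq_mul, Fin.sum_univ_three]; ring

/-- Near the tip, the weight controls the angle seen from the tip. -/
lemma cos_near_le {o x : E3} (hx : x ≠ 0) (hs : x ≠ o) (ho : o ≠ 0) (hr : ‖x‖ ≤ 2 * ‖o‖) :
    (1 + dot3 (‖x - o‖⁻¹ • (x - o)) (‖o‖⁻¹ • o)) / 2 ≤ 1 + dot3 (x - o) x / (‖x - o‖ * ‖x‖) := by
  have hρ : 0 < ‖x‖ := norm_pos_iff.2 hx
  have hs' : 0 < ‖x - o‖ := norm_pos_iff.2 (sub_ne_zero.2 hs)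
  have hr₀ : 0 < ‖o‖ := norm_pos_iff.2 ho
  have hb := abs_le.1 (dot3_abs_le (x - o) o)
  have htri : ‖o‖ ≤ ‖x‖ + ‖x - o‖ := norm_le_norm_add_norm_sub x o
  have hd : dot3 (x - o) x = dot3 (x - o) o + ‖x - o‖ ^ 2 := by
    simp only [dot3, norm_sq_E3, PiLp.sub_apply, Fin.sum_univ_three]; ring
  rw [dot3_smul_smul, hd]
  set s := ‖x - o‖
  set ρ := ‖x‖
  set r := ‖o‖
  set D := dot3 (x - o) o
  rw [show 1 + (D + s ^ 2) / (s * ρ) = (s * ρ + D + s ^ 2) / (s * ρ) by field_simp; ring,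
    show (1 + s⁻¹ * r⁻¹ * D) / 2 = (s * r + D) / (2 * s * r) by field_simp]
  have h0 : 0 ≤ s * r + D := by linarith [hb.1]
  calc (s * r + D) / (2 * s * r) ≤ (s * r + D) / (s * ρ) :=
        div_le_div_of_nonneg_left h0 (by positivity) (by nlinarith)
    _ ≤ _ := by
      refine div_le_div_of_nonneg_right ?_ (by positivity)
      nlinarith

/-- Away from the tip, the weight controls the angle seen from the origin. -/
lemma cos_far_le {o x : E3} (hx : x ≠ 0) (hs : x ≠ o) (ho : o ≠ 0) (hr : ‖x - o‖ ≤ ‖o‖) :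
    1 + dot3 (‖x‖⁻¹ • x) (-(‖o‖⁻¹ • o)) ≤ 1 + dot3 (x - o) x / (‖x - o‖ * ‖x‖) := by
  have hρ : 0 < ‖x‖ := norm_pos_iff.2 hx
  have hs' : 0 < ‖x - o‖ := norm_pos_iff.2 (sub_ne_zero.2 hs)
  have hr₀ : 0 < ‖o‖ := norm_pos_iff.2 ho
  have hb := abs_le.1 (dot3_abs_le x o)
  have htri : ‖o‖ ≤ ‖x‖ + ‖x - o‖ := norm_le_norm_add_norm_sub x o
  have hd : dot3 (x - o) x = ‖x‖ ^ 2 - dot3 x o := by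
    simp only [dot3, norm_sq_E3, PiLp.sub_apply, Fin.sum_univ_three]; ring
  rw [← neg_smul, dot3_smul_smul, hd]
  set s := ‖x - o‖
  set ρ := ‖x‖
  set r := ‖o‖
  set D := dot3 x o
  rw [show 1 + ρ⁻¹ * -r⁻¹ * D = (ρ * r - D) / (ρ * r) by field_simp; ring,
    show 1 + (ρ ^ 2 - D) / (s * ρ) = (s * ρ + ρ ^ 2 - D) / (s * ρ) by field_simp; ring]
  have h0 : 0 ≤ ρ * r - D := by linarith [hb.2]
  calc (ρ * r - D) / (ρ * r) ≤ (ρ * r - D) / (s * ρ) :=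
        div_le_div_of_nonneg_left h0 (by positivity) (by nlinarith)
    _ ≤ _ := by
      refine div_le_div_of_nonneg_right ?_ (by positivity)
      nlinarith

lemma rpow_weight_le {l τ δ W ρ γ y : ℝ} (hτ : 0 < τ) (hl : τ ≤ l) (hW : 1 ≤ W) (hρ : 0 < ρ)
    (hδ : 0 < δ) (hy : 0 ≤ y) (h : ρ ^ γ * (δ + y) ≤ W) :
    W ^ (-l) ≤ ρ ^ (-(γ * τ)) * (δ + y) ^ (-τ) := by
  have hp : 0 < ρ ^ γ := rpow_pos_of_pos hρ _
  calc W ^ (-l) ≤ W ^ (-τ) := rpow_le_rpow_of_exponent_le hW (by linarith)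
    _ ≤ (ρ ^ γ * (δ + y)) ^ (-τ) := rpow_le_rpow_of_nonpos (by positivity) h (by linarith)
    _ = _ := by rw [mul_rpow hp.le (by linarith), ← rpow_mul hρ.le]; congr 2; ring

/-- The pointwise decay rate `r^{-κ} u^{-β}`. -/
def kAmp (κ β r u : ℝ) : ℝ := r ^ (-κ) * u ^ (-β)

lemma kAmp_pos {κ β r u : ℝ} (hr : 0 < r) (hu : 0 < u) : 0 < kAmp κ β r u :=
  mul_pos (rpow_pos_of_pos hr _) (rpow_pos_of_pos hu _)

lemma kAmp_rpow {κ β r u : ℝ} (hr : 0 < r) (hu : 0 < u) (e : ℝ) :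
    kAmp κ β r u ^ e = r ^ (-(κ * e)) * u ^ (-(β * e)) := by
  unfold kAmp
  rw [mul_rpow (rpow_nonneg hr.le _) (rpow_nonneg hu.le _), ← rpow_mul hr.le, ← rpow_mul hu.le,
    neg_mul, neg_mul]

/-- Relations between the exponents in the estimate of the backward cone integral. -/
structure ConeExp (γ κ β a q τ l : ℝ) : Prop where
  γ_pos : 0 < γ
  κ_nonneg : 0 ≤ κ
  β_nonneg : 0 ≤ β
  a_pos : 0 < a
  a_lt : a < 1
  q_gt : 1 < q
  q_lt : q < 3
  τ_pos : 0 < τ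
  τ_lt : τ < 1
  τ_le : τ ≤ l
  bal : γ * τ = 3 - q + (1 - a) * (κ + β) * q
  gap : 0 < 1 - κ - (1 - a) * β

section

variable {γ κ β a q τ l : ℝ}

lemma amp_absorb (h : ConeExp γ κ β a q τ l) {r u : ℝ} (hu : 0 < u) (hur : u ≤ r) :
    r ^ (-(κ * q) - (1 - a) * β * q) * u ^ (-(β * (a * q))) ≤ kAmp κ β r u ^ q := by
  have hr : 0 < r := hu.trans_le hur
  have h1 : 0 ≤ (1 - a) * β * q := by
    have := h.a_lt; have := h.β_nonneg; have := h.q_gt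
    have : 0 ≤ 1 - a := by linarith
    positivity
  rw [kAmp_rpow hr hu, sub_eq_add_neg, rpow_add hr, mul_assoc]
  refine mul_le_mul_of_nonneg_left ?_ (rpow_nonneg hr.le _)
  calc r ^ (-((1 - a) * β * q)) * u ^ (-(β * (a * q)))
      ≤ u ^ (-((1 - a) * β * q)) * u ^ (-(β * (a * q))) :=
        mul_le_mul_of_nonneg_right (rpow_le_rpow_of_nonpos hu hur (by linarith))
          (rpow_nonneg hu.le _)
    _ = _ := by rw [← rpow_add hu]; congr 1; ring

lemma cone_weight_ge (h : ConeExp γ κ β a q τ l) {o x : E3} {y : ℝ} (ho : 0 < ‖o‖)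
    (hr : ‖x‖ ≤ 2 * ‖o‖) (hy : y ≤ 1 + dot3 (x - o) x / (‖x - o‖ * ‖x‖)) :
    ‖x‖ ^ γ * ((2 * ‖o‖) ^ (-γ) + y) ≤ coneW γ o x := by
  have h1 : ‖x‖ ^ γ * (2 * ‖o‖) ^ (-γ) ≤ 1 := by
    rw [rpow_neg (by positivity), ← div_eq_mul_inv, div_le_one (by positivity)]
    exact rpow_le_rpow (norm_nonneg _) hr h.γ_pos.le
  have h2 := mul_le_mul_of_nonneg_left hy (rpow_nonneg (norm_nonneg x) γ)
  unfold coneW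
  rw [mul_add]; linarith

/-- The integrand of the backward cone integral. -/
def coneIntegrand (γ κ β a q l T : ℝ) (o x : E3) : ℝ :=
  ‖x - o‖ ^ (-q) * kAmp κ β ‖x‖ (‖x‖ - (T - ‖x - o‖)) ^ (a * q) * coneW γ o x ^ (-l)

lemma abs_dir_dot_le {v e : E3} (hv : v ≠ 0) (he : ‖e‖ = 1) : |dot3 (‖v‖⁻¹ • v) e| ≤ 1 := by
  have := dot3_abs_le (‖v‖⁻¹ • v) e
  rwa [he, mul_one, norm_smul, norm_inv, norm_norm, inv_mul_cancel₀ (norm_ne_zero_iff.2 hv)] at this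

lemma norm_dir {v : E3} (hv : v ≠ 0) : ‖‖v‖⁻¹ • v‖ = 1 := by
  rw [norm_smul, norm_inv, norm_norm, inv_mul_cancel₀ (norm_ne_zero_iff.2 hv)]

lemma coneIntegrand_near (h : ConeExp γ κ β a q τ l) {T : ℝ} {o x : E3} (ht : 0 ≤ T)
    (ho : T + 2 ≤ ‖o‖) (hx : x ≠ o) (hs : ‖x - o‖ < ‖o‖ / 2) (hst : ‖x - o‖ < T) :
    coneIntegrand γ κ β a q l T o x ≤
      (2 * (‖o‖ / 2) ^ (-(κ * (a * q)) - γ * τ) * (‖o‖ - T) ^ (-(β * (a * q)))) *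
      (‖x - o‖ ^ (-q) * (1 + (2 * ‖o‖) ^ (-γ) +
        dot3 (‖x - o‖⁻¹ • (x - o)) (‖o‖⁻¹ • o)) ^ (-τ)) := by
  have hr0 : 0 < ‖o‖ := by linarith
  have ho0 : o ≠ 0 := norm_pos_iff.1 hr0
  have htri : ‖o‖ ≤ ‖x‖ + ‖x - o‖ := norm_le_norm_add_norm_sub x o
  have htri2 : ‖x‖ ≤ ‖o‖ + ‖x - o‖ := norm_le_norm_add_norm_sub' x o
  have hρ : 0 < ‖x‖ := by linarith
  have hx0 : x ≠ 0 := norm_pos_iff.1 hρ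
  have hcos := cos_near_le hx0 hx ho0 (by linarith)
  have hb := abs_le.1 (abs_dir_dot_le (sub_ne_zero.2 hx) (norm_dir ho0))
  have hW1 := cone_weight_ge h hr0 (by linarith) hcos
  have hδ : 0 < (2 * ‖o‖) ^ (-γ) := rpow_pos_of_pos (by positivity) _
  have hW := rpow_weight_le h.τ_pos h.τ_le (one_le_coneW γ o x) hρ hδ (by linarith [hb.1]) hW1
  have ha := h.a_pos
  have hq := h.q_gt
  have hκ := h.κ_nonneg
  have hβ := h.β_nonneg
  have hγ := h.γ_pos
  have hτ := h.τ_pos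
  have hτ1 := h.τ_lt
  unfold coneIntegrand
  rw [kAmp_rpow hρ (by linarith)]
  set δ := (2 * ‖o‖) ^ (-γ)
  set c := dot3 (‖x - o‖⁻¹ • (x - o)) (‖o‖⁻¹ • o)
  set s := ‖x - o‖
  set r := ‖o‖
  have e1 : ‖x‖ ^ (-(κ * (a * q))) ≤ (r / 2) ^ (-(κ * (a * q))) :=
    rpow_le_rpow_of_nonpos (by linarith) (by linarith) (by
      have : 0 ≤ κ * (a * q) := by positivity
      linarith)
  have e2 : (‖x‖ - (T - s)) ^ (-(β * (a * q))) ≤ (r - T) ^ (-(β * (a * q))) :=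
    rpow_le_rpow_of_nonpos (by linarith) (by linarith) (by
      have : 0 ≤ β * (a * q) := by positivity
      linarith)
  have e3 : ‖x‖ ^ (-(γ * τ)) ≤ (r / 2) ^ (-(γ * τ)) :=
    rpow_le_rpow_of_nonpos (by linarith) (by linarith) (by
      have : 0 ≤ γ * τ := by positivity
      linarith)
  have e4 : (δ + (1 + c) / 2) ^ (-τ) ≤ 2 * (1 + δ + c) ^ (-τ) := by
    calc (δ + (1 + c) / 2) ^ (-τ) ≤ (2⁻¹ * (1 + δ + c)) ^ (-τ) :=
          rpow_le_rpow_of_nonpos (by linarith [hb.1]) (by linarith [hb.1]) (by linarith)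
      _ = 2 ^ τ * (1 + δ + c) ^ (-τ) := by
        rw [mul_rpow (by norm_num) (by linarith [hb.1]), rpow_neg (by norm_num : (0:ℝ) ≤ 2⁻¹),
          inv_rpow (by norm_num : (0:ℝ) ≤ 2), inv_inv]
      _ ≤ _ := by
        refine mul_le_mul_of_nonneg_right ?_ (rpow_nonneg (by linarith [hb.1]) _)
        calc (2:ℝ) ^ τ ≤ 2 ^ (1:ℝ) := rpow_le_rpow_of_exponent_le (by norm_num) hτ1.le
          _ = 2 := rpow_one 2
  have p0 : 0 ≤ s ^ (-q) := rpow_nonneg (norm_nonneg _) _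
  have p1 : 0 ≤ (r / 2) ^ (-(κ * (a * q))) := rpow_nonneg (by linarith) _
  have p2 : 0 ≤ (r - T) ^ (-(β * (a * q))) := rpow_nonneg (by linarith) _
  have p3 : 0 ≤ (‖x‖ - (T - s)) ^ (-(β * (a * q))) := rpow_nonneg (by linarith) _
  have p4 : 0 ≤ (r / 2) ^ (-(γ * τ)) := rpow_nonneg (by linarith) _
  have p5 : 0 ≤ (δ + (1 + c) / 2) ^ (-τ) := rpow_nonneg (by linarith [hb.1]) _
  have p6 : 0 ≤ coneW γ o x ^ (-l) :=
    rpow_nonneg (by linarith [one_le_coneW γ o x]) _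
  calc s ^ (-q) * (‖x‖ ^ (-(κ * (a * q))) * (‖x‖ - (T - s)) ^ (-(β * (a * q)))) * coneW γ o x ^ (-l)
      ≤ s ^ (-q) * ((r / 2) ^ (-(κ * (a * q))) * (r - T) ^ (-(β * (a * q)))) *
        ((r / 2) ^ (-(γ * τ)) * (2 * (1 + δ + c) ^ (-τ))) := by
        refine mul_le_mul (mul_le_mul_of_nonneg_left (mul_le_mul e1 e2 p3 p1) p0)
          (hW.trans (mul_le_mul e3 e4 p5 p4)) p6 (by positivity)
    _ = _ := by rw [sub_eq_add_neg (-(κ * (a * q))), rpow_add (by linarith : 0 < r / 2)]; ring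

lemma coneIntegrand_far (h : ConeExp γ κ β a q τ l) {T : ℝ} {o x : E3} (ht : 0 ≤ T)
    (ho : T + 2 ≤ ‖o‖) (hs : ‖o‖ / 2 ≤ ‖x - o‖) (hst : ‖x - o‖ < T) :
    coneIntegrand γ κ β a q l T o x ≤ ((‖o‖ / 2) ^ (-q) * (‖o‖ - T) ^ (-(β * (a * q)))) *
      (‖x‖ ^ (-(κ * (a * q)) - γ * τ) * (1 + (2 * ‖o‖) ^ (-γ) +
        dot3 (‖x‖⁻¹ • x) (-(‖o‖⁻¹ • o))) ^ (-τ)) := by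
  have hr0 : 0 < ‖o‖ := by linarith
  have ho0 : o ≠ 0 := norm_pos_iff.1 hr0
  have htri : ‖o‖ ≤ ‖x‖ + ‖x - o‖ := norm_le_norm_add_norm_sub x o
  have htri2 : ‖x‖ ≤ ‖o‖ + ‖x - o‖ := norm_le_norm_add_norm_sub' x o
  have hρ : 0 < ‖x‖ := by linarith
  have hx0 : x ≠ 0 := norm_pos_iff.1 hρ
  have hx : x ≠ o := fun h0 => by
    rw [h0, sub_self, norm_zero] at hs; linarith
  have hcos := cos_far_le hx0 hx ho0 (by linarith)
  have hb := abs_le.1 (abs_dir_dot_le hx0 (e := -(‖o‖⁻¹ • o)) (by rw [norm_neg]; exact norm_dir ho0))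
  have hW1 := cone_weight_ge h hr0 (by linarith) hcos
  have hδ : 0 < (2 * ‖o‖) ^ (-γ) := rpow_pos_of_pos (by positivity) _
  have hW := rpow_weight_le h.τ_pos h.τ_le (one_le_coneW γ o x) hρ hδ (by linarith [hb.1]) hW1
  have ha := h.a_pos
  have hq := h.q_gt
  have hβ := h.β_nonneg
  unfold coneIntegrand
  rw [kAmp_rpow hρ (by linarith)]
  set δ := (2 * ‖o‖) ^ (-γ)
  set c := dot3 (‖x‖⁻¹ • x) (-(‖o‖⁻¹ • o))
  set s := ‖x - o‖
  set r := ‖o‖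
  have e1 : s ^ (-q) ≤ (r / 2) ^ (-q) :=
    rpow_le_rpow_of_nonpos (by linarith) hs (by linarith)
  have e2 : (‖x‖ - (T - s)) ^ (-(β * (a * q))) ≤ (r - T) ^ (-(β * (a * q))) :=
    rpow_le_rpow_of_nonpos (by linarith) (by linarith) (by
      have : 0 ≤ β * (a * q) := by positivity
      linarith)
  have p0 : 0 ≤ ‖x‖ ^ (-(κ * (a * q))) := rpow_nonneg (norm_nonneg _) _
  have p1 : 0 ≤ (r / 2) ^ (-q) := rpow_nonneg (by linarith) _
  have p2 : 0 ≤ (r - T) ^ (-(β * (a * q))) := rpow_nonneg (by linarith) _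
  have p3 : 0 ≤ (‖x‖ - (T - s)) ^ (-(β * (a * q))) := rpow_nonneg (by linarith) _
  have p6 : 0 ≤ coneW γ o x ^ (-l) :=
    rpow_nonneg (by linarith [one_le_coneW γ o x]) _
  calc s ^ (-q) * (‖x‖ ^ (-(κ * (a * q))) * (‖x‖ - (T - s)) ^ (-(β * (a * q)))) * coneW γ o x ^ (-l)
      ≤ (r / 2) ^ (-q) * (‖x‖ ^ (-(κ * (a * q))) * (r - T) ^ (-(β * (a * q)))) *
        (‖x‖ ^ (-(γ * τ)) * (δ + (1 + c)) ^ (-τ)) := by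
        refine mul_le_mul (mul_le_mul e1 (mul_le_mul_of_nonneg_left e2 p0) (by positivity) p1)
          hW p6 (by positivity)
    _ = _ := by
      rw [sub_eq_add_neg (-(κ * (a * q))), rpow_add hρ, show δ + (1 + c) = 1 + δ + c by ring]; ring

lemma cone_integral_le (h : ConeExp γ κ β a q τ l) :
    ∃ C : ℝ, 0 ≤ C ∧ ∀ (T : ℝ) (o : E3), 0 ≤ T → T + 2 ≤ ‖o‖ →
      ∫⁻ x in ball o T, ofReal (coneIntegrand γ κ β a q l T o x) ≤
        ofReal (C * kAmp κ β ‖o‖ (‖o‖ - T) ^ q) := by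
  set Z := (2 - τ) * 3 / (2 - 2 * τ) * sphMass with hZ
  have hZ0 : 0 ≤ Z := mul_nonneg (div_nonneg (by linarith [h.τ_lt]) (by linarith [h.τ_lt]))
    sphMass_nonneg
  set g := q * (1 - κ - (1 - a) * β) with hg
  have hq3 : 0 < 3 - q := by linarith [h.q_lt]
  have hq0 : 0 < q := by linarith [h.q_gt]
  have hg0 : 0 < g := mul_pos hq0 h.gap
  set σ := -(κ * q) - (1 - a) * β * q with hσ
  set C₁ := 2 * (2⁻¹ : ℝ) ^ σ * (Z / (3 - q)) with hC₁
  set C₂ := (2⁻¹ : ℝ) ^ (-q) * 2 ^ g * (Z / g) with hC₂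
  have hC₁0 : 0 ≤ C₁ := by positivity
  have hC₂0 : 0 ≤ C₂ := by positivity
  refine ⟨C₁ + C₂, by positivity, fun T o ht ho => ?_⟩
  have hr0 : 0 < ‖o‖ := by linarith
  have ho0 : o ≠ 0 := norm_pos_iff.1 hr0
  have hu : 0 < ‖o‖ - T := by linarith
  have hδ : 0 < (2 * ‖o‖) ^ (-γ) := rpow_pos_of_pos (by positivity) _
  have hδ1 : (2 * ‖o‖) ^ (-γ) ≤ 1 :=
    rpow_le_one_of_one_le_of_nonpos (by linarith) (by linarith [h.γ_pos])
  have habs := amp_absorb h hu (by linarith : ‖o‖ - T ≤ ‖o‖)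
  rw [← hσ] at habs
  set fA : E3 → ℝ := fun x => ‖x - o‖ ^ (-q) * (1 + (2 * ‖o‖) ^ (-γ) +
        dot3 (‖x - o‖⁻¹ • (x - o)) (‖o‖⁻¹ • o)) ^ (-τ) with hfA
  set fB : E3 → ℝ := fun x => ‖x‖ ^ (-(κ * (a * q)) - γ * τ) * (1 + (2 * ‖o‖) ^ (-γ) +
        dot3 (‖x‖⁻¹ • x) (-(‖o‖⁻¹ • o))) ^ (-τ) with hfB
  set MA := 2 * (‖o‖ / 2) ^ (-(κ * (a * q)) - γ * τ) * (‖o‖ - T) ^ (-(β * (a * q))) with hMA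
  set MB := (‖o‖ / 2) ^ (-q) * (‖o‖ - T) ^ (-(β * (a * q))) with hMB
  have hMA0 : 0 ≤ MA := by positivity
  have hMB0 : 0 ≤ MB := by positivity
  have hbal := h.bal
  have eb : -(κ * (a * q)) - γ * τ + 3 = g := by rw [hbal, hg]; ring
  have iA := lintegral_ball_zonal_le h.τ_pos h.τ_lt hδ hδ1 (b := -q) (by linarith)
    (R := ‖o‖ / 2) (by linarith) o (norm_dir ho0)
  have iB := lintegral_ball_zonal_le h.τ_pos h.τ_lt hδ hδ1 (b := -(κ * (a * q)) - γ * τ)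
    (by linarith) (R := 2 * ‖o‖) (by linarith) 0 (e := -(‖o‖⁻¹ • o))
    (by rw [norm_neg]; exact norm_dir ho0)
  simp only [sub_zero] at iB
  rw [eb] at iB
  have hnear : ∫⁻ x in ball o T ∩ {x | ‖x - o‖ < ‖o‖ / 2},
      ofReal (coneIntegrand γ κ β a q l T o x) ≤ ofReal (C₁ * kAmp κ β ‖o‖ (‖o‖ - T) ^ q) := by
    calc _ ≤ ∫⁻ x in ball o T ∩ {x | ‖x - o‖ < ‖o‖ / 2}, ofReal MA * ofReal (fA x) := by
          refine setLIntegral_mono' (isOpen_ball.measurableSet.inter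
            (measurableSet_lt (by fun_prop) (by fun_prop))) fun x hx => ?_
          rw [← ofReal_mul hMA0]
          by_cases hxx : x = o
          · have : coneIntegrand γ κ β a q l T o x = 0 := by
              unfold coneIntegrand
              rw [hxx, sub_self, norm_zero, zero_rpow (by linarith)]; ring
            rw [this]; simp
          · exact ofReal_le_ofReal (coneIntegrand_near h ht ho hxx hx.2
              (by simpa [dist_eq_norm] using hx.1))
      _ ≤ ∫⁻ x in ball o (‖o‖ / 2), ofReal MA * ofReal (fA x) :=
          lintegral_mono_set fun x hx => by
            have : ‖x - o‖ < ‖o‖ / 2 := hx.2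
            simpa [dist_eq_norm] using this
      _ ≤ ofReal (MA * ((‖o‖ / 2) ^ (-q + 3) / (-q + 3) * Z)) := by
          rw [lintegral_ofReal_mul, ofReal_mul hMA0]
          exact mul_le_mul' le_rfl iA
      _ ≤ _ := by
          refine ofReal_le_ofReal ?_
          calc MA * ((‖o‖ / 2) ^ (-q + 3) / (-q + 3) * Z)
              = C₁ * (‖o‖ ^ σ * (‖o‖ - T) ^ (-(β * (a * q)))) := by
                have e5 : (‖o‖ / 2) ^ (-(κ * (a * q)) - γ * τ) * (‖o‖ / 2) ^ (-q + 3) =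
                    (2⁻¹ : ℝ) ^ σ * ‖o‖ ^ σ := by
                  rw [← rpow_add (by positivity), ← mul_rpow (by norm_num) (by positivity)]
                  congr 1
                  · ring
                  · rw [hbal, hσ]; ring
                rw [hMA, hC₁, show -q + 3 = 3 - q by ring] at *
                linear_combination (2 * (‖o‖ - T) ^ (-(β * (a * q))) * (Z / (3 - q))) * e5
            _ ≤ _ := mul_le_mul_of_nonneg_left habs hC₁0
  have hfar : ∫⁻ x in ball o T ∩ {x | ‖o‖ / 2 ≤ ‖x - o‖}, ofReal (coneIntegrand γ κ β a q l T o x) ≤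
      ofReal (C₂ * kAmp κ β ‖o‖ (‖o‖ - T) ^ q) := by
    calc _ ≤ ∫⁻ x in ball o T ∩ {x | ‖o‖ / 2 ≤ ‖x - o‖}, ofReal MB * ofReal (fB x) := by
          refine setLIntegral_mono' (isOpen_ball.measurableSet.inter
            (measurableSet_le (by fun_prop) (by fun_prop))) fun x hx => ?_
          rw [← ofReal_mul hMB0]
          exact ofReal_le_ofReal (coneIntegrand_far h ht ho hx.2
              (by simpa [dist_eq_norm] using hx.1))
      _ ≤ ∫⁻ x in ball (0 : E3) (2 * ‖o‖), ofReal MB * ofReal (fB x) :=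
          lintegral_mono_set fun x hx => by
            have h1 : ‖x - o‖ < T := by simpa [dist_eq_norm] using hx.1
            have htri2 : ‖x‖ ≤ ‖o‖ + ‖x - o‖ := norm_le_norm_add_norm_sub' x o
            rw [mem_ball_zero_iff]; linarith
      _ ≤ ofReal (MB * ((2 * ‖o‖) ^ g / g * Z)) := by
          rw [lintegral_ofReal_mul, ofReal_mul hMB0]
          exact mul_le_mul' le_rfl iB
      _ ≤ _ := by
          refine ofReal_le_ofReal ?_
          calc MB * ((2 * ‖o‖) ^ g / g * Z)
              = C₂ * (‖o‖ ^ σ * (‖o‖ - T) ^ (-(β * (a * q)))) := by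
                have e5 : (‖o‖ / 2) ^ (-q) * (2 * ‖o‖) ^ g =
                    (2⁻¹ : ℝ) ^ (-q) * 2 ^ g * ‖o‖ ^ σ := by
                  rw [show ‖o‖ / 2 = 2⁻¹ * ‖o‖ by ring, mul_rpow (by norm_num) hr0.le,
                    mul_rpow (by norm_num) hr0.le, show σ = -q + g by rw [hσ, hg]; ring,
                    rpow_add hr0]
                  ring
                rw [hMB, hC₂]
                linear_combination ((‖o‖ - T) ^ (-(β * (a * q))) * (Z / g)) * e5
            _ ≤ _ := mul_le_mul_of_nonneg_left habs hC₂0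
  have hsplit : ball o T ⊆ (ball o T ∩ {x | ‖x - o‖ < ‖o‖ / 2}) ∪
      (ball o T ∩ {x | ‖o‖ / 2 ≤ ‖x - o‖}) := fun x hx => by
    rcases lt_or_ge ‖x - o‖ (‖o‖ / 2) with h1 | h1
    · exact Or.inl ⟨hx, h1⟩
    · exact Or.inr ⟨hx, h1⟩
  have hK : 0 ≤ kAmp κ β ‖o‖ (‖o‖ - T) ^ q := rpow_nonneg (kAmp_pos hr0 hu).le _
  calc _ ≤ _ := lintegral_mono_set hsplit
    _ ≤ _ := lintegral_union_le _ _ _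
    _ ≤ _ := add_le_add hnear hfar
    _ = _ := by rw [← ofReal_add (by positivity) (by positivity), ← add_mul]

end

lemma Adm.exists_coneExp {p γ ε : ℝ} (h : Adm p γ ε) : ∃ a : ℝ, 0 < a ∧ a < 1 ∧
    ConeExp γ ((3 + ε) / (2 * (p - 1))) ((1 + ε) / (2 * (p - 1))) a ((p + 1) / (1 + a))
      ((3 - (p + 1) / (1 + a) + (1 - a) * ((3 + ε) / (2 * (p - 1)) + (1 + ε) / (2 * (p - 1))) *
        ((p + 1) / (1 + a))) / γ) ((p - a) / (1 + a)) := by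
  have hp := h.p_gt
  have hp5 := h.p_lt
  have hγ := h.γ_gt
  have hε := h.ε_pos
  have hε2 := h.ε_lt
  have hdec := h.decay
  have hp1 : 0 < p - 1 := by linarith
  have hdec' : 4 < (γ + 1) * (p - 1) := by
    rw [div_le_iff₀ hp1] at hdec; linarith
  set κ := (3 + ε) / (2 * (p - 1)) with hκ
  set β := (1 + ε) / (2 * (p - 1)) with hβ
  have hκ0 : 0 < κ := by positivity
  have hβ0 : 0 < β := by positivity
  have hκ1 : κ < 1 := by rw [hκ, div_lt_one (by linarith)]; linarith
  set q : ℝ → ℝ := fun a => (p + 1) / (1 + a) with hq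
  set τ : ℝ → ℝ := fun a => (3 - q a + (1 - a) * (κ + β) * q a) / γ with hτ
  have hcq : ContinuousAt q 1 := by
    refine ContinuousAt.div (by fun_prop) (by fun_prop) (by norm_num)
  have hcl : ContinuousAt (fun a : ℝ => (p - a) / (1 + a)) 1 :=
    ContinuousAt.div (by fun_prop) (by fun_prop) (by norm_num)
  have hcτ : ContinuousAt τ 1 := by
    refine ContinuousAt.div_const ?_ _
    exact (continuousAt_const.sub hcq).add ((by fun_prop : ContinuousAt (fun a : ℝ =>
      (1 - a) * (κ + β)) 1).mul hcq)
  have hcg : ContinuousAt (fun a : ℝ => 1 - κ - (1 - a) * β) 1 := by fun_prop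
  have hq1 : q 1 = (p + 1) / 2 := by simp only [hq]; norm_num
  have hτ1 : τ 1 = (5 - p) / (2 * γ) := by
    simp only [hτ, hq1]
    field_simp; ring
  have hev : ∀ {f g : ℝ → ℝ}, ContinuousAt f 1 → ContinuousAt g 1 → f 1 < g 1 →
      ∀ᶠ a in nhdsWithin 1 (Set.Iio 1), f a < g a := fun hf hg hlt =>
    (hf.eventually_lt hg hlt).filter_mono nhdsWithin_le_nhds
  have E1 := hev continuousAt_const hcq (show (1:ℝ) < q 1 by rw [hq1]; linarith)
  have E2 := hev hcq continuousAt_const (show q 1 < (3:ℝ) by rw [hq1]; linarith)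
  have E3' := hev continuousAt_const hcτ (show (0:ℝ) < τ 1 by
    rw [hτ1]; exact div_pos (by linarith) (by linarith))
  have E4 := hev hcτ continuousAt_const (show τ 1 < (1:ℝ) by
    rw [hτ1, div_lt_one (by linarith)]
    rcases le_total p 3 with h3 | h3
    · nlinarith
    · linarith)
  have E5 := hev hcτ hcl (show τ 1 < (p - 1) / (1 + 1) by
    rw [hτ1, div_lt_div_iff₀ (by linarith) (by norm_num)]
    nlinarith)
  have E6 := hev continuousAt_const hcg (show (0:ℝ) < 1 - κ - (1 - 1) * β by linarith)
  have E7 := hev (f := fun _ => 0) (g := fun a => a) continuousAt_const continuousAt_id one_pos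
  obtain ⟨a, ⟨⟨⟨⟨⟨⟨⟨h1, h2⟩, h3⟩, h4⟩, h5⟩, h6⟩, h7⟩, h8⟩⟩ :=
    (((((((E1.and E2).and E3').and E4).and E5).and E6).and E7).and
      (self_mem_nhdsWithin : Set.Iio (1:ℝ) ∈ nhdsWithin 1 (Set.Iio 1))).exists
  refine ⟨a, h7, h8, ⟨by linarith, hκ0.le, hβ0.le, h7, h8, h1, h2, h3, h4, h5.le, ?_, h6⟩⟩
  exact mul_div_cancel₀ _ (by linarith)

lemma le_of_le_add_mul_rpow {M A b a : ℝ} (hM : 0 ≤ M) (hA : 0 ≤ A) (hb : 0 ≤ b) (ha1 : a < 1)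
    (h : M ≤ A + b * M ^ a) : M ≤ 2 * A + (2 * b) ^ (1 / (1 - a)) := by
  have hB : 0 ≤ (2 * b) ^ (1 / (1 - a)) := rpow_nonneg (by linarith) _
  rcases hM.eq_or_lt with h0 | h0
  · rw [← h0]; positivity
  by_cases hc : b * M ^ a ≤ M / 2
  · linarith
  · have h1 : M ^ (1 - a) ≤ 2 * b := by
      rw [rpow_sub h0, rpow_one, div_le_iff₀ (rpow_pos_of_pos h0 _)]
      linarith
    have h2 : M ≤ (2 * b) ^ (1 / (1 - a)) := by
      calc M = (M ^ (1 - a)) ^ (1 / (1 - a)) := by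
            rw [← rpow_mul hM, mul_one_div_cancel (by linarith), rpow_one]
        _ ≤ _ := rpow_le_rpow (rpow_nonneg hM _) h1 (by
          have : 0 < 1 - a := by linarith
          positivity)
    linarith

lemma coneIntegrand_eq_rpow {γ κ β a q l p T : ℝ} {o x : E3} (ha : 0 < a)
    (hp : 0 < p + 1) (hq : q = (p + 1) / (1 + a)) (hl : l = (p - a) / (1 + a))
    (hK : 0 ≤ kAmp κ β ‖x‖ (‖x‖ - (T - ‖x - o‖))) :
    (‖x - o‖⁻¹ * kAmp κ β ‖x‖ (‖x‖ - (T - ‖x - o‖)) ^ a *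
      coneW γ o x ^ (-((p - a) / (p + 1)))) ^ q = coneIntegrand γ κ β a q l T o x := by
  have hW : 0 ≤ coneW γ o x := by linarith [one_le_coneW γ o x]
  have ha1 : 1 + a ≠ 0 := by linarith
  unfold coneIntegrand
  rw [mul_rpow (mul_nonneg (inv_nonneg.2 (norm_nonneg _)) (rpow_nonneg hK _)) (rpow_nonneg hW _),
    mul_rpow (inv_nonneg.2 (norm_nonneg _)) (rpow_nonneg hK _), ← rpow_mul hK, ← rpow_mul hW,
    inv_rpow (norm_nonneg _), ← rpow_neg (norm_nonneg _)]
  congr 2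
  rw [hq, hl]; field_simp

lemma nonlinear_cone_le {γ κ β a q τ l p : ℝ} (h : ConeExp γ κ β a q τ l) (hp : 1 < p)
    (hq : q = (p + 1) / (1 + a)) (hl : l = (p - a) / (1 + a)) :
    ∃ C : ℝ, 0 ≤ C ∧ ∀ (T : ℝ) (o : E3), 0 ≤ T → T + 2 ≤ ‖o‖ → ∀ f : E3 → ℝ,
      Measurable f → ∀ M F : ℝ, 0 ≤ M → 0 ≤ F →
      (∀ x ∈ ball o T, |f x| ≤ M * kAmp κ β ‖x‖ (‖x‖ - (T - ‖x - o‖))) →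
      (∫⁻ x in ball o T, ofReal (coneW γ o x * |f x| ^ (p + 1)) ≤ ofReal F) →
      ∫⁻ x in ball o T, ofReal (‖x - o‖⁻¹ * |f x| ^ p) ≤
        ofReal (C * M ^ a * F ^ ((p - a) / (p + 1)) * kAmp κ β ‖o‖ (‖o‖ - T)) := by
  obtain ⟨C, hC, hInt⟩ := cone_integral_le h
  have ha := h.a_pos
  have ha1 := h.a_lt
  have hq1 := h.q_gt
  refine ⟨C ^ (1 / q), rpow_nonneg hC _, fun T o ht ho f hf M F hM hF hfM hfF => ?_⟩
  have hr0 : 0 < ‖o‖ := by linarith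
  have hK0 : 0 < kAmp κ β ‖o‖ (‖o‖ - T) := kAmp_pos hr0 (by linarith)
  have hI := hInt T o ht ho
  set P := (p + 1) / (p - a) with hP
  have hpa : 0 < p - a := by linarith
  have hPq : P.HolderConjugate q := by
    rw [Real.holderConjugate_iff]
    refine ⟨by rw [hP, lt_div_iff₀ hpa]; linarith, ?_⟩
    rw [hP, hq]; field_simp; ring
  have hP1 : 1 / P = (p - a) / (p + 1) := by rw [hP, one_div_div]
  set K : E3 → ℝ := fun x => kAmp κ β ‖x‖ (‖x‖ - (T - ‖x - o‖)) with hKdef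
  set fF : E3 → ℝ≥0∞ := fun x =>
    ofReal ((coneW γ o x * |f x| ^ (p + 1)) ^ (1 / P)) with hfFd
  set fG : E3 → ℝ≥0∞ := fun x =>
    ofReal (‖x - o‖⁻¹ * K x ^ a * coneW γ o x ^ (-((p - a) / (p + 1)))) with hfGd
  have hKm : Measurable K := by
    simp only [hKdef]; unfold kAmp; fun_prop
  have hmW := measurable_coneW γ o
  have hmF : Measurable fF := by
    have h1 : Measurable fun x => |f x| ^ (p + 1) := (_root_.continuous_abs.measurable.comp hf).pow_const _
    exact ((hmW.mul h1).pow_const _).ennreal_ofReal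
  have hmG : Measurable fG :=
    (((by fun_prop : Measurable fun x : E3 => ‖x - o‖⁻¹).mul (hKm.pow_const _)).mul
      (hmW.pow_const _)).ennreal_ofReal
  have hpos : ∀ x ∈ ball o T, 0 < K x := by
    intro x hx
    have h1 : ‖x - o‖ < T := by simpa [dist_eq_norm] using hx
    have htri : ‖o‖ ≤ ‖x‖ + ‖x - o‖ := norm_le_norm_add_norm_sub x o
    exact kAmp_pos (by linarith) (by linarith)
  have hpt : ∀ x ∈ ball o T, ofReal (‖x - o‖⁻¹ * |f x| ^ p) ≤ ofReal (M ^ a) * (fF x * fG x) := by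
    intro x hx
    have hW : 0 < coneW γ o x := by linarith [one_le_coneW γ o x]
    have hKx := hpos x hx
    rw [← ofReal_mul (by positivity), ← ofReal_mul (by positivity)]
    refine ofReal_le_ofReal ?_
    have e1 : |f x| ^ p ≤ M ^ a * K x ^ a * |f x| ^ (p - a) := by
      calc |f x| ^ p = |f x| ^ a * |f x| ^ (p - a) := by
            rw [← rpow_add_of_nonneg (abs_nonneg _) ha.le hpa.le]; congr 1; ring
        _ ≤ (M * K x) ^ a * |f x| ^ (p - a) :=
            mul_le_mul_of_nonneg_right (rpow_le_rpow (abs_nonneg _) (hfM x hx) ha.le) (by positivity)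
        _ = _ := by rw [mul_rpow hM hKx.le]
    have e2 : (coneW γ o x * |f x| ^ (p + 1)) ^ (1 / P) =
        coneW γ o x ^ ((p - a) / (p + 1)) * |f x| ^ (p - a) := by
      rw [mul_rpow hW.le (by positivity), ← rpow_mul (abs_nonneg _), hP1]
      congr 2; field_simp
    have e3 : coneW γ o x ^ ((p - a) / (p + 1)) * coneW γ o x ^ (-((p - a) / (p + 1))) = 1 := by
      rw [← rpow_add hW, add_neg_cancel, rpow_zero]
    calc ‖x - o‖⁻¹ * |f x| ^ p ≤ ‖x - o‖⁻¹ * (M ^ a * K x ^ a * |f x| ^ (p - a)) :=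
          mul_le_mul_of_nonneg_left e1 (by positivity)
      _ = _ := by
        rw [e2]
        linear_combination (-(M ^ a * ‖x - o‖⁻¹ * K x ^ a * |f x| ^ (p - a))) * e3
  have hFP : ∫⁻ x in ball o T, fF x ^ P ≤ ofReal F := by
    refine le_trans (le_of_eq ?_) hfF
    refine lintegral_congr fun x => ?_
    have hW : 0 < coneW γ o x := by linarith [one_le_coneW γ o x]
    rw [hfFd, ofReal_rpow_of_nonneg (by positivity) hPq.nonneg, ← rpow_mul (by positivity),
      one_div_mul_cancel hPq.ne_zero, rpow_one]
  have hGq : ∫⁻ x in ball o T, fG x ^ q ≤ ofReal (C * kAmp κ β ‖o‖ (‖o‖ - T) ^ q) := by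
    refine le_trans (le_of_eq ?_) hI
    refine setLIntegral_congr_fun isOpen_ball.measurableSet fun x hx => ?_
    have hW : 0 < coneW γ o x := by linarith [one_le_coneW γ o x]
    have hKx := hpos x hx
    simp only [hfGd]
    rw [ofReal_rpow_of_nonneg (by positivity) (by linarith),
      coneIntegrand_eq_rpow ha (by linarith) hq hl hKx.le]
  calc _ ≤ ∫⁻ x in ball o T, ofReal (M ^ a) * (fF x * fG x) :=
        setLIntegral_mono' isOpen_ball.measurableSet hpt
    _ = ofReal (M ^ a) * ∫⁻ x in ball o T, (fF * fG) x :=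
        lintegral_ofReal_mul
    _ ≤ ofReal (M ^ a) * ((∫⁻ x in ball o T, fF x ^ P) ^ (1 / P) *
          (∫⁻ x in ball o T, fG x ^ q) ^ (1 / q)) :=
        mul_le_mul' le_rfl (ENNReal.lintegral_mul_le_Lp_mul_Lq _ hPq hmF.aemeasurable
          hmG.aemeasurable)
    _ ≤ ofReal (M ^ a) * (ofReal F ^ (1 / P) * ofReal (C * kAmp κ β ‖o‖ (‖o‖ - T) ^ q) ^ (1 / q)) :=
        mul_le_mul' le_rfl (mul_le_mul'
          (ENNReal.rpow_le_rpow hFP (one_div_nonneg.2 hPq.nonneg))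
          (ENNReal.rpow_le_rpow hGq (one_div_nonneg.2 (by linarith))))
    _ = _ := by
        rw [ofReal_rpow_of_nonneg hF (one_div_nonneg.2 hPq.nonneg),
          ofReal_rpow_of_nonneg (by positivity) (one_div_nonneg.2 (by linarith)),
          ← ofReal_mul (by positivity), ← ofReal_mul (by positivity),
          mul_rpow hC (by positivity), ← rpow_mul hK0.le, mul_one_div_cancel (by linarith),
          rpow_one, hP1]
        congr 1; ring

/-- Density of the weighted energy current. -/
def wCur0 (p γ ε c : ℝ) (ψ : Wave) : M4 → ℝ :=
  cur0 (wt1 p γ ε + wt2 γ ε) (wt1 p γ ε - wt2 γ ε) (pot c p ψ) ψ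

/-- Flux of the weighted energy current. -/
def wCurS (p γ ε c : ℝ) (ψ : Wave) (i : Fin 3) : M4 → ℝ :=
  curS (wt1 p γ ε + wt2 γ ε) (wt1 p γ ε - wt2 γ ε) (pot c p ψ) ψ i

section Initial

variable {p γ ε c : ℝ} {ψ : Wave}

lemma pot_nonneg (hp : 1 < p) (hc : 0 ≤ c) (q : M4) : 0 ≤ pot c p ψ q :=
  div_nonneg (mul_nonneg hc (by positivity)) (by linarith)

lemma gradSq_le (ψ : Wave) (q : M4) : gradSq ψ q ≤ 3 * ‖fderiv ℝ (ψ q.1) q.2‖ ^ 2 := by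
  have h : ∀ i : Fin 3, dx i ψ q.1 q.2 ^ 2 ≤ ‖fderiv ℝ (ψ q.1) q.2‖ ^ 2 := fun i => by
    have := (fderiv ℝ (ψ q.1) q.2).le_opNorm (e3 i)
    rw [norm_e3, mul_one] at this
    exact sq_le_sq.2 (this.trans (le_abs_self _))
  calc gradSq ψ q ≤ ∑ _i : Fin 3, ‖fderiv ℝ (ψ q.1) q.2‖ ^ 2 := sum_le_sum fun i _ => h i
    _ = _ := by simp

lemma wCur0_init_le (ha : Adm p γ ε) (hc : 0 ≤ c) {x : E3} (hx : 2 ≤ ‖x‖) :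
    wCur0 p γ ε c ψ (0, x) ≤ (wAmp p γ + 2) *
      (9 * (‖x‖ ^ γ * (dt1 ψ 0 x ^ 2 + ‖fderiv ℝ (ψ 0) x‖ ^ 2)) +
        2 * (‖x‖ ^ (γ - 2) * ψ 0 x ^ 2) + ‖x‖ ^ γ * pot c p ψ (0, x)) := by
  have hq : ((0 : ℝ), x) ∈ extReg := ⟨le_rfl, by simpa using hx⟩
  have hr : 0 < ‖x‖ := by linarith
  have hrγ : 0 ≤ ‖x‖ ^ γ := by positivity
  have h1 := le_wt1 ha hq
  have h1' := wt1_le ha hq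
  have h2 := wt2_le ha hq
  have h2' := le_wt2 ha hq
  simp only [sub_zero] at h1 h1' h2 h2'
  have hp : 1 < p := by linarith [ha.p_gt]
  have hU := pot_nonneg (ψ := ψ) hp hc (0, x)
  have hg := gradSq_le ψ (0, x)
  have hm := cur0_le (f₁ := wt1 p γ ε) (f₂ := wt2 γ ε) (U := pot c p ψ) (ψ := ψ) (q := (0, x))
    (by linarith) (by linarith)
  have hA := ha.amp_ge
  have hr2 : ‖x‖ ^ γ * (ψ 0 x ^ 2 / ‖x‖ ^ 2) = ‖x‖ ^ (γ - 2) * ψ 0 x ^ 2 := by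
    rw [Real.rpow_sub hr, rpow_two]
    ring
  have hS : 0 ≤ dt1 ψ 0 x ^ 2 + 3 * gradSq ψ (0, x) + 2 * (ψ 0 x ^ 2 / ‖x‖ ^ 2) +
      pot c p ψ (0, x) := by
    have : 0 ≤ gradSq ψ (0, x) := sum_nonneg fun i _ => sq_nonneg _
    positivity
  simp only at hg hm
  calc wCur0 p γ ε c ψ (0, x) ≤ _ := hm
    _ ≤ ((wAmp p γ + 2) * ‖x‖ ^ γ) * (dt1 ψ 0 x ^ 2 + 3 * gradSq ψ (0, x) +
          2 * (ψ 0 x ^ 2 / ‖x‖ ^ 2) + pot c p ψ (0, x)) :=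
        mul_le_mul_of_nonneg_right (by linarith) hS
    _ ≤ ((wAmp p γ + 2) * ‖x‖ ^ γ) * (9 * (dt1 ψ 0 x ^ 2 + ‖fderiv ℝ (ψ 0) x‖ ^ 2) +
          2 * (ψ 0 x ^ 2 / ‖x‖ ^ 2) + pot c p ψ (0, x)) :=
        mul_le_mul_of_nonneg_left (by nlinarith [sq_nonneg (dt1 ψ 0 x)]) (by positivity)
    _ = _ := by rw [← hr2]; ring

variable {k : ℕ} {φ : Wave}

lemma lintegral_data_le_wEnergy {l : ℕ} (hl : l ≤ k) :
    ∫⁻ x : E3, ofReal ((1 + ‖x‖) ^ (γ + 2 * (l : ℝ)) *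
      (‖iteratedFDeriv ℝ (l + 1) (φ 0) x‖ ^ 2 + ‖iteratedFDeriv ℝ l (dt1 φ 0) x‖ ^ 2)) ≤
    wEnergy p k γ φ :=
  (Finset.single_le_sum (f := fun l : ℕ => ∫⁻ x : E3, ofReal ((1 + ‖x‖) ^
      (γ + 2 * (l : ℝ)) * (‖iteratedFDeriv ℝ (l + 1) (φ 0) x‖ ^ 2 +
        ‖iteratedFDeriv ℝ l (dt1 φ 0) x‖ ^ 2))) (fun _ _ => zero_le)
      (Finset.mem_range_succ_iff.2 hl)).trans le_self_add

lemma setLIntegral_energy_le_wEnergy (hγ : 0 ≤ γ) (s : Set E3) :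
    ∫⁻ x in s, ofReal (‖x‖ ^ γ * (dt1 φ 0 x ^ 2 + ‖fderiv ℝ (φ 0) x‖ ^ 2)) ≤ wEnergy p k γ φ := by
  refine (setLIntegral_le_lintegral _ _).trans
    (le_trans (lintegral_mono fun x => ?_) (lintegral_data_le_wEnergy (p := p) (Nat.zero_le k)))
  refine ofReal_le_ofReal ?_
  rw [zero_add, norm_iteratedFDeriv_one, norm_iteratedFDeriv_zero, norm_eq_abs, sq_abs,
    Nat.cast_zero, mul_zero, add_zero, add_comm (dt1 φ 0 x ^ 2)]
  gcongr
  linarith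

lemma setLIntegral_energy_one_le_wEnergy (hγ : 0 ≤ γ) (hk : 1 ≤ k) (s : Set E3) :
    ∫⁻ x in s, ofReal (‖x‖ ^ (γ + 2) *
      (‖iteratedFDeriv ℝ 2 (φ 0) x‖ ^ 2 + ‖fderiv ℝ (dt1 φ 0) x‖ ^ 2)) ≤ wEnergy p k γ φ := by
  refine (setLIntegral_le_lintegral _ _).trans
    (le_trans (lintegral_mono fun x => ?_) (lintegral_data_le_wEnergy (p := p) hk))
  refine ofReal_le_ofReal ?_
  rw [norm_iteratedFDeriv_one, Nat.cast_one, mul_one]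
  gcongr
  linarith

lemma setLIntegral_pot_le_wEnergy (hγ : 0 ≤ γ) (s : Set E3) :
    ∫⁻ x in s, ofReal (‖x‖ ^ γ * |φ 0 x| ^ (p + 1)) ≤ wEnergy p k γ φ := by
  refine (setLIntegral_le_lintegral _ _).trans
    (le_trans (lintegral_mono fun x => ?_) le_add_self)
  refine ofReal_le_ofReal ?_
  gcongr
  linarith

lemma measurableSet_lt_norm (b : ℝ) : MeasurableSet {x : E3 | b < ‖x‖} :=
  measurableSet_lt measurable_const measurable_norm

lemma setLIntegral_abs_rpow_le_wEnergy (hγ : 0 ≤ γ) :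
    ∫⁻ x in {x : E3 | 1 < ‖x‖}, ofReal (|φ 0 x| ^ (p + 1)) ≤ wEnergy p k γ φ :=
  (setLIntegral_mono' (measurableSet_lt_norm 1) fun x hx => ofReal_le_ofReal
    (le_mul_of_one_le_left (by positivity) (one_le_rpow (le_of_lt hx) hγ))).trans
    (setLIntegral_pot_le_wEnergy hγ _)

lemma setLIntegral_hardy_le_wEnergy (h : Smooth φ) (hp : 1 < p) (hγ : 0 < γ)
    (hE : wEnergy p k γ φ ≠ ⊤) : ∫⁻ x in {x : E3 | 1 < ‖x‖}, ofReal (‖x‖ ^ (γ - 2) * φ 0 x ^ 2) ≤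
      ofReal (2 / γ) * wEnergy p k γ φ := by
  refine (hardy_outside ((h.slice 0).of_le (by exact_mod_cast le_top)) one_pos
    (q := p + 1) (by linarith) hγ
    (ne_top_of_le_ne_top hE (setLIntegral_abs_rpow_le_wEnergy hγ.le))).trans ?_
  refine mul_le_mul' le_rfl ?_
  refine le_trans (lintegral_mono fun x => ofReal_le_ofReal ?_)
    (setLIntegral_energy_le_wEnergy (p := p) (k := k) hγ.le _)
  exact mul_le_mul_of_nonneg_left (by linarith [sq_nonneg (dt1 φ 0 x)]) (by positivity)

lemma exists_initial_energy_le (ha : Adm p γ ε) (k : ℕ) :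
    ∃ C : ℝ, 0 ≤ C ∧ ∀ φ : Wave, Smooth φ → wEnergy p k γ φ ≠ ⊤ →
      ∫⁻ x in farDom, ofReal (wCur0 p γ ε 1 φ (0, x)) ≤ ofReal C * wEnergy p k γ φ := by
  have hp : 1 < p := by linarith [ha.p_gt]
  have hγ : 0 < γ := by linarith [ha.γ_gt]
  have hA : 0 ≤ wAmp p γ + 2 := by linarith [ha.amp_ge]
  refine ⟨(wAmp p γ + 2) * (10 + 2 * (2 / γ)), by positivity, fun φ h hE => ?_⟩
  have hS : farDom ⊆ {x : E3 | 1 < ‖x‖} := fun x hx =>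
    show 1 < ‖x‖ from lt_of_lt_of_le one_lt_two hx
  have hms : MeasurableSet farDom := measurableSet_le measurable_const measurable_norm
  have cφ : Continuous (φ 0) := (h.slice 0).continuous
  have cD : Continuous (fun x => ‖fderiv ℝ (φ 0) x‖) :=
    ((h.slice 0).continuous_fderiv (by simp)).norm
  have cT : Continuous (dt1 φ 0) := (h.dt1.slice 0).continuous
  have m1 : Measurable fun x : E3 => ofReal (‖x‖ ^ γ * (dt1 φ 0 x ^ 2 + ‖fderiv ℝ (φ 0) x‖ ^ 2)) :=
    ((measurable_norm.pow_const γ).mul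
      ((cT.measurable.pow_const 2).add (cD.measurable.pow_const 2))).ennreal_ofReal
  have m2 : Measurable fun x : E3 => ofReal (‖x‖ ^ (γ - 2) * φ 0 x ^ 2) :=
    ((measurable_norm.pow_const (γ - 2)).mul (cφ.measurable.pow_const 2)).ennreal_ofReal
  have m3 : Measurable fun x : E3 => ofReal 9 * ofReal (‖x‖ ^ γ *
      (dt1 φ 0 x ^ 2 + ‖fderiv ℝ (φ 0) x‖ ^ 2)) + ofReal 2 * ofReal (‖x‖ ^ (γ - 2) * φ 0 x ^ 2) :=
    (m1.const_mul _).add (m2.const_mul _)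
  have h10 : ofReal (10 + 2 * (2 / γ)) = ofReal 9 + ofReal 2 * ofReal (2 / γ) + 1 := by
    rw [← ofReal_mul (by norm_num), ← ofReal_add (by norm_num) (by positivity),
      ← ofReal_one, ← ofReal_add (by positivity) zero_le_one]
    congr 1
    ring
  calc ∫⁻ x in farDom, ofReal (wCur0 p γ ε 1 φ (0, x))
      ≤ ∫⁻ x in farDom, ofReal (wAmp p γ + 2) * ((ofReal 9 * ofReal (‖x‖ ^ γ *
              (dt1 φ 0 x ^ 2 + ‖fderiv ℝ (φ 0) x‖ ^ 2)) +
            ofReal 2 * ofReal (‖x‖ ^ (γ - 2) * φ 0 x ^ 2)) +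
            ofReal (‖x‖ ^ γ * |φ 0 x| ^ (p + 1))) := by
        refine setLIntegral_mono' hms fun x hx => ?_
        rw [← ofReal_mul (by norm_num), ← ofReal_mul (by norm_num),
          ← ofReal_add (by positivity) (by positivity),
          ← ofReal_add (by positivity) (by positivity), ← ofReal_mul hA]
        refine ofReal_le_ofReal ((wCur0_init_le ha zero_le_one hx).trans ?_)
        refine mul_le_mul_of_nonneg_left (by
          refine add_le_add le_rfl (mul_le_mul_of_nonneg_left ?_ (by positivity))
          change 1 * |φ 0 x| ^ (p + 1) / (p + 1) ≤ _
          rw [one_mul]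
          exact div_le_self (by positivity) (by linarith)) hA
    _ = ofReal (wAmp p γ + 2) * ((ofReal 9 * ∫⁻ x in farDom, ofReal (‖x‖ ^ γ *
              (dt1 φ 0 x ^ 2 + ‖fderiv ℝ (φ 0) x‖ ^ 2))) + (ofReal 2 * ∫⁻ x in farDom,
              ofReal (‖x‖ ^ (γ - 2) * φ 0 x ^ 2)) +
            ∫⁻ x in farDom, ofReal (‖x‖ ^ γ * |φ 0 x| ^ (p + 1))) := by
        rw [lintegral_ofReal_mul,
          lintegral_add_left m3, lintegral_add_left (m1.const_mul _), lintegral_ofReal_mul,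
          lintegral_ofReal_mul]
    _ ≤ ofReal (wAmp p γ + 2) * ((ofReal 9 * wEnergy p k γ φ +
          ofReal 2 * (ofReal (2 / γ) * wEnergy p k γ φ)) + wEnergy p k γ φ) := by
        gcongr
        · exact setLIntegral_energy_le_wEnergy hγ.le _
        · exact (lintegral_mono_set hS).trans (setLIntegral_hardy_le_wEnergy h hp hγ hE)
        · exact setLIntegral_pot_le_wEnergy hγ.le _
    _ = ofReal ((wAmp p γ + 2) * (10 + 2 * (2 / γ))) * wEnergy p k γ φ := by
        rw [ofReal_mul hA, h10]
        ring

end Initial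

lemma IsNLWSolution.smooth {p : ℝ} {φ : Wave} (h : IsNLWSolution p φ) : Smooth φ := h.1

lemma sphMass_pos : 0 < sphMass := by
  refine ENNReal.toReal_pos ?_ (measure_ne_top _ _)
  change (volume : Measure E3).toSphere univ ≠ 0
  rw [Measure.toSphere_apply_univ]
  simp [Real.pi_pos]

section Current

variable {p γ ε c : ℝ} {φ ψ : Wave}

lemma contDiffOn_wCur0 (hp : 1 < p) (h : Smooth ψ) : ContDiffOn ℝ 1 (wCur0 p γ ε c ψ) extDom :=
  contDiffOn_cur0 h (fun _ hq => ne_zero_of_mem_extDom hq) (contDiffOn_wt1.add contDiffOn_wt2)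
    (contDiffOn_wt1.sub contDiffOn_wt2) (contDiff_pot c hp h).contDiffOn

lemma contDiffOn_wCurS (hp : 1 < p) (h : Smooth ψ) (i : Fin 3) :
    ContDiffOn ℝ 1 (wCurS p γ ε c ψ i) extDom :=
  contDiffOn_curS h (fun _ hq => ne_zero_of_mem_extDom hq) (contDiffOn_wt1.add contDiffOn_wt2)
    (contDiffOn_wt1.sub contDiffOn_wt2) (contDiff_pot c hp h).contDiffOn i

lemma wt1_nonneg (ha : Adm p γ ε) {q : M4} (hq : q ∈ extReg) : 0 ≤ wt1 p γ ε q :=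
  (mul_nonneg (by norm_num) (by positivity)).trans (le_wt1 ha hq)

lemma wt2_nonneg (ha : Adm p γ ε) {q : M4} (hq : q ∈ extReg) : 0 ≤ wt2 γ ε q :=
  (zero_le_one.trans (one_le_u_rpow ha hq)).trans (le_wt2 ha hq)

lemma wCur0_nonneg (ha : Adm p γ ε) (hc : 0 ≤ c) {q : M4} (hq : q ∈ extReg) :
    0 ≤ wCur0 p γ ε c ψ q :=
  cur0_nonneg (wt1_nonneg ha hq) (wt2_nonneg ha hq) (pot_nonneg (by linarith [ha.p_gt]) hc q)

lemma divST_wCur_nonpos (ha : Adm p γ ε) (h : IsNLWSolution p φ) {q : M4} (hq : q ∈ extReg) :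
    divST (wCur0 p γ ε 1 φ) (wCurS p γ ε 1 φ) q ≤ 0 := by
  have hr : 2 ≤ ‖q.2‖ := by linarith [hq.1, hq.2]
  have hu : 0 < ‖q.2‖ - q.1 := u_pos_of_mem (extReg_subset_extDom hq)
  have h1 := divST_weighted_le ha hq zero_le_one h.smooth
  have h2 : lap3 (φ q.1) q.2 - dtt φ q.1 q.2 - 1 * |φ q.1 q.2| ^ (p - 1) * φ q.1 q.2 = 0 := by
    linarith [h.2 q.1 hq.1 q.2]
  rw [h2] at h1
  have h3 := rdot_sq_le φ q
  have hg2 := ha.γ_lt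
  have hε := ha.ε_pos
  have b1 : 0 ≤ ‖q.2‖ ^ (γ - 1) * (dt1 φ q.1 q.2 + wrad φ q) ^ 2 := by positivity
  have b2 : 0 ≤ ε * (‖q.2‖ ^ γ * (‖q.2‖ - q.1) ^ (-ε - 1)) *
    (dt1 φ q.1 q.2 + wrad φ q) ^ 2 := by positivity
  have b3 : 0 ≤ ε / 4 * (‖q.2‖ ^ (-ε - 1) * (‖q.2‖ - q.1) ^ γ) *
    (dt1 φ q.1 q.2 - wrad φ q) ^ 2 := by positivity
  have b4 : 0 ≤ (2 - γ) * ‖q.2‖ ^ (γ - 1) * (gradSq φ q - rdot φ q ^ 2 / ‖q.2‖ ^ 2) :=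
    mul_nonneg (mul_nonneg (by linarith) (by positivity)) h3
  have b5 : 0 ≤ 1 / 2 * ‖q.2‖ ^ (γ - 1) * |φ q.1 q.2| ^ (p + 1) := by positivity
  change divST (cur0 _ _ _ _) (curS _ _ _ _) q ≤ 0
  linarith

lemma cone_flux_pot_le (ha : Adm p γ ε) (hc : 0 ≤ c) {q : M4} (hq : q ∈ extReg)
    {n : Fin 3 → ℝ} (hn : ∑ i, n i ^ 2 = 1) :
    (1 + ‖q.2‖ ^ γ * (1 + (∑ i, n i * q.2 i) / ‖q.2‖)) * pot c p ψ q ≤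
      wCur0 p γ ε c ψ q + ∑ i, n i * wCurS p γ ε c ψ i q := by
  have hr : 2 ≤ ‖q.2‖ := by linarith [hq.1, hq.2]
  have hU := pot_nonneg (ψ := ψ) (show 1 < p by linarith [ha.p_gt]) hc q
  refine le_trans (mul_le_mul_of_nonneg_right ?_ hU) (cone_flux_ge (U := pot c p ψ) (ψ := ψ)
    (ne_zero_of_mem_extDom (extReg_subset_extDom hq)) (wt1_nonneg ha hq) (wt2_nonneg ha hq) hn)
  have hcs := abs_le.1 (abs_dot_div_norm_le hn q.2)
  set z := (∑ i, n i * q.2 i) / ‖q.2‖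
  have h1 := le_wt1 ha hq
  have h2 := (one_le_u_rpow ha hq).trans (le_wt2 ha hq)
  have h3 : 1 ≤ ‖q.2‖ ^ γ := one_le_rpow (by linarith) (by linarith [ha.γ_gt])
  have e1 : 4 * ‖q.2‖ ^ γ * (1 + z) ≤ wt1 p γ ε q * (1 + z) :=
    mul_le_mul_of_nonneg_right h1 (by linarith)
  have e2 : 1 * (1 - z) ≤ wt2 γ ε q * (1 - z) := mul_le_mul_of_nonneg_right h2 (by linarith)
  have e3 : 1 * (1 + z) ≤ ‖q.2‖ ^ γ * (1 + z) := mul_le_mul_of_nonneg_right h3 (by linarith)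
  linarith

lemma cone_potential_le (ha : Adm p γ ε) (h : IsNLWSolution p φ) {T : ℝ} {o : E3}
    (hT : 0 ≤ T) (ho : T + 2 ≤ ‖o‖) : ∫⁻ x in ball o T,
      ofReal (coneW γ o x * |φ (T - ‖x - o‖) x| ^ (p + 1)) ≤ ofReal (p + 1) *
      ∫⁻ x in farDom, ofReal (wCur0 p γ ε 1 φ (0, x)) := by
  have hp : 1 < p := by linarith [ha.p_gt]
  have hnn : ∀ q ∈ extReg, ∀ n : Fin 3 → ℝ, ∑ i, n i ^ 2 = 1 →
      0 ≤ 1 + ‖q.2‖ ^ γ * (1 + (∑ i, n i * q.2 i) / ‖q.2‖) := fun q _ n hn => by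
    have := (abs_le.1 (abs_dot_div_norm_le hn q.2)).1
    have : 0 ≤ ‖q.2‖ ^ γ * (1 + (∑ i, n i * q.2 i) / ‖q.2‖) :=
      mul_nonneg (by positivity) (by linarith)
    linarith
  have hm : Measurable fun x : E3 => pot 1 p φ (T - ‖x - o‖, x) :=
    ((contDiff_pot 1 hp h.smooth).continuous.comp (by fun_prop :
      Continuous fun x : E3 => (T - ‖x - o‖, x))).measurable
  have key := cone_energy (contDiffOn_wCur0 hp h.smooth) (contDiffOn_wCurS hp h.smooth)
    (fun q hq => divST_wCur_nonpos ha h hq) (fun q hq => wCur0_nonneg (c := 1) ha zero_le_one hq)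
    (fun q hq n hn => (mul_nonneg (hnn q hq n hn) (pot_nonneg hp zero_le_one q)).trans
      (cone_flux_pot_le (c := 1) ha zero_le_one hq hn)) hT ho
    (H := fun x => ofReal (coneW γ o x * pot 1 p φ (T - ‖x - o‖, x)))
    (((measurable_coneW γ o).mul hm).ennreal_ofReal) (fun s hs ω => by
      have hs0 : 0 < s := hs.1
      have hq : (T - s, o + s • ω.1) ∈ extReg := by
        refine ⟨by linarith [hs.2], ?_⟩
        have := norm_sub_norm_le o (-(s • ω.1))
        rw [norm_neg, norm_smul_sphere hs0.le, sub_neg_eq_add] at this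
        change T - s + 2 ≤ ‖o + s • ω.1‖
        linarith
      have hw := cone_flux_pot_le (ψ := φ) (c := 1) ha zero_le_one hq (sphere_coord_sq ω)
      refine ofReal_le_ofReal (le_trans (le_of_eq ?_) hw)
      have e1 : ‖o + s • ω.1 - o‖ = s := by
        rw [add_sub_cancel_left, norm_smul_sphere hs0.le]
      have e2 : dot3 (o + s • ω.1 - o) (o + s • ω.1) = s * ∑ i, ω.1 i * (o + s • ω.1) i := by
        rw [add_sub_cancel_left]
        simp only [dot3, PiLp.smul_apply, smul_eq_mul, Fin.sum_univ_three]
        ring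
      simp only [coneW, e1, e2]
      rw [mul_div_mul_left _ _ hs0.ne'])
  refine le_trans (le_of_eq ?_) (mul_le_mul' (le_refl (ofReal (p + 1))) key)
  rw [← lintegral_ofReal_mul]
  refine lintegral_congr fun x => ?_
  rw [← ofReal_mul (by linarith)]
  congr 1
  have : p + 1 ≠ 0 := by linarith
  simp only [pot]
  field_simp

end Current

section Linear

variable {p γ ε : ℝ} {φ : Wave}

lemma linDecay_le_kAmp (ha : Adm p γ ε) {t : ℝ} {x : E3} (ht : 0 ≤ t) (hx : t + 2 ≤ ‖x‖) :
    linDecay γ t x ≤ kAmp ((3 + ε) / (2 * (p - 1))) ((1 + ε) / (2 * (p - 1))) ‖x‖ (‖x‖ - t) := by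
  have hp : 0 < p - 1 := by linarith [ha.p_gt]
  have hr : 0 < ‖x‖ := by linarith
  have hu : 0 < ‖x‖ - t := by linarith
  have hκ : (3 + ε) / (2 * (p - 1)) ≤ 1 := by
    rw [div_le_one (by linarith)]; linarith [ha.ε_lt]
  have hsum : (3 + ε) / (2 * (p - 1)) + (1 + ε) / (2 * (p - 1)) ≤ (γ + 1) / 2 := by
    refine le_trans (le_of_eq ?_) ha.decay
    field_simp
    ring
  set κ := (3 + ε) / (2 * (p - 1))
  set β := (1 + ε) / (2 * (p - 1))
  have e1 : ‖x‖⁻¹ = ‖x‖ ^ (-κ) * ‖x‖ ^ (κ - 1) := by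
    rw [← rpow_add hr, ← Real.rpow_neg_one]
    congr 1; ring
  have e2 : ‖x‖ ^ (κ - 1) ≤ (‖x‖ - t) ^ (κ - 1) :=
    rpow_le_rpow_of_nonpos hu (by linarith) (by linarith)
  have e3 : (‖x‖ - t) ^ (κ - 1) * (‖x‖ - t) ^ ((1 - γ) / 2) ≤ (‖x‖ - t) ^ (-β) := by
    rw [← rpow_add hu]
    exact rpow_le_rpow_of_exponent_le (by linarith) (by linarith)
  calc linDecay γ t x = ‖x‖ ^ (-κ) * (‖x‖ ^ (κ - 1) * (‖x‖ - t) ^ ((1 - γ) / 2)) := by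
        rw [linDecay, e1]; ring
    _ ≤ ‖x‖ ^ (-κ) * ((‖x‖ - t) ^ (κ - 1) * (‖x‖ - t) ^ ((1 - γ) / 2)) := by gcongr
    _ ≤ ‖x‖ ^ (-κ) * (‖x‖ - t) ^ (-β) := by gcongr

lemma norm_fderiv_dx_le (h : Smooth φ) (i : Fin 3) (t : ℝ) (x : E3) :
    ‖fderiv ℝ (dx i φ t) x‖ ≤ 3 * ‖iteratedFDeriv ℝ 2 (φ t) x‖ :=
  calc ‖fderiv ℝ (dx i φ t) x‖ ≤ ∑ j, |fderiv ℝ (dx i φ t) x (e3 j)| := norm_fderiv_le_sum _ _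
    _ ≤ ∑ _j : Fin 3, ‖iteratedFDeriv ℝ 2 (φ t) x‖ :=
        sum_le_sum fun j _ => abs_dx_dx_le h j i t x
    _ = _ := by simp

lemma setLIntegral_ofReal_mono_mul {f g : E3 → ℝ} {c : ℝ} {s : Set E3} (hc : 0 ≤ c)
    (h : ∀ x, f x ≤ c * g x) : ∫⁻ x in s, ofReal (f x) ≤ ofReal c * ∫⁻ x in s, ofReal (g x) := by
  rw [← lintegral_ofReal_mul]
  refine lintegral_mono fun x => ?_
  rw [← ofReal_mul hc]
  exact ofReal_le_ofReal (h x)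

lemma exists_linear_cone_le (ha : Adm p γ ε) : ∃ C : ℝ, 0 ≤ C ∧ ∀ φ : Wave, Smooth φ →
    wEnergy p 1 γ φ ≠ ⊤ → ∀ (T : ℝ) (o : E3), 0 ≤ T → T + 2 ≤ ‖o‖ →
      ofReal T * sphAbs o (dt1 φ 0) T + sphAbs o (φ 0) T + (∑ i, ofReal T * sphAbs o (dx i φ 0) T) ≤
      ofReal (C * √(wEnergy p 1 γ φ).toReal *
        kAmp ((3 + ε) / (2 * (p - 1))) ((1 + ε) / (2 * (p - 1))) ‖o‖ (‖o‖ - T)) := by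
  have hp : 1 < p := by linarith [ha.p_gt]
  have hγ : 0 < γ := by linarith [ha.γ_gt]
  obtain ⟨C₁, hC₁, H₁⟩ := exists_time_mul_sphAbs_le ha.γ_gt ha.γ_lt
  obtain ⟨C₂, hC₂, H₂⟩ := exists_sphAbs_le ha.γ_gt ha.γ_lt
  refine ⟨(4 * C₁ + C₂) * 3, by positivity, fun φ h hE T o ht hx => ?_⟩
  set E := wEnergy p 1 γ φ with hEdef
  set A : ℝ := 3 * √E.toReal with hA
  have hA0 : 0 ≤ A := by positivity
  have hA2 : ofReal (A ^ 2) = ofReal 9 * E := by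
    rw [hA, mul_pow, sq_sqrt toReal_nonneg, ofReal_mul (by norm_num), ofReal_toReal hE]
    norm_num
  have le9 : ∀ {I J : ℝ≥0∞} {c : ℝ}, I ≤ ofReal c * J → c ≤ 9 → J ≤ E →
      I ≤ ofReal (A ^ 2) := fun hI hc hJ => by
    rw [hA2]
    exact hI.trans (mul_le_mul' (ofReal_le_ofReal hc) hJ)
  have S := setLIntegral_energy_le_wEnergy (p := p) (k := 1) (φ := φ) hγ.le {x : E3 | 1 < ‖x‖}
  have S' := setLIntegral_energy_one_le_wEnergy (p := p) (φ := φ) hγ.le le_rfl {x : E3 | 1 < ‖x‖}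
  have hdx : ∀ (i : Fin 3) (x : E3), dx i φ 0 x ^ 2 ≤ ‖fderiv ℝ (φ 0) x‖ ^ 2 := fun i x => by
    rw [← norm_iteratedFDeriv_one]
    exact sq_le_sq.2 ((abs_dx_le φ i 0 x).trans (le_abs_self _))
  have hdd : ∀ (i : Fin 3) (x : E3),
      ‖fderiv ℝ (dx i φ 0) x‖ ^ 2 ≤ 9 * ‖iteratedFDeriv ℝ 2 (φ 0) x‖ ^ 2 := fun i x => by
    have := pow_le_pow_left₀ (norm_nonneg _) (norm_fderiv_dx_le h i 0 x) 2
    rw [mul_pow] at this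
    linarith
  have cd : ∀ (n : ℕ) {f : Wave}, Smooth f → ContDiff ℝ n (f 0) := fun n f hf =>
    (hf.slice 0).of_le (by exact_mod_cast le_top)
  have d2 : ∀ i : Fin 3, ∫⁻ x in {x : E3 | 1 < ‖x‖}, ofReal (‖x‖ ^ (γ + 2) *
      ‖fderiv ℝ (dx i φ 0) x‖ ^ 2) ≤ ofReal (A ^ 2) := fun i =>
    le9 (setLIntegral_ofReal_mono_mul (c := 9) (by norm_num) fun x => by
      rw [mul_left_comm]
      refine mul_le_mul_of_nonneg_left ((hdd i x).trans ?_) (by positivity)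
      exact mul_le_mul_of_nonneg_left (le_add_of_nonneg_right (sq_nonneg _)) (by norm_num))
      le_rfl S'
  have i1 := H₁ (dt1 φ 0) (cd 1 h.dt1) A hA0
    (le9 (setLIntegral_ofReal_mono_mul (c := 1) zero_le_one fun x => by
      rw [one_mul]
      exact mul_le_mul_of_nonneg_left (le_add_of_nonneg_right (sq_nonneg _)) (by positivity))
      (by norm_num) S)
    (le9 (setLIntegral_ofReal_mono_mul (c := 1) zero_le_one fun x => by
      rw [one_mul]
      exact mul_le_mul_of_nonneg_left (le_add_of_nonneg_left (sq_nonneg _)) (by positivity))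
      (by norm_num) S') o T ht hx
  have i2 : ∀ i, _ := fun i => H₁ (dx i φ 0) (cd 1 (h.dx i)) A hA0
    (le9 (setLIntegral_ofReal_mono_mul (c := 1) zero_le_one fun x => by
      rw [one_mul]
      exact mul_le_mul_of_nonneg_left ((hdx i x).trans (le_add_of_nonneg_left (sq_nonneg _)))
        (by positivity)) (by norm_num) S) (d2 i) o T ht hx
  have i3 := H₂ (φ 0) (cd 2 h) A hA0
    (le9 (setLIntegral_hardy_le_wEnergy h hp hγ hE) (by
      rw [div_le_iff₀ hγ]; linarith [ha.γ_gt]) le_rfl)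
    (le9 (setLIntegral_ofReal_mono_mul (c := 1) zero_le_one fun x => by
      rw [one_mul]
      exact mul_le_mul_of_nonneg_left (le_add_of_nonneg_left (sq_nonneg _)) (by positivity))
      (by norm_num) S) d2 o T ht hx
  have hY := linDecay_nonneg (γ := γ) hx
  have hYK := linDecay_le_kAmp ha ht hx
  refine (add_le_add (add_le_add i1 i3) (sum_le_sum fun i _ => i2 i)).trans ?_
  rw [Finset.sum_const, Finset.card_univ, Fintype.card_fin, nsmul_eq_mul,
    ← ENNReal.ofReal_natCast, ← ofReal_mul (by positivity),
    ← ofReal_add (by positivity) (by positivity), ← ofReal_add (by positivity) (by positivity)]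
  refine ofReal_le_ofReal ?_
  have e : (4 * C₁ + C₂) * 3 * √E.toReal = (4 * C₁ + C₂) * A := by rw [hA]; ring
  rw [e]
  have := mul_le_mul_of_nonneg_left hYK (show 0 ≤ (4 * C₁ + C₂) * A by positivity)
  refine le_trans (le_of_eq ?_) this
  push_cast
  ring

end Linear

/-- The pointwise decay profile. -/
def supDecay (p ε : ℝ) (q : M4) : ℝ :=
  kAmp ((3 + ε) / (2 * (p - 1))) ((1 + ε) / (2 * (p - 1))) ‖q.2‖ (‖q.2‖ - q.1)

section Sup

variable {p γ ε : ℝ}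

lemma supDecay_pos {q : M4} (hq : q ∈ extReg) : 0 < supDecay p ε q :=
  kAmp_pos (by linarith [hq.1, hq.2]) (by linarith [hq.2])

/-- The part of the exterior region in the past of a light cone. -/
def extTrunc (R : ℝ) : Set M4 := {q | q ∈ extReg ∧ ‖q.2‖ + q.1 ≤ R}

lemma isCompact_extTrunc (R : ℝ) : IsCompact (extTrunc R) := by
  refine Metric.isCompact_of_isClosed_isBounded ?_ ?_
  · have h1 : IsClosed {q : M4 | 0 ≤ q.1} := isClosed_le (by fun_prop) (by fun_prop)
    have h2 : IsClosed {q : M4 | q.1 + 2 ≤ ‖q.2‖} := isClosed_le (by fun_prop) (by fun_prop)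
    have h3 : IsClosed {q : M4 | ‖q.2‖ + q.1 ≤ R} := isClosed_le (by fun_prop) (by fun_prop)
    exact (h1.inter h2).inter h3
  · refine (Metric.isBounded_closedBall (x := (0 : M4)) (r := R)).subset fun q hq => ?_
    obtain ⟨⟨h0, h2⟩, h3⟩ := hq
    rw [mem_closedBall_zero_iff, Prod.norm_def, max_le_iff, norm_eq_abs, abs_of_nonneg h0]
    exact ⟨by linarith [norm_nonneg q.2], by linarith⟩

lemma mem_extTrunc_of_cone {R T : ℝ} {o x : E3} (h : (T, o) ∈ extTrunc R)
    (hx : x ∈ ball o T) : (T - ‖x - o‖, x) ∈ extTrunc R := by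
  obtain ⟨⟨h0, h2⟩, h3⟩ := h
  have hs : ‖x - o‖ < T := by simpa [dist_eq_norm] using hx
  have e1 : ‖o‖ - ‖x‖ ≤ ‖x - o‖ := by rw [norm_sub_rev]; exact norm_sub_norm_le _ _
  have e2 : ‖x‖ - ‖o‖ ≤ ‖x - o‖ := norm_sub_norm_le _ _
  simp only at h0 h2 h3
  exact ⟨⟨by simp only; linarith, by simp only; linarith⟩, by simp only; linarith⟩

lemma exists_abs_le_supDecay (ha : Adm p γ ε) {B : ℝ} (hB : 0 ≤ B) :
    ∃ C : ℝ, 0 ≤ C ∧ ∀ φ : Wave, IsNLWSolution p φ →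
      wEnergy p 0 γ φ ≤ ofReal B → wEnergy p 1 γ φ ≠ ⊤ → ∀ q ∈ extReg,
        |φ q.1 q.2| ≤ C * (1 + √(wEnergy p 1 γ φ).toReal) * supDecay p ε q := by
  have hp : 1 < p := by linarith [ha.p_gt]
  obtain ⟨a, ha0, ha1, hcone⟩ := ha.exists_coneExp
  obtain ⟨CI, hCI, HI⟩ := exists_initial_energy_le ha 0
  obtain ⟨CL, hCL, HL⟩ := exists_linear_cone_le ha
  obtain ⟨CN, hCN, HN⟩ := nonlinear_cone_le hcone hp rfl rfl
  have hs := sphMass_pos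
  set F : ℝ := (p + 1) * (CI * B) with hF
  have hF0 : 0 ≤ F := by positivity
  set b : ℝ := CN * F ^ ((p - a) / (p + 1)) / sphMass with hb
  have hb0 : 0 ≤ b := by positivity
  have hP : 0 ≤ (2 * b) ^ (1 / (1 - a)) := by positivity
  have hL : 0 ≤ 2 * (CL / sphMass) := by positivity
  refine ⟨2 * (CL / sphMass) + (2 * b) ^ (1 / (1 - a)), by positivity, fun φ h hE0 hE1 q hq => ?_⟩
  set E := (wEnergy p 1 γ φ).toReal
  obtain ⟨z, hz, hmax⟩ := (isCompact_extTrunc (‖q.2‖ + q.1)).exists_isMaxOn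
    (f := fun q => |φ q.1 q.2| / supDecay p ε q) ⟨q, hq, le_rfl⟩ (by
      refine h.smooth.continuous.abs.continuousOn.div ?_ fun y hy => (supDecay_pos hy.1).ne'
      refine ContinuousOn.mul ?_ ?_
      · exact continuous_snd.norm.continuousOn.rpow_const fun y hy =>
          Or.inl (norm_ne_zero_iff.2 (ne_zero_of_mem_extDom (extReg_subset_extDom hy.1)))
      · exact (continuous_snd.norm.sub continuous_fst).continuousOn.rpow_const fun y hy =>
          Or.inl (u_pos_of_mem (extReg_subset_extDom hy.1)).ne')
  set M := |φ z.1 z.2| / supDecay p ε z with hM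
  have hM0 : 0 ≤ M := div_nonneg (abs_nonneg _) (supDecay_pos hz.1).le
  have hle : ∀ y ∈ extTrunc (‖q.2‖ + q.1), |φ y.1 y.2| ≤ M * supDecay p ε y := fun y hy =>
    (div_le_iff₀ (supDecay_pos hy.1)).1 (hmax hy)
  have hK := supDecay_pos (p := p) (ε := ε) hz.1
  have hflux : ∫⁻ x in ball z.2 z.1,
      ofReal (coneW γ z.2 x * |φ (z.1 - ‖x - z.2‖) x| ^ (p + 1)) ≤ ofReal F := by
    refine (cone_potential_le ha h hz.1.1 hz.1.2).trans ?_
    rw [hF, ofReal_mul (by linarith), ofReal_mul hCI]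
    refine mul_le_mul' le_rfl ((HI φ h.smooth (ne_top_of_le_ne_top ofReal_ne_top
      hE0)).trans (mul_le_mul' le_rfl hE0))
  have hN := HN z.1 z.2 hz.1.1 hz.1.2 (fun x => φ (z.1 - ‖x - z.2‖) x)
    ((h.smooth.continuous.comp (by fun_prop : Continuous fun x : E3 =>
      (z.1 - ‖x - z.2‖, x))).measurable) M F hM0 hF0
    (fun x hx => hle _ (mem_extTrunc_of_cone hz hx)) hflux
  have hLz := HL φ h.smooth hE1 z.1 z.2 hz.1.1 hz.1.2
  have hkir := (ofReal_abs_le_kirchhoff hp h hz.1.1 z.2).trans (add_le_add hLz hN)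
  change _ ≤ ofReal (CL * √E * supDecay p ε z) +
    ofReal (CN * M ^ a * F ^ ((p - a) / (p + 1)) * supDecay p ε z) at hkir
  rw [← ofReal_add (by positivity) (by positivity),
    ENNReal.ofReal_le_ofReal_iff (by positivity)] at hkir
  have hφz : |φ z.1 z.2| = M * supDecay p ε z := by rw [hM, div_mul_cancel₀ _ hK.ne']
  have hMle : M ≤ CL / sphMass * √E + b * M ^ a := by
    have e : sphMass * M ≤ CL * √E + CN * F ^ ((p - a) / (p + 1)) * M ^ a := by
      refine le_of_mul_le_mul_right ?_ hK
      rw [hφz] at hkir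
      linarith
    have e2 : CL / sphMass * √E + b * M ^ a =
        (CL * √E + CN * F ^ ((p - a) / (p + 1)) * M ^ a) / sphMass := by
      rw [hb]; ring
    rw [e2, le_div_iff₀ hs]
    linarith
  have hfin := le_of_le_add_mul_rpow hM0 (by positivity) hb0 ha1 hMle
  refine (hle q ⟨hq, le_rfl⟩).trans (mul_le_mul_of_nonneg_right ?_ (supDecay_pos hq).le)
  have hsE : 0 ≤ √E := sqrt_nonneg _
  have x1 := mul_nonneg hP hsE
  linarith

end Sup

/-- Coefficients of a Killing field `(a + α·x) ∂_t + (b + t α + S x)·∇` of Minkowski space, of size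
at most one. -/
structure Killing where
  a : ℝ
  α : Fin 3 → ℝ
  b : Fin 3 → ℝ
  S : Fin 3 → Fin 3 → ℝ
  skew : ∀ i j, S i j = -S j i
  a_le : |a| ≤ 1
  α_le : ∀ i, |α i| ≤ 1
  b_le : ∀ i, |b i| ≤ 1
  S_le : ∀ i j, |S i j| ≤ 1

namespace Killing

/-- Time coefficient. -/
def tc (Z : Killing) (x : E3) : ℝ := Z.a + ∑ i, Z.α i * x i

/-- Space coefficients. -/
def xc (Z : Killing) (j : Fin 3) (t : ℝ) (x : E3) : ℝ := Z.b j + t * Z.α j + ∑ k, Z.S j k * x k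

/-- The action on functions. -/
def act (Z : Killing) (ψ : Wave) (t : ℝ) (x : E3) : ℝ :=
  Z.tc x * dt1 ψ t x + ∑ j, Z.xc j t x * dx j ψ t x

end Killing

section Commute

variable {φ ψ : Wave} (Z : Killing)

lemma hasDerivAt_coord_line (x : E3) (i k : Fin 3) (s : ℝ) :
    HasDerivAt (fun s : ℝ => (x + s • e3 i) k) (if k = i then 1 else 0) s := by
  have : (fun s : ℝ => (x + s • e3 i) k) = fun s => x k + s * (if k = i then 1 else 0) := by
    ext s; simp [e3_apply]
  rw [this]
  simpa using ((hasDerivAt_id s).mul_const (if k = i then (1 : ℝ) else 0)).const_add (x k)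

lemma Smooth.hasDerivAt_x (h : Smooth ψ) (i : Fin 3) (t : ℝ) (x : E3) :
    HasDerivAt (fun s : ℝ => ψ t (x + s • e3 i)) (_root_.dx i ψ t x) 0 := by
  have h1 := h.hasDerivAt_comp (hasDerivAt_const (0 : ℝ) t)
    (((hasDerivAt_id (0 : ℝ)).smul_const (e3 i)).const_add x)
  refine h1.congr_deriv ?_
  simp [e3_apply]

lemma Smooth.dx_eq_of_hasDerivAt (h : Smooth ψ) {i : Fin 3} {t d : ℝ} {x : E3}
    (hd : HasDerivAt (fun s : ℝ => ψ t (x + s • e3 i)) d 0) : _root_.dx i ψ t x = d :=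
  (h.hasDerivAt_x i t x).unique hd

lemma Smooth.killing (h : Smooth ψ) : Smooth (Z.act ψ) := by
  have hT := h.dt1
  have hX := fun j => h.dx j
  unfold Smooth at hT hX ⊢
  unfold Killing.act Killing.tc Killing.xc
  refine ContDiff.add (ContDiff.mul ?_ hT) (ContDiff.sum fun j _ => ContDiff.mul ?_ (hX j))
  · exact contDiff_const.add (ContDiff.sum fun i _ => contDiff_const.mul (by fun_prop))
  · exact (contDiff_const.add (contDiff_fst.mul contDiff_const)).add
      (ContDiff.sum fun i _ => contDiff_const.mul (by fun_prop))

lemma hasDerivAt_xc_t (j : Fin 3) (t : ℝ) (x : E3) :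
    HasDerivAt (fun s => Z.xc j s x) (Z.α j) t := by
  simpa [Killing.xc] using
    (((hasDerivAt_id t).mul_const (Z.α j)).const_add (Z.b j)).add_const (∑ k, Z.S j k * x k)

lemma hasDerivAt_tc_x (i : Fin 3) (x : E3) :
    HasDerivAt (fun s : ℝ => Z.tc (x + s • e3 i)) (Z.α i) 0 := by
  have h := (HasDerivAt.fun_sum (u := Finset.univ) fun k _ =>
    (hasDerivAt_coord_line x i k 0).const_mul (Z.α k)).const_add Z.a
  refine h.congr_deriv ?_
  simp

lemma hasDerivAt_xc_x (i j : Fin 3) (t : ℝ) (x : E3) :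
    HasDerivAt (fun s : ℝ => Z.xc j t (x + s • e3 i)) (Z.S j i) 0 := by
  have h := (HasDerivAt.fun_sum (u := Finset.univ) fun k _ =>
    (hasDerivAt_coord_line x i k 0).const_mul (Z.S j k)).const_add (Z.b j + t * Z.α j)
  refine h.congr_deriv ?_
  simp

lemma dt1_killing (h : Smooth ψ) (t : ℝ) (x : E3) :
    dt1 (Z.act ψ) t x = (∑ j, Z.α j * dx j ψ t x) + Z.act (dt1 ψ) t x := by
  have h1 : HasDerivAt (fun s => Z.act ψ s x) _ t := (((h.dt1.hasDerivAt_t t x).const_mul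
    (Z.tc x)).add (HasDerivAt.fun_sum (u := Finset.univ) fun j _ =>
      (hasDerivAt_xc_t Z j t x).mul ((h.dx j).hasDerivAt_t t x)))
  rw [show dt1 (Z.act ψ) t x = _ from h1.deriv]
  simp only [Killing.act, h.dt1_dx, sum_add_distrib]
  ring

lemma dx_killing (h : Smooth ψ) (i : Fin 3) (t : ℝ) (x : E3) :
    dx i (Z.act ψ) t x = Z.α i * dt1 ψ t x + (∑ j, Z.S j i * dx j ψ t x) + Z.act (dx i ψ) t x := by
  have h1 : HasDerivAt (fun s : ℝ => Z.act ψ t (x + s • e3 i)) _ 0 :=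
    ((hasDerivAt_tc_x Z i x).mul (h.dt1.hasDerivAt_x i t x)).add
    (HasDerivAt.fun_sum (u := Finset.univ) fun j _ =>
      (hasDerivAt_xc_x Z i j t x).mul ((h.dx j).hasDerivAt_x i t x))
  rw [(h.killing Z).dx_eq_of_hasDerivAt h1]
  simp only [Killing.act, h.dt1_dx, zero_smul, add_zero, sum_add_distrib, h.dx_comm i]
  ring

lemma Smooth.sum_mul {f : Fin 3 → Wave} (hf : ∀ i, Smooth (f i)) (c : Fin 3 → ℝ) :
    Smooth (fun t x => ∑ i, c i * f i t x) :=
  ContDiff.sum fun i _ => contDiff_const.mul (hf i)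

lemma Smooth.dx_sum_mul {f : Fin 3 → Wave} (hf : ∀ i, Smooth (f i)) (c : Fin 3 → ℝ)
    (j : Fin 3) (t : ℝ) (x : E3) : _root_.dx j (fun t x => ∑ i, c i * f i t x) t x =
      ∑ i, c i * _root_.dx j (f i) t x :=
  (Smooth.sum_mul hf c).dx_eq_of_hasDerivAt (HasDerivAt.fun_sum (u := Finset.univ) fun i _ =>
    ((hf i).hasDerivAt_x j t x).const_mul (c i))

lemma Smooth.add {f g : Wave} (hf : Smooth f) (hg : Smooth g) :
    Smooth (fun t x => f t x + g t x) := ContDiff.add hf hg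

lemma Smooth.const_mul {f : Wave} (hf : Smooth f) (c : ℝ) :
    Smooth (fun t x => c * f t x) := ContDiff.mul contDiff_const hf

lemma Smooth.dx_add {f g : Wave} (hf : Smooth f) (hg : Smooth g) (j : Fin 3) (t : ℝ)
    (x : E3) : _root_.dx j (fun t x => f t x + g t x) t x = _root_.dx j f t x + _root_.dx j g t x :=
  (hf.add hg).dx_eq_of_hasDerivAt ((hf.hasDerivAt_x j t x).add (hg.hasDerivAt_x j t x))

lemma Smooth.dx_const_mul {f : Wave} (hf : Smooth f) (c : ℝ) (j : Fin 3) (t : ℝ)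
    (x : E3) : _root_.dx j (fun t x => c * f t x) t x = c * _root_.dx j f t x :=
  (hf.const_mul c).dx_eq_of_hasDerivAt ((hf.hasDerivAt_x j t x).const_mul c)

lemma dtt_killing (h : Smooth ψ) (t : ℝ) (x : E3) :
    dtt (Z.act ψ) t x = 2 * (∑ j, Z.α j * dx j (dt1 ψ) t x) + Z.act (dt1 (dt1 ψ)) t x := by
  have e : dt1 (Z.act ψ) = fun t x => (∑ j, Z.α j * dx j ψ t x) + Z.act (dt1 ψ) t x := by
    ext t x; exact dt1_killing Z h t x
  have h1 := (HasDerivAt.fun_sum (u := Finset.univ) fun i _ =>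
    ((h.dx i).hasDerivAt_t t x).const_mul (Z.α i)).add ((h.dt1.killing Z).hasDerivAt_t t x)
  rw [dtt_eq, e, show dt1 (fun t x => (∑ j, Z.α j * dx j ψ t x) + Z.act (dt1 ψ) t x) t x = _
    from h1.deriv, dt1_killing Z h.dt1]
  simp only [h.dt1_dx]
  ring

lemma dx_dx_killing (h : Smooth ψ) (i : Fin 3) (t : ℝ) (x : E3) :
    dx i (dx i (Z.act ψ)) t x = 2 * (Z.α i * dx i (dt1 ψ) t x) +
      2 * (∑ j, Z.S j i * dx i (dx j ψ) t x) + Z.act (dx i (dx i ψ)) t x := by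
  have e : dx i (Z.act ψ) = fun t x => (Z.α i * dt1 ψ t x + (∑ j, Z.S j i * dx j ψ t x)) +
      Z.act (dx i ψ) t x := by
    ext t x; exact dx_killing Z h i t x
  have s1 := h.dt1.const_mul (Z.α i)
  have s2 := Smooth.sum_mul h.dx (fun j => Z.S j i)
  rw [e, (s1.add s2).dx_add ((h.dx i).killing Z), s1.dx_add s2, h.dt1.dx_const_mul,
    Smooth.dx_sum_mul h.dx, dx_killing Z (h.dx i), h.dt1_dx]
  simp only [h.dx_comm i]
  ring

lemma lap3_sub_dtt_killing (h : Smooth ψ) (t : ℝ) (x : E3) :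
    lap3 (Z.act ψ t) x - dtt (Z.act ψ) t x =
      (∑ i, Z.act (dx i (dx i ψ)) t x) - Z.act (dt1 (dt1 ψ)) t x := by
  rw [lap3_eq, dtt_killing Z h]
  simp only [dx_dx_killing Z h, Fin.sum_univ_three]
  have d : ∀ i, Z.S i i = 0 := fun i => by linarith [Z.skew i i]
  rw [h.dx_comm 1 0, h.dx_comm 2 0, h.dx_comm 2 1, Z.skew 1 0, Z.skew 2 0, Z.skew 2 1,
    d 0, d 1, d 2]
  ring

end Commute

section Equation

variable {p : ℝ} {φ : Wave} (Z : Killing)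

lemma hasDerivAt_abs_rpow_mul (hp : 2 < p) {f : ℝ → ℝ} {f' s : ℝ} (hf : HasDerivAt f f' s) :
    HasDerivAt (fun s => |f s| ^ (p - 1) * f s) (p * |f s| ^ (p - 1) * f') s := by
  have h1 := ((hasDerivAt_abs_rpow (f s) (p := p - 1) (by linarith)).comp s hf).mul hf
  refine h1.congr_deriv ?_
  simp only [Function.comp]
  rcases eq_or_ne (f s) 0 with h0 | h0
  · have e0 : (0 : ℝ) ^ (p - 1) = 0 := Real.zero_rpow (by linarith)
    rw [h0, abs_zero, e0]; ring
  · have hpos : 0 < |f s| := abs_pos.2 h0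
    have e : |f s| ^ (p - 1) = |f s| ^ (p - 1 - 2) * f s ^ 2 := by
      rw [← sq_abs (f s), ← rpow_two, ← rpow_add hpos]
      congr 1; ring
    rw [e]; ring

lemma killing_equation (hp : 2 < p) (h : IsNLWSolution p φ) {t : ℝ} (ht : 0 ≤ t) (x : E3) :
    lap3 (Z.act φ t) x - dtt (Z.act φ) t x = p * |φ t x| ^ (p - 1) * Z.act φ t x := by
  have hs := h.smooth
  have hdd : ∀ i, Smooth (dx i (dx i φ)) := fun i => (hs.dx i).dx i
  have htt := hs.dt1.dt1
  have eqn : ∀ s, 0 ≤ s → ∀ y, (∑ i, dx i (dx i φ) s y) - dt1 (dt1 φ) s y =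
      |φ s y| ^ (p - 1) * φ s y := fun s hs y => by
    have := h.2 s hs y
    rw [lap3_eq, dtt_eq] at this
    linarith
  have e1 : (∑ i, dt1 (dx i (dx i φ)) t x) - dt1 (dt1 (dt1 φ)) t x =
      p * |φ t x| ^ (p - 1) * dt1 φ t x := by
    have a1 := (HasDerivAt.fun_sum (u := Finset.univ) fun i _ =>
      (hdd i).hasDerivAt_t t x).sub (htt.hasDerivAt_t t x)
    have a2 := hasDerivAt_abs_rpow_mul hp (hs.hasDerivAt_t t x)
    have a3 : HasDerivWithinAt (fun s => |φ s x| ^ (p - 1) * φ s x) _ (Set.Ici t) t :=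
      a1.hasDerivWithinAt.congr (fun s hs => (eqn s (ht.trans hs) x).symm) (eqn t ht x).symm
    exact (uniqueDiffWithinAt_Ici t).eq_deriv _ a3 a2.hasDerivWithinAt
  have e2 : ∀ j, (∑ i, dx j (dx i (dx i φ)) t x) - dx j (dt1 (dt1 φ)) t x =
      p * |φ t x| ^ (p - 1) * dx j φ t x := fun j => by
    have a1 := (HasDerivAt.fun_sum (u := Finset.univ) fun i _ =>
      (hdd i).hasDerivAt_x j t x).sub (htt.hasDerivAt_x j t x)
    have a2 := hasDerivAt_abs_rpow_mul hp (hs.hasDerivAt_x j t x)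
    have a3 := a1.congr_of_eventuallyEq (Eventually.of_forall fun s =>
      (eqn t ht (x + s • e3 j)).symm)
    have := a3.unique a2
    rw [this, zero_smul, add_zero]
  rw [lap3_sub_dtt_killing Z hs]
  simp only [Killing.act, Fin.sum_univ_three] at e1 e2 ⊢
  linear_combination Z.tc x * e1 + Z.xc 0 t x * e2 0 + Z.xc 1 t x * e2 1 + Z.xc 2 t x * e2 2

end Equation

section KillingPointwise

variable {p γ ε : ℝ} {φ ψ : Wave}

lemma sq_sum_le_three (f : Fin 3 → ℝ) : (∑ i, f i) ^ 2 ≤ 3 * ∑ i, f i ^ 2 := by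
  simp only [Fin.sum_univ_three]
  nlinarith [sq_nonneg (f 0 - f 1), sq_nonneg (f 0 - f 2), sq_nonneg (f 1 - f 2)]

lemma abs_sum_mul_le_two_norm {a : Fin 3 → ℝ} (ha : ∀ i, |a i| ≤ 1) (x : E3) :
    |∑ i, a i * x i| ≤ 2 * ‖x‖ := by
  refine abs_le_of_sq_le_sq ?_ (by positivity)
  have h1 := sq_sum_le_three fun i => a i * x i
  have h2 : ∑ i, (a i * x i) ^ 2 ≤ ∑ i, x i ^ 2 := sum_le_sum fun i _ => by
    rw [mul_pow]
    have : a i ^ 2 ≤ 1 := (sq_le_one_iff_abs_le_one _).2 (ha i)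
    nlinarith [sq_nonneg (x i)]
  rw [← norm_sq_E3] at h2
  nlinarith [sq_nonneg ‖x‖]

lemma angSq_eq_sum {q : M4} (hq : q.2 ≠ 0) (ψ : Wave) :
    angSq ψ q = ∑ j, (dx j ψ q.1 q.2 - rdot ψ q / ‖q.2‖ ^ 2 * q.2 j) ^ 2 := by
  have hr : ‖q.2‖ ≠ 0 := norm_ne_zero_iff.2 hq
  have h1 := norm_sq_E3 q.2
  have h2 : rdot ψ q = ∑ i, q.2 i * dx i ψ q.1 q.2 := rfl
  have h3 : gradSq ψ q = ∑ i, dx i ψ q.1 q.2 ^ 2 := rfl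
  have h4 : ∀ c : ℝ, ∑ j, (dx j ψ q.1 q.2 - c * q.2 j) ^ 2 =
      gradSq ψ q - 2 * c * rdot ψ q + c ^ 2 * ‖q.2‖ ^ 2 := fun c => by
    rw [h3, h1, h2]
    simp only [Fin.sum_univ_three]
    ring
  rw [h4, angSq]
  field_simp
  ring

lemma killing_decomp (Z : Killing) {q : M4} (hq : q.2 ≠ 0) (φ : Wave) : Z.act φ q.1 q.2 =
      (Z.a / 2 + (∑ i, Z.b i * q.2 i) / ‖q.2‖ / 2 +
          (∑ i, Z.α i * q.2 i) / ‖q.2‖ * (‖q.2‖ + q.1) / 2) * (dt1 φ q.1 q.2 + wrad φ q) +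
        (Z.a / 2 - (∑ i, Z.b i * q.2 i) / ‖q.2‖ / 2 +
          (∑ i, Z.α i * q.2 i) / ‖q.2‖ * (‖q.2‖ - q.1) / 2) * (dt1 φ q.1 q.2 - wrad φ q) -
        ((∑ i, Z.b i * q.2 i) / ‖q.2‖ / ‖q.2‖ +
          (∑ i, Z.α i * q.2 i) / ‖q.2‖ * (q.1 / ‖q.2‖)) * φ q.1 q.2 +
        ∑ j, Z.xc j q.1 q.2 * (dx j φ q.1 q.2 - rdot φ q / ‖q.2‖ ^ 2 * q.2 j) := by
  have hr : ‖q.2‖ ≠ 0 := norm_ne_zero_iff.2 hq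
  have d : ∀ i, Z.S i i = 0 := fun i => by linarith [Z.skew i i]
  have h1 : ∑ j, Z.xc j q.1 q.2 * q.2 j = (∑ i, Z.b i * q.2 i) + q.1 * ∑ i, Z.α i * q.2 i := by
    simp only [Killing.xc, Fin.sum_univ_three, Z.skew 1 0, Z.skew 2 0, Z.skew 2 1, d]
    ring
  have h2 : ∑ j, Z.xc j q.1 q.2 * (dx j φ q.1 q.2 - rdot φ q / ‖q.2‖ ^ 2 * q.2 j) =
      (∑ j, Z.xc j q.1 q.2 * dx j φ q.1 q.2) -
        rdot φ q / ‖q.2‖ ^ 2 * ∑ j, Z.xc j q.1 q.2 * q.2 j := by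
    simp only [Fin.sum_univ_three]; ring
  rw [h2, h1, Killing.act, Killing.tc, wrad]
  field_simp
  ring

lemma abs_xc_le (Z : Killing) (j : Fin 3) {q : M4} (hq : q ∈ extReg) :
    |Z.xc j q.1 q.2| ≤ 3 * ‖q.2‖ := by
  have h1 := abs_sum_mul_le_two_norm (Z.S_le j) q.2
  have h2 : |q.1 * Z.α j| ≤ q.1 := by
    rw [abs_mul, abs_of_nonneg hq.1]
    exact mul_le_of_le_one_right hq.1 (Z.α_le j)
  have h3 := abs_add_three (Z.b j) (q.1 * Z.α j) (∑ k, Z.S j k * q.2 k)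
  have h4 := Z.b_le j
  have h5 := hq.2
  rw [Killing.xc]
  linarith

lemma killing_sq_le (Z : Killing) {q : M4} (hq : q ∈ extReg) (φ : Wave) :
    Z.act φ q.1 q.2 ^ 2 ≤ 256 * (‖q.2‖ ^ 2 * (dt1 φ q.1 q.2 + wrad φ q) ^ 2 +
      (‖q.2‖ - q.1) ^ 2 * (dt1 φ q.1 q.2 - wrad φ q) ^ 2 + ‖q.2‖ ^ 2 * angSq φ q +
      φ q.1 q.2 ^ 2) := by
  have hx : q.2 ≠ 0 := ne_zero_of_mem_extDom (extReg_subset_extDom hq)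
  have hrpos : 0 < ‖q.2‖ := norm_pos_iff.2 hx
  obtain ⟨ht, hu⟩ := hq
  set r := ‖q.2‖
  have hn : |(∑ i, Z.b i * q.2 i) / r| ≤ 2 := by
    rw [abs_div, abs_of_pos hrpos, div_le_iff₀ hrpos]
    exact abs_sum_mul_le_two_norm Z.b_le q.2
  have hm : |(∑ i, Z.α i * q.2 i) / r| ≤ 2 := by
    rw [abs_div, abs_of_pos hrpos, div_le_iff₀ hrpos]
    exact abs_sum_mul_le_two_norm Z.α_le q.2
  have hA : (∑ j, Z.xc j q.1 q.2 * (dx j φ q.1 q.2 - rdot φ q / r ^ 2 * q.2 j)) ^ 2 ≤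
      27 * (r ^ 2 * angSq φ q) := by
    refine (sq_sum_le_three _).trans ?_
    rw [angSq_eq_sum hx, mul_sum, mul_sum, mul_sum]
    refine sum_le_sum fun j _ => ?_
    rw [mul_pow]
    have h1 : Z.xc j q.1 q.2 ^ 2 ≤ (3 * r) ^ 2 := sq_le_sq' (by
      linarith [neg_abs_le (Z.xc j q.1 q.2), abs_xc_le Z j ⟨ht, hu⟩]) (by
      linarith [le_abs_self (Z.xc j q.1 q.2), abs_xc_le Z j ⟨ht, hu⟩])
    have h2 := mul_le_mul_of_nonneg_right h1
      (sq_nonneg (dx j φ q.1 q.2 - rdot φ q / r ^ 2 * q.2 j))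
    change 3 * _ ≤ 27 * (r ^ 2 * _)
    linarith
  rw [killing_decomp Z hx]
  change ((Z.a / 2 + (∑ i, Z.b i * q.2 i) / r / 2 +
          (∑ i, Z.α i * q.2 i) / r * (r + q.1) / 2) * (dt1 φ q.1 q.2 + wrad φ q) +
        (Z.a / 2 - (∑ i, Z.b i * q.2 i) / r / 2 +
          (∑ i, Z.α i * q.2 i) / r * (r - q.1) / 2) * (dt1 φ q.1 q.2 - wrad φ q) -
        ((∑ i, Z.b i * q.2 i) / r / r + (∑ i, Z.α i * q.2 i) / r * (q.1 / r)) * φ q.1 q.2 +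
        ∑ j, Z.xc j q.1 q.2 * (dx j φ q.1 q.2 - rdot φ q / r ^ 2 * q.2 j)) ^ 2 ≤ _
  revert hA
  generalize (∑ i, Z.b i * q.2 i) / r = n at *
  generalize (∑ i, Z.α i * q.2 i) / r = m at *
  generalize ∑ j, Z.xc j q.1 q.2 * (dx j φ q.1 q.2 - rdot φ q / r ^ 2 * q.2 j) = S
  generalize dt1 φ q.1 q.2 + wrad φ q = L
  generalize dt1 φ q.1 q.2 - wrad φ q = K
  intro hA
  have ha := abs_le.1 Z.a_le
  rw [abs_le] at hn hm
  have b1 : (Z.a / 2 + n / 2 + m * (r + q.1) / 2) ^ 2 ≤ (4 * r) ^ 2 :=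
    sq_le_sq' (by nlinarith) (by nlinarith)
  have b2 : (Z.a / 2 - n / 2 + m * (r - q.1) / 2) ^ 2 ≤ (4 * (r - q.1)) ^ 2 :=
    sq_le_sq' (by nlinarith) (by nlinarith)
  have b3 : (n / r + m * (q.1 / r)) ^ 2 ≤ 4 ^ 2 := by
    have e : n / r + m * (q.1 / r) = (n + m * q.1) / r := by ring
    rw [e]
    refine sq_le_sq' ?_ ?_
    · rw [le_div_iff₀ hrpos]; nlinarith
    · rw [div_le_iff₀ hrpos]; nlinarith
  have c1 := mul_le_mul_of_nonneg_right b1 (sq_nonneg L)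
  have c2 := mul_le_mul_of_nonneg_right b2 (sq_nonneg K)
  have c3 := mul_le_mul_of_nonneg_right b3 (sq_nonneg (φ q.1 q.2))
  rw [← mul_pow] at c1 c2 c3
  have four : ∀ a b c d : ℝ, (a + b - c + d) ^ 2 ≤ 4 * (a ^ 2 + b ^ 2 + c ^ 2 + d ^ 2) :=
    fun a b c d => by
      nlinarith [sq_nonneg (a - b), sq_nonneg (a + c), sq_nonneg (a - d), sq_nonneg (b + c),
        sq_nonneg (b - d), sq_nonneg (c + d)]
  have hang : 0 ≤ r ^ 2 * angSq φ q := by nlinarith [sq_nonneg S]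
  refine (four _ _ _ _).trans ?_
  linarith [mul_nonneg (sq_nonneg r) (sq_nonneg L), mul_nonneg (sq_nonneg (r - q.1)) (sq_nonneg K),
    sq_nonneg (φ q.1 q.2)]

end KillingPointwise

section Absorption

variable {p γ ε : ℝ} {φ ψ : Wave}

lemma divST_add_const_mul {J0 K0 : M4 → ℝ} {J K : Fin 3 → M4 → ℝ} {q : M4} (l : ℝ)
    (h0 : DifferentiableAt ℝ J0 q) (k0 : DifferentiableAt ℝ K0 q)
    (h : ∀ i, DifferentiableAt ℝ (J i) q) (k : ∀ i, DifferentiableAt ℝ (K i) q) :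
    divST (fun q => J0 q + l * K0 q) (fun i q => J i q + l * K i q) q =
      divST J0 J q + l * divST K0 K q := by
  have e0 : fderiv ℝ (fun q => J0 q + l * K0 q) q = fderiv ℝ J0 q + l • fderiv ℝ K0 q :=
    (h0.hasFDerivAt.fun_add (k0.hasFDerivAt.const_mul l)).fderiv
  have e1 : ∀ i, fderiv ℝ (fun q => J i q + l * K i q) q = fderiv ℝ (J i) q + l • fderiv ℝ (K i) q :=
    fun i => ((h i).hasFDerivAt.fun_add ((k i).hasFDerivAt.const_mul l)).fderiv
  simp only [divST, e0, e1, _root_.add_apply, _root_.smul_apply, smul_eq_mul, Fin.sum_univ_three]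
  ring

lemma neg_mul_le_young {e : ℝ} (he : 0 < e) (x L : ℝ) : -(x * L) ≤ e * L ^ 2 + x ^ 2 / (4 * e) := by
  have h : 0 ≤ (2 * e * L + x) ^ 2 / (4 * e) := by positivity
  have h2 : (2 * e * L + x) ^ 2 / (4 * e) = e * L ^ 2 + x * L + x ^ 2 / (4 * e) := by
    field_simp; ring
  linarith

lemma source_young (ha : Adm p γ ε) {q : M4} (hq : q ∈ extReg) (G L K : ℝ) :
    -G * (wt1 p γ ε q * L + wt2 γ ε q * K) ≤ ε * (‖q.2‖ ^ γ * (‖q.2‖ - q.1) ^ (-ε - 1)) * L ^ 2 +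
        ε / 4 * (‖q.2‖ ^ (-ε - 1) * (‖q.2‖ - q.1) ^ γ) * K ^ 2 +
        (wAmp p γ ^ 2 / 4 + 4) / ε * (‖q.2‖ ^ γ * (‖q.2‖ - q.1) ^ (1 + ε) * G ^ 2) := by
  have hu : 0 < ‖q.2‖ - q.1 := u_pos_of_mem (extReg_subset_extDom hq)
  have hu2 : 2 ≤ ‖q.2‖ - q.1 := by linarith [hq.2]
  have hur : ‖q.2‖ - q.1 ≤ ‖q.2‖ := by linarith [hq.1]
  have hε := ha.ε_pos
  have w1 := wt1_le ha hq
  have w2 := wt2_le ha hq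
  have w1n := wt1_nonneg ha hq
  have w2n := wt2_nonneg ha hq
  set r := ‖q.2‖
  set u := r - q.1
  have hr : 0 < r := by linarith
  have y1 := neg_mul_le_young (show 0 < ε * (r ^ γ * u ^ (-ε - 1)) by positivity) (G * wt1 p γ ε q) L
  have y2 := neg_mul_le_young (show 0 < ε / 4 * (r ^ (-ε - 1) * u ^ γ) by positivity)
    (G * wt2 γ ε q) K
  have ui : u ^ (1 + ε) * u ^ (-ε - 1) = 1 := by
    rw [← rpow_add hu, ← rpow_zero u]; congr 1; ring
  have ri : r ^ (1 + ε) * r ^ (-ε - 1) = 1 := by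
    rw [← rpow_add hr, ← rpow_zero r]; congr 1; ring
  have z1 : (G * wt1 p γ ε q) ^ 2 / (4 * (ε * (r ^ γ * u ^ (-ε - 1)))) ≤
      wAmp p γ ^ 2 / 4 / ε * (r ^ γ * u ^ (1 + ε) * G ^ 2) := by
    rw [div_le_iff₀ (by positivity)]
    have e : wAmp p γ ^ 2 / 4 / ε * (r ^ γ * u ^ (1 + ε) * G ^ 2) *
        (4 * (ε * (r ^ γ * u ^ (-ε - 1)))) =
        (wAmp p γ * r ^ γ) ^ 2 * G ^ 2 * (u ^ (1 + ε) * u ^ (-ε - 1)) := by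
      field_simp
    rw [e, ui, mul_one, mul_pow, mul_comm]
    exact mul_le_mul_of_nonneg_right (pow_le_pow_left₀ w1n w1 2) (sq_nonneg G)
  have z2 : (G * wt2 γ ε q) ^ 2 / (4 * (ε / 4 * (r ^ (-ε - 1) * u ^ γ))) ≤
      4 / ε * (r ^ γ * u ^ (1 + ε) * G ^ 2) := by
    have s1 : (G * wt2 γ ε q) ^ 2 / (4 * (ε / 4 * (r ^ (-ε - 1) * u ^ γ))) ≤
        4 / ε * (r ^ (1 + ε) * u ^ γ * G ^ 2) := by
      rw [div_le_iff₀ (by positivity)]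
      have e : 4 / ε * (r ^ (1 + ε) * u ^ γ * G ^ 2) * (4 * (ε / 4 * (r ^ (-ε - 1) * u ^ γ))) =
          (2 * u ^ γ) ^ 2 * G ^ 2 * (r ^ (1 + ε) * r ^ (-ε - 1)) := by
        field_simp; ring
      rw [e, ri, mul_one, mul_pow, mul_comm]
      exact mul_le_mul_of_nonneg_right (pow_le_pow_left₀ w2n w2 2) (sq_nonneg G)
    have s2 : r ^ (1 + ε) * u ^ γ ≤ r ^ γ * u ^ (1 + ε) := by
      have e1 : r ^ γ = r ^ (1 + ε) * r ^ (γ - 1 - ε) := by rw [← rpow_add hr]; congr 1; ring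
      have e2 : u ^ γ = u ^ (1 + ε) * u ^ (γ - 1 - ε) := by rw [← rpow_add hu]; congr 1; ring
      have e3 : u ^ (γ - 1 - ε) ≤ r ^ (γ - 1 - ε) :=
        rpow_le_rpow hu.le hur (by linarith [ha.ε_le])
      rw [e1, e2]
      calc r ^ (1 + ε) * (u ^ (1 + ε) * u ^ (γ - 1 - ε)) =
            r ^ (1 + ε) * u ^ (1 + ε) * u ^ (γ - 1 - ε) := by ring
        _ ≤ r ^ (1 + ε) * u ^ (1 + ε) * r ^ (γ - 1 - ε) := by gcongr
        _ = _ := by ring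
    refine s1.trans ?_
    gcongr
  have fin : (wAmp p γ ^ 2 / 4 + 4) / ε * (r ^ γ * u ^ (1 + ε) * G ^ 2) =
    wAmp p γ ^ 2 / 4 / ε * (r ^ γ * u ^ (1 + ε) * G ^ 2) +
      4 / ε * (r ^ γ * u ^ (1 + ε) * G ^ 2) := by ring
  rw [fin]
  linarith

lemma supDecay_rpow (hp : 1 < p) {q : M4} (hq : q ∈ extDom) : supDecay p ε q ^ (p - 1) =
      ‖q.2‖ ^ (-((3 + ε) / 2)) * (‖q.2‖ - q.1) ^ (-((1 + ε) / 2)) := by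
  have hp' : p - 1 ≠ 0 := by linarith
  rw [supDecay, kAmp_rpow (norm_pos_iff.2 (ne_zero_of_mem_extDom hq)) (u_pos_of_mem hq)]
  congr 3 <;> field_simp

lemma source_sq_le (ha : Adm p γ ε) (Z : Killing) {M : ℝ} (hM : 1 ≤ M) {q : M4}
    (hq : q ∈ extReg)
    (hφ : |φ q.1 q.2| ^ (p - 1) ≤
      M * (‖q.2‖ ^ (-((3 + ε) / 2)) * (‖q.2‖ - q.1) ^ (-((1 + ε) / 2)))) :
    ‖q.2‖ ^ γ * (‖q.2‖ - q.1) ^ (1 + ε) * (|φ q.1 q.2| ^ (p - 1) * Z.act φ q.1 q.2) ^ 2 ≤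
      256 * M ^ 2 * (‖q.2‖ ^ (γ - 1) * (dt1 φ q.1 q.2 + wrad φ q) ^ 2 +
        ‖q.2‖ ^ (-ε - 1) * (‖q.2‖ - q.1) ^ γ * (dt1 φ q.1 q.2 - wrad φ q) ^ 2 +
        ‖q.2‖ ^ (γ - 1) * angSq φ q + ‖q.2‖ ^ (γ - 1) * |φ q.1 q.2| ^ (p + 1)) := by
  have hu : 0 < ‖q.2‖ - q.1 := u_pos_of_mem (extReg_subset_extDom hq)
  have hur : ‖q.2‖ - q.1 ≤ ‖q.2‖ := by linarith [hq.1]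
  have hr1 : 1 ≤ ‖q.2‖ := by linarith [hq.1, hq.2]
  have hε := ha.ε_pos
  have hk := killing_sq_le Z hq φ
  have hEA : 0 ≤ angSq φ q := rdot_sq_le φ q
  have hp1 : p - 1 + 2 = p + 1 := by ring
  have hpow : |φ q.1 q.2| ^ (p + 1) = |φ q.1 q.2| ^ (p - 1) * φ q.1 q.2 ^ 2 := by
    rw [← hp1, rpow_add_of_nonneg (abs_nonneg _) (by linarith [ha.p_gt]) (by norm_num),
      rpow_two, sq_abs]
  set r := ‖q.2‖
  set u := r - q.1
  have hr : 0 < r := by linarith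
  set S := |φ q.1 q.2| ^ (p - 1)
  have hS : 0 ≤ S := by positivity
  have hQS2 : r ^ γ * u ^ (1 + ε) * S ^ 2 ≤ M ^ 2 * r ^ (γ - 3 - ε) := by
    have h1 := pow_le_pow_left₀ hS hφ 2
    have h2 : r ^ γ * u ^ (1 + ε) * (M * (r ^ (-((3 + ε) / 2)) * u ^ (-((1 + ε) / 2)))) ^ 2 =
        M ^ 2 * r ^ (γ - 3 - ε) := by
      have e1 : r ^ (γ - 3 - ε) = r ^ γ * (r ^ (-((3 + ε) / 2)) * r ^ (-((3 + ε) / 2))) := by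
        rw [← rpow_add hr, ← rpow_add hr]; congr 1; ring
      have e2 : u ^ (1 + ε) * (u ^ (-((1 + ε) / 2)) * u ^ (-((1 + ε) / 2))) = 1 := by
        rw [← rpow_add hu, ← rpow_add hu, ← rpow_zero u]; congr 1; ring
      rw [e1]
      linear_combination (r ^ γ * M ^ 2 * (r ^ (-((3 + ε) / 2))) ^ 2) * e2
    rw [← h2]
    exact mul_le_mul_of_nonneg_left h1 (by positivity)
  have hQS : r ^ γ * u ^ (1 + ε) * S ≤ M * r ^ (γ - 1) := by
    have h2 : r ^ γ * u ^ (1 + ε) * (M * (r ^ (-((3 + ε) / 2)) * u ^ (-((1 + ε) / 2)))) =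
        M * (r ^ (γ - (3 + ε) / 2) * u ^ ((1 + ε) / 2)) := by
      have e1 : r ^ (γ - (3 + ε) / 2) = r ^ γ * r ^ (-((3 + ε) / 2)) := by
        rw [← rpow_add hr]; congr 1
      have e2 : u ^ ((1 + ε) / 2) = u ^ (1 + ε) * u ^ (-((1 + ε) / 2)) := by
        rw [← rpow_add hu]; congr 1; ring
      rw [e1, e2]; ring
    have h3 : r ^ (γ - 1) = r ^ (γ - (3 + ε) / 2) * r ^ ((1 + ε) / 2) := by
      rw [← rpow_add hr]; congr 1; ring
    calc _ ≤ r ^ γ * u ^ (1 + ε) * (M * (r ^ (-((3 + ε) / 2)) * u ^ (-((1 + ε) / 2)))) :=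
          mul_le_mul_of_nonneg_left hφ (by positivity)
      _ ≤ _ := by
        rw [h2, h3]
        gcongr
  have p1 : r ^ (γ - 3 - ε) * r ^ 2 ≤ r ^ (γ - 1) := by
    rw [← rpow_two, ← rpow_add hr]
    exact rpow_le_rpow_of_exponent_le hr1 (by linarith)
  have p2 : r ^ (γ - 3 - ε) * u ^ 2 ≤ r ^ (-ε - 1) * u ^ γ := by
    have e1 : r ^ (γ - 3 - ε) = r ^ (-ε - 1) * r ^ (γ - 2) := by
      rw [← rpow_add hr]; congr 1; ring
    have e2 : u ^ γ = u ^ (γ - 2) * u ^ 2 := by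
      rw [← rpow_two, ← rpow_add hu]; congr 1; ring
    have e3 : r ^ (γ - 2) ≤ u ^ (γ - 2) :=
      rpow_le_rpow_of_nonpos hu hur (by linarith [ha.γ_lt])
    rw [e1, e2, mul_assoc]
    gcongr
  rw [hpow]
  generalize dt1 φ q.1 q.2 + wrad φ q = L at *
  generalize dt1 φ q.1 q.2 - wrad φ q = K at *
  generalize φ q.1 q.2 = f at *
  have g1 : r ^ γ * u ^ (1 + ε) * (S * Z.act φ q.1 q.2) ^ 2 ≤
      r ^ γ * u ^ (1 + ε) * S ^ 2 *
        (256 * (r ^ 2 * L ^ 2 + u ^ 2 * K ^ 2 + r ^ 2 * angSq φ q + f ^ 2)) := by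
    have := mul_le_mul_of_nonneg_left hk (show 0 ≤ r ^ γ * u ^ (1 + ε) * S ^ 2 by positivity)
    linarith
  have g2 := mul_le_mul_of_nonneg_right hQS2
    (show 0 ≤ r ^ 2 * L ^ 2 + u ^ 2 * K ^ 2 + r ^ 2 * angSq φ q by positivity)
  have g3 := mul_le_mul_of_nonneg_right hQS (show 0 ≤ S * f ^ 2 by positivity)
  have g4 : M * r ^ (γ - 1) * (S * f ^ 2) ≤ M ^ 2 * r ^ (γ - 1) * (S * f ^ 2) := by
    gcongr
    nlinarith
  have g5 := mul_le_mul_of_nonneg_right p1 (show 0 ≤ M ^ 2 * L ^ 2 by positivity)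
  have g6 := mul_le_mul_of_nonneg_right p2 (show 0 ≤ M ^ 2 * K ^ 2 by positivity)
  have g7 := mul_le_mul_of_nonneg_right p1 (show 0 ≤ M ^ 2 * angSq φ q by positivity)
  refine g1.trans ?_
  linarith

/-- The source of the equation for a commuted field is controlled by the bulk of the undifferentiated
one. -/
lemma exists_divST_total_nonpos (ha : Adm p γ ε) : ∃ Λ : ℝ, 1 ≤ Λ ∧
    ∀ φ : Wave, IsNLWSolution p φ → ∀ Z : Killing, ∀ M : ℝ, 1 ≤ M → ∀ q ∈ extReg,
      |φ q.1 q.2| ^ (p - 1) ≤ M * (‖q.2‖ ^ (-((3 + ε) / 2)) * (‖q.2‖ - q.1) ^ (-((1 + ε) / 2))) →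
      divST (fun q => wCur0 p γ ε 0 (Z.act φ) q + Λ * M ^ 2 * wCur0 p γ ε 1 φ q)
        (fun i q => wCurS p γ ε 0 (Z.act φ) i q + Λ * M ^ 2 * wCurS p γ ε 1 φ i q) q ≤ 0 := by
  have hε := ha.ε_pos
  have hγ : 0 < 2 - γ := by linarith [ha.γ_lt]
  have hp : 1 < p := by linarith [ha.p_gt]
  set C := (wAmp p γ ^ 2 / 4 + 4) / ε * p ^ 2 * 256 with hC
  have hC0 : 0 ≤ C := by positivity
  set k := 1 + 4 / ε + 1 / (2 - γ) + 2 with hk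
  have k4 : 0 < 4 / ε := by positivity
  have kγ : 0 < 1 / (2 - γ) := by positivity
  refine ⟨C * k + 1, by nlinarith, fun φ h Z M hM q hq hφ => ?_⟩
  have hd := extReg_subset_extDom hq
  have nhd := isOpen_extDom.mem_nhds hd
  have hZ : Smooth (Z.act φ) := h.smooth.killing Z
  rw [divST_add_const_mul _
    (((contDiffOn_wCur0 hp hZ).contDiffAt nhd).differentiableAt (by norm_num))
    (((contDiffOn_wCur0 hp h.smooth).contDiffAt nhd).differentiableAt (by norm_num))
    (fun i => ((contDiffOn_wCurS hp hZ i).contDiffAt nhd).differentiableAt (by norm_num))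
    (fun i => ((contDiffOn_wCurS hp h.smooth i).contDiffAt nhd).differentiableAt (by norm_num))]
  have d1 : divST (wCur0 p γ ε 0 (Z.act φ)) (wCurS p γ ε 0 (Z.act φ)) q ≤ _ :=
    divST_weighted_le ha hq le_rfl hZ
  have d2 : divST (wCur0 p γ ε 1 φ) (wCurS p γ ε 1 φ) q ≤ _ :=
    divST_weighted_le ha hq zero_le_one h.smooth
  have h2 : lap3 (φ q.1) q.2 - dtt φ q.1 q.2 - 1 * |φ q.1 q.2| ^ (p - 1) * φ q.1 q.2 = 0 := by
    linarith [h.2 q.1 hq.1 q.2]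
  rw [h2] at d2
  rw [killing_equation Z (by linarith [ha.p_gt]) h hq.1] at d1
  have s := source_young ha hq (p * |φ q.1 q.2| ^ (p - 1) * Z.act φ q.1 q.2)
    (dt1 (Z.act φ) q.1 q.2 + wrad (Z.act φ) q) (dt1 (Z.act φ) q.1 q.2 - wrad (Z.act φ) q)
  have s2 := source_sq_le ha Z hM hq hφ
  have a1 := rdot_sq_le (Z.act φ) q
  have a2 := rdot_sq_le φ q
  have hu : 0 < ‖q.2‖ - q.1 := u_pos_of_mem hd
  simp only [angSq] at s2
  generalize dt1 (Z.act φ) q.1 q.2 + wrad (Z.act φ) q = L' at *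
  generalize dt1 (Z.act φ) q.1 q.2 - wrad (Z.act φ) q = K' at *
  generalize dt1 φ q.1 q.2 + wrad φ q = L at *
  generalize dt1 φ q.1 q.2 - wrad φ q = K at *
  generalize gradSq φ q - rdot φ q ^ 2 / ‖q.2‖ ^ 2 = EA at *
  generalize gradSq (Z.act φ) q - rdot (Z.act φ) q ^ 2 / ‖q.2‖ ^ 2 = EA' at *
  set r := ‖q.2‖
  set u := r - q.1
  have x1 : 0 ≤ r ^ (γ - 1) * L ^ 2 := by positivity
  have x2 : 0 ≤ r ^ (-ε - 1) * u ^ γ * K ^ 2 := by positivity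
  have x3 : 0 ≤ r ^ (γ - 1) * EA := by positivity
  have x4 : 0 ≤ r ^ (γ - 1) * |φ q.1 q.2| ^ (p + 1) := by positivity
  have x5 : 0 ≤ ε * (r ^ γ * u ^ (-ε - 1)) * L ^ 2 := by positivity
  have x6 : 0 ≤ r ^ (γ - 1) * L' ^ 2 := by positivity
  have x7 : 0 ≤ (2 - γ) * r ^ (γ - 1) * EA' := by positivity
  have d1' : divST (wCur0 p γ ε 0 (Z.act φ)) (wCurS p γ ε 0 (Z.act φ)) q ≤
      C * (M ^ 2 * (r ^ (γ - 1) * L ^ 2 + r ^ (-ε - 1) * u ^ γ * K ^ 2 + r ^ (γ - 1) * EA +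
        r ^ (γ - 1) * |φ q.1 q.2| ^ (p + 1))) := by
    have m := mul_le_mul_of_nonneg_left s2
      (show 0 ≤ (wAmp p γ ^ 2 / 4 + 4) / ε * p ^ 2 by positivity)
    rw [hC]
    linarith
  have d2' : divST (wCur0 p γ ε 1 φ) (wCurS p γ ε 1 φ) q ≤
      -(r ^ (γ - 1) * L ^ 2 + ε / 4 * (r ^ (-ε - 1) * u ^ γ * K ^ 2) +
        (2 - γ) * (r ^ (γ - 1) * EA) + 1 / 2 * (r ^ (γ - 1) * |φ q.1 q.2| ^ (p + 1))) := by
    linarith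
  clear d1 d2 s
  generalize r ^ (γ - 1) * |φ q.1 q.2| ^ (p + 1) = X4 at *
  generalize r ^ (γ - 1) * L ^ 2 = X1 at *
  generalize r ^ (-ε - 1) * u ^ γ * K ^ 2 = X2 at *
  generalize r ^ (γ - 1) * EA = X3 at *
  have hkX : X1 + X2 + X3 + X4 ≤ k * (X1 + ε / 4 * X2 + (2 - γ) * X3 + 1 / 2 * X4) := by
    have i1 : 4 / ε * (ε / 4 * X2) = X2 := by field_simp
    have i2 : 1 / (2 - γ) * ((2 - γ) * X3) = X3 := by field_simp
    have j2 : 0 ≤ ε / 4 * X2 := by positivity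
    have j3 : 0 ≤ (2 - γ) * X3 := by positivity
    have n1 := mul_nonneg k4.le x1
    have n2 := mul_nonneg k4.le j3
    have n3 := mul_nonneg k4.le x4
    have n4 := mul_nonneg kγ.le x1
    have n5 := mul_nonneg kγ.le j2
    have n6 := mul_nonneg kγ.le x4
    rw [hk]
    generalize ε / 4 * X2 = Y2 at *
    generalize (2 - γ) * X3 = Y3 at *
    linarith
  have hY : 0 ≤ X1 + ε / 4 * X2 + (2 - γ) * X3 + 1 / 2 * X4 := by positivity
  have f1 := mul_le_mul_of_nonneg_left d2' (show 0 ≤ (C * k + 1) * M ^ 2 by positivity)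
  have f2 := mul_le_mul_of_nonneg_left hkX (show 0 ≤ C * M ^ 2 by positivity)
  have f3 := mul_nonneg (sq_nonneg M) hY
  linarith

end Absorption

section KillingInit

variable {p γ ε : ℝ} {φ ψ : Wave}

/-- Weighted density of the initial data. -/
def iniDen (γ : ℝ) (ψ : Wave) (x : E3) : ℝ :=
  ‖x‖ ^ γ * (dt1 ψ 0 x ^ 2 + ‖fderiv ℝ (ψ 0) x‖ ^ 2) + ‖x‖ ^ (γ - 2) * ψ 0 x ^ 2

lemma abs_sum_mul_le_three {c d : Fin 3 → ℝ} {C D : ℝ} (hc : ∀ j, |c j| ≤ C) (hd : ∀ j, |d j| ≤ D) :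
    |∑ j, c j * d j| ≤ 3 * (C * D) := by
  have h : ∀ j, |c j * d j| ≤ C * D := fun j => by
    rw [abs_mul]
    exact mul_le_mul (hc j) (hd j) (abs_nonneg _) ((abs_nonneg _).trans (hc j))
  rw [Fin.sum_univ_three]
  refine (abs_add_three _ _ _).trans ?_
  linarith [h 0, h 1, h 2]

lemma abs_tc_le (Z : Killing) {x : E3} (hx : 2 ≤ ‖x‖) : |Z.tc x| ≤ 3 * ‖x‖ := by
  have h1 := abs_sum_mul_le_two_norm Z.α_le x
  have h2 := Z.a_le
  rw [Killing.tc]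
  refine (abs_add_le _ _).trans ?_
  linarith

lemma abs_act_le (Z : Killing) {x : E3} (hx : 2 ≤ ‖x‖) {T G : ℝ} (hT : |dt1 ψ 0 x| ≤ T)
    (hG : ∀ j, |dx j ψ 0 x| ≤ G) : |Z.act ψ 0 x| ≤ ‖x‖ * (3 * T + 9 * G) := by
  have h0 : ((0 : ℝ), x) ∈ extReg := ⟨le_rfl, by simpa using hx⟩
  have h1 := abs_sum_mul_le_three (fun j => abs_xc_le Z j h0) hG
  have h2 : |Z.tc x * dt1 ψ 0 x| ≤ 3 * ‖x‖ * T := by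
    rw [abs_mul]
    exact mul_le_mul (abs_tc_le Z hx) hT (abs_nonneg _) (by positivity)
  rw [Killing.act]
  refine (abs_add_le _ _).trans ?_
  change _ + |∑ j, Z.xc j (0, x).1 (0, x).2 * dx j ψ 0 x| ≤ _
  change _ ≤ 3 * (3 * ‖x‖ * G) at h1
  linarith

lemma sq_le_of_abs_le {a b : ℝ} (h : |a| ≤ b) : a ^ 2 ≤ b ^ 2 :=
  sq_le_sq' (abs_le.1 h).1 (abs_le.1 h).2

lemma iniDen_killing_le (ha : Adm p γ ε) (h : IsNLWSolution p φ) (Z : Killing) {M : ℝ}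
    {x : E3} (hx : 2 ≤ ‖x‖)
    (hφ : |φ 0 x| ^ (p - 1) ≤ M * (‖x‖ ^ (-((3 + ε) / 2)) * ‖x‖ ^ (-((1 + ε) / 2)))) (hM : 0 ≤ M) :
    iniDen γ (Z.act φ) x ≤ 10000 * (‖x‖ ^ γ * (dt1 φ 0 x ^ 2 + ‖fderiv ℝ (φ 0) x‖ ^ 2)) +
      10000 * (‖x‖ ^ (γ + 2) * (‖iteratedFDeriv ℝ 2 (φ 0) x‖ ^ 2 + ‖fderiv ℝ (dt1 φ 0) x‖ ^ 2)) +
      10000 * M * (‖x‖ ^ γ * |φ 0 x| ^ (p + 1)) := by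
  have hs := h.smooth
  have hr : 0 < ‖x‖ := by linarith
  have hp : 2 < p := by linarith [ha.p_gt]
  have hg : ∀ j, |dx j φ 0 x| ≤ ‖fderiv ℝ (φ 0) x‖ := fun j => by
    rw [← norm_iteratedFDeriv_one]; exact abs_dx_le φ j 0 x
  have hk : ∀ j, |dx j (dt1 φ) 0 x| ≤ ‖fderiv ℝ (dt1 φ 0) x‖ := fun j => by
    rw [← norm_iteratedFDeriv_one]; exact abs_dx_le (dt1 φ) j 0 x
  have hh : ∀ i j, |dx i (dx j φ) 0 x| ≤ ‖iteratedFDeriv ℝ 2 (φ 0) x‖ := fun i j =>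
    abs_dx_dx_le hs i j 0 x
  have htt : |dt1 (dt1 φ) 0 x| ≤ 3 * ‖iteratedFDeriv ℝ 2 (φ 0) x‖ + |φ 0 x| ^ p := by
    have h1 := h.2 0 le_rfl x
    rw [lap3_eq, dtt_eq, Fin.sum_univ_three] at h1
    have h2 : dt1 (dt1 φ) 0 x = dx 0 (dx 0 φ) 0 x + dx 1 (dx 1 φ) 0 x + dx 2 (dx 2 φ) 0 x -
        |φ 0 x| ^ (p - 1) * φ 0 x := by linarith
    have h3 : |(|φ 0 x| ^ (p - 1) * φ 0 x)| = |φ 0 x| ^ p := by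
      rw [abs_mul, abs_of_nonneg (by positivity)]
      nth_rw 2 [← Real.rpow_one |φ 0 x|]
      rw [← rpow_add_of_nonneg (abs_nonneg _) (by linarith) zero_le_one, sub_add_cancel]
    have h4 := abs_sub (dx 0 (dx 0 φ) 0 x + dx 1 (dx 1 φ) 0 x + dx 2 (dx 2 φ) 0 x)
      (|φ 0 x| ^ (p - 1) * φ 0 x)
    have h5 := abs_add_three (dx 0 (dx 0 φ) 0 x) (dx 1 (dx 1 φ) 0 x) (dx 2 (dx 2 φ) 0 x)
    rw [h2]
    rw [h3] at h4
    linarith [hh 0 0, hh 1 1, hh 2 2]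
  have hpow : ‖x‖ ^ 2 * (|φ 0 x| ^ p) ^ 2 ≤ M * |φ 0 x| ^ (p + 1) := by
    have e1 : (|φ 0 x| ^ p) ^ 2 = |φ 0 x| ^ (p - 1) * |φ 0 x| ^ (p + 1) := by
      rw [← rpow_add_of_nonneg (abs_nonneg _) (by linarith) (by linarith), sq,
        ← rpow_add_of_nonneg (abs_nonneg _) (by linarith) (by linarith)]
      congr 1; ring
    have e2 : ‖x‖ ^ 2 * |φ 0 x| ^ (p - 1) ≤ M := by
      have e3 : ‖x‖ ^ 2 * (‖x‖ ^ (-((3 + ε) / 2)) * ‖x‖ ^ (-((1 + ε) / 2))) ≤ 1 := by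
        rw [← rpow_two, ← rpow_add hr, ← rpow_add hr]
        exact rpow_le_one_of_one_le_of_nonpos (by linarith) (by linarith [ha.ε_pos])
      have e4 := mul_le_mul_of_nonneg_left hφ (sq_nonneg ‖x‖)
      have e5 := mul_le_mul_of_nonneg_left e3 hM
      linarith
    rw [e1, ← mul_assoc]
    exact mul_le_mul_of_nonneg_right e2 (by positivity)
  set T := dt1 φ 0 x
  set g := ‖fderiv ℝ (φ 0) x‖
  set H := ‖iteratedFDeriv ℝ 2 (φ 0) x‖
  set k := ‖fderiv ℝ (dt1 φ 0) x‖
  set s := |φ 0 x| ^ p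
  set r := ‖x‖
  have g0 : 0 ≤ g := norm_nonneg _
  have H0 : 0 ≤ H := norm_nonneg _
  have k0 : 0 ≤ k := norm_nonneg _
  have s0 : 0 ≤ s := by positivity
  have b0 : |Z.act φ 0 x| ≤ r * (3 * |T| + 9 * g) := abs_act_le Z hx le_rfl hg
  have bt : |dt1 (Z.act φ) 0 x| ≤ 3 * g + r * (3 * (3 * H + s) + 9 * k) := by
    rw [dt1_killing Z hs]
    refine (abs_add_le _ _).trans (add_le_add ?_ (abs_act_le Z hx htt hk))
    refine (abs_sum_mul_le_three Z.α_le hg).trans (by linarith)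
  have bx : ∀ i, |dx i (Z.act φ) 0 x| ≤ |T| + 3 * g + r * (3 * k + 9 * H) := fun i => by
    rw [dx_killing Z hs]
    refine (abs_add_three _ _ _).trans (add_le_add (add_le_add ?_ ?_) (abs_act_le Z hx ?_ ?_))
    · rw [abs_mul]
      exact mul_le_of_le_one_left (abs_nonneg _) (Z.α_le i)
    · exact (abs_sum_mul_le_three (fun j => Z.S_le j i) hg).trans (by linarith)
    · rw [hs.dt1_dx]; exact hk i
    · exact fun j => hh j i
  have bf : ‖fderiv ℝ (Z.act φ 0) x‖ ≤ 3 * (|T| + 3 * g + r * (3 * k + 9 * H)) := by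
    refine (norm_fderiv_le_sum _ _).trans ?_
    rw [Fin.sum_univ_three]
    linarith [bx 0, bx 1, bx 2, show |dx 0 (Z.act φ) 0 x| = |fderiv ℝ (Z.act φ 0) x (e3 0)| from rfl,
      show |dx 1 (Z.act φ) 0 x| = |fderiv ℝ (Z.act φ 0) x (e3 1)| from rfl,
      show |dx 2 (Z.act φ) 0 x| = |fderiv ℝ (Z.act φ 0) x (e3 2)| from rfl]
  have two : ∀ a b : ℝ, (a + b) ^ 2 ≤ 2 * a ^ 2 + 2 * b ^ 2 := fun a b => by
    nlinarith [sq_nonneg (a - b)]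
  have three : ∀ a b c : ℝ, (a + b + c) ^ 2 ≤ 3 * a ^ 2 + 3 * b ^ 2 + 3 * c ^ 2 := fun a b c => by
    nlinarith [sq_nonneg (a - b), sq_nonneg (a - c), sq_nonneg (b - c)]
  have q0 : Z.act φ 0 x ^ 2 ≤ r ^ 2 * (200 * (T ^ 2 + g ^ 2)) := by
    refine (sq_le_of_abs_le b0).trans ?_
    rw [mul_pow]
    refine mul_le_mul_of_nonneg_left ((two _ _).trans ?_) (sq_nonneg r)
    rw [mul_pow, sq_abs]
    nlinarith [sq_nonneg T, sq_nonneg g]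
  have qt : dt1 (Z.act φ) 0 x ^ 2 ≤ 18 * g ^ 2 + r ^ 2 * (486 * H ^ 2 + 54 * s ^ 2 + 486 * k ^ 2) := by
    refine (sq_le_of_abs_le bt).trans ((two _ _).trans ?_)
    have := mul_le_mul_of_nonneg_left (three (9 * H) (3 * s) (9 * k)) (sq_nonneg r)
    linarith
  have qf : ‖fderiv ℝ (Z.act φ 0) x‖ ^ 2 ≤
      27 * T ^ 2 + 243 * g ^ 2 + r ^ 2 * (486 * k ^ 2 + 4374 * H ^ 2) := by
    refine (pow_le_pow_left₀ (norm_nonneg _) bf 2).trans ?_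
    rw [mul_pow]
    have t1 := three |T| (3 * g) (r * (3 * k + 9 * H))
    have t2 := mul_le_mul_of_nonneg_left (two (3 * k) (9 * H)) (sq_nonneg r)
    rw [sq_abs] at t1
    linarith
  have e1 : r ^ (γ + 2) = r ^ γ * r ^ 2 := by rw [rpow_add hr, rpow_two]
  have e2 : r ^ γ = r ^ (γ - 2) * r ^ 2 := by
    rw [← rpow_two, ← rpow_add hr, sub_add_cancel]
  have hR : 0 ≤ r ^ γ := by positivity
  have f0 : r ^ (γ - 2) * Z.act φ 0 x ^ 2 ≤ r ^ γ * (200 * (T ^ 2 + g ^ 2)) := by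
    rw [e2, mul_assoc]
    exact mul_le_mul_of_nonneg_left q0 (by positivity)
  have f1 := mul_le_mul_of_nonneg_left (add_le_add qt qf) hR
  have f2 := mul_le_mul_of_nonneg_left hpow hR
  have n1 := mul_nonneg hR (sq_nonneg T)
  have n2 := mul_nonneg hR (sq_nonneg g)
  have n3 := mul_nonneg hR (mul_nonneg (sq_nonneg r) (sq_nonneg H))
  have n4 := mul_nonneg hR (mul_nonneg (sq_nonneg r) (sq_nonneg k))
  have n5 := mul_nonneg hR (mul_nonneg (sq_nonneg r) (sq_nonneg s))
  rw [iniDen, e1]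
  linarith

lemma wCur0_zero_le_iniDen (ha : Adm p γ ε) {x : E3} (hx : 2 ≤ ‖x‖) :
    wCur0 p γ ε 0 ψ (0, x) ≤ (9 * (wAmp p γ + 2)) * iniDen γ ψ x := by
  have h := wCur0_init_le (ψ := ψ) ha le_rfl hx
  have hA : 0 ≤ wAmp p γ := by linarith [Adm.amp_ge ha]
  have h2 : 0 ≤ (wAmp p γ + 2) * (7 * (‖x‖ ^ (γ - 2) * ψ 0 x ^ 2)) := by positivity
  have h3 : pot 0 p ψ (0, x) = 0 := by simp [pot]
  rw [h3] at h
  rw [iniDen]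
  linarith

lemma measurable_iniDen (h : Smooth ψ) : Measurable (iniDen γ ψ) := by
  have hc : ContDiff ℝ 1 (ψ 0) := (h.slice 0).of_le (by exact_mod_cast le_top)
  have h1 : Measurable (dt1 ψ 0) := (h.dt1.slice 0).continuous.measurable
  have h2 : Measurable fun x => ‖fderiv ℝ (ψ 0) x‖ :=
    (hc.continuous_fderiv one_ne_zero).norm.measurable
  exact ((measurable_norm.pow_const γ).mul ((h1.pow_const 2).add (h2.pow_const 2))).add
    ((measurable_norm.pow_const (γ - 2)).mul (hc.continuous.measurable.pow_const 2))

lemma measurableSet_le_norm (b : ℝ) : MeasurableSet {x : E3 | b ≤ ‖x‖} :=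
  measurableSet_le measurable_const measurable_norm

lemma setLIntegral_iniDen_killing_le (ha : Adm p γ ε) (h : IsNLWSolution p φ) (Z : Killing) {M : ℝ}
    (hM : 0 ≤ M)
    (hφ : ∀ q ∈ extReg, |φ q.1 q.2| ^ (p - 1) ≤
      M * (‖q.2‖ ^ (-((3 + ε) / 2)) * (‖q.2‖ - q.1) ^ (-((1 + ε) / 2)))) :
    ∫⁻ x in farDom, ofReal (iniDen γ (Z.act φ) x) ≤
      ofReal 20000 * wEnergy p 1 γ φ + ofReal (10000 * M) * wEnergy p 0 γ φ := by
  have hγ : 0 ≤ γ := by linarith [ha.γ_gt]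
  have hs := h.smooth
  set s := farDom
  set D1 : E3 → ℝ := fun x => ‖x‖ ^ γ * (dt1 φ 0 x ^ 2 + ‖fderiv ℝ (φ 0) x‖ ^ 2)
  set D2 : E3 → ℝ := fun x => ‖x‖ ^ (γ + 2) *
    (‖iteratedFDeriv ℝ 2 (φ 0) x‖ ^ 2 + ‖fderiv ℝ (dt1 φ 0) x‖ ^ 2)
  set D3 : E3 → ℝ := fun x => ‖x‖ ^ γ * |φ 0 x| ^ (p + 1)
  have n1 : ∀ x, 0 ≤ D1 x := fun x => by positivity
  have n2 : ∀ x, 0 ≤ D2 x := fun x => by positivity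
  have n3 : ∀ x, 0 ≤ D3 x := fun x => by positivity
  have cd (n : ℕ) : ContDiff ℝ n (φ 0) := (hs.slice 0).of_le (by exact_mod_cast le_top)
  have hc : ContDiff ℝ 2 (φ 0) := cd 2
  have hct : ContDiff ℝ 1 (dt1 φ 0) := (hs.dt1.slice 0).of_le (by exact_mod_cast le_top)
  have m1 : Measurable D1 := (measurable_norm.pow_const γ).mul
    (((hs.dt1.slice 0).continuous.measurable.pow_const 2).add
      ((hc.continuous_fderiv two_ne_zero).norm.measurable.pow_const 2))
  have m2 : Measurable D2 := (measurable_norm.pow_const (γ + 2)).mul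
    (((hc.continuous_iteratedFDeriv le_rfl).norm.measurable.pow_const 2).add
      ((hct.continuous_fderiv one_ne_zero).norm.measurable.pow_const 2))
  calc _ ≤ ∫⁻ x in s, ((ofReal 10000 * ofReal (D1 x)) + (ofReal 10000 * ofReal (D2 x)) +
        (ofReal (10000 * M) * ofReal (D3 x))) := by
        refine setLIntegral_mono' (measurableSet_le_norm 2) fun x hx => ?_
        have h0 : ((0 : ℝ), x) ∈ extReg := ⟨le_rfl, by simpa using (show 2 ≤ ‖x‖ from hx)⟩
        have h1 := hφ _ h0
        simp only [sub_zero] at h1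
        rw [← ofReal_mul (by norm_num), ← ofReal_mul (by norm_num), ← ofReal_mul (by positivity),
          ← ofReal_add (mul_nonneg (by norm_num) (n1 x)) (mul_nonneg (by norm_num) (n2 x)),
          ← ofReal_add (add_nonneg (mul_nonneg (by norm_num) (n1 x))
            (mul_nonneg (by norm_num) (n2 x))) (mul_nonneg (by positivity) (n3 x))]
        exact ofReal_le_ofReal (iniDen_killing_le ha h Z hx h1 hM)
    _ = (ofReal 10000 * ∫⁻ x in s, ofReal (D1 x)) + (ofReal 10000 * ∫⁻ x in s, ofReal (D2 x)) +
        (ofReal (10000 * M) * ∫⁻ x in s, ofReal (D3 x)) := by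
        rw [lintegral_add_left, lintegral_add_left, lintegral_ofReal_mul, lintegral_ofReal_mul,
          lintegral_ofReal_mul]
        · exact m1.ennreal_ofReal.const_mul _
        · exact (m1.ennreal_ofReal.const_mul _).add (m2.ennreal_ofReal.const_mul _)
    _ ≤ (ofReal 10000 * wEnergy p 1 γ φ) + (ofReal 10000 * wEnergy p 1 γ φ) +
        (ofReal (10000 * M) * wEnergy p 0 γ φ) :=
        add_le_add (add_le_add (mul_le_mul' le_rfl (setLIntegral_energy_le_wEnergy hγ s))
          (mul_le_mul' le_rfl (setLIntegral_energy_one_le_wEnergy hγ le_rfl s)))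
          (mul_le_mul' le_rfl (setLIntegral_pot_le_wEnergy hγ s))
    _ = _ := by
        rw [← add_mul, ← ofReal_add (by norm_num) (by norm_num)]
        norm_num

end KillingInit

/-- The weighted flux density on the hyperboloid. -/
def hypFlux (γ : ℝ) (ψ : Wave) (q : M4) : ℝ :=
  ‖q.2‖ ^ (γ + 2) * (dt1 ψ q.1 q.2 + wrad ψ q) ^ 2 + (dt1 ψ q.1 q.2 - wrad ψ q) ^ 2 +
    ‖q.2‖ ^ 2 * angSq ψ q

/-- The point of the hyperboloid with parameters `t`, `ω`. -/
def hypPt (t : ℝ) (ω : S2) : M4 := (t, hypRho t • ω.1)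

section HypFlux

variable {p γ ε c : ℝ} {φ ψ : Wave}

lemma norm_hypPt {t : ℝ} (ht : 0 ≤ t) (ω : S2) : ‖(hypPt t ω).2‖ = hypRho t :=
  norm_smul_sphere (hypRho_pos (by linarith)).le ω

lemma hypPt_mem {t : ℝ} (ht : 0 ≤ t) (ω : S2) : hypPt t ω ∈ extReg :=
  ⟨ht, by rw [norm_hypPt ht]; exact add_two_le_hypRho ht⟩

lemma hypPt_div {t : ℝ} (ht : 0 ≤ t) (ω : S2) (i : Fin 3) :
    (hypPt t ω).2 i / ‖(hypPt t ω).2‖ = ω.1 i := by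
  have h := hypRho_pos (show -1 < t by linarith)
  rw [norm_hypPt ht]
  simp [hypPt, h.ne']

lemma div_sq_le_hypRho'_sub_one {t : ℝ} (ht : 0 ≤ t) : (4 / 25) / hypRho t ^ 2 ≤ hypRho' t - 1 := by
  have h := hypRho_pos (show -1 < t by linarith)
  have h1 := hypRho_sq (show -1 < t by linarith)
  have h2 := add_two_le_hypRho ht
  rw [hypRho', div_sub_one h.ne', div_le_div_iff₀ (by positivity) h]
  have h3 : (t + 12 / 5 - hypRho t) * (t + 12 / 5 + hypRho t) = 9 / 25 := by linarith
  have h4 : 0 < t + 12 / 5 + hypRho t := by linarith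
  have h5 : t + 12 / 5 - hypRho t = (9 / 25) / (t + 12 / 5 + hypRho t) := by
    rw [eq_div_iff h4.ne']; exact h3
  rw [h5, div_mul_eq_mul_div (9 / 25 : ℝ) (t + 12 / 5 + hypRho t), le_div_iff₀ h4]
  nlinarith

lemma one_le_hypRho' {t : ℝ} (ht : 0 ≤ t) : 1 ≤ hypRho' t := by
  have h := div_sq_le_hypRho'_sub_one ht
  have h2 : 0 ≤ (4 / 25) / hypRho t ^ 2 := by positivity
  linarith

lemma angSq_nonneg (ψ : Wave) (q : M4) : 0 ≤ angSq ψ q := rdot_sq_le ψ q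

lemma le_radial_flux (ha : Adm p γ ε) (hc : 0 ≤ c) {q : M4} (hq : q ∈ extReg) {s : ℝ}
    (hs : 1 ≤ s) : ‖q.2‖ ^ γ * (dt1 ψ q.1 q.2 + wrad ψ q) ^ 2 +
        (s - 1) / 2 * (dt1 ψ q.1 q.2 - wrad ψ q) ^ 2 + angSq ψ q ≤
      s * wCur0 p γ ε c ψ q - ∑ i, q.2 i / ‖q.2‖ * wCurS p γ ε c ψ i q := by
  have hp : 1 < p := by linarith [ha.p_gt]
  have e := radial_flux_eq (f₁ := wt1 p γ ε) (f₂ := wt2 γ ε) (U := pot c p ψ) (ψ := ψ)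
    (ne_zero_of_mem_extDom (extReg_subset_extDom hq)) s
  change s * wCur0 p γ ε c ψ q - ∑ i, q.2 i / ‖q.2‖ * wCurS p γ ε c ψ i q = _ at e
  rw [e]
  have h1 := le_wt1 ha hq
  have h2 := (one_le_u_rpow ha hq).trans (le_wt2 ha hq)
  have h3 := wt1_nonneg ha hq
  have hU := pot_nonneg (ψ := ψ) hp hc q
  have hA := angSq_nonneg ψ q
  have hr : 0 ≤ ‖q.2‖ ^ γ := by positivity
  generalize wt1 p γ ε q = f at *
  generalize wt2 γ ε q = g at *
  generalize ‖q.2‖ ^ γ = R at *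
  generalize angSq ψ q = A at *
  generalize pot c p ψ q = U at *
  have k1 : R ≤ (s + 1) / 2 * f := by nlinarith
  have k2 : (s - 1) / 2 * 1 ≤ (s - 1) / 2 * g := mul_le_mul_of_nonneg_left h2 (by linarith)
  have k3 : 2 * 1 ≤ (s + 1) * g := mul_le_mul (by linarith) h2 (by norm_num) (by linarith)
  have k4 : 0 ≤ (s - 1) * f := mul_nonneg (by linarith) h3
  have k5 : 2 * (A / 2 + U) ≤ ((s - 1) * f + (s + 1) * g) * (A / 2 + U) :=
    mul_le_mul_of_nonneg_right (by linarith) (by linarith)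
  have k6 := mul_le_mul_of_nonneg_right k1 (sq_nonneg (dt1 ψ q.1 q.2 + wrad ψ q))
  have k7 := mul_le_mul_of_nonneg_right k2 (sq_nonneg (dt1 ψ q.1 q.2 - wrad ψ q))
  linarith

lemma radial_flux_nonneg (ha : Adm p γ ε) (hc : 0 ≤ c) {q : M4} (hq : q ∈ extReg) {s : ℝ}
    (hs : 1 ≤ s) : 0 ≤ s * wCur0 p γ ε c ψ q - ∑ i, q.2 i / ‖q.2‖ * wCurS p γ ε c ψ i q := by
  refine le_trans ?_ (le_radial_flux ha hc hq hs)
  have h1 := angSq_nonneg ψ q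
  have h2 : 0 ≤ (s - 1) / 2 * (dt1 ψ q.1 q.2 - wrad ψ q) ^ 2 :=
    mul_nonneg (by linarith) (sq_nonneg _)
  positivity

lemma cone_flux_nonneg (ha : Adm p γ ε) (hc : 0 ≤ c) {q : M4} (hq : q ∈ extReg) :
    0 ≤ wCur0 p γ ε c ψ q + ∑ i, q.2 i / ‖q.2‖ * wCurS p γ ε c ψ i q := by
  have hr : 0 < ‖q.2‖ := by linarith [hq.1, hq.2]
  have hn : ∑ i, (q.2 i / ‖q.2‖) ^ 2 = 1 := by
    simp only [div_pow, ← sum_div]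
    rw [← norm_sq_E3, div_self (by positivity)]
  refine le_trans ?_ (cone_flux_pot_le ha hc hq hn)
  have h1 : ∑ i, q.2 i / ‖q.2‖ * q.2 i = ‖q.2‖ := by
    have : ∀ i, q.2 i / ‖q.2‖ * q.2 i = q.2 i ^ 2 / ‖q.2‖ := fun i => by ring
    simp only [this, ← sum_div]
    rw [← norm_sq_E3]
    field_simp
  have hU := pot_nonneg (ψ := ψ) (show 1 < p by linarith [ha.p_gt]) hc q
  rw [h1]
  positivity

lemma lintegral_hypFlux_le (ha : Adm p γ ε) (hc : 0 ≤ c) {J0 : M4 → ℝ}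
    {J : Fin 3 → M4 → ℝ} (h0 : ContDiffOn ℝ 1 J0 extDom)
    (hJ : ∀ i, ContDiffOn ℝ 1 (J i) extDom) (hdiv : ∀ q ∈ extReg, divST J0 J q ≤ 0)
    (hpos : ∀ q ∈ extReg, 0 ≤ J0 q)
    (hout : ∀ q ∈ extReg, 0 ≤ J0 q + ∑ i, q.2 i / ‖q.2‖ * J i q)
    (hin : ∀ q ∈ extReg, ∀ s, 1 ≤ s →
      s * wCur0 p γ ε c ψ q - ∑ i, q.2 i / ‖q.2‖ * wCurS p γ ε c ψ i q ≤
        s * J0 q - ∑ i, q.2 i / ‖q.2‖ * J i q) :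
    ∫⁻ t in Ioi (0 : ℝ), ∫⁻ ω : S2, ofReal (hypFlux γ ψ (hypPt t ω)) ∂sphereMeasure ≤
      ofReal (25 / 2) * ∫⁻ x in farDom, ofReal (J0 (0, x)) := by
  have key := hyperboloid_energy h0 hJ hdiv hpos hout fun q hq =>
    (radial_flux_nonneg (ψ := ψ) ha hc hq (one_le_hypRho' hq.1)).trans
      (hin q hq _ (one_le_hypRho' hq.1))
  refine le_trans ?_ (mul_le_mul' le_rfl key)
  rw [← lintegral_ofReal_mul]
  refine setLIntegral_mono' measurableSet_Ioi fun t ht => ?_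
  have ht : 0 ≤ t := (mem_Ioi.1 ht).le
  rw [← lintegral_ofReal_mul]
  refine lintegral_mono fun ω => ?_
  rw [← ofReal_mul (by norm_num)]
  refine ofReal_le_ofReal ?_
  have hm := hypPt_mem ht ω
  have h1 := (le_radial_flux (ψ := ψ) ha hc hm (one_le_hypRho' ht)).trans
    (hin _ hm _ (one_le_hypRho' ht))
  have hd := div_sq_le_hypRho'_sub_one ht
  have hr := hypRho_pos (show -1 < t by linarith)
  simp only [hypPt_div ht] at h1
  rw [norm_hypPt ht] at h1
  rw [hypFlux, norm_hypPt ht, rpow_add hr, rpow_two]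
  change _ ≤ _ * (hypRho t ^ 2 * (hypRho' t * J0 (hypPt t ω) - ∑ i, ω.1 i * J i (hypPt t ω)))
  have hA := angSq_nonneg ψ (hypPt t ω)
  rw [div_le_iff₀ (by positivity)] at hd
  set EL := (dt1 ψ (hypPt t ω).1 (hypPt t ω).2 + wrad ψ (hypPt t ω)) ^ 2
  have hL : 0 ≤ EL := sq_nonneg _
  set EB := (dt1 ψ (hypPt t ω).1 (hypPt t ω).2 - wrad ψ (hypPt t ω)) ^ 2
  have hB : 0 ≤ EB := sq_nonneg _
  have hR : 0 ≤ hypRho t ^ γ := by positivity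
  have hR2 : 0 ≤ hypRho t ^ 2 := by positivity
  have k1 := mul_le_mul_of_nonneg_left h1 hR2
  have k2 := mul_le_mul_of_nonneg_right hd hB
  have k3 : 0 ≤ hypRho t ^ γ * hypRho t ^ 2 * EL := by positivity
  have k4 : 0 ≤ hypRho t ^ 2 * angSq ψ (hypPt t ω) := by positivity
  have : hypRho t ^ 2 * (hypRho t ^ γ * EL + (hypRho' t - 1) / 2 * EB + angSq ψ (hypPt t ω)) =
    hypRho t ^ γ * hypRho t ^ 2 * EL + (hypRho' t - 1) * hypRho t ^ 2 * EB / 2 +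
      hypRho t ^ 2 * angSq ψ (hypPt t ω) := by ring
  linarith

lemma exists_decay (ha : Adm p γ ε) {B : ℝ} (hB : 0 ≤ B) : ∃ K : ℝ, 0 ≤ K ∧
    ∀ φ : Wave, IsNLWSolution p φ → wEnergy p 0 γ φ ≤ ofReal B →
      wEnergy p 1 γ φ ≠ ⊤ → ∃ M : ℝ, 1 ≤ M ∧ M ^ 2 ≤ K * (1 + (wEnergy p 1 γ φ).toReal) ^ (p - 1) ∧
        ∀ q ∈ extReg, |φ q.1 q.2| ^ (p - 1) ≤
          M * (‖q.2‖ ^ (-((3 + ε) / 2)) * (‖q.2‖ - q.1) ^ (-((1 + ε) / 2))) := by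
  have hp := ha.p_gt
  obtain ⟨C, hC, h⟩ := exists_abs_le_supDecay ha hB
  refine ⟨(2 * (C + 1) ^ 2) ^ (p - 1), by positivity, fun φ hφ h0 h1 => ?_⟩
  have hb := h φ hφ h0 h1
  set e := (wEnergy p 1 γ φ).toReal
  have he : 0 ≤ e := toReal_nonneg
  have hm : 1 ≤ (C + 1) * (1 + √e) := by nlinarith [sqrt_nonneg e, mul_nonneg hC (sqrt_nonneg e)]
  refine ⟨((C + 1) * (1 + √e)) ^ (p - 1), one_le_rpow hm (by linarith), ?_, fun q hq => ?_⟩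
  · rw [← mul_rpow (by positivity) (by positivity), ← rpow_natCast,
      ← Real.rpow_mul (by positivity), mul_comm (p - 1), Real.rpow_mul (by positivity)]
    refine rpow_le_rpow (by positivity) ?_ (by linarith)
    rw [rpow_natCast, mul_pow]
    have h2 : (1 + √e) ^ 2 ≤ 2 * (1 + e) := by
      nlinarith [sq_sqrt he, sq_nonneg (1 - √e)]
    calc _ ≤ (C + 1) ^ 2 * (2 * (1 + e)) := mul_le_mul_of_nonneg_left h2 (by positivity)
      _ = _ := by ring
  · have hs := supDecay_pos (p := p) (ε := ε) hq
    rw [← supDecay_rpow (show 1 < p by linarith) (extReg_subset_extDom hq),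
      ← mul_rpow (zero_le_one.trans hm) hs.le]
    refine rpow_le_rpow (abs_nonneg _) ((hb q hq).trans ?_) (by linarith)
    exact mul_le_mul_of_nonneg_right
      (mul_le_mul_of_nonneg_right (by linarith) (by positivity)) hs.le

lemma setLIntegral_iniDen_le (ha : Adm p γ ε) (h : Smooth φ) (hE : wEnergy p 0 γ φ ≠ ⊤) :
    ∫⁻ x in farDom, ofReal (iniDen γ φ x) ≤ ofReal (1 + 2 / γ) * wEnergy p 0 γ φ := by
  have hγ : 0 < γ := by linarith [ha.γ_gt]
  have hc : ContDiff ℝ 1 (φ 0) := (h.slice 0).of_le (by exact_mod_cast le_top)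
  have m : Measurable fun x : E3 => ofReal (‖x‖ ^ (γ - 2) * φ 0 x ^ 2) :=
    ((measurable_norm.pow_const _).mul (hc.continuous.measurable.pow_const 2)).ennreal_ofReal
  calc _ = ∫⁻ x in farDom, (ofReal (‖x‖ ^ γ * (dt1 φ 0 x ^ 2 + ‖fderiv ℝ (φ 0) x‖ ^ 2)) +
          ofReal (‖x‖ ^ (γ - 2) * φ 0 x ^ 2)) :=
        lintegral_congr fun x => ofReal_add (by positivity) (by positivity)
    _ ≤ wEnergy p 0 γ φ + ofReal (2 / γ) * wEnergy p 0 γ φ := by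
        rw [lintegral_add_right _ m]
        refine add_le_add (setLIntegral_energy_le_wEnergy hγ.le _) ?_
        exact (lintegral_mono_set fun x (hx : 2 ≤ ‖x‖) => show 1 < ‖x‖ by linarith).trans
          (setLIntegral_hardy_le_wEnergy h (by linarith [ha.p_gt]) hγ hE)
    _ = _ := by
        rw [ofReal_add (by norm_num) (by positivity), ofReal_one, add_mul, one_mul]

end HypFlux

/-- The flux of `ψ` through the hyperboloid together with its initial size. -/
def hypSize (γ : ℝ) (ψ : Wave) : ℝ≥0∞ :=
  (∫⁻ t in Ioi (0 : ℝ), ∫⁻ ω : S2, ofReal (hypFlux γ ψ (hypPt t ω)) ∂sphereMeasure) +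
    ∫⁻ x in farDom, ofReal (iniDen γ ψ x)

section HypSize

variable {p γ ε : ℝ} {φ ψ : Wave}

lemma setLIntegral_total_init_le (ha : Adm p γ ε) (hψ : Smooth ψ) (l : ℝ)
    (hl : 0 ≤ l) : ∫⁻ x in farDom, ofReal (wCur0 p γ ε 0 ψ (0, x) + l * wCur0 p γ ε 1 φ (0, x)) ≤
      (ofReal (9 * (wAmp p γ + 2)) * ∫⁻ x in farDom, ofReal (iniDen γ ψ x)) +
      (ofReal l * ∫⁻ x in farDom, ofReal (wCur0 p γ ε 1 φ (0, x))) := by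
  have hA : 0 ≤ 9 * (wAmp p γ + 2) := by linarith [ha.amp_ge]
  rw [← lintegral_ofReal_mul, ← lintegral_ofReal_mul,
    ← lintegral_add_left ((measurable_iniDen hψ).ennreal_ofReal.const_mul _)]
  refine setLIntegral_mono' (measurableSet_le_norm 2) fun x hx => ?_
  have h0 : ((0 : ℝ), x) ∈ extReg := ⟨le_rfl, by simpa using (show 2 ≤ ‖x‖ from hx)⟩
  have hn : 0 ≤ iniDen γ ψ x := by unfold iniDen; positivity
  have h1 := wCur0_zero_le_iniDen (ψ := ψ) ha (show 2 ≤ ‖x‖ from hx)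
  have h2 := wCur0_nonneg (ψ := φ) ha zero_le_one h0
  rw [← ofReal_mul hA, ← ofReal_mul hl, ← ofReal_add (mul_nonneg hA hn) (mul_nonneg hl h2)]
  exact ofReal_le_ofReal (by linarith)

lemma exists_hypSize_le (ha : Adm p γ ε) {B : ℝ} (hB : 0 ≤ B) : ∃ C : ℝ, 0 ≤ C ∧
    ∀ φ : Wave, IsNLWSolution p φ → wEnergy p 0 γ φ ≤ ofReal B →
      wEnergy p 1 γ φ ≠ ⊤ → hypSize γ φ ≤ ofReal C ∧ ∀ Z : Killing, hypSize γ (Z.act φ) ≤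
          ofReal (C * (1 + (wEnergy p 1 γ φ).toReal) ^ (p - 1)) := by
  have hp : 1 < p := by linarith [ha.p_gt]
  have hγ : 0 < γ := by linarith [ha.γ_gt]
  have hA : 0 ≤ 9 * (wAmp p γ + 2) := by linarith [ha.amp_ge]
  obtain ⟨C₁, hC₁, ini⟩ := exists_initial_energy_le ha 0
  obtain ⟨Λ, hΛ, total⟩ := exists_divST_total_nonpos ha
  obtain ⟨K, hK, decay⟩ := exists_decay ha hB
  set a := 25 / 2 * (C₁ * B) + (1 + 2 / γ) * B with hadef
  set b := 20000 + 10000 * K * B with hbdef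
  set d := 25 / 2 * (9 * (wAmp p γ + 2) * b + Λ * K * (C₁ * B)) + b with hddef
  have ha0 : 0 ≤ a := by positivity
  have hb0 : 0 ≤ b := by positivity
  have hd0 : 0 ≤ d := by positivity
  refine ⟨a + d, by positivity, fun φ h h0 h1 => ?_⟩
  obtain ⟨M, hM, hMX, hφ⟩ := decay φ h h0 h1
  have hE0 : wEnergy p 0 γ φ ≠ ⊤ := ne_top_of_le_ne_top ofReal_ne_top h0
  have hI : ∫⁻ x in farDom, ofReal (wCur0 p γ ε 1 φ (0, x)) ≤ ofReal (C₁ * B) := by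
    rw [ofReal_mul hC₁]
    exact (ini φ h.smooth hE0).trans (mul_le_mul' le_rfl h0)
  have hE1 : wEnergy p 1 γ φ = ofReal (wEnergy p 1 γ φ).toReal :=
    (ofReal_toReal h1).symm
  set e := (wEnergy p 1 γ φ).toReal
  have he : 0 ≤ e := toReal_nonneg
  set X := (1 + e) ^ (p - 1)
  have hX : 1 + e ≤ X := Real.self_le_rpow_of_one_le (by linarith) (by linarith [ha.p_gt])
  have hM1 : M ≤ K * X := by nlinarith
  constructor
  · refine (add_le_add (lintegral_hypFlux_le ha zero_le_one (contDiffOn_wCur0 hp h.smooth)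
      (contDiffOn_wCurS hp h.smooth) (fun q hq => divST_wCur_nonpos ha h hq)
      (fun q hq => wCur0_nonneg ha zero_le_one hq)
      (fun q hq => cone_flux_nonneg ha zero_le_one hq) fun q hq s hs => le_rfl)
      (setLIntegral_iniDen_le ha h.smooth hE0)).trans ?_
    refine (add_le_add (mul_le_mul' le_rfl hI) (mul_le_mul' le_rfl h0)).trans ?_
    rw [← ofReal_mul (by norm_num), ← ofReal_mul (by positivity),
      ← ofReal_add (by positivity) (by positivity)]
    exact ofReal_le_ofReal (by linarith)
  · intro Z
    have hZ := h.smooth.killing Z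
    have hZI : ∫⁻ x in farDom, ofReal (iniDen γ (Z.act φ) x) ≤ ofReal (b * X) := by
      refine (setLIntegral_iniDen_killing_le ha h Z (zero_le_one.trans hM) hφ).trans ?_
      rw [hE1]
      refine (add_le_add le_rfl (mul_le_mul' le_rfl h0)).trans ?_
      rw [← ofReal_mul (by norm_num), ← ofReal_mul (by positivity),
        ← ofReal_add (by positivity) (by positivity)]
      refine ofReal_le_ofReal ?_
      have := mul_le_mul_of_nonneg_right hM1 hB
      rw [hbdef]
      linarith
    have hl : 0 ≤ Λ * M ^ 2 := by positivity
    refine (add_le_add (lintegral_hypFlux_le (c := 0) ha le_rfl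
      ((contDiffOn_wCur0 hp hZ).add (contDiffOn_const.mul (contDiffOn_wCur0 hp h.smooth)))
      (fun i => (contDiffOn_wCurS hp hZ i).add
        (contDiffOn_const.mul (contDiffOn_wCurS hp h.smooth i)))
      (fun q hq => total φ h Z M hM q hq (hφ q hq))
      (fun q hq => add_nonneg (wCur0_nonneg ha le_rfl hq)
        (mul_nonneg hl (wCur0_nonneg ha zero_le_one hq)))
      (fun q hq => ?_) fun q hq s hs => ?_) hZI).trans ?_
    · have k1 := cone_flux_nonneg (ψ := Z.act φ) ha le_rfl hq
      have k2 := mul_nonneg hl (cone_flux_nonneg (ψ := φ) ha zero_le_one hq)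
      rw [Fin.sum_univ_three] at *
      linarith
    · have k2 := mul_nonneg hl (radial_flux_nonneg (ψ := φ) ha zero_le_one hq hs)
      simp only [Fin.sum_univ_three] at *
      linarith
    · refine (add_le_add (mul_le_mul' le_rfl ((setLIntegral_total_init_le ha hZ _ hl).trans
        (add_le_add (mul_le_mul' le_rfl hZI) (mul_le_mul' le_rfl hI)))) le_rfl).trans ?_
      have hbX : 0 ≤ b * X := by positivity
      have hCB : 0 ≤ C₁ * B := by positivity
      rw [← ofReal_mul hA, ← ofReal_mul hl, ← ofReal_add (by positivity) (by positivity),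
        ← ofReal_mul (by norm_num), ← ofReal_add (by positivity) (by positivity)]
      refine ofReal_le_ofReal ?_
      have k1 := mul_le_mul_of_nonneg_right
        (mul_le_mul_of_nonneg_left hMX (zero_le_one.trans hΛ)) hCB
      have k2 : 0 ≤ a * X := by positivity
      rw [add_mul, hddef]
      linarith

end HypSize

section HypHardy

variable {p γ ε : ℝ} {φ ψ : Wave}

lemma hardy_half_line {y y' : ℝ → ℝ} (hy : ∀ t, 0 ≤ t → HasDerivAt y (y' t) t)
    (hc : ContinuousOn y' (Set.Ici 0)) : ∫⁻ t in Ioi (0 : ℝ), ofReal (y t ^ 2 / (t + 1) ^ 2) ≤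
      ofReal (2 * y 0 ^ 2) + (ofReal 4 * ∫⁻ t in Ioi (0 : ℝ), ofReal (y' t ^ 2)) := by
  have hU : Ioi (0 : ℝ) = ⋃ n : ℕ, Ioc 0 (n : ℝ) := by
    ext t
    simp only [mem_Ioi, Set.mem_iUnion, Set.mem_Ioc]
    exact ⟨fun h => (exists_nat_ge t).imp fun n hn => ⟨h, hn⟩, fun ⟨n, hn⟩ => hn.1⟩
  conv_lhs => rw [hU]
  rw [setLIntegral_iUnion_of_directed]
  swap
  · exact (monotone_nat_of_le_succ fun n => Set.Ioc_subset_Ioc_right (by simp)).directed_le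
  refine iSup_le fun n => ?_
  set T : ℝ := (n : ℝ)
  have hT : 0 ≤ T := Nat.cast_nonneg n
  have hcy : ContinuousOn y (Icc 0 T) := fun t ht =>
    (hy t ht.1).continuousAt.continuousWithinAt
  have hcy' : ContinuousOn y' (Icc 0 T) := hc.mono fun t ht => ht.1
  have hne : ∀ t ∈ Icc 0 T, t + 1 ≠ 0 := fun t ht => by linarith [ht.1]
  have hq : ContinuousOn (fun t => y t ^ 2 / (t + 1) ^ 2) (Icc 0 T) :=
    (hcy.pow 2).div (by fun_prop) fun t ht => pow_ne_zero 2 (hne t ht)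
  have hp : ContinuousOn (fun t => y' t ^ 2) (Icc 0 T) := hcy'.pow 2
  have hF : ContinuousOn (fun t => 2 * y t * y' t / (t + 1) - y t ^ 2 / (t + 1) ^ 2)
      (Icc 0 T) :=
    (((continuousOn_const.mul hcy).mul hcy').div (by fun_prop) hne).sub hq
  have hI : uIcc 0 T = Icc 0 T := uIcc_of_le hT
  have ftc := intervalIntegral.integral_eq_sub_of_hasDerivAt (a := 0) (b := T)
    (f := fun t => y t ^ 2 / (t + 1)) (fun t ht => by
      rw [hI] at ht
      have h1 := ((hy t ht.1).fun_pow 2).fun_div ((hasDerivAt_id t).add_const (1 : ℝ)) (hne t ht)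
      refine h1.congr_deriv (g' := 2 * y t * y' t / (t + 1) - y t ^ 2 / (t + 1) ^ 2) ?_
      have := hne t ht
      simp only [id]
      field_simp
      ring) (hF.intervalIntegrable_of_Icc hT)
  have iq := hq.intervalIntegrable_of_Icc (μ := volume) hT
  have ip := hp.intervalIntegrable_of_Icc (μ := volume) hT
  have mono := intervalIntegral.integral_mono_on hT (hF.intervalIntegrable_of_Icc (μ := volume) hT)
    ((ip.const_mul 2).sub (iq.const_mul (1 / 2))) fun t ht => by
      have e : 2 * y t * y' t / (t + 1) = 2 * (y t / (t + 1)) * y' t := by ring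
      rw [e, ← div_pow]
      nlinarith [sq_nonneg (y t / (t + 1) - 2 * y' t)]
  rw [ftc, intervalIntegral.integral_sub (ip.const_mul 2) (iq.const_mul (1 / 2)),
    intervalIntegral.integral_const_mul, intervalIntegral.integral_const_mul,
    intervalIntegral.integral_of_le hT, intervalIntegral.integral_of_le hT] at mono
  have hyT : 0 ≤ y T ^ 2 / (T + 1) := by positivity
  simp only [zero_add, div_one] at mono
  have nq : 0 ≤ᵐ[volume.restrict (Ioc 0 T)] fun t => y t ^ 2 / (t + 1) ^ 2 :=
    ae_of_all _ fun t => by positivity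
  have np : 0 ≤ᵐ[volume.restrict (Ioc 0 T)] fun t => y' t ^ 2 :=
    ae_of_all _ fun t => by positivity
  rw [← ofReal_integral_eq_lintegral_ofReal
    ((intervalIntegrable_iff_integrableOn_Ioc_of_le hT).1 iq) nq]
  refine le_trans ?_ (add_le_add le_rfl (mul_le_mul' le_rfl (lintegral_mono_set
    (fun t (ht : t ∈ Ioc 0 T) => ht.1))))
  rw [← ofReal_integral_eq_lintegral_ofReal
    ((intervalIntegrable_iff_integrableOn_Ioc_of_le hT).1 ip) np,
    ← ofReal_mul (by norm_num), ← ofReal_add (by positivity)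
      (mul_nonneg (by norm_num) (integral_nonneg_of_ae np))]
  exact ofReal_le_ofReal (by linarith)

lemma continuous_hypRho : Continuous hypRho := by
  unfold hypRho
  fun_prop

lemma continuous_hypPt : Continuous fun z : ℝ × S2 => hypPt z.1 z.2 :=
  continuous_fst.prodMk ((continuous_hypRho.comp continuous_fst).smul
    (continuous_subtype_val.comp continuous_snd))

/-- The derivative of `r ψ` along the hyperboloid. -/
def hypDeriv (ψ : Wave) (t : ℝ) (ω : S2) : ℝ :=
  hypRho' t * (rdot ψ (hypPt t ω) + ψ (hypPt t ω).1 (hypPt t ω).2) +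
    hypRho t * dt1 ψ (hypPt t ω).1 (hypPt t ω).2

lemma hasDerivAt_hypPt (h : Smooth ψ) {t : ℝ} (ht : 0 ≤ t) (ω : S2) :
    HasDerivAt (fun t => hypRho t * ψ (hypPt t ω).1 (hypPt t ω).2) (hypDeriv ψ t ω) t := by
  have h1 := hasDerivAt_hypRho (show -1 < t by linarith)
  have h2 := h.hasDerivAt_comp (hasDerivAt_id t) (h1.smul_const ω.1)
  refine (h1.fun_mul h2).congr_deriv ?_
  simp only [hypDeriv, rdot, hypPt, Fin.sum_univ_three, PiLp.smul_apply, smul_eq_mul, id]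
  ring

lemma continuous_rdot (h : Smooth ψ) : Continuous (rdot ψ) := (contDiff_rdot h).continuous

lemma hypDeriv_sq_le (hγ : 0 ≤ γ) {t : ℝ} (ht : 0 ≤ t) (ω : S2) :
    hypDeriv ψ t ω ^ 2 ≤ 3 * hypFlux γ ψ (hypPt t ω) := by
  have hr := hypRho_pos (show -1 < t by linarith)
  have hr2 := add_two_le_hypRho ht
  have hs1 := one_le_hypRho' ht
  have hsq := hypRho_sq (show -1 < t by linarith)
  have hs : (hypRho' t - 1) * hypRho t ^ 2 ≤ 9 / 25 := by
    have h1 : (hypRho' t - 1) * hypRho t = t + 12 / 5 - hypRho t := by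
      rw [hypRho']; field_simp
    have h2 : (hypRho' t - 1) * hypRho t * hypRho t ≤
        (t + 12 / 5 - hypRho t) * (t + 12 / 5 + hypRho t) := by
      rw [h1]
      exact mul_le_mul_of_nonneg_left (by linarith) (by rw [← h1]; nlinarith)
    nlinarith
  have e : hypDeriv ψ t ω = (1 + (hypRho' t - 1) / 2) *
      (hypRho t * (dt1 ψ (hypPt t ω).1 (hypPt t ω).2 + wrad ψ (hypPt t ω))) -
      (hypRho' t - 1) * hypRho t / 2 *
        (dt1 ψ (hypPt t ω).1 (hypPt t ω).2 - wrad ψ (hypPt t ω)) := by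
    rw [hypDeriv, wrad, norm_hypPt ht]
    field_simp
    ring
  rw [e, hypFlux, norm_hypPt ht]
  have hA := angSq_nonneg ψ (hypPt t ω)
  have hs0 : 0 ≤ hypRho' t - 1 := by linarith
  have hR : (1 : ℝ) ≤ hypRho t ^ γ := one_le_rpow (by linarith) hγ
  rw [rpow_add hr, rpow_two]
  generalize dt1 ψ (hypPt t ω).1 (hypPt t ω).2 + wrad ψ (hypPt t ω) = L
  generalize dt1 ψ (hypPt t ω).1 (hypPt t ω).2 - wrad ψ (hypPt t ω) = K
  generalize hypRho' t - 1 = s at *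
  generalize hypRho t = ρ at *
  have a1 : s ≤ 9 / 25 := by nlinarith [mul_nonneg hs0 (show (0:ℝ) ≤ ρ ^ 2 - 1 by nlinarith)]
  have a2 : s * ρ ≤ 9 / 25 := by nlinarith [mul_nonneg hs0 (show (0:ℝ) ≤ ρ ^ 2 - ρ by nlinarith)]
  have b1 : (1 + s / 2) ^ 2 ≤ 3 / 2 := by nlinarith
  have b2 : (s * ρ / 2) ^ 2 ≤ 1 := by nlinarith [mul_nonneg hs0 hr.le]
  have c1 := mul_le_mul_of_nonneg_right b1 (sq_nonneg (ρ * L))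
  have c2 := mul_le_mul_of_nonneg_right b2 (sq_nonneg K)
  have c3 := mul_le_mul_of_nonneg_right hR (sq_nonneg (ρ * L))
  have c4 := sq_nonneg ((1 + s / 2) * (ρ * L) + s * ρ / 2 * K)
  have c5 : 0 ≤ ρ ^ 2 * angSq ψ (hypPt t ω) := by positivity
  nlinarith [sq_nonneg K]

lemma sphere_trace_le (hγ : 0 ≤ γ) {f : E3 → ℝ} (hf : ContDiff ℝ 1 f) {r : ℝ} (hr : 2 ≤ r) :
    ∫⁻ ω : S2, ofReal (f (r • ω.1) ^ 2) ∂sphereMeasure ≤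
      (2 * ∫⁻ x in {x : E3 | r < ‖x‖}, ofReal (‖x‖ ^ (γ - 2) * f x ^ 2)) +
        ∫⁻ x in {x : E3 | r < ‖x‖}, ofReal (‖fderiv ℝ f x‖ ^ 2) := by
  set D := ∫⁻ x in {x : E3 | r < ‖x‖}, ofReal (‖fderiv ℝ f x‖ ^ 2)
  have hv : volume (Ioc r (r + 1)) = 1 := by simp
  have hm : Measurable fun x : E3 => ofReal (‖x‖ ^ (γ - 2) * f x ^ 2) :=
    ((measurable_norm.pow_const _).mul (hf.continuous.measurable.pow_const 2)).ennreal_ofReal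
  calc _ = ∫⁻ _ in Ioc r (r + 1), ∫⁻ ω : S2, ofReal (f (r • ω.1) ^ 2) ∂sphereMeasure := by
        rw [setLIntegral_const, hv, mul_one]
    _ ≤ ∫⁻ R in Ioc r (r + 1), ((2 * (ofReal (R ^ 2) *
        ∫⁻ ω : S2, ofReal (‖R • ω.1‖ ^ (γ - 2) * f (R • ω.1) ^ 2)
          ∂sphereMeasure)) + D) := by
        refine setLIntegral_mono' measurableSet_Ioc fun R hR => ?_
        have hR0 : 0 < R := by linarith [hR.1]
        refine (sphere_sq_le_two hf (by linarith) hR.1.le).trans (add_le_add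
          (mul_le_mul' le_rfl ?_) ?_)
        · rw [← lintegral_ofReal_mul]
          refine lintegral_mono fun ω => ?_
          rw [← ofReal_mul (by positivity), norm_smul_sphere hR0.le, ← mul_assoc,
            ← rpow_two R, ← rpow_add hR0]
          refine ofReal_le_ofReal (le_mul_of_one_le_left (sq_nonneg _) ?_)
          exact one_le_rpow (by linarith [hR.1]) (by linarith)
        · exact mul_le_of_le_one_left' (ENNReal.ofReal_le_one.2
            ((div_le_one (by linarith)).2 hr))
    _ = (2 * ∫⁻ R in Ioc r (r + 1), (ofReal (R ^ 2) *
        ∫⁻ ω : S2, ofReal (‖R • ω.1‖ ^ (γ - 2) * f (R • ω.1) ^ 2)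
          ∂sphereMeasure)) + D := by
        rw [lintegral_add_right _ measurable_const, setLIntegral_const, hv, mul_one,
          lintegral_const_mul' _ _ (by norm_num)]
    _ ≤ _ := by
        refine add_le_add (mul_le_mul' le_rfl ?_) le_rfl
        rw [lintegral_outside_polar r (by linarith) hm]
        exact lintegral_mono_set Set.Ioc_subset_Ioi_self

lemma lintegral_initial_trace_le (hγ : 0 ≤ γ) (h : Smooth ψ) :
    ∫⁻ ω : S2, ofReal (2 * (hypRho 0 * ψ 0 (hypRho 0 • ω.1)) ^ 2) ∂sphereMeasure ≤
      ofReal 36 * ∫⁻ x in farDom, ofReal (iniDen γ ψ x) := by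
  have hρ : hypRho 0 ^ 2 = 27 / 5 := by rw [hypRho_sq (by norm_num)]; norm_num
  have hρ2 : 2 ≤ hypRho 0 := by simpa using add_two_le_hypRho (le_refl (0 : ℝ))
  have hc : ContDiff ℝ 1 (ψ 0) := (h.slice 0).of_le (by exact_mod_cast le_top)
  have e : ∀ ω : S2, ofReal (2 * (hypRho 0 * ψ 0 (hypRho 0 • ω.1)) ^ 2) =
      ofReal (54 / 5) * ofReal (ψ 0 (hypRho 0 • ω.1) ^ 2) := fun ω => by
    rw [← ofReal_mul (by norm_num), mul_pow, hρ]; congr 1; ring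
  rw [lintegral_congr e, lintegral_ofReal_mul]
  have h1 : ∫⁻ x in {x : E3 | hypRho 0 < ‖x‖}, ofReal (‖x‖ ^ (γ - 2) * ψ 0 x ^ 2) ≤
      ∫⁻ x in farDom, ofReal (iniDen γ ψ x) :=
    (lintegral_mono_set fun x (hx : hypRho 0 < ‖x‖) => hρ2.trans hx.le).trans
      (lintegral_mono fun x => ofReal_le_ofReal (le_add_of_nonneg_left (by positivity)))
  have h2 : ∫⁻ x in {x : E3 | hypRho 0 < ‖x‖}, ofReal (‖fderiv ℝ (ψ 0) x‖ ^ 2) ≤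
      ∫⁻ x in farDom, ofReal (iniDen γ ψ x) := by
    refine (lintegral_mono_set fun x (hx : hypRho 0 < ‖x‖) => hρ2.trans hx.le).trans
      (setLIntegral_mono' (measurableSet_le_norm 2) fun x hx => ofReal_le_ofReal ?_)
    have k1 : 1 ≤ ‖x‖ ^ γ := one_le_rpow (by linarith [show 2 ≤ ‖x‖ from hx]) hγ
    have k2 : 0 ≤ ‖x‖ ^ (γ - 2) * ψ 0 x ^ 2 := by positivity
    have k3 : 1 * (dt1 ψ 0 x ^ 2 + ‖fderiv ℝ (ψ 0) x‖ ^ 2) ≤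
      ‖x‖ ^ γ * (dt1 ψ 0 x ^ 2 + ‖fderiv ℝ (ψ 0) x‖ ^ 2) :=
      mul_le_mul_of_nonneg_right k1 (by positivity)
    rw [iniDen]
    linarith [sq_nonneg (dt1 ψ 0 x)]
  refine (mul_le_mul' le_rfl ((sphere_trace_le hγ hc hρ2).trans
    (add_le_add (mul_le_mul' le_rfl h1) h2))).trans ?_
  have e3 : (2 : ℝ≥0∞) = ofReal 2 := by simp
  have e4 : ∀ I : ℝ≥0∞, 2 * I + I = ofReal 3 * I := fun I => by
    rw [e3, ← one_mul I, ← mul_assoc, mul_one, ← ofReal_one, ← add_mul,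
      ← ofReal_add (by norm_num) (by norm_num)]
    norm_num
  rw [e4, ← mul_assoc, ← ofReal_mul (by norm_num)]
  exact mul_le_mul' (ofReal_le_ofReal (by norm_num)) le_rfl

lemma continuous_hypPt_apply (h : Smooth ψ) :
    Continuous fun z : ℝ × S2 => ψ (hypPt z.1 z.2).1 (hypPt z.1 z.2).2 :=
  h.continuous.comp continuous_hypPt

lemma measurable_hypDeriv (h : Smooth ψ) : Measurable fun z : ℝ × S2 => hypDeriv ψ z.1 z.2 := by
  have hm' : Measurable hypRho' :=
    (measurable_id.add_const _).div continuous_hypRho.measurable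
  exact ((hm'.comp measurable_fst).mul (((continuous_rdot h).comp continuous_hypPt).add
    (continuous_hypPt_apply h)).measurable).add
      ((continuous_hypRho.comp continuous_fst).mul (continuous_hypPt_apply h.dt1)).measurable

lemma continuousOn_hypDeriv (h : Smooth ψ) (ω : S2) :
    ContinuousOn (fun t => hypDeriv ψ t ω) (Set.Ici 0) := by
  have h0 : Continuous fun t : ℝ => hypPt t ω := continuous_hypPt.comp
    (by fun_prop : Continuous fun t : ℝ => (t, ω))
  have h1 : Continuous fun t => rdot ψ (hypPt t ω) + ψ (hypPt t ω).1 (hypPt t ω).2 :=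
    ((continuous_rdot h).comp h0).add (h.continuous.comp h0)
  have h2 : Continuous fun t => hypRho t * dt1 ψ (hypPt t ω).1 (hypPt t ω).2 :=
    continuous_hypRho.mul (h.dt1.continuous.comp h0)
  have h3 : ContinuousOn hypRho' (Set.Ici 0) := continuousOn_hypRho'.mono fun t ht =>
    lt_of_lt_of_le (by norm_num) (Set.mem_Ici.1 ht)
  exact (h3.mul h1.continuousOn).add h2.continuousOn

lemma lintegral_sq_hypPt_le (hγ : 0 ≤ γ) (h : Smooth ψ) : ∫⁻ t in Ioi (0 : ℝ), ∫⁻ ω : S2,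
        ofReal (ψ (hypPt t ω).1 (hypPt t ω).2 ^ 2) ∂sphereMeasure ≤ ofReal 36 * hypSize γ ψ := by
  have hv := continuous_hypPt_apply h
  have md : Measurable fun z : ℝ × S2 => ofReal (hypDeriv ψ z.1 z.2 ^ 2) :=
    ((measurable_hypDeriv h).pow_const 2).ennreal_ofReal
  have mini : Measurable fun ω : S2 =>
      ofReal (2 * (hypRho 0 * ψ 0 (hypRho 0 • ω.1)) ^ 2) := by
    have hi : Continuous fun ω : S2 => ((0 : ℝ), ω) := by fun_prop
    exact (((((continuous_hypPt_apply h).comp hi).measurable.const_mul _).pow_const 2).const_mul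
      _).ennreal_ofReal
  calc _ ≤ ∫⁻ t in Ioi (0 : ℝ), ∫⁻ ω : S2, ofReal
        ((hypRho t * ψ (hypPt t ω).1 (hypPt t ω).2) ^ 2 / (t + 1) ^ 2) ∂sphereMeasure := by
        refine setLIntegral_mono' measurableSet_Ioi fun t ht => lintegral_mono fun ω =>
          ofReal_le_ofReal ?_
        have ht : 0 ≤ t := (mem_Ioi.1 ht).le
        have h2 := add_two_le_hypRho ht
        rw [le_div_iff₀ (by positivity), mul_pow, mul_comm]
        exact mul_le_mul_of_nonneg_right (by nlinarith) (sq_nonneg _)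
    _ = ∫⁻ ω : S2, (∫⁻ t in Ioi (0 : ℝ), ofReal
        ((hypRho t * ψ (hypPt t ω).1 (hypPt t ω).2) ^ 2 / (t + 1) ^ 2)) ∂sphereMeasure := by
        refine lintegral_lintegral_swap (Measurable.aemeasurable ?_)
        exact ((((continuous_hypRho.measurable.comp measurable_fst).mul hv.measurable).pow_const
          2).div ((measurable_fst.add_const (1 : ℝ)).pow_const 2)).ennreal_ofReal
    _ ≤ ∫⁻ ω : S2, (ofReal (2 * (hypRho 0 * ψ 0 (hypRho 0 • ω.1)) ^ 2) +
        (ofReal 4 * ∫⁻ t in Ioi (0 : ℝ), ofReal (hypDeriv ψ t ω ^ 2)))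
          ∂sphereMeasure := by
        exact lintegral_mono fun ω => hardy_half_line
          (fun t ht => hasDerivAt_hypPt h ht ω) (continuousOn_hypDeriv h ω)
    _ = (∫⁻ ω : S2, ofReal (2 * (hypRho 0 * ψ 0 (hypRho 0 • ω.1)) ^ 2)
          ∂sphereMeasure) + (ofReal 4 * ∫⁻ t in Ioi (0 : ℝ), ∫⁻ ω : S2,
          ofReal (hypDeriv ψ t ω ^ 2) ∂sphereMeasure) := by
        rw [lintegral_lintegral_swap md.aemeasurable,
          ← lintegral_ofReal_mul, lintegral_add_left mini]
    _ ≤ _ := by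
        rw [hypSize, mul_add, add_comm]
        refine add_le_add ?_ (lintegral_initial_trace_le hγ h)
        have e : ofReal 36 = ofReal 4 * (ofReal 9) := by
          rw [← ofReal_mul (by norm_num)]; norm_num
        rw [e, mul_assoc]
        refine mul_le_mul' le_rfl ?_
        rw [← lintegral_ofReal_mul]
        refine setLIntegral_mono' measurableSet_Ioi fun t ht => ?_
        rw [← lintegral_ofReal_mul]
        refine lintegral_mono fun ω => ?_
        rw [← ofReal_mul (by norm_num)]
        refine ofReal_le_ofReal ?_
        have := hypDeriv_sq_le (ψ := ψ) hγ (mem_Ioi.1 ht).le ω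
        have := sq_nonneg (hypDeriv ψ t ω)
        linarith

end HypHardy

section Assembly

variable {p γ ε : ℝ} {φ ψ : Wave} (Z : Killing)

lemma exists_killing {Y : Wave × (ℝ → E3 → E3)} (hY : Y ∈ GammaSet) :
    ∃ Z : Killing, ∀ ψ, applyZ Y ψ = Z.act ψ := by
  suffices h : ∃ Z : Killing, (∀ t x, Y.1 t x = Z.tc x) ∧ ∀ t x j, Y.2 t x j = Z.xc j t x by
    obtain ⟨Z, h1, h2⟩ := h
    refine ⟨Z, fun ψ => funext fun t => funext fun x => ?_⟩
    simp only [applyZ, Killing.act, h1, inner_E3, h2, gradient_apply, dx]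
  have hone : ∀ i j : Fin 3, |(if j = i then 1 else 0 : ℝ)| ≤ 1 := fun i j => by
    split_ifs <;> norm_num
  simp only [GammaSet, Set.mem_union, Set.mem_iUnion, Set.mem_singleton_iff] at hY
  rcases hY with ((rfl | ⟨i, rfl⟩) | ⟨i, j, hij, rfl⟩) | ⟨i, rfl⟩
  · refine ⟨⟨1, 0, 0, 0, by simp, by simp, by simp, by simp, by simp⟩, ?_, ?_⟩
    · simp [Killing.tc]
    · simp [Killing.xc]
  · refine ⟨⟨0, 0, fun j => if j = i then 1 else 0, 0, by simp, by simp, by simp, hone i,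
      by simp⟩, ?_, ?_⟩
    · simp [Killing.tc]
    · simp [Killing.xc, e3_apply]
  · refine ⟨⟨0, 0, 0, fun k l => (if k = j then 1 else 0) * (if l = i then 1 else 0) -
      (if k = i then 1 else 0) * (if l = j then 1 else 0), fun k l => by ring, by simp, by simp,
      by simp, fun k l => ?_⟩, ?_, ?_⟩
    · split_ifs <;> norm_num
    · simp [Killing.tc]
    · intro t x k
      simp [Killing.xc, e3_apply, sub_mul, Finset.sum_sub_distrib]
  · refine ⟨⟨0, fun j => if j = i then 1 else 0, 0, 0, by simp, by simp, hone i, by simp,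
      by simp⟩, ?_, ?_⟩
    · simp [Killing.tc]
    · simp [Killing.xc, e3_apply]

/-- The radial component of the space coefficients. -/
def Killing.rc (t : ℝ) (x : E3) : ℝ := (∑ j, (Z.b j + t * Z.α j) * x j) / ‖x‖

lemma sum_xc_mul (t : ℝ) (x : E3) : ∑ j, Z.xc j t x * x j = ∑ j, (Z.b j + t * Z.α j) * x j := by
  have h := Z.skew
  have h00 := h 0 0
  have h11 := h 1 1
  have h22 := h 2 2
  simp only [Killing.xc, Fin.sum_univ_three, h 1 0, h 2 0, h 2 1]
  linear_combination (x 0 ^ 2 / 2) * h00 + (x 1 ^ 2 / 2) * h11 + (x 2 ^ 2 / 2) * h22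

lemma dx_rmul (h : Smooth φ) {x : E3} (hx : x ≠ 0) (j : Fin 3) (t : ℝ) :
    dx j (rmul φ) t x = x j / ‖x‖ * φ t x + ‖x‖ * dx j φ t x := by
  refine fderiv_eq_of_hasDerivAt_line (((contDiffAt_norm ℝ hx).differentiableAt one_ne_zero).mul
    (h.hasFDerivAt_x t x).differentiableAt) ?_
  have h1 := (hasDerivAt_norm_line (y := e3 j) hx).fun_mul (h.hasDerivAt_x j t x)
  refine h1.congr_deriv ?_
  simp [e3_apply]

lemma act_rmul (h : Smooth φ) {x : E3} (hx : x ≠ 0) (t : ℝ) :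
    Z.act (rmul φ) t x = ‖x‖ * Z.act φ t x + Z.rc t x * φ t x := by
  have h1 : dt1 (rmul φ) t x = ‖x‖ * dt1 φ t x := ((h.hasDerivAt_t t x).const_mul ‖x‖).deriv
  rw [Killing.rc, ← sum_xc_mul]
  simp only [Killing.act, h1, dx_rmul h hx, Fin.sum_univ_three]
  ring

lemma dt1_act_rmul (h : Smooth φ) {x : E3} (hx : x ≠ 0) (t : ℝ) :
    dt1 (Z.act (rmul φ)) t x = ‖x‖ * dt1 (Z.act φ) t x +
      ((∑ j, Z.α j * x j) / ‖x‖ * φ t x + Z.rc t x * dt1 φ t x) := by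
  have hc : HasDerivAt (fun s => Z.rc s x) ((∑ j, Z.α j * x j) / ‖x‖) t := by
    have h1 : HasDerivAt (fun s : ℝ => ∑ j, (Z.b j + s * Z.α j) * x j) (∑ j, Z.α j * x j) t := by
      refine (HasDerivAt.fun_sum (u := Finset.univ) fun j _ =>
        (((hasDerivAt_id t).mul_const (Z.α j)).const_add (Z.b j)).mul_const (x j)).congr_deriv ?_
      simp
    exact h1.div_const _
  have h2 := (((h.killing Z).hasDerivAt_t t x).const_mul ‖x‖).fun_add
    (hc.fun_mul (h.hasDerivAt_t t x))
  have e : (fun s => Z.act (rmul φ) s x) = fun s => ‖x‖ * Z.act φ s x + Z.rc s x * φ s x :=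
    funext fun s => act_rmul Z h hx s
  change deriv (fun s => Z.act (rmul φ) s x) t = _
  rw [e, h2.deriv]

/-- The derivatives of `Killing.rc`. -/
def Killing.drc (i : Fin 3) (t : ℝ) (x : E3) : ℝ :=
  (Z.b i + t * Z.α i) / ‖x‖ - Z.rc t x * x i / ‖x‖ ^ 2

lemma dx_act_rmul (h : Smooth φ) {x : E3} (hx : x ≠ 0) (i : Fin 3) (t : ℝ) :
    dx i (Z.act (rmul φ)) t x = x i / ‖x‖ * Z.act φ t x + ‖x‖ * dx i (Z.act φ) t x +
      (Z.drc i t x * φ t x + Z.rc t x * dx i φ t x) := by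
  have hr : ‖x‖ ≠ 0 := norm_ne_zero_iff.2 hx
  have hZ := h.killing Z
  have e : Z.act (rmul φ) t =ᶠ[nhds x] fun y => ‖y‖ * Z.act φ t y + Z.rc t y * φ t y :=
    Filter.mem_of_superset (isOpen_ne.mem_nhds hx) fun y hy => act_rmul Z h hy t
  have dn : DifferentiableAt ℝ (fun y : E3 => ‖y‖) x :=
    (contDiffAt_norm ℝ hx).differentiableAt one_ne_zero
  have ds : DifferentiableAt ℝ (fun y : E3 => ∑ j, (Z.b j + t * Z.α j) * y j) x := by fun_prop
  have dq : DifferentiableAt ℝ (fun y : E3 => Z.rc t y) x := by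
    simp only [Killing.rc, div_eq_mul_inv]
    exact ds.fun_mul (dn.fun_inv hr)
  rw [dx, e.fderiv_eq]
  refine fderiv_eq_of_hasDerivAt_line ((dn.mul (hZ.hasFDerivAt_x t x).differentiableAt).add
    (dq.mul (h.hasFDerivAt_x t x).differentiableAt)) ?_
  have ln := hasDerivAt_norm_line (y := e3 i) hx
  have ls : HasDerivAt (fun s : ℝ => ∑ j, (Z.b j + t * Z.α j) * (x + s • e3 i) j)
      (Z.b i + t * Z.α i) 0 := by
    refine (HasDerivAt.fun_sum (u := Finset.univ) fun j _ =>
      (hasDerivAt_coord_line x i j 0).const_mul (Z.b j + t * Z.α j)).congr_deriv ?_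
    simp
  have lc := ls.fun_div ln (by simpa using hr)
  refine ((ln.fun_mul (hZ.hasDerivAt_x i t x)).fun_add
    (lc.fun_mul (h.hasDerivAt_x i t x))).congr_deriv ?_
  simp [e3_apply, Killing.rc, Killing.drc]
  field_simp
  exact Or.inl trivial

lemma drad_eq (F : Wave) (t : ℝ) (x : E3) : drad F t x = ∑ i, x i / ‖x‖ * dx i F t x := by
  simp only [drad, inner_E3, gradient_apply, dx, PiLp.smul_apply, smul_eq_mul]
  exact sum_congr rfl fun i _ => by ring

lemma angGrad_sq_eq (F : Wave) (t : ℝ) (x : E3) :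
    ‖angGrad F t x‖ ^ 2 = ∑ i, (dx i F t x - drad F t x * (x i / ‖x‖)) ^ 2 := by
  rw [norm_sq_E3]
  refine sum_congr rfl fun i _ => ?_
  simp only [angGrad, PiLp.sub_apply, PiLp.smul_apply, gradient_apply, dx, smul_eq_mul]
  ring

lemma drad_eq_rdot (F : Wave) (t : ℝ) (x : E3) : drad F t x = rdot F (t, x) / ‖x‖ := by
  rw [drad_eq, rdot, sum_div]
  exact sum_congr rfl fun i _ => by ring

lemma drad_act_rmul (h : Smooth φ) {x : E3} (hx : x ≠ 0) (t : ℝ) : drad (Z.act (rmul φ)) t x =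
      Z.act φ t x + rdot (Z.act φ) (t, x) + Z.rc t x * rdot φ (t, x) / ‖x‖ := by
  have hr : ‖x‖ ≠ 0 := norm_ne_zero_iff.2 hx
  have hn := norm_sq_E3 x
  have hc : Z.rc t x * ‖x‖ = ∑ j, (Z.b j + t * Z.α j) * x j := by rw [Killing.rc]; field_simp
  rw [drad_eq]
  simp only [dx_act_rmul Z h hx, rdot, Killing.drc, Fin.sum_univ_three] at *
  generalize Z.rc t x = c at *
  field_simp
  linear_combination (-(‖x‖ * Z.act φ t x) + c * φ t x) * hn - ‖x‖ * φ t x * hc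

end Assembly

section Pointwise

variable {p γ ε : ℝ} {φ ψ : Wave} (Z : Killing)

lemma lop_eq (ψ : Wave) (t : ℝ) {x : E3} (hx : x ≠ 0) :
    ‖x‖ * Lop ψ t x = ‖x‖ * (dt1 ψ t x + wrad ψ (t, x)) - ψ t x := by
  have hr : ‖x‖ ≠ 0 := norm_ne_zero_iff.2 hx
  simp only [Lop, drad_eq_rdot, wrad]
  field_simp
  ring

lemma lbop_eq (ψ : Wave) (t : ℝ) (x : E3) :
    Lbop ψ t x = dt1 ψ t x - wrad ψ (t, x) + ψ t x / ‖x‖ := by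
  simp only [Lbop, drad_eq_rdot, wrad]
  ring

lemma lop_act_rmul (h : Smooth φ) {x : E3} (hx : x ≠ 0) (t : ℝ) :
    Lop (Z.act (rmul φ)) t x = ‖x‖ * (dt1 (Z.act φ) t x + wrad (Z.act φ) (t, x)) +
      Z.rc t x * (dt1 φ t x + wrad φ (t, x)) +
      ((∑ j, Z.α j * x j) / ‖x‖ - Z.rc t x / ‖x‖) * φ t x := by
  have hr : ‖x‖ ≠ 0 := norm_ne_zero_iff.2 hx
  rw [Lop, dt1_act_rmul Z h hx, drad_act_rmul Z h hx, wrad, wrad]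
  field_simp
  ring

lemma rc_eq (t : ℝ) (x : E3) : Z.rc t x = ((∑ j, Z.b j * x j) + t * ∑ j, Z.α j * x j) / ‖x‖ := by
  simp only [Killing.rc, Fin.sum_univ_three]
  ring

variable {t : ℝ} {x : E3}

lemma abs_rc_le (ht : 0 ≤ t) (hx : t + 2 ≤ ‖x‖) : |Z.rc t x| ≤ 2 * ‖x‖ := by
  have hr : 0 < ‖x‖ := by linarith
  have h1 := abs_sum_mul_le_two_norm Z.b_le x
  have h2 := abs_sum_mul_le_two_norm Z.α_le x
  rw [rc_eq, abs_div, abs_of_pos hr, div_le_iff₀ hr]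
  refine (abs_add_le _ _).trans ?_
  rw [abs_mul, abs_of_nonneg ht]
  nlinarith [mul_le_mul_of_nonneg_left h2 ht]

lemma abs_rc_defect_le (ht : 0 ≤ t) (hx : t + 2 ≤ ‖x‖) (hx' : ‖x‖ ≤ t + 12 / 5) :
    |(∑ j, Z.α j * x j) / ‖x‖ - Z.rc t x / ‖x‖| ≤ 7 / ‖x‖ := by
  have hr : 0 < ‖x‖ := by linarith
  have h1 := abs_sum_mul_le_two_norm Z.b_le x
  have h2 := abs_sum_mul_le_two_norm Z.α_le x
  rw [rc_eq, ← sub_div, abs_div, abs_of_pos hr]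
  refine div_le_div_of_nonneg_right ?_ hr.le
  rw [show (∑ j, Z.α j * x j) - ((∑ j, Z.b j * x j) + t * ∑ j, Z.α j * x j) / ‖x‖ =
    ((‖x‖ - t) * (∑ j, Z.α j * x j) - ∑ j, Z.b j * x j) / ‖x‖ by field_simp; ring,
    abs_div, abs_of_pos hr, div_le_iff₀ hr]
  refine (abs_sub _ _).trans ?_
  rw [abs_mul, abs_of_nonneg (by linarith : 0 ≤ ‖x‖ - t)]
  have h3 := mul_le_mul_of_nonneg_left h2 (by linarith : 0 ≤ ‖x‖ - t)
  have h4 := mul_le_mul_of_nonneg_right (by linarith : ‖x‖ - t ≤ 12 / 5) hr.le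
  linarith

lemma sq_add_three_le (a b c : ℝ) : (a + b + c) ^ 2 ≤ 3 * (a ^ 2 + b ^ 2 + c ^ 2) := by
  linarith [sq_nonneg (a - b), sq_nonneg (a - c), sq_nonneg (b - c),
    (by ring : (a - b) ^ 2 + (a - c) ^ 2 + (b - c) ^ 2 + (a + b + c) ^ 2 =
      3 * (a ^ 2 + b ^ 2 + c ^ 2))]

lemma lop_act_rmul_sq_le (hγ2 : γ ≤ 2) (h : Smooth φ) (ht : 0 ≤ t)
    (hx : t + 2 ≤ ‖x‖) (hx' : ‖x‖ ≤ t + 12 / 5) : ‖x‖ ^ γ * Lop (Z.act (rmul φ)) t x ^ 2 ≤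
      3 * (‖x‖ ^ (γ + 2) * (dt1 (Z.act φ) t x + wrad (Z.act φ) (t, x)) ^ 2) +
      12 * (‖x‖ ^ (γ + 2) * (dt1 φ t x + wrad φ (t, x)) ^ 2) + 147 * φ t x ^ 2 := by
  have hr : 0 < ‖x‖ := by linarith
  have hr1 : 1 ≤ ‖x‖ := by linarith
  have h0 : x ≠ 0 := norm_pos_iff.1 hr
  have e1 : ‖x‖ ^ (γ + 2) = ‖x‖ ^ γ * ‖x‖ ^ 2 := by rw [rpow_add hr, rpow_two]
  have e2 : ‖x‖ ^ γ ≤ ‖x‖ ^ 2 := by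
    rw [← rpow_two ‖x‖]; exact rpow_le_rpow_of_exponent_le hr1 hγ2
  have hG : 0 ≤ ‖x‖ ^ γ := by positivity
  have hc := sq_le_sq' (by linarith [abs_le.1 (abs_rc_le Z ht hx)]) (abs_le.1 (abs_rc_le Z ht hx)).2
  have hd' := abs_le.1 (abs_rc_defect_le Z ht hx hx')
  have hd := sq_le_sq' hd'.1 hd'.2
  rw [lop_act_rmul Z h h0, e1]
  generalize (∑ j, Z.α j * x j) / ‖x‖ - Z.rc t x / ‖x‖ = d at *
  generalize Z.rc t x = c at *
  generalize dt1 (Z.act φ) t x + wrad (Z.act φ) (t, x) = U at *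
  generalize dt1 φ t x + wrad φ (t, x) = V at *
  have k1 : (c * V) ^ 2 ≤ (2 * ‖x‖) ^ 2 * V ^ 2 := by
    rw [mul_pow]; exact mul_le_mul_of_nonneg_right hc (sq_nonneg V)
  have k2 : ‖x‖ ^ γ * (d * φ t x) ^ 2 ≤ 49 * φ t x ^ 2 := by
    rw [mul_pow, ← mul_assoc]
    refine mul_le_mul_of_nonneg_right ?_ (sq_nonneg _)
    calc ‖x‖ ^ γ * d ^ 2 ≤ ‖x‖ ^ 2 * (7 / ‖x‖) ^ 2 :=
          mul_le_mul e2 hd (sq_nonneg d) (sq_nonneg _)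
      _ = 49 := by field_simp; norm_num
  have k3 := mul_le_mul_of_nonneg_left (sq_add_three_le (‖x‖ * U) (c * V) (d * φ t x)) hG
  have k4 := mul_le_mul_of_nonneg_left k1 hG
  linarith [(by ring : ‖x‖ ^ γ * (3 * ((‖x‖ * U) ^ 2 + (c * V) ^ 2 + (d * φ t x) ^ 2)) =
    3 * (‖x‖ ^ γ * ‖x‖ ^ 2 * U ^ 2) + 3 * (‖x‖ ^ γ * (c * V) ^ 2) +
    3 * (‖x‖ ^ γ * (d * φ t x) ^ 2)), (by ring : ‖x‖ ^ γ * ((2 * ‖x‖) ^ 2 * V ^ 2) =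
    4 * (‖x‖ ^ γ * ‖x‖ ^ 2 * V ^ 2))]

lemma sum_drc_sq_le (ht : 0 ≤ t) (hx : t + 2 ≤ ‖x‖) : ∑ i, Z.drc i t x ^ 2 ≤ 3 := by
  have hr : 0 < ‖x‖ := by linarith
  have hn := norm_sq_E3 x
  have hc : Z.rc t x * ‖x‖ = ∑ j, (Z.b j + t * Z.α j) * x j := by rw [Killing.rc]; field_simp
  have hb : ∀ i, ((Z.b i + t * Z.α i) / ‖x‖) ^ 2 ≤ 1 := fun i => by
    have h1 := abs_le.1 (Z.b_le i)
    have h2 := abs_le.1 (Z.α_le i)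
    rw [sq_le_one_iff_abs_le_one, abs_div, abs_of_pos hr, div_le_one hr, abs_le]
    constructor <;> nlinarith
  have e : ∑ i, Z.drc i t x ^ 2 = ∑ i, ((Z.b i + t * Z.α i) / ‖x‖) ^ 2 - (Z.rc t x / ‖x‖) ^ 2 := by
    simp only [Killing.drc, Fin.sum_univ_three] at *
    generalize Z.rc t x = c at *
    field_simp
    linear_combination (-(c ^ 2)) * hn + 2 * c * ‖x‖ * hc
  rw [e, Fin.sum_univ_three]
  linarith [hb 0, hb 1, hb 2, sq_nonneg (Z.rc t x / ‖x‖)]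

lemma angGrad_act_rmul_sq_le (h : Smooth φ) (ht : 0 ≤ t) (hx : t + 2 ≤ ‖x‖) :
    ‖angGrad (Z.act (rmul φ)) t x‖ ^ 2 ≤ 3 * (‖x‖ ^ 2 * angSq (Z.act φ) (t, x)) +
      12 * (‖x‖ ^ 2 * angSq φ (t, x)) + 9 * φ t x ^ 2 := by
  have hr : 0 < ‖x‖ := by linarith
  have h0 : x ≠ 0 := norm_pos_iff.1 hr
  have hc := sq_le_sq' (by linarith [abs_le.1 (abs_rc_le Z ht hx)]) (abs_le.1 (abs_rc_le Z ht hx)).2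
  have hd := mul_le_mul_of_nonneg_right (sum_drc_sq_le Z ht hx) (sq_nonneg (φ t x))
  have hA : 0 ≤ angSq φ (t, x) := angSq_nonneg φ (t, x)
  have e := fun i => show dx i (Z.act (rmul φ)) t x - drad (Z.act (rmul φ)) t x * (x i / ‖x‖) =
      ‖x‖ * (dx i (Z.act φ) t x - rdot (Z.act φ) (t, x) / ‖x‖ ^ 2 * x i) +
      Z.rc t x * (dx i φ t x - rdot φ (t, x) / ‖x‖ ^ 2 * x i) + Z.drc i t x * φ t x by
    rw [dx_act_rmul Z h h0, drad_act_rmul Z h h0]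
    field_simp
    ring
  rw [angGrad_sq_eq]
  simp only [e]
  refine (sum_le_sum fun i _ => sq_add_three_le _ _ _).trans ?_
  rw [← mul_sum, sum_add_distrib, sum_add_distrib]
  simp only [mul_pow]
  rw [← mul_sum, ← mul_sum, ← Finset.sum_mul, ← angSq_eq_sum (q := (t, x)) h0,
    ← angSq_eq_sum (q := (t, x)) h0]
  linarith [mul_le_mul_of_nonneg_right hc hA]

lemma integrand_le (hγ : 0 ≤ γ) (hγ2 : γ ≤ 2) (h : Smooth φ) (ht : 0 ≤ t)
    (hx : t + 2 ≤ ‖x‖) (hx' : ‖x‖ ≤ t + 12 / 5) :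
    ‖x‖ ^ γ * Lop (Z.act (rmul φ)) t x ^ 2 + Lbop (Z.act φ) t x ^ 2 +
        ‖x‖ ^ 2 * Lop (Z.act φ) t x ^ 2 + ‖angGrad (Z.act (rmul φ)) t x‖ ^ 2 ≤
      200 * (hypFlux γ (Z.act φ) (t, x) + hypFlux γ φ (t, x) + (Z.act φ t x ^ 2 + φ t x ^ 2)) := by
  have hr : 0 < ‖x‖ := by linarith
  have hr1 : 1 ≤ ‖x‖ := by linarith
  have h0 : x ≠ 0 := norm_pos_iff.1 hr
  have h1 := lop_act_rmul_sq_le Z hγ2 h ht hx hx'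
  have h2 := angGrad_act_rmul_sq_le Z h ht hx
  have h3 : Lbop (Z.act φ) t x ^ 2 ≤ 2 * (dt1 (Z.act φ) t x - wrad (Z.act φ) (t, x)) ^ 2 +
      2 * Z.act φ t x ^ 2 := by
    have k : (Z.act φ t x / ‖x‖) ^ 2 ≤ Z.act φ t x ^ 2 := by
      rw [div_pow]; exact div_le_self (sq_nonneg _) (one_le_pow₀ hr1)
    rw [lbop_eq]
    nlinarith [sq_nonneg (dt1 (Z.act φ) t x - wrad (Z.act φ) (t, x) - Z.act φ t x / ‖x‖)]
  have h4 : ‖x‖ ^ 2 * Lop (Z.act φ) t x ^ 2 ≤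
      2 * (‖x‖ ^ (γ + 2) * (dt1 (Z.act φ) t x + wrad (Z.act φ) (t, x)) ^ 2) +
        2 * Z.act φ t x ^ 2 := by
    have k : ‖x‖ ^ 2 ≤ ‖x‖ ^ (γ + 2) := by
      rw [← rpow_two ‖x‖]; exact rpow_le_rpow_of_exponent_le hr1 (by linarith)
    have k1 := mul_le_mul_of_nonneg_right k
      (sq_nonneg (dt1 (Z.act φ) t x + wrad (Z.act φ) (t, x)))
    rw [← mul_pow, lop_eq _ _ h0]
    nlinarith [sq_nonneg (‖x‖ * (dt1 (Z.act φ) t x + wrad (Z.act φ) (t, x)) + Z.act φ t x)]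
  have p1 : 0 ≤ ‖x‖ ^ (γ + 2) * (dt1 (Z.act φ) t x + wrad (Z.act φ) (t, x)) ^ 2 := by positivity
  have p2 : 0 ≤ ‖x‖ ^ (γ + 2) * (dt1 φ t x + wrad φ (t, x)) ^ 2 := by positivity
  have p3 := mul_nonneg (sq_nonneg ‖x‖) (angSq_nonneg (Z.act φ) (t, x))
  have p4 := mul_nonneg (sq_nonneg ‖x‖) (angSq_nonneg φ (t, x))
  simp only [hypFlux]
  linarith [sq_nonneg (dt1 (Z.act φ) t x - wrad (Z.act φ) (t, x)),
    sq_nonneg (dt1 φ t x - wrad φ (t, x)), sq_nonneg (Z.act φ t x), sq_nonneg (φ t x)]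

end Pointwise

section Integrated

variable {p γ ε : ℝ} {φ ψ : Wave} (Z : Killing)

lemma measurable_hypFlux (h : Smooth ψ) :
    Measurable fun z : ℝ × S2 => hypFlux γ ψ (hypPt z.1 z.2) := by
  have hn : Measurable fun q : M4 => ‖q.2‖ := measurable_snd.norm
  have hT : Measurable fun q : M4 => dt1 ψ q.1 q.2 := h.dt1.continuous.measurable
  have hR : Measurable (rdot ψ) := (continuous_rdot h).measurable
  have hG : Measurable (gradSq ψ) := (contDiff_gradSq h).continuous.measurable
  have hW : Measurable (wrad ψ) := (hR.add h.continuous.measurable).div hn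
  have hA : Measurable (angSq ψ) := hG.sub ((hR.pow_const 2).div (hn.pow_const 2))
  exact ((((hn.pow_const (γ + 2)).mul ((hT.add hW).pow_const 2)).add
    ((hT.sub hW).pow_const 2)).add ((hn.pow_const 2).mul hA)).comp continuous_hypPt.measurable

lemma lintegral_sphere_add {f g : ℝ × S2 → ℝ} (hf : Measurable f) (f0 : ∀ z, 0 ≤ f z)
    (g0 : ∀ z, 0 ≤ g z) :
    (∫⁻ t in Ioi (0 : ℝ), ∫⁻ ω : S2, ofReal (f (t, ω) + g (t, ω)) ∂sphereMeasure) =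
      (∫⁻ t in Ioi (0 : ℝ), ∫⁻ ω : S2, ofReal (f (t, ω)) ∂sphereMeasure) +
        ∫⁻ t in Ioi (0 : ℝ), ∫⁻ ω : S2, ofReal (g (t, ω)) ∂sphereMeasure := by
  have m : Measurable fun z : ℝ × S2 => ofReal (f z) := hf.ennreal_ofReal
  rw [← lintegral_add_left m.lintegral_prod_right']
  refine lintegral_congr fun t => ?_
  have m' : Measurable fun ω : S2 => ofReal (f (t, ω)) := m.comp measurable_prodMk_left
  rw [← lintegral_add_left m']
  exact lintegral_congr fun ω => ofReal_add (f0 _) (g0 _)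

lemma hypFlux_nonneg (γ : ℝ) (ψ : Wave) (q : M4) : 0 ≤ hypFlux γ ψ q := by
  have := angSq_nonneg ψ q
  unfold hypFlux
  positivity

lemma lintegral_flux_add_sq_le (hγ : 0 ≤ γ) (h : Smooth ψ) :
    ∫⁻ t in Ioi (0 : ℝ), ∫⁻ ω : S2, ofReal (hypFlux γ ψ (hypPt t ω) +
        ψ (hypPt t ω).1 (hypPt t ω).2 ^ 2) ∂sphereMeasure ≤ ofReal 37 * hypSize γ ψ := by
  have h1 := lintegral_sphere_add (f := fun z => hypFlux γ ψ (hypPt z.1 z.2))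
    (g := fun z => ψ (hypPt z.1 z.2).1 (hypPt z.1 z.2).2 ^ 2) (measurable_hypFlux h)
    (fun _ => hypFlux_nonneg γ ψ _) (fun _ => sq_nonneg _)
  refine h1.trans_le ?_
  have e : (37 : ℝ) = 1 + 36 := by norm_num
  rw [e, ofReal_add one_pos.le (by norm_num), add_mul, ofReal_one, one_mul]
  exact add_le_add le_self_add (lintegral_sq_hypPt_le hγ h)

lemma lintegral_integrand_le (hγ : 0 ≤ γ) (hγ2 : γ ≤ 2) (h : Smooth φ) :
    ∫⁻ t in Ioi (0 : ℝ), ∫⁻ ω : S2,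
        ofReal (hypRho t ^ γ * Lop (Z.act (rmul φ)) t (hypRho t • ω.1) ^ 2
          + Lbop (Z.act φ) t (hypRho t • ω.1) ^ 2
          + hypRho t ^ 2 * Lop (Z.act φ) t (hypRho t • ω.1) ^ 2
          + ‖angGrad (Z.act (rmul φ)) t (hypRho t • ω.1)‖ ^ 2) ∂sphereMeasure ≤
      ofReal 7400 * (hypSize γ (Z.act φ) + hypSize γ φ) := by
  have hZ := h.killing Z
  calc _ ≤ ∫⁻ t in Ioi (0 : ℝ), ∫⁻ ω : S2, ofReal 200 * ofReal ((hypFlux γ (Z.act φ) (hypPt t ω) +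
          Z.act φ (hypPt t ω).1 (hypPt t ω).2 ^ 2) + (hypFlux γ φ (hypPt t ω) +
          φ (hypPt t ω).1 (hypPt t ω).2 ^ 2)) ∂sphereMeasure := by
        refine setLIntegral_mono' measurableSet_Ioi fun t ht => lintegral_mono fun ω => ?_
        have ht : 0 ≤ t := (mem_Ioi.1 ht).le
        have hn := norm_hypPt ht ω
        change ‖hypRho t • ω.1‖ = hypRho t at hn
        rw [← ofReal_mul (by norm_num)]
        refine ofReal_le_ofReal ?_
        have := integrand_le (x := hypRho t • ω.1) Z hγ hγ2 h ht
          (by rw [hn]; exact add_two_le_hypRho ht) (by rw [hn]; exact hypRho_le ht)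
        rw [hn] at this
        simp only [hypPt]
        linarith
    _ = ofReal 200 * ((∫⁻ t in Ioi (0 : ℝ), ∫⁻ ω : S2, ofReal (hypFlux γ (Z.act φ) (hypPt t ω) +
            Z.act φ (hypPt t ω).1 (hypPt t ω).2 ^ 2) ∂sphereMeasure) +
          ∫⁻ t in Ioi (0 : ℝ), ∫⁻ ω : S2, ofReal (hypFlux γ φ (hypPt t ω) +
            φ (hypPt t ω).1 (hypPt t ω).2 ^ 2) ∂sphereMeasure) := by
        have h1 := lintegral_sphere_add
          (f := fun z => hypFlux γ (Z.act φ) (hypPt z.1 z.2) +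
            Z.act φ (hypPt z.1 z.2).1 (hypPt z.1 z.2).2 ^ 2)
          (g := fun z => hypFlux γ φ (hypPt z.1 z.2) + φ (hypPt z.1 z.2).1 (hypPt z.1 z.2).2 ^ 2)
          ((measurable_hypFlux hZ).add ((continuous_hypPt_apply hZ).measurable.pow_const 2))
          (fun _ => add_nonneg (hypFlux_nonneg γ _ _) (sq_nonneg _))
          (fun _ => add_nonneg (hypFlux_nonneg γ _ _) (sq_nonneg _))
        simp only [lintegral_ofReal_mul]
        exact congrArg _ h1
    _ ≤ ofReal 200 * (ofReal 37 * hypSize γ (Z.act φ) + ofReal 37 * hypSize γ φ) :=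
        mul_le_mul' le_rfl (add_le_add (lintegral_flux_add_sq_le hγ hZ)
          (lintegral_flux_add_sq_le hγ h))
    _ = ofReal 7400 * (hypSize γ (Z.act φ) + hypSize γ φ) := by
        rw [← mul_add, ← mul_assoc, ← ofReal_mul (by norm_num)]
        norm_num

end Integrated

lemma exists_adm {p γ : ℝ} (hp : (1 + √17) / 2 < p) (hp5 : p < 5)
    (hγ₁ : max (4 / (p - 1) - 1) 1 < γ) (hγ₂ : γ < min (p - 1) 2) : ∃ ε, Adm p γ ε := by
  obtain ⟨h1, h2⟩ := max_lt_iff.1 hγ₁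
  obtain ⟨h3, h4⟩ := lt_min_iff.1 hγ₂
  have h17 : (4 : ℝ) < √17 := Real.lt_sqrt_of_sq_lt (by norm_num)
  have hp' : 5 / 2 < p := by linarith
  have hp1 : 0 < p - 1 := by linarith
  have h5 : 4 < (γ + 1) * (p - 1) := (div_lt_iff₀ hp1).1 (by linarith)
  refine ⟨min (γ - 1) (min ((2 * p - 5) / 2) ((γ + 1) / 2 * (p - 1) - 2)), hp', hp5, h2, h4, h3,
    lt_min (by linarith) (lt_min (by linarith) (by linarith)), min_le_left _ _,
    ((min_le_right _ _).trans (min_le_left _ _)).trans_lt (by linarith), ?_⟩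
  rw [div_le_iff₀ hp1]
  linarith [(min_le_right (γ - 1) _).trans
    (min_le_right ((2 * p - 5) / 2) ((γ + 1) / 2 * (p - 1) - 2))]

/-- First-order weighted energy flux bound through the future
hyperboloid, for all commuting vector fields `Z ∈ Γ`, in the range
`(1+√17)/2 < p < 5`, `max{4/(p−1) − 1, 1} < γ₀ < min{p−1, 2}`. -/
theorem nlw_hyperboloid_flux_bound_derivatives (p γ₀ B : ℝ)
    (hp : (1 + Real.sqrt 17) / 2 < p) (hp5 : p < 5)
    (hγ₁ : max (4 / (p - 1) - 1) 1 < γ₀) (hγ₂ : γ₀ < min (p - 1) 2) (hB : 0 < B) :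
    ∃ C : ℝ, 0 < C ∧ ∀ φ : ℝ → E3 → ℝ, IsNLWSolution p φ →
      wEnergy p 0 γ₀ φ ≤ ENNReal.ofReal B → wEnergy p 1 γ₀ φ < ⊤ →
      ∀ Z ∈ GammaSet,
        (∫⁻ t in Set.Ioi (0 : ℝ), ∫⁻ ω : Metric.sphere (0 : E3) 1,
          ENNReal.ofReal (hypRho t ^ γ₀ * Lop (applyZ Z (rmul φ)) t (hypRho t • (ω : E3)) ^ 2
            + Lbop (applyZ Z φ) t (hypRho t • (ω : E3)) ^ 2
            + hypRho t ^ 2 * Lop (applyZ Z φ) t (hypRho t • (ω : E3)) ^ 2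
            + ‖angGrad (applyZ Z (rmul φ)) t (hypRho t • (ω : E3))‖ ^ 2) ∂sphereMeasure)
          ≤ ENNReal.ofReal (C * (1 + (wEnergy p 1 γ₀ φ).toReal) ^ (p - 1)) := by
  obtain ⟨ε, ha⟩ := exists_adm hp hp5 hγ₁ hγ₂
  obtain ⟨C, hC, H⟩ := exists_hypSize_le ha hB.le
  refine ⟨14800 * C + 1, by positivity, fun φ hφ h0 h1 Y hY => ?_⟩
  obtain ⟨Z, hZ⟩ := exists_killing hY
  obtain ⟨s1, s2⟩ := H φ hφ h0 h1.ne
  simp only [hZ]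
  refine (lintegral_integrand_le Z (by linarith [ha.γ_gt]) ha.γ_lt.le hφ.smooth).trans ?_
  have hX : 1 ≤ (1 + (wEnergy p 1 γ₀ φ).toReal) ^ (p - 1) :=
    one_le_rpow (le_add_of_nonneg_right toReal_nonneg) (by linarith [ha.p_gt])
  refine (mul_le_mul' le_rfl (add_le_add (s2 Z) s1)).trans ?_
  rw [← ofReal_add (by positivity) hC, ← ofReal_mul (by norm_num)]
  refine ofReal_le_ofReal ?_
  linarith [mul_le_mul_of_nonneg_left hX hC]
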